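/- Let n ≥ 3 and let u : ℝⁿ → ℝ be a convex, three times continuously differentiable function solving det(D²u(x)) = f(x) for all x ∈ ℝⁿ, where f is asymptotically periodic with periodic model f_p (see context). Then there exist a symmetric positive definite n×n real matrix A, a vector b ∈ ℝⁿ, and constants ε > 0 and C > 0 such that |u(x) − ½ xᵀA x − b·x| ≤ C(1+|x|)^{2−ε} for all x ∈ ℝⁿ. -/

import Mathlib

open scoped BigOperators
open MeasureTheory

noncomputable def hess {n : ℕ} (u : EuclideanSpace ℝ (Fin n) → ℝ)
    (x : EuclideanSpace ℝ (Fin n)) : Matrix (Fin n) (Fin n) ℝ :=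
  Matrix.of fun i j =>
    iteratedFDeriv ℝ 2 u x ![EuclideanSpace.single i 1, EuclideanSpace.single j 1]

namespace MongeAmpere

open Matrix Filter
open Metric (closedBall ball sphere closedBall_subset_closedBall closedBall_subset_closedBall'
  mem_closedBall)
open EuclideanSpace (single)
open Real (sqrt_pos rpow_mul norm_of_nonneg rpow_natCast rpow_le_rpow_of_exponent_le mul_rpow
  sq_sqrt mul_self_sqrt rpow_one rpow_le_rpow_of_nonpos rpow_add sqrt_eq_rpow rpow_neg)
open Finset (sum_congr mul_sum sum_le_sum sum_nonneg sum_add_distrib sum_mul sum_comm mem_univ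
  sum_sub_distrib single_le_sum univ range)
open ContinuousLinearMap (adjoint adjoint_inner_left)
open ENNReal (ofReal toReal_ofReal toReal_mul ofReal_le_ofReal mul_ne_top)
open Set (indicator_of_mem indicator_of_notMem indicator_nonneg)
open intervalIntegral (integral_eq_sub_of_hasDerivAt integral_mono_on
  continuous_parametric_intervalIntegral_of_continuous')

variable {n : ℕ}

/-- Euclidean space of dimension `n`. -/
abbrev Eu (n : ℕ) := EuclideanSpace ℝ (Fin n)

/-- Real square matrices of size `n`. -/
abbrev Mat (n : ℕ) := Matrix (Fin n) (Fin n) ℝ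

variable {u : Eu n → ℝ} {lam Lam β : ℝ} {Γ : AddSubgroup (Eu n)}

theorem _root_.Continuous.integrableOn_compact {X E : Type*} [MeasurableSpace X] [TopologicalSpace X]
    [NormedAddCommGroup E] {μ : Measure X} [OpensMeasurableSpace X] [IsFiniteMeasureOnCompacts μ]
    [T2Space X] {K : Set X} {F : X → E} (hF : Continuous F) (hK : IsCompact K) :
    IntegrableOn F K μ := hF.continuousOn.integrableOn_compact hK

theorem exists_transpose_mul_self {A : Mat n} (hA : A.PosSemidef) : ∃ Q : Mat n, A = Qᵀ * Q := by
  have hH := hA.1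
  set D : Mat n := diagonal fun i => √(hH.eigenvalues i)
  set V : Mat n := (hH.eigenvectorUnitary : Mat n)
  refine ⟨D * Vᵀ, ?_⟩
  have h := hH.spectral_theorem
  rw [Unitary.conjStarAlgAut_apply] at h
  have hD : D * D = diagonal (RCLike.ofReal ∘ hH.eigenvalues) := by
    rw [diagonal_mul_diagonal]
    congr 1
    ext i
    simp [mul_self_sqrt (hA.eigenvalues_nonneg i)]
  have hs : (star (hH.eigenvectorUnitary : Mat n)) = Vᵀ := by
    rw [star_eq_conjTranspose, conjTranspose_eq_transpose_of_trivial]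
  rw [transpose_mul, transpose_transpose, diagonal_transpose, Matrix.mul_assoc,
    ← Matrix.mul_assoc D D, hD, ← Matrix.mul_assoc]
  conv_lhs => rw [h]
  simp only [hs]
  rfl

/-- The arithmetic-geometric mean inequality for positive semidefinite matrices. -/
theorem det_le_trace_div_pow {B : Mat n} (hB : B.PosSemidef) : B.det ≤ (B.trace / n) ^ n := by
  rcases Nat.eq_zero_or_pos n with rfl | hn
  · simp
  have hn' : (0 : ℝ) < n := by exact_mod_cast hn
  have hd : B.det = ∏ i, hB.1.eigenvalues i := by simpa using hB.1.det_eq_prod_eigenvalues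
  have ht : B.trace = ∑ i, hB.1.eigenvalues i := by simpa using hB.1.trace_eq_sum_eigenvalues
  have hnn := hB.eigenvalues_nonneg
  have h := Real.geom_mean_le_arith_mean_weighted univ (fun _ : Fin n => (1 / n : ℝ))
    hB.1.eigenvalues (fun _ _ => by positivity) (by simp [hn'.ne']) (fun i _ => hnn i)
  rw [hd, ht]
  have h2 : (∏ i, hB.1.eigenvalues i ^ (1 / n : ℝ)) ^ n = ∏ i, hB.1.eigenvalues i := by
    rw [← Finset.prod_pow]
    refine Finset.prod_congr rfl fun i _ => ?_
    rw [← rpow_natCast, ← rpow_mul (hnn i)]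
    simp [hn'.ne']
  rw [← h2, Finset.sum_div]
  refine pow_le_pow_left₀ (Finset.prod_nonneg fun i _ => Real.rpow_nonneg (hnn i) _) ?_ n
  refine h.trans (le_of_eq (sum_congr rfl fun i _ => by ring))

theorem det_le_det_mul_trace_pow {H B : Mat n} (hH : H.PosDef)
    (hB : B.PosSemidef) : B.det ≤ H.det * ((H⁻¹ * B).trace / n) ^ n := by
  obtain ⟨Q, hQ⟩ := exists_transpose_mul_self hH.inv.posSemidef
  have hC : (Q * B * Qᵀ).PosSemidef := by simpa using hB.mul_mul_conjTranspose_same Q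
  have h1 := det_le_trace_div_pow hC
  have ht : (Q * B * Qᵀ).trace = (H⁻¹ * B).trace := by
    rw [hQ, Matrix.trace_mul_comm (Q * B), ← Matrix.mul_assoc]
  have hdet : (Q * B * Qᵀ).det = (H.det)⁻¹ * B.det := by
    rw [det_mul, det_mul, det_transpose]
    have : (H⁻¹).det = Q.det * Q.det := by rw [hQ, det_mul, det_transpose]
    rw [det_nonsing_inv, Ring.inverse_eq_inv'] at this
    rw [this]; ring
  rw [ht, hdet] at h1
  have := hH.det_pos
  calc B.det = H.det * ((H.det)⁻¹ * B.det) := by field_simp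
    _ ≤ _ := by gcongr

theorem trace_inv_mul_nonneg {H B : Mat n} (hH : H.PosDef)
    (hB : B.PosSemidef) : 0 ≤ (H⁻¹ * B).trace := by
  obtain ⟨Q, hQ⟩ := exists_transpose_mul_self hH.inv.posSemidef
  have hC : (Q * B * Qᵀ).PosSemidef := by simpa using hB.mul_mul_conjTranspose_same Q
  have ht : (Q * B * Qᵀ).trace = (H⁻¹ * B).trace := by
    rw [hQ, Matrix.trace_mul_comm (Q * B), ← Matrix.mul_assoc]
  exact ht ▸ hC.trace_nonneg

theorem rpow_det_le_trace {H B : Mat n} (hn : 0 < n) (hH : H.PosDef) (hB : B.PosSemidef) :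
    n * B.det ^ ((1 : ℝ) / n) ≤ H.det ^ ((1 : ℝ) / n) * (H⁻¹ * B).trace := by
  have hn' : (0 : ℝ) < n := by exact_mod_cast hn
  have h := det_le_det_mul_trace_pow hH hB
  have ht := trace_inv_mul_nonneg hH hB
  have h2 : B.det ^ ((1 : ℝ) / n) ≤ (H.det * ((H⁻¹ * B).trace / n) ^ n) ^ ((1 : ℝ) / n) :=
    Real.rpow_le_rpow hB.det_nonneg h (by positivity)
  rw [mul_rpow hH.det_pos.le (by positivity), ← rpow_natCast (_ / _),
    ← rpow_mul (by positivity), mul_one_div_cancel hn'.ne', rpow_one] at h2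
  calc n * B.det ^ ((1 : ℝ) / n) ≤ n * (H.det ^ ((1 : ℝ) / n) * ((H⁻¹ * B).trace / n)) := by gcongr
    _ = _ := by field_simp

/-- Cauchy-Schwarz for a positive definite matrix and its inverse. -/
theorem dotProduct_sq_le {H : Mat n} (hH : H.PosDef) (a g : Fin n → ℝ) :
    (a ⬝ᵥ g) ^ 2 ≤ (a ⬝ᵥ H *ᵥ a) * (g ⬝ᵥ H⁻¹ *ᵥ g) := by
  obtain ⟨Q, hQ⟩ := exists_transpose_mul_self hH.posSemidef
  have hu : IsUnit H.det := hH.det_pos.ne'.isUnit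
  have h1 : a ⬝ᵥ g = (Q *ᵥ a) ⬝ᵥ (Q *ᵥ (H⁻¹ *ᵥ g)) := by
    rw [dotProduct_mulVec (Q *ᵥ a), ← mulVec_transpose, mulVec_mulVec, ← hQ, dotProduct_mulVec,
      ← mulVec_transpose, mulVec_mulVec, transpose_nonsing_inv, show Hᵀ = H from hH.isHermitian,
      nonsing_inv_mul _ hu, one_mulVec]
  have h2 : a ⬝ᵥ H *ᵥ a = (Q *ᵥ a) ⬝ᵥ (Q *ᵥ a) := by
    conv_lhs => rw [hQ]
    rw [← mulVec_mulVec, dotProduct_mulVec, vecMul_transpose]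
  have h3 : g ⬝ᵥ H⁻¹ *ᵥ g = (Q *ᵥ (H⁻¹ *ᵥ g)) ⬝ᵥ (Q *ᵥ (H⁻¹ *ᵥ g)) := by
    rw [dotProduct_mulVec (Q *ᵥ (H⁻¹ *ᵥ g)), ← mulVec_transpose, mulVec_mulVec, ← hQ,
      mulVec_mulVec, mul_nonsing_inv _ hu, one_mulVec]
  rw [h1, h2, h3]
  simpa [dotProduct, sq] using Finset.sum_mul_sq_le_sq_mul_sq univ (Q *ᵥ a) (Q *ᵥ (H⁻¹ *ᵥ g))

/-- The second derivative of `u` at `x` as a bilinear form. -/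
noncomputable def D2 (u : Eu n → ℝ) (x a b : Eu n) : ℝ := fderiv ℝ (fderiv ℝ u) x a b

theorem hess_apply (u : Eu n → ℝ) (x : Eu n) (i j : Fin n) :
    hess u x i j = D2 u x (single i 1) (single j 1) := by
  simp [hess, D2, iteratedFDeriv_two_apply]

theorem sum_single (a : Eu n) : a = ∑ i, a i • single i (1 : ℝ) := by
  ext j; simp [Finset.sum_apply, Pi.single_apply]

theorem D2_eq_sum (u : Eu n → ℝ) (x a b : Eu n) :
    D2 u x a b = ∑ i, ∑ j, a i * b j * hess u x i j := by
  simp only [hess_apply]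
  unfold D2
  conv_lhs => rw [sum_single a, sum_single b]
  simp only [map_sum, map_smul, _root_.sum_apply, _root_.smul_apply,
    smul_eq_mul, mul_sum, mul_assoc]
  rw [sum_comm]
  exact sum_congr rfl fun i _ => sum_congr rfl fun j _ => by ring

theorem D2_eq_dotProduct (u : Eu n → ℝ) (x a b : Eu n) :
    D2 u x a b = a.ofLp ⬝ᵥ hess u x *ᵥ b.ofLp := by
  rw [D2_eq_sum]
  simp only [dotProduct, mulVec, mul_sum]
  exact sum_congr rfl fun i _ => sum_congr rfl fun j _ => by ring

theorem D2_comm (hu : ContDiff ℝ 2 u) (x a b : Eu n) : D2 u x a b = D2 u x b a :=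
  (hu.contDiffAt.isSymmSndFDerivAt (by simp)).eq a b

theorem differentiable_fderiv (hu : ContDiff ℝ 2 u) : Differentiable ℝ (fderiv ℝ u) :=
  (hu.fderiv_right (m := 1) (by norm_num)).differentiable (by norm_num)

theorem continuous_D2 (hu : ContDiff ℝ 2 u) (a b : Eu n) : Continuous fun x => D2 u x a b := by
  have h : Continuous (fderiv ℝ (fderiv ℝ u)) :=
    ((hu.fderiv_right (m := 1) (by norm_num)).fderiv_right (m := 0) (by norm_num)).continuous
  exact ((h.clm_apply continuous_const).clm_apply continuous_const)

theorem continuous_hess (hu : ContDiff ℝ 2 u) : Continuous (hess u) := by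
  refine continuous_matrix fun i j => ?_
  simp only [hess_apply]
  exact continuous_D2 hu _ _

theorem hess_isSymm (hu : ContDiff ℝ 2 u) (x : Eu n) : (hess u x).IsSymm := by
  ext i j
  rw [transpose_apply, hess_apply, hess_apply, D2_comm hu]

theorem hasDerivAt_line (hu : ContDiff ℝ 1 u) (x a : Eu n) (t : ℝ) :
    HasDerivAt (fun t : ℝ => u (x + t • a)) (fderiv ℝ u (x + t • a) a) t := by
  have h1 : HasDerivAt (fun t : ℝ => x + t • a) a t := by
    simpa using ((hasDerivAt_id t).smul_const a).const_add x
  exact ((hu.differentiable (by norm_num)) _).hasFDerivAt.comp_hasDerivAt t h1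

theorem hasDerivAt_line_fderiv (hu : ContDiff ℝ 2 u) (x a b : Eu n) (t : ℝ) :
    HasDerivAt (fun t : ℝ => fderiv ℝ u (x + t • a) b) (D2 u (x + t • a) a b) t := by
  have h1 : HasDerivAt (fun t : ℝ => x + t • a) a t := by
    simpa using ((hasDerivAt_id t).smul_const a).const_add x
  have h2 := ((differentiable_fderiv hu) (x + t • a)).hasFDerivAt.comp_hasDerivAt t h1
  simpa [D2] using h2.clm_apply (hasDerivAt_const t b)

/-- The necessary second order condition at a local minimum. -/
theorem D2_nonneg_of_isLocalMin (hu : ContDiff ℝ 2 u) {x : Eu n}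
    (hx : IsLocalMin u x) (a : Eu n) : 0 ≤ D2 u x a a := by
  by_contra! hneg
  set g : ℝ → ℝ := fun t => u (x + t • a) with hg
  have hd : deriv g = fun t => fderiv ℝ u (x + t • a) a :=
    funext fun t => (hasDerivAt_line (hu.of_le (by norm_num)) x a t).deriv
  have hdd : deriv (deriv g) 0 = D2 u x a a := by
    rw [hd]; simpa using (hasDerivAt_line_fderiv hu x a a 0).deriv
  have hmin : IsLocalMin g 0 := by
    have hc : ContinuousAt (fun t : ℝ => x + t • a) 0 := by fun_prop
    have : Tendsto (fun t : ℝ => x + t • a) (nhds 0) (nhds x) := by simpa [ContinuousAt] using hc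
    have h := this.eventually hx
    simpa [IsLocalMin, IsMinFilter, hg] using h
  have hmax : IsLocalMax g 0 :=
    isLocalMax_of_deriv_deriv_neg (by rw [hdd]; exact hneg) hmin.deriv_eq_zero
      (by rw [hg]; exact (hasDerivAt_line (hu.of_le (by norm_num)) x a 0).continuousAt)
  have hconst : g =ᶠ[nhds 0] fun _ => g 0 := by
    filter_upwards [hmin, hmax] with t h1 h2 using le_antisymm h2 h1
  have h1 : deriv g =ᶠ[nhds 0] fun _ => 0 := by
    have := hconst.deriv
    simpa using this
  have h2 := h1.deriv_eq
  rw [hdd] at h2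
  simp at h2
  linarith

theorem hess_add {u v : Eu n → ℝ} (hu : ContDiff ℝ 2 u) (hv : ContDiff ℝ 2 v) (x : Eu n) :
    hess (fun y => u y + v y) x = hess u x + hess v x := by
  ext i j
  have := iteratedFDeriv_add_apply (𝕜 := ℝ) (i := 2) (x := x) hu.contDiffAt hv.contDiffAt
  simp only [hess, of_apply, Matrix.add_apply]
  rw [show (fun y => u y + v y) = u + v from rfl, this]
  rfl

theorem hess_const_mul (hu : ContDiff ℝ 2 u) (c : ℝ) (x : Eu n) :
    hess (fun y => c * u y) x = c • hess u x := by
  ext i j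
  have := iteratedFDeriv_const_smul_apply (𝕜 := ℝ) (i := 2) (x := x) (a := c) hu.contDiffAt
  simp only [hess, of_apply, Matrix.smul_apply]
  rw [show (fun y => c * u y) = c • u from rfl, this]
  rfl

theorem hess_comp_add (u : Eu n → ℝ) (e x : Eu n) :
    hess (fun y => u (y + e)) x = hess u (x + e) := by
  ext i j
  simp only [hess, of_apply]
  rw [iteratedFDeriv_comp_add_right]

theorem hess_affine (l : Eu n →L[ℝ] ℝ) (c : ℝ) (x : Eu n) : hess (fun y => l y + c) x = 0 := by
  ext i j
  have h : fderiv ℝ (fun y => l y + c) = fun _ => l := by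
    funext y
    rw [fderiv_add_const]; exact l.fderiv
  simp [hess_apply, D2, h]

theorem gradient_hasFDerivAt (hu : ContDiff ℝ 2 u) (x : Eu n) :
    HasFDerivAt (gradient u) (toEuclideanCLM (𝕜 := ℝ) (hess u x)) x := by
  have h := ((differentiable_fderiv hu) x).hasFDerivAt
  have h2 := ((InnerProductSpace.toDual ℝ (Eu n)).symm.toContinuousLinearEquiv.toContinuousLinearMap
    ).hasFDerivAt.comp x h
  have h3 : gradient u = fun y => (InnerProductSpace.toDual ℝ (Eu n)).symm (fderiv ℝ u y) := rfl
  rw [h3]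
  refine h2.congr_fderiv ?_
  ext a j
  have e1 : (toEuclideanCLM (𝕜 := ℝ) (hess u x) a) j = ∑ k, hess u x j k * a k := by
    rw [ofLp_toEuclideanCLM]; rfl
  rw [e1]
  have e2 : ∀ w : Eu n, w j = inner ℝ w (single j (1 : ℝ)) := by
    intro w; simp [EuclideanSpace.inner_single_right]
  rw [e2]
  have : inner ℝ ((InnerProductSpace.toDual ℝ (Eu n)).symm ((fderiv ℝ (fderiv ℝ u) x) a))
      (single j (1 : ℝ)) = D2 u x a (single j 1) := by
    rw [InnerProductSpace.toDual_symm_apply]; rfl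
  refine (this.trans ?_)
  rw [D2_comm hu, D2_eq_sum]
  simp [mul_comm]

theorem det_toEuclideanCLM (A : Mat n) :
    (toEuclideanCLM (𝕜 := ℝ) A : Eu n →L[ℝ] Eu n).det = A.det := by
  have h : ((toEuclideanCLM (𝕜 := ℝ) A : Eu n →L[ℝ] Eu n) : Eu n →ₗ[ℝ] Eu n)
      = Matrix.toLin (EuclideanSpace.basisFun (Fin n) ℝ).toBasis
        (EuclideanSpace.basisFun (Fin n) ℝ).toBasis A := by
    rw [coe_toEuclideanCLM_eq_toEuclideanLin, toEuclideanLin_eq_toLin_orthonormal]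
  rw [ContinuousLinearMap.det, h, LinearMap.det_toLin]

theorem continuous_gradient (hu : ContDiff ℝ 2 u) : Continuous (gradient u) :=
  continuous_iff_continuousAt.2 fun x => (gradient_hasFDerivAt hu x).continuousAt

/-- A `C²` function with positive definite Hessian. -/
structure ConvexC2 (u : Eu n → ℝ) : Prop where
  smooth : ContDiff ℝ 2 u
  pos : ∀ x, (hess u x).PosDef

/-- The Bregman divergence of `u`: the gap between `u` and its tangent plane at `x`. -/
noncomputable def breg (u : Eu n → ℝ) (x z : Eu n) : ℝ := u z - u x - fderiv ℝ u x (z - x)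

/-- The section of `u` with center `x` and height `h`. -/
def sec (u : Eu n → ℝ) (x : Eu n) (h : ℝ) : Set (Eu n) := {z | breg u x z ≤ h}

theorem mem_sec {x z : Eu n} {h : ℝ} : z ∈ sec u x h ↔ breg u x z ≤ h := Iff.rfl

@[simp] theorem breg_self (u : Eu n → ℝ) (x : Eu n) : breg u x x = 0 := by simp [breg]

theorem sec_mono (u : Eu n → ℝ) (x : Eu n) {h k : ℝ} (hk : h ≤ k) : sec u x h ⊆ sec u x k :=
  fun _ hz => le_trans hz hk

theorem breg_three (u : Eu n → ℝ) (x y z : Eu n) :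
    breg u y z = breg u x z - breg u x y - (fderiv ℝ u y - fderiv ℝ u x) (z - y) := by
  have : z - x = (z - y) + (y - x) := by abel
  simp only [breg, this, map_add, _root_.sub_apply]
  ring

theorem inner_gradient_sub (u : Eu n → ℝ) (x y z : Eu n) :
    inner ℝ (gradient u y - gradient u x) z = (fderiv ℝ u y - fderiv ℝ u x) z := by
  rw [inner_sub_left, inner_gradient_left, inner_gradient_left, _root_.sub_apply]

theorem self_mem_sec (u : Eu n → ℝ) (x : Eu n) {h : ℝ} (hh : 0 ≤ h) : x ∈ sec u x h := by
  simpa [mem_sec] using hh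

namespace ConvexC2


theorem smooth1 (hu : ConvexC2 u) : ContDiff ℝ 1 u := hu.smooth.of_le (by norm_num)

theorem differentiable (hu : ConvexC2 u) : Differentiable ℝ u := hu.smooth.differentiable (by norm_num)

theorem continuous (hu : ConvexC2 u) : Continuous u := hu.smooth.continuous

theorem D2_pos (hu : ConvexC2 u) (x : Eu n) {a : Eu n} (ha : a ≠ 0) : 0 < D2 u x a a := by
  rw [D2_eq_dotProduct]
  have := (hu.pos x).dotProduct_mulVec_pos (x := a.ofLp) (by simpa using ha)
  simpa using this

theorem D2_nonneg (hu : ConvexC2 u) (x a : Eu n) : 0 ≤ D2 u x a a := by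
  rcases eq_or_ne a 0 with rfl | ha
  · simp [D2]
  · exact (hu.D2_pos x ha).le

theorem fderiv_line_strictMono (hu : ConvexC2 u) (x : Eu n) {a : Eu n} (ha : a ≠ 0) :
    StrictMono fun t : ℝ => fderiv ℝ u (x + t • a) a := by
  refine strictMono_of_deriv_pos fun t => ?_
  rw [(hasDerivAt_line_fderiv hu.smooth x a a t).deriv]
  exact hu.D2_pos _ ha

theorem breg_pos (hu : ConvexC2 u) {x z : Eu n} (h : z ≠ x) : 0 < breg u x z := by
  have ha : z - x ≠ 0 := sub_ne_zero.2 h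
  obtain ⟨c, hc, hc'⟩ := exists_hasDerivAt_eq_slope (fun t : ℝ => u (x + t • (z - x)))
    (fun t => fderiv ℝ u (x + t • (z - x)) (z - x)) zero_lt_one
    (fun t _ => (hasDerivAt_line hu.smooth1 x (z - x) t).continuousAt.continuousWithinAt)
    (fun t _ => hasDerivAt_line hu.smooth1 x (z - x) t)
  have h1 := hu.fderiv_line_strictMono x ha hc.1
  simp only [one_smul, add_sub_cancel, zero_smul, add_zero, sub_zero, div_one] at hc' h1
  unfold breg
  linarith

theorem breg_nonneg (hu : ConvexC2 u) (x z : Eu n) : 0 ≤ breg u x z := by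
  rcases eq_or_ne z x with rfl | h
  · simp
  · exact (hu.breg_pos h).le

theorem continuous_breg (hu : ConvexC2 u) (x : Eu n) : Continuous (breg u x) := by
  unfold breg
  have := hu.continuous
  fun_prop

theorem convexOn (hu : ConvexC2 u) : ConvexOn ℝ Set.univ u := by
  refine ⟨convex_univ, fun x _ y _ a b ha hb hab => ?_⟩
  have h1 := hu.breg_nonneg (a • x + b • y) x
  have h2 := hu.breg_nonneg (a • x + b • y) y
  have h3 : a * breg u (a • x + b • y) x + b * breg u (a • x + b • y) y
      = a * u x + b * u y - u (a • x + b • y) := by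
    have e : a • (x - (a • x + b • y)) + b • (y - (a • x + b • y)) = 0 := by
      have : a • (x - (a • x + b • y)) + b • (y - (a • x + b • y))
        = a • x + b • y - (a + b) • (a • x + b • y) := by module
      rw [this, hab]; module
    have e2 := congrArg (fderiv ℝ u (a • x + b • y)) e
    simp only [map_add, map_smul, smul_eq_mul, map_zero] at e2
    unfold breg
    linear_combination (-1) * e2 - (u (a • x + b • y)) * hab
  simp only [smul_eq_mul]
  nlinarith [mul_nonneg ha h1, mul_nonneg hb h2]

theorem convexOn_breg (hu : ConvexC2 u) (x : Eu n) : ConvexOn ℝ Set.univ (breg u x) := by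
  have h1 : ConvexOn ℝ Set.univ fun z => -(fderiv ℝ u x) z :=
    (-(fderiv ℝ u x) : Eu n →L[ℝ] ℝ).toLinearMap.convexOn convex_univ
  have h2 := (hu.convexOn.add h1).add (convexOn_const (fderiv ℝ u x x - u x) convex_univ)
  refine h2.congr fun z _ => ?_
  simp [breg]
  ring

theorem convex_sec (hu : ConvexC2 u) (x : Eu n) (h : ℝ) : Convex ℝ (sec u x h) := by
  simpa [sec] using (hu.convexOn_breg x).convex_le h

theorem isClosed_sec (hu : ConvexC2 u) (x : Eu n) (h : ℝ) : IsClosed (sec u x h) :=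
  isClosed_le (hu.continuous_breg x) continuous_const

theorem breg_smul_le (hu : ConvexC2 u) (x a : Eu n) {t : ℝ} (h0 : 0 ≤ t) (h1 : t ≤ 1) :
    breg u x (x + t • a) ≤ t * breg u x (x + a) := by
  have := (hu.convexOn_breg x).2 (Set.mem_univ x) (Set.mem_univ (x + a)) (sub_nonneg.2 h1) h0
    (by ring)
  have e : (1 - t) • x + t • (x + a) = x + t • a := by module
  rw [e] at this
  simpa using this

theorem exists_linear_lower_bound (hu : ConvexC2 u) (x : Eu n) :
    ∃ m > 0, ∀ z, 1 ≤ ‖z - x‖ → m * ‖z - x‖ ≤ breg u x z := by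
  rcases (sphere x 1).eq_empty_or_nonempty with hE | hne
  · refine ⟨1, one_pos, fun z hz => ?_⟩
    exfalso
    have : x + ‖z - x‖⁻¹ • (z - x) ∈ sphere x 1 := by
      have : ‖z - x‖ ≠ 0 := by positivity
      simp [norm_smul, this]
    simp [hE] at this
  obtain ⟨y, hy, hmin⟩ := (isCompact_sphere x 1).exists_isMinOn hne (hu.continuous_breg x).continuousOn
  have hyx : y ≠ x := by rintro rfl; simp at hy
  refine ⟨breg u x y, hu.breg_pos hyx, fun z hz => ?_⟩
  have hz0 : 0 < ‖z - x‖ := by positivity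
  have hs : x + ‖z - x‖⁻¹ • (z - x) ∈ sphere x 1 := by simp [norm_smul, hz0.ne']
  have h1 : breg u x y ≤ breg u x (x + ‖z - x‖⁻¹ • (z - x)) := hmin hs
  have h2 := hu.breg_smul_le x (z - x) (t := ‖z - x‖⁻¹) (by positivity) (inv_le_one_of_one_le₀ hz)
  rw [add_sub_cancel] at h2
  have := h1.trans h2
  rw [← div_eq_inv_mul, le_div_iff₀ hz0] at this
  exact this

theorem isCompact_sec (hu : ConvexC2 u) (x : Eu n) (h : ℝ) : IsCompact (sec u x h) := by
  obtain ⟨m, hm, hb⟩ := hu.exists_linear_lower_bound x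
  refine Metric.isCompact_of_isClosed_isBounded (hu.isClosed_sec x h)
    ((Metric.isBounded_closedBall (x := x) (r := max 1 (h / m))).subset fun z hz => ?_)
  rw [mem_closedBall, dist_eq_norm]
  by_contra! hlt
  have h1 := hb z ((le_max_left _ _).trans hlt.le)
  have h2 : h / m < ‖z - x‖ := (le_max_right _ _).trans_lt hlt
  rw [div_lt_iff₀ hm] at h2
  have : breg u x z ≤ h := hz
  nlinarith

theorem isOpen_breg_lt (hu : ConvexC2 u) (x : Eu n) (h : ℝ) : IsOpen {z | breg u x z < h} :=
  isOpen_lt (hu.continuous_breg x) continuous_const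

theorem sec_mem_nhds (hu : ConvexC2 u) (x : Eu n) {h : ℝ} (hh : 0 < h) : sec u x h ∈ nhds x :=
  mem_of_superset ((hu.isOpen_breg_lt x h).mem_nhds (by simpa using hh))
    fun _ hz => le_of_lt (Set.mem_ofPred.1 hz)

theorem gradient_injective (hu : ConvexC2 u) : Function.Injective (gradient u) := by
  intro x y hxy
  by_contra hne
  have h1 := hu.breg_pos (x := x) (z := y) (Ne.symm hne)
  have h2 := hu.breg_pos (x := y) (z := x) hne
  have h3 : fderiv ℝ u x = fderiv ℝ u y := by simpa [gradient] using hxy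
  have e : fderiv ℝ u y (x - y) = - fderiv ℝ u y (y - x) := by rw [← map_neg]; congr 1; abel
  unfold breg at h1 h2
  rw [h3] at h1
  rw [e] at h2
  linarith

/-- An interior minimum exists as soon as the boundary values dominate one interior value. -/
theorem exists_isLocalMin (hu : ConvexC2 u) {ψ : Eu n → ℝ} (hψ : Continuous ψ) {x y : Eu n} {h : ℝ}
    (hy : breg u x y < h) (hb : ∀ z, breg u x z = h → ψ y ≤ ψ z) :
    ∃ z, breg u x z < h ∧ IsLocalMin ψ z ∧ ψ z ≤ ψ y := by
  obtain ⟨z, hz, hmin⟩ := (hu.isCompact_sec x h).exists_isMinOn ⟨y, hy.le⟩ hψ.continuousOn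
  have key : ∀ w, breg u x w < h → (∀ w' ∈ sec u x h, ψ w ≤ ψ w') → IsLocalMin ψ w := by
    intro w hw hm
    filter_upwards [(hu.isOpen_breg_lt x h).mem_nhds hw] with w' hw' using hm w' (le_of_lt hw')
  rcases lt_or_eq_of_le (show breg u x z ≤ h from hz) with hlt | heq
  · exact ⟨z, hlt, key z hlt fun w' hw' => hmin hw', hmin hy.le⟩
  · exact ⟨y, hy, key y hy fun w' hw' => (hb z heq).trans (hmin hw'), le_rfl⟩

theorem exists_gradient_eq (hu : ConvexC2 u) {x y p : Eu n} {h : ℝ} (hy : breg u x y < h)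
    (hb : ∀ z, breg u x z = h → inner ℝ p (z - y) ≤ h - breg u x y) :
    ∃ z ∈ sec u x h, gradient u z - gradient u x = p := by
  set ψ : Eu n → ℝ := fun z => breg u x z - inner ℝ p z
  have hψc : Continuous ψ := by
    have := hu.continuous_breg x
    fun_prop
  obtain ⟨z, hz, hloc, -⟩ := hu.exists_isLocalMin hψc hy (fun z hz => by
    have := hb z hz
    rw [inner_sub_right] at this
    simp only [ψ, hz]; linarith)
  refine ⟨z, hz.le, ?_⟩
  have hd : HasFDerivAt ψ (fderiv ℝ u z - fderiv ℝ u x - innerSL ℝ p) z := by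
    have h1 : HasFDerivAt (breg u x) (fderiv ℝ u z - fderiv ℝ u x) z := by
      have h3 := (((hu.differentiable z).hasFDerivAt.sub_const (u x)).sub
        ((fderiv ℝ u x).hasFDerivAt.comp z ((hasFDerivAt_id z).sub_const x)))
      convert! h3 using 1
    exact h1.sub (innerSL ℝ p).hasFDerivAt
  have h0 := hloc.hasFDerivAt_eq_zero hd
  apply ext_inner_right ℝ
  intro w
  rw [inner_gradient_sub]
  have := congrArg (fun l : Eu n →L[ℝ] ℝ => l w) h0
  simp at this
  rw [_root_.sub_apply]; linarith

theorem volume_gradient_image (hu : ConvexC2 u) {s : Set (Eu n)} (hs : MeasurableSet s) :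
    volume (gradient u '' s) = ∫⁻ x in s, ofReal (hess u x).det := by
  rw [← lintegral_abs_det_fderiv_eq_addHaar_image volume hs
    (fun x _ => (gradient_hasFDerivAt hu.smooth x).hasFDerivWithinAt) hu.gradient_injective.injOn]
  simp_rw [det_toEuclideanCLM]
  refine lintegral_congr fun x => ?_
  rw [abs_of_pos (hu.pos x).det_pos]

theorem volume_gradient_image_le (hu : ConvexC2 u) {s : Set (Eu n)} (hs : MeasurableSet s) {Lam : ℝ}
    (hL : ∀ x, (hess u x).det ≤ Lam) :
    volume (gradient u '' s) ≤ ofReal Lam * volume s := by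
  rw [hu.volume_gradient_image hs, ← setLIntegral_const]
  exact lintegral_mono fun x => ofReal_le_ofReal (hL x)

theorem le_volume_gradient_image (hu : ConvexC2 u) {s : Set (Eu n)} (hs : MeasurableSet s) {lam : ℝ}
    (hL : ∀ x, lam ≤ (hess u x).det) :
    ofReal lam * volume s ≤ volume (gradient u '' s) := by
  rw [hu.volume_gradient_image hs, ← setLIntegral_const]
  exact lintegral_mono fun x => ofReal_le_ofReal (hL x)

end ConvexC2

theorem det_adjoint (B : Eu n →L[ℝ] Eu n) : (adjoint B).det = B.det := by
  obtain ⟨M, rfl⟩ := (toEuclideanCLM (𝕜 := ℝ) (n := Fin n)).surjective B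
  have h : adjoint (toEuclideanCLM (𝕜 := ℝ) M) = toEuclideanCLM (𝕜 := ℝ) Mᵀ := by
    rw [← ContinuousLinearMap.star_eq_adjoint, ← conjTranspose_eq_transpose_of_trivial,
      ← star_eq_conjTranspose]
    exact (map_star (toEuclideanCLM (𝕜 := ℝ) (n := Fin n)) M).symm
  have e : ∀ A : Mat n, ((toEuclideanCLM (𝕜 := ℝ) (n := Fin n)) A).det = A.det := det_toEuclideanCLM
  exact (congrArg ContinuousLinearMap.det h).trans ((e _).trans ((det_transpose M).trans (e M).symm))

/-- The volume of the unit ball. -/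
noncomputable def ballVol (n : ℕ) : ℝ := volume.real (ball (0 : Eu n) 1)

theorem ballVol_pos (n : ℕ) : 0 < ballVol n := by
  unfold ballVol
  exact ENNReal.toReal_pos (Metric.measure_ball_pos _ _ one_pos).ne' measure_ball_lt_top.ne

theorem volume_closedBall (x : Eu n) {r : ℝ} (hr : 0 ≤ r) :
    volume.real (closedBall x r) = r ^ n * ballVol n := by
  rw [Measure.addHaar_real_closedBall _ _ hr, finrank_euclideanSpace_fin, ballVol]

/-- The affine image `x + B (closedBall c r)`. -/
def ell (x : Eu n) (B : Eu n →L[ℝ] Eu n) (c : Eu n) (r : ℝ) : Set (Eu n) :=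
  (fun t => x + B t) '' closedBall c r

theorem isCompact_ell (x : Eu n) (B : Eu n →L[ℝ] Eu n) (c : Eu n) (r : ℝ) :
    IsCompact (ell x B c r) := (isCompact_closedBall c r).image (by fun_prop)

theorem volume_ell (x : Eu n) (B : Eu n →L[ℝ] Eu n) (c : Eu n) {r : ℝ} (hr : 0 ≤ r) :
    volume.real (ell x B c r) = |B.det| * (r ^ n * ballVol n) := by
  have : ell x B c r = (fun y => x + y) '' (B '' closedBall c r) := by rw [Set.image_image]; rfl
  rw [← volume_closedBall c hr, measureReal_def, this, Set.image_add_left, measure_preimage_add,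
    Measure.addHaar_image_continuousLinearMap, toReal_mul, measureReal_def,
    toReal_ofReal (abs_nonneg _)]

theorem volume_adjoint_preimage {B : Eu n →L[ℝ] Eu n} (hB : B.det ≠ 0) {r : ℝ} (hr : 0 ≤ r) :
    volume.real {p : Eu n | ‖adjoint B p‖ ≤ r} = |B.det|⁻¹ * (r ^ n * ballVol n) := by
  have : {p : Eu n | ‖adjoint B p‖ ≤ r} = adjoint B ⁻¹' closedBall 0 r := by ext p; simp
  rw [← volume_closedBall 0 hr, measureReal_def, this,
    Measure.addHaar_preimage_continuousLinearMap _ ((det_adjoint B).trans_ne hB),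
    toReal_mul, measureReal_def, toReal_ofReal (abs_nonneg _), abs_inv]
  rw [show LinearMap.det ((adjoint B : Eu n →L[ℝ] Eu n) : Eu n →ₗ[ℝ] Eu n)
    = B.det from det_adjoint B]

/-- Normalization of a convex body by a simplex of maximal volume with a vertex at `x`. -/
theorem exists_simplex_normalization {S : Set (Eu n)} (hS : IsCompact S) (hconv : Convex ℝ S)
    {x : Eu n} (hx : S ∈ nhds x) :
    ∃ B : Eu n →L[ℝ] Eu n, B.det ≠ 0 ∧ (∀ t : Eu n, (∀ i, 0 ≤ t i) → ∑ i, t i ≤ 1 → x + B t ∈ S) ∧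
      ∀ z ∈ S, ∃ t : Eu n, (∀ i, |t i| ≤ 1) ∧ z = x + B t := by
  set M : (Fin n → Eu n) → Mat n := fun y => Matrix.of fun i j => (y j - x) i
  have hMc : Continuous M := by
    refine continuous_matrix fun i j => ?_
    simp only [M, of_apply]
    fun_prop
  have hxS : x ∈ S := mem_of_mem_nhds hx
  obtain ⟨y, hyS, hmax⟩ := (isCompact_univ_pi fun _ : Fin n => hS).exists_isMaxOn
    ⟨fun _ => x, fun _ _ => hxS⟩ (f := fun y => |(M y).det|) (by have := hMc.matrix_det; fun_prop)
  have hpos : 0 < |(M y).det| := by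
    obtain ⟨δ, hδ, hball⟩ := Metric.mem_nhds_iff.1 hx
    have hy0 : (fun j : Fin n => x + (δ / 2) • single j (1 : ℝ)) ∈ Set.univ.pi fun _ => S := by
      intro j _
      apply hball
      simp [norm_smul, abs_of_pos hδ]
      linarith
    have h1 := hmax hy0
    have h2 : M (fun j : Fin n => x + (δ / 2) • single j (1 : ℝ)) = diagonal fun _ => δ / 2 := by
      ext i j
      simp [M, diagonal_apply]
    refine lt_of_lt_of_le ?_ h1
    simp only [h2, det_diagonal]
    positivity
  have hdet : (M y).det ≠ 0 := abs_pos.1 hpos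
  set B : Eu n →L[ℝ] Eu n := toEuclideanCLM (𝕜 := ℝ) (M y)
  have hBt : ∀ t : Eu n, B t = ∑ j, t j • (y j - x) := by
    intro t
    ext i
    simp only [B, ofLp_toEuclideanCLM, mulVec, dotProduct, M, of_apply]
    simp [Finset.sum_apply, mul_comm]
  refine ⟨B, by rwa [det_toEuclideanCLM], fun t ht0 ht1 => ?_, fun z hz => ?_⟩
  · rw [hBt]
    have e : x + ∑ j, t j • (y j - x) = (1 - ∑ j, t j) • x + ∑ j, t j • y j := by
      simp only [smul_sub, sum_sub_distrib, ← Finset.sum_smul, sub_smul, one_smul]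
      abel
    rw [e]
    have := hconv.sum_mem (t := (univ : Finset (Option (Fin n))))
      (w := fun o => o.elim (1 - ∑ j, t j) fun j => t j) (z := fun o => o.elim x y)
      (by rintro (_ | j) _ <;> simp [ht0, ht1]) (by simp [Fintype.sum_option])
      (by rintro (_ | j) _ <;> simp [hxS]; exact hyS j (Set.mem_univ j))
    simpa [Fintype.sum_option] using this
  · set b : Fin n → ℝ := (z - x).ofLp
    set t : Eu n := WithLp.toLp 2 ((M y)⁻¹ *ᵥ b)
    refine ⟨t, fun j => ?_, ?_⟩
    · have hc := det_smul_inv_mulVec_eq_cramer (M y) b hdet.isUnit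
      have hcj := congrFun hc j
      rw [cramer_apply] at hcj
      have hup : (M y).updateCol j b = M (Function.update y j z) := by
        ext i k
        rcases eq_or_ne k j with rfl | hk
        · simp [M, b]
        · simp [M, updateCol_ne hk, Function.update_of_ne hk]
      rw [hup] at hcj
      have hm : |(M (Function.update y j z)).det| ≤ |(M y).det| := by
        refine hmax ?_
        intro k _
        rcases eq_or_ne k j with rfl | hk
        · simpa using hz
        · simpa [Function.update_of_ne hk] using hyS k (Set.mem_univ k)
      rw [← hcj] at hm
      simp only [Pi.smul_apply, smul_eq_mul, abs_mul] at hm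
      exact (mul_le_iff_le_one_right hpos).1 hm
    · have : B t = z - x := by
        ext i
        simp only [B, t, ofLp_toEuclideanCLM, mulVec_mulVec, mul_nonsing_inv _ hdet.isUnit,
          one_mulVec, b]
      rw [this]; abel

theorem norm_le_sqrt_of_abs_le {t : Eu n} (ht : ∀ i, |t i| ≤ 1) : ‖t‖ ≤ √n := by
  rw [EuclideanSpace.norm_eq]
  refine Real.sqrt_le_sqrt ?_
  calc ∑ i, ‖t i‖ ^ 2 ≤ ∑ _i : Fin n, (1 : ℝ) := sum_le_sum fun i _ => by
        have := ht i
        rw [Real.norm_eq_abs]; exact pow_le_one₀ (abs_nonneg _) this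
    _ = n := by simp

theorem abs_apply_le_norm (t : Eu n) (i : Fin n) : |t i| ≤ ‖t‖ := PiLp.norm_apply_le t i

/-- Normalization of a convex body by an ellipsoid. -/
theorem exists_normalization (hn : 0 < n) {S : Set (Eu n)} (hS : IsCompact S)
    (hconv : Convex ℝ S) {x : Eu n} (hx : S ∈ nhds x) :
    ∃ B : Eu n →L[ℝ] Eu n, B.det ≠ 0 ∧
      ell x B (WithLp.toLp 2 fun _ => 1 / (2 * n)) (1 / (2 * n)) ⊆ S ∧
      S ⊆ ell x B 0 (√n) := by
  obtain ⟨B, hB, h1, h2⟩ := exists_simplex_normalization hS hconv hx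
  have hn' : (0 : ℝ) < n := by exact_mod_cast hn
  refine ⟨B, hB, ?_, ?_⟩
  · rintro _ ⟨t, ht, rfl⟩
    have hti : ∀ i, |t i - 1 / (2 * n)| ≤ 1 / (2 * n) := by
      intro i
      rw [mem_closedBall, dist_eq_norm] at ht
      exact (abs_apply_le_norm (t - WithLp.toLp 2 fun _ => 1 / (2 * (n : ℝ))) i).trans ht
    refine h1 t (fun i => ?_) ?_
    · have := (abs_le.1 (hti i)).1; linarith
    · calc ∑ i, t i ≤ ∑ _i : Fin n, (1 / n : ℝ) := sum_le_sum fun i _ => by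
            have := (abs_le.1 (hti i)).2
            have e : 1 / (2 * (n : ℝ)) + 1 / (2 * n) = 1 / n := by field_simp; norm_num
            linarith
        _ = 1 := by simp [hn'.ne']
  · intro z hz
    obtain ⟨t, ht, rfl⟩ := h2 z hz
    exact ⟨t, by simpa using norm_le_sqrt_of_abs_le ht, rfl⟩

/-- A convex set containing a ball and a far point has large volume. -/
theorem volume_ge_of_ball_of_mem {K : Set (Eu n)} (hK : Convex ℝ K) {ρ : ℝ} (hρ : 0 < ρ)
    (hball : closedBall 0 ρ ⊆ K) {a : Eu n} (ha : a ∈ K) (hfin : volume K ≠ ⊤) :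
    ‖a‖ * ρ ^ n * ballVol n ≤ 4 * 2 ^ n * ρ * volume.real K := by
  have hω := ballVol_pos n
  rcases eq_or_ne a 0 with rfl | ha0
  · simp; positivity
  have hna : 0 < ‖a‖ := norm_pos_iff.2 ha0
  set N : ℕ := ⌊‖a‖ / (4 * ρ)⌋₊ + 1
  have hN : ‖a‖ / (4 * ρ) ≤ N := by
    have := (Nat.lt_floor_add_one (‖a‖ / (4 * ρ))).le
    push_cast [N]; exact this
  set c : ℕ → Eu n := fun k => (2 * ρ * k / ‖a‖) • a
  have hsub : ∀ k ∈ range N, ball (c k) (ρ / 2) ⊆ K := by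
    intro k hk z hz
    have hk' : (k : ℝ) ≤ ‖a‖ / (4 * ρ) := by
      have : k ≤ ⌊‖a‖ / (4 * ρ)⌋₊ := Nat.lt_succ_iff.1 (Finset.mem_range.1 hk)
      exact (Nat.cast_le.2 this).trans (Nat.floor_le (by positivity))
    set s : ℝ := 2 * ρ * k / ‖a‖
    have hs0 : 0 ≤ s := by positivity
    have hs1 : s ≤ 1 / 2 := by
      rw [le_div_iff₀ (by positivity)] at hk'
      simp only [s]; rw [div_le_iff₀ hna]; linarith
    rw [Metric.mem_ball, dist_eq_norm] at hz
    have h1s : 0 < 1 - s := by linarith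
    have e : z = (1 - s) • ((1 - s)⁻¹ • (z - s • a)) + s • a := by
      rw [smul_smul, mul_inv_cancel₀ h1s.ne', one_smul]; abel
    rw [e]
    refine hK (hball ?_) ha h1s.le hs0 (by ring)
    rw [mem_closedBall_zero_iff, norm_smul, norm_inv, norm_of_nonneg h1s.le, inv_mul_le_iff₀ h1s]
    refine hz.le.trans ?_
    nlinarith
  have hdisj : (range N : Set ℕ).PairwiseDisjoint fun k => ball (c k) (ρ / 2) := by
    intro k _ l _ hkl
    refine Metric.ball_disjoint_ball ?_
    have hkl' : (1 : ℝ) ≤ |(k : ℝ) - l| := by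
      have : (1 : ℤ) ≤ |(k : ℤ) - l| := Int.one_le_abs (sub_ne_zero.2 (by exact_mod_cast hkl))
      exact_mod_cast this
    rw [dist_eq_norm, ← sub_smul, norm_smul, Real.norm_eq_abs, ← sub_div, abs_div, abs_norm,
      div_mul_cancel₀ _ hna.ne', ← mul_sub, abs_mul, abs_of_pos (by positivity : 0 < 2 * ρ)]
    nlinarith
  have h1 : volume.real (⋃ k ∈ range N, ball (c k) (ρ / 2)) ≤ volume.real K :=
    measureReal_mono (Set.iUnion₂_subset hsub) hfin
  have h2 : volume.real (⋃ k ∈ range N, ball (c k) (ρ / 2)) = N * ((ρ / 2) ^ n * ballVol n) := by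
    rw [measureReal_biUnion_finset hdisj (fun _ _ => measurableSet_ball)
      (fun _ _ => measure_ball_lt_top.ne)]
    have : ∀ k, volume.real (ball (c k) (ρ / 2)) = (ρ / 2) ^ n * ballVol n := by
      intro k
      rw [measureReal_def, Measure.addHaar_ball_of_pos _ _ (by positivity), toReal_mul,
        toReal_ofReal (by positivity), finrank_euclideanSpace_fin, ballVol,
        measureReal_def]
    simp [this]
  rw [h2] at h1
  have h3 : ‖a‖ / (4 * ρ) * ((ρ / 2) ^ n * ballVol n) ≤ volume.real K :=
    (mul_le_mul_of_nonneg_right hN (by positivity)).trans h1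
  have e : ‖a‖ * ρ ^ n * ballVol n
      = (4 * 2 ^ n * ρ) * (‖a‖ / (4 * ρ) * ((ρ / 2) ^ n * ballVol n)) := by
    rw [div_pow]; field_simp
  rw [e]
  exact mul_le_mul_of_nonneg_left h3 (by positivity)

/-- A `C²` convex function on the whole space whose Monge-Ampère density is pinched. -/
structure Pinched (u : Eu n → ℝ) (lam Lam : ℝ) : Prop extends ConvexC2 u where
  lam_pos : 0 < lam
  lower : ∀ x, lam ≤ (hess u x).det
  upper : ∀ x, (hess u x).det ≤ Lam

theorem norm_le_of_forall_inner_le {w : Eu n} {ρ M : ℝ} (hρ : 0 < ρ) (hM : 0 ≤ M)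
    (h : ∀ t : Eu n, ‖t‖ ≤ ρ → inner ℝ w t ≤ M) : ‖w‖ ≤ M / ρ := by
  rcases eq_or_ne w 0 with rfl | hw
  · simp; positivity
  have hw' : 0 < ‖w‖ := norm_pos_iff.2 hw
  have := h ((ρ / ‖w‖) • w) (by
    rw [norm_smul, norm_of_nonneg (by positivity), div_mul_cancel₀ _ hw'.ne'])
  rw [inner_smul_right, real_inner_self_eq_norm_sq] at this
  rw [le_div_iff₀ hρ]
  calc ‖w‖ * ρ = ρ / ‖w‖ * ‖w‖ ^ 2 := by field_simp
    _ ≤ M := this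

namespace Pinched

theorem Lam_pos (hu : Pinched u lam Lam) : 0 < Lam :=
  hu.lam_pos.trans_le ((hu.lower 0).trans (hu.upper 0))

theorem volume_le_of_subset_gradient_image (hu : Pinched u lam Lam) {s P : Set (Eu n)}
    (hs : IsCompact s) (x : Eu n)
    (hP : ∀ p ∈ P, ∃ z ∈ s, gradient u z - gradient u x = p) :
    volume P ≠ ⊤ ∧ volume.real P ≤ Lam * volume.real s := by
  have hsub : P ⊆ (fun q => -gradient u x + q) '' (gradient u '' s) := by
    intro p hp
    obtain ⟨z, hz, rfl⟩ := hP p hp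
    exact ⟨gradient u z, ⟨z, hz, rfl⟩, by simp only []; abel⟩
  have h1 : volume P ≤ ofReal Lam * volume s := by
    refine (measure_mono hsub).trans ?_
    rw [Set.image_add_left, measure_preimage_add]
    exact hu.volume_gradient_image_le hs.measurableSet hu.upper
  have h2 : ofReal Lam * volume s ≠ ⊤ := mul_ne_top ENNReal.ofReal_ne_top hs.measure_lt_top.ne
  refine ⟨ne_top_of_le_ne_top h2 h1, ?_⟩
  have := ENNReal.toReal_mono h2 h1
  rwa [toReal_mul, toReal_ofReal hu.Lam_pos.le] at this

theorem le_volume_of_gradient_mem (hu : Pinched u lam Lam) {s P : Set (Eu n)}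
    (hs : MeasurableSet s) (x : Eu n) (hP : ∀ z ∈ s, gradient u z - gradient u x ∈ P)
    (hfin : volume P ≠ ⊤) : lam * volume.real s ≤ volume.real P := by
  have hsub : (fun q => -gradient u x + q) '' (gradient u '' s) ⊆ P := by
    rintro _ ⟨_, ⟨z, hz, rfl⟩, rfl⟩
    have := hP z hz
    rw [sub_eq_neg_add] at this
    exact this
  have h1 : ofReal lam * volume s ≤ volume P := by
    refine (hu.le_volume_gradient_image hs hu.lower).trans ?_
    refine le_trans ?_ (measure_mono hsub)
    rw [Set.image_add_left, measure_preimage_add]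
  have := ENNReal.toReal_mono hfin h1
  rwa [toReal_mul, toReal_ofReal hu.lam_pos.le] at this

/-- Two-sided volume bounds for the normalization of a section. -/
theorem exists_det_bounds (hu : Pinched u lam Lam) (hn : 0 < n) :
    ∃ c > 0, ∃ C > 0, ∀ (x : Eu n) (h : ℝ) (B : Eu n →L[ℝ] Eu n), 0 < h → B.det ≠ 0 →
      ell x B (WithLp.toLp 2 fun _ => 1 / (2 * n)) (1 / (2 * n)) ⊆ sec u x h →
      sec u x h ⊆ ell x B 0 (√n) →
      c * h ^ n ≤ B.det ^ 2 ∧ B.det ^ 2 ≤ C * h ^ n := by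
  have hn' : (0 : ℝ) < n := by exact_mod_cast hn
  have hsn : 0 < √n := sqrt_pos.2 hn'
  have hω := ballVol_pos n
  have hL := hu.Lam_pos
  have hl := hu.lam_pos
  set r₀ : ℝ := 1 / (2 * n) with hr₀
  have hr₀p : 0 < r₀ := by positivity
  refine ⟨(Lam * √n ^ n * √n ^ n)⁻¹, by positivity, (4 / (r₀ * r₀)) ^ n / lam, by positivity, ?_⟩
  intro x h B hh hB hin hout
  have hBp : 0 < |B.det| := abs_pos.2 hB
  constructor
  · have key : ∀ p ∈ {p : Eu n | ‖adjoint B p‖ ≤ h / √n},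
        ∃ z ∈ sec u x h, gradient u z - gradient u x = p := by
      intro p hp
      refine hu.exists_gradient_eq (y := x) (by simpa using hh) fun z hz => ?_
      obtain ⟨t, ht, rfl⟩ := hout (show z ∈ sec u x h from hz.le)
      simp only [add_sub_cancel_left, breg_self, sub_zero]
      rw [← adjoint_inner_left]
      calc inner ℝ (adjoint B p) t
          ≤ ‖adjoint B p‖ * ‖t‖ := real_inner_le_norm _ _
        _ ≤ h / √n * √n := by
            gcongr
            · exact hp
            · simpa using ht
        _ = h := by field_simp
    have h1 := (hu.volume_le_of_subset_gradient_image (hu.isCompact_sec x h) x key).2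
    rw [volume_adjoint_preimage hB (by positivity)] at h1
    have h2 : volume.real (sec u x h) ≤ |B.det| * (√n ^ n * ballVol n) := by
      rw [← volume_ell x B 0 hsn.le]
      exact measureReal_mono hout (isCompact_ell _ _ _ _).measure_lt_top.ne
    have h3 : |B.det|⁻¹ * ((h / √n) ^ n * ballVol n) ≤ Lam * (|B.det| * (√n ^ n * ballVol n)) :=
      h1.trans (mul_le_mul_of_nonneg_left h2 hL.le)
    rw [inv_mul_le_iff₀ hBp, div_pow, div_mul_eq_mul_div, div_le_iff₀ (by positivity)] at h3
    rw [inv_mul_le_iff₀ (by positivity), ← sq_abs B.det]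
    have := le_of_mul_le_mul_right (a := ballVol n) (by linarith [h3] : h ^ n * ballVol n
      ≤ (Lam * √n ^ n * √n ^ n * |B.det| ^ 2) * ballVol n) hω
    exact this
  · set c₀ : Eu n := WithLp.toLp 2 fun _ => 1 / (2 * (n : ℝ))
    have key : ∀ y ∈ ell x B c₀ (r₀ / 2), gradient u y - gradient u x ∈
        {p : Eu n | ‖adjoint B p‖ ≤ h / (r₀ / 2)} := by
      rintro _ ⟨t, ht, rfl⟩
      refine norm_le_of_forall_inner_le (by positivity) hh.le fun s hs => ?_
      rw [adjoint_inner_left, inner_gradient_sub]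
      have h3 := breg_three u x (x + B t) (x + B t + B s)
      have h4 := hu.breg_nonneg (x + B t) (x + B t + B s)
      have h5 := hu.breg_nonneg x (x + B t)
      have h6 : x + B t + B s ∈ sec u x h := by
        refine hin ⟨t + s, ?_, by simp [add_assoc]⟩
        rw [mem_closedBall, dist_eq_norm] at ht ⊢
        calc ‖t + s - c₀‖ = ‖(t - c₀) + s‖ := by congr 1; abel
          _ ≤ ‖t - c₀‖ + ‖s‖ := norm_add_le _ _
          _ ≤ r₀ / 2 + r₀ / 2 := add_le_add ht hs
          _ = r₀ := by ring
      rw [mem_sec] at h6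
      rw [add_sub_cancel_left] at h3
      linarith
    have hfin : volume {p : Eu n | ‖adjoint B p‖ ≤ h / (r₀ / 2)} ≠ ⊤ := by
      have : {p : Eu n | ‖adjoint B p‖ ≤ h / (r₀ / 2)}
          = adjoint B ⁻¹' closedBall 0 (h / (r₀ / 2)) := by
        ext p; simp
      rw [this, Measure.addHaar_preimage_continuousLinearMap _ ((det_adjoint B).trans_ne hB)]
      exact mul_ne_top ENNReal.ofReal_ne_top measure_closedBall_lt_top.ne
    have h1 := hu.le_volume_of_gradient_mem (isCompact_ell x B c₀ (r₀ / 2)).measurableSet x key hfin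
    rw [volume_ell x B c₀ (by positivity), volume_adjoint_preimage hB (by positivity),
      le_inv_mul_iff₀ hBp] at h1
    rw [← sq_abs B.det, div_mul_eq_mul_div, le_div_iff₀ hl]
    have e : (h / (r₀ / 2)) ^ n = (4 / (r₀ * r₀)) ^ n * h ^ n * (r₀ / 2) ^ n := by
      rw [← mul_pow, ← mul_pow]; congr 1; field_simp; norm_num
    rw [e] at h1
    have h2 : (|B.det| ^ 2 * lam) * ((r₀ / 2) ^ n * ballVol n)
        ≤ ((4 / (r₀ * r₀)) ^ n * h ^ n) * ((r₀ / 2) ^ n * ballVol n) := by linarith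
    exact le_of_mul_le_mul_right h2 (by positivity)

/-- Sections grow by a definite factor when the height doubles. -/
theorem exists_dilation (hu : Pinched u lam Lam) (hn : 0 < n) :
    ∃ κ : ℝ, 0 < κ ∧ κ ≤ 1 ∧ ∀ (x y z : Eu n) (h : ℝ), 0 < h → y ∈ sec u x h → z ∈ sec u x h →
      y + κ • (y - z) ∈ sec u x (2 * h) := by
  have hn' : (0 : ℝ) < n := by exact_mod_cast hn
  have hsn : 0 < √n := sqrt_pos.2 hn'
  have hω := ballVol_pos n
  have hL := hu.Lam_pos
  obtain ⟨_, _, C, hC, hdet⟩ := hu.exists_det_bounds hn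
  set C' : ℝ := 4 * 2 ^ n * Lam * √n ^ n * (C * 2 ^ n) * (2 * √n) ^ n with hC'
  have hC'p : 0 < C' := by positivity
  refine ⟨(C' + 1)⁻¹, by positivity, inv_le_one_of_one_le₀ (by linarith), ?_⟩
  intro x y z h hh hy hz
  by_contra hq
  set κ := (C' + 1)⁻¹
  have hκ : 0 < κ := by positivity
  set S := sec u x (2 * h)
  have hyS : y ∈ S := sec_mono u x (by linarith) hy
  have hzS : z ∈ S := sec_mono u x (by linarith) hz
  obtain ⟨B, hB, hin, hout⟩ := exists_normalization hn (hu.isCompact_sec x (2 * h))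
    (hu.convex_sec x _) (hu.sec_mem_nhds x (by linarith : 0 < 2 * h))
  have hBp : 0 < |B.det| := abs_pos.2 hB
  have hd := (hdet x (2 * h) B (by linarith) hB hin hout).2
  obtain ⟨f, s, hf1, hf2⟩ := geometric_hahn_banach_closed_point (hu.convex_sec x (2 * h))
    (hu.isClosed_sec x _) hq
  set ν := (InnerProductSpace.toDual ℝ (Eu n)).symm f
  have hν : ∀ w, inner ℝ ν w = f w := fun w => InnerProductSpace.toDual_symm_apply
  set γ := f (κ • (y - z)) with hγ
  have hq1 : ∀ ζ ∈ S, f (ζ - y) ≤ γ := by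
    intro ζ hζ
    have := (hf1 ζ hζ).trans hf2
    rw [map_add] at this
    rw [map_sub]; linarith
  have hγp : 0 < γ := by
    have := (hf1 y hyS).trans hf2
    rw [map_add] at this
    linarith
  set P : Set (Eu n) := {p | ∀ ζ ∈ S, inner ℝ p (ζ - y) ≤ h}
  have hPconv : Convex ℝ P := by
    intro p hp q hq a b ha hb hab ζ hζ
    rw [inner_add_left, inner_smul_left, inner_smul_left]
    have h1 := hp ζ hζ
    have h2 := hq ζ hζ
    simp only [conj_trivial]
    calc a * inner ℝ p (ζ - y) + b * inner ℝ q (ζ - y) ≤ a * h + b * h := by gcongr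
      _ = h := by rw [← add_mul, hab, one_mul]
  have hPv := hu.volume_le_of_subset_gradient_image (hu.isCompact_sec x (2 * h)) x (P := P)
    (fun p hp => by
      have hy' : breg u x y ≤ h := hy
      refine hu.exists_gradient_eq (y := y) (by linarith) fun z hz => ?_
      have := hp z hz.le
      linarith)
  set A := adjoint B
  have hAdet : LinearMap.det (A : Eu n →ₗ[ℝ] Eu n) ≠ 0 := (det_adjoint B).trans_ne hB
  have hKv : volume.real (A '' P) = |B.det| * volume.real P := by
    rw [measureReal_def, Measure.addHaar_image_continuousLinearMap, toReal_mul,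
      toReal_ofReal (abs_nonneg _), measureReal_def]
    rw [show LinearMap.det (A : Eu n →ₗ[ℝ] Eu n) = B.det from det_adjoint B]
  have hKfin : volume (A '' P) ≠ ⊤ := by
    rw [Measure.addHaar_image_continuousLinearMap]
    exact mul_ne_top ENNReal.ofReal_ne_top hPv.1
  set ρ := h / (2 * √n)
  have hρ : 0 < ρ := by positivity
  have hball : closedBall 0 ρ ⊆ A '' P := by
    intro w hw
    set e := LinearMap.equivOfDetNeZero (A : Eu n →ₗ[ℝ] Eu n) hAdet
    have hew : A (e.symm w) = w := e.apply_symm_apply w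
    refine ⟨e.symm w, fun ζ hζ => ?_, hew⟩
    obtain ⟨t, ht, rfl⟩ := hout hζ
    obtain ⟨t', ht', rfl⟩ := hout hyS
    have : x + B t - (x + B t') = B (t - t') := by rw [map_sub]; abel
    simp only [this]
    rw [← adjoint_inner_left]
    change inner ℝ (A (e.symm w)) (t - t') ≤ h
    rw [hew]
    rw [mem_closedBall_zero_iff] at hw ht ht'
    calc inner ℝ w (t - t') ≤ ‖w‖ * ‖t - t'‖ := real_inner_le_norm _ _
      _ ≤ ρ * (2 * √n) := by
          gcongr
          exact (norm_sub_le _ _).trans (by linarith)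
      _ = h := by simp only [ρ]; field_simp
  have hp1 : (h / γ) • ν ∈ P := by
    intro ζ hζ
    rw [inner_smul_left, hν]
    simp only [conj_trivial]
    calc h / γ * f (ζ - y) ≤ h / γ * γ := by gcongr; exact hq1 ζ hζ
      _ = h := by field_simp
  have hvol := volume_ge_of_ball_of_mem (hPconv.is_linear_image A.isBoundedLinearMap.toIsLinearMap)
    hρ hball ⟨_, hp1, rfl⟩ hKfin
  have hnorm : ρ / κ ≤ ‖A ((h / γ) • ν)‖ := by
    obtain ⟨t, ht, e1⟩ := hout hyS
    obtain ⟨t', ht', e2⟩ := hout hzS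
    rw [mem_closedBall_zero_iff] at ht ht'
    have e3 : y - z = B (t - t') := by
      rw [← e1, ← e2, map_sub]
      exact add_sub_add_left_eq_sub _ _ _
    have h1 : γ ≤ κ * (‖A ν‖ * (2 * √n)) := by
      rw [hγ, map_smul, smul_eq_mul, ← hν, e3, ← adjoint_inner_left]
      gcongr
      refine (real_inner_le_norm _ _).trans ?_
      gcongr
      exact (norm_sub_le _ _).trans (by linarith)
    rw [map_smul, norm_smul, norm_of_nonneg (by positivity), div_mul_eq_mul_div, le_div_iff₀ hγp]
    calc ρ / κ * γ ≤ ρ / κ * (κ * (‖A ν‖ * (2 * √n))) := by gcongr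
      _ = h * ‖A ν‖ := by simp only [ρ]; field_simp
  rw [hKv] at hvol
  have hSv : volume.real S ≤ |B.det| * (√n ^ n * ballVol n) := by
    rw [← volume_ell x B 0 hsn.le]
    exact measureReal_mono hout (isCompact_ell _ _ _ _).measure_lt_top.ne
  have h1 : ρ / κ * ρ ^ n * ballVol n
      ≤ 4 * 2 ^ n * ρ * (|B.det| * (Lam * (|B.det| * (√n ^ n * ballVol n)))) :=
    calc ρ / κ * ρ ^ n * ballVol n ≤ ‖A ((h / γ) • ν)‖ * ρ ^ n * ballVol n := by gcongr
      _ ≤ _ := hvol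
      _ ≤ _ := by
        gcongr
        exact hPv.2.trans (by gcongr)
  have h2 : 4 * 2 ^ n * ρ * (|B.det| * (Lam * (|B.det| * (√n ^ n * ballVol n))))
      = (4 * 2 ^ n * Lam * √n ^ n) * B.det ^ 2 * (ρ * ballVol n) := by
    rw [← sq_abs B.det]; ring
  rw [h2] at h1
  have h3 : (4 * 2 ^ n * Lam * √n ^ n) * B.det ^ 2 * (ρ * ballVol n)
      ≤ (4 * 2 ^ n * Lam * √n ^ n) * (C * (2 * h) ^ n) * (ρ * ballVol n) := by gcongr
  have h4 : (4 * 2 ^ n * Lam * √n ^ n) * (C * (2 * h) ^ n) * (ρ * ballVol n)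
      = C' * ρ ^ n * (ρ * ballVol n) := by
    simp only [hC', ρ, div_pow, mul_pow]; field_simp
  have h5 : (C' + 1) * (ρ ^ n * (ρ * ballVol n)) ≤ C' * (ρ ^ n * (ρ * ballVol n)) := by
    have : ρ / κ * ρ ^ n * ballVol n = (C' + 1) * (ρ ^ n * (ρ * ballVol n)) := by
      simp only [κ, div_inv_eq_mul]; ring
    rw [← this]; linarith
  have h6 : 0 < ρ ^ n * (ρ * ballVol n) := by positivity
  linarith

end Pinched

/-- The geometry of the sections of `u`: engulfing, and ellipsoids `x + B x h (ball)` comparable to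
the sections, of volume comparable to `h ^ (n / 2)`. -/
structure Geom (u : Eu n → ℝ) where
  Θ : ℝ
  two_le : 2 ≤ Θ
  engulf : ∀ {x y : Eu n} {h : ℝ}, 0 < h → y ∈ sec u x h → sec u x h ⊆ sec u y (Θ * h)
  engulf' : ∀ {x y : Eu n} {h : ℝ}, 0 < h → y ∈ sec u x h → sec u y h ⊆ sec u x (Θ * h)
  r : ℝ
  R : ℝ
  r_pos : 0 < r
  r_le : r ≤ 1
  one_le_R : 1 ≤ R
  B : Eu n → ℝ → (Eu n ≃L[ℝ] Eu n)
  inner_mem : ∀ {x z : Eu n} {h : ℝ}, 0 < h → ‖(B x h).symm (z - x)‖ ≤ r → z ∈ sec u x h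
  outer_le : ∀ {x z : Eu n} {h : ℝ}, 0 < h → z ∈ sec u x h → ‖(B x h).symm (z - x)‖ ≤ R
  cd : ℝ
  Cd : ℝ
  cd_pos : 0 < cd
  Cd_pos : 0 < Cd
  le_det : ∀ (x : Eu n) {h : ℝ}, 0 < h → cd * √h ^ n ≤ |(B x h : Eu n →L[ℝ] Eu n).det|
  det_le : ∀ (x : Eu n) {h : ℝ}, 0 < h → |(B x h : Eu n →L[ℝ] Eu n).det| ≤ Cd * √h ^ n
  J : ℝ
  one_le_J : 1 ≤ J
  swallow : ∀ {x z : Eu n} {h : ℝ}, 0 < h → z ∈ sec u x h → ‖(B x (J * h)).symm (z - x)‖ ≤ r / 4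

namespace Pinched

theorem exists_centered_normalization (hu : Pinched u lam Lam) (hn : 0 < n) :
    ∃ r > 0, r ≤ 1 ∧ ∃ c > 0, ∃ C > 0, ∀ (x : Eu n) (h : ℝ), 0 < h →
      ∃ B : Eu n ≃L[ℝ] Eu n, (∀ z, ‖B.symm (z - x)‖ ≤ r → z ∈ sec u x h) ∧
        (∀ z ∈ sec u x h, ‖B.symm (z - x)‖ ≤ √n) ∧
        c * √h ^ n ≤ |(B : Eu n →L[ℝ] Eu n).det| ∧
        |(B : Eu n →L[ℝ] Eu n).det| ≤ C * √h ^ n := by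
  have hn' : (0 : ℝ) < n := by exact_mod_cast hn
  obtain ⟨c, hc, C, hC, hdet⟩ := hu.exists_det_bounds hn
  obtain ⟨κ, hκ, hκ1, hdil⟩ := hu.exists_dilation hn
  have hr0 : 1 / (2 * (n : ℝ)) ≤ 1 := by
    rw [div_le_one (by positivity)]
    have : (1 : ℝ) ≤ n := by exact_mod_cast hn
    linarith
  refine ⟨κ * (1 / (2 * n)) / 2, by positivity, ?_, √c, sqrt_pos.2 hc, √C,
    sqrt_pos.2 hC, fun x h hh => ?_⟩
  · have : κ * (1 / (2 * n)) ≤ 1 := mul_le_one₀ hκ1 (by positivity) hr0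
    linarith [show 0 < κ * (1 / (2 * n)) by positivity]
  obtain ⟨B, hB, hin, hout⟩ := exists_normalization hn (hu.isCompact_sec x h)
    (hu.convex_sec x _) (hu.sec_mem_nhds x hh)
  obtain ⟨hd1, hd2⟩ := hdet x h B hh hB hin hout
  set E : Eu n ≃L[ℝ] Eu n := (LinearMap.equivOfDetNeZero (B : Eu n →ₗ[ℝ] Eu n) hB).toContinuousLinearEquiv
  have hE : ∀ t, E t = B t := fun t => rfl
  have hEB : (E : Eu n →L[ℝ] Eu n) = B := by ext1 t; exact hE t
  have hsq : (√h ^ n) ^ 2 = h ^ n := by rw [← pow_mul, mul_comm, pow_mul, sq_sqrt hh.le]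
  set c₀ : Eu n := WithLp.toLp 2 fun _ => 1 / (2 * (n : ℝ))
  have hsym : ∀ t : Eu n, ‖t‖ ≤ 1 / (2 * n) → x + κ • B t ∈ sec u x (2 * h) := by
    intro t ht
    have h1 : x + B (c₀ - t) ∈ sec u x h := hin ⟨c₀ - t, by simpa using ht, rfl⟩
    have h2 : x + B (c₀ + t) ∈ sec u x h := hin ⟨c₀ + t, by simpa using ht, rfl⟩
    have h3 := hdil x x _ h hh (self_mem_sec u x hh.le) h1
    have h4 : x + κ • B (c₀ + t) ∈ sec u x (2 * h) := by
      refine sec_mono u x (by linarith : h ≤ 2 * h) ?_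
      have := hu.breg_smul_le x (B (c₀ + t)) hκ.le hκ1
      rw [mem_sec] at h2 ⊢
      refine this.trans ((mul_le_of_le_one_left (hu.breg_nonneg _ _) hκ1).trans h2)
    have := hu.convex_sec x (2 * h) h3 h4 (by norm_num : (0 : ℝ) ≤ 1 / 2)
      (by norm_num : (0 : ℝ) ≤ 1 / 2) (by norm_num)
    convert this using 1
    simp only [map_add, map_sub]
    module
  refine ⟨E, fun z hz => ?_, fun z hz => ?_, ?_, ?_⟩
  · set t := E.symm (z - x)
    have ht : B t = z - x := by rw [← hE]; exact E.apply_symm_apply _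
    have h1 := hsym ((2 / κ) • t) (by
      rw [norm_smul, norm_of_nonneg (by positivity), div_mul_eq_mul_div, div_le_iff₀ hκ]
      linarith)
    rw [map_smul, smul_smul, mul_div_cancel₀ _ hκ.ne', ht] at h1
    have h2 := hu.breg_smul_le x ((2 : ℝ) • (z - x)) (t := 1 / 2) (by norm_num) (by norm_num)
    rw [smul_smul, show (1 / 2 : ℝ) * 2 = 1 by norm_num, one_smul, add_sub_cancel] at h2
    rw [mem_sec] at h1 ⊢
    linarith
  · obtain ⟨t, ht, rfl⟩ := hout hz
    rw [add_sub_cancel_left, ← hE, E.symm_apply_apply]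
    simpa using ht
  · rw [hEB]
    refine le_of_sq_le_sq ?_ (abs_nonneg _) |>.trans le_rfl
    rw [mul_pow, hsq, sq_sqrt hc.le, sq_abs]
    exact hd1
  · rw [hEB]
    refine le_of_sq_le_sq ?_ (by positivity)
    rw [mul_pow, hsq, sq_sqrt hC.le, sq_abs]
    exact hd2

theorem exists_engulfing (hu : Pinched u lam Lam) (hn : 0 < n) :
    ∃ θ : ℝ, 2 ≤ θ ∧ ∀ {x y : Eu n} {h : ℝ}, 0 < h → y ∈ sec u x h →
      sec u x h ⊆ sec u y (θ * h) := by
  obtain ⟨κ, hκ, hκ1, hdil⟩ := hu.exists_dilation hn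
  have h2κ : 2 ≤ 2 / κ := by rw [le_div_iff₀ hκ]; linarith
  refine ⟨1 + 2 / κ, by linarith, ?_⟩
  intro x y h hh hy z hz
  have h1 := hdil x y z h hh hy hz
  have h2 := breg_three u x y (y + κ • (y - z))
  have h3 := hu.breg_nonneg y (y + κ • (y - z))
  have h4 := breg_three u x y z
  have h5 := hu.breg_nonneg x y
  rw [add_sub_cancel_left, map_smul, smul_eq_mul] at h2
  have h6 : (fderiv ℝ u y - fderiv ℝ u x) (z - y) = - (fderiv ℝ u y - fderiv ℝ u x) (y - z) := by
    rw [← map_neg, neg_sub]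
  set g := (fderiv ℝ u y - fderiv ℝ u x) (y - z)
  rw [mem_sec] at *
  have h7 : g ≤ 2 * h / κ := by rw [le_div_iff₀ hκ]; linarith
  have h8 : (1 + 2 / κ) * h = h + 2 * h / κ := by ring
  rw [h8]; linarith

theorem nonempty_geom (hu : Pinched u lam Lam) (hn : 0 < n) : Nonempty (Geom u) := by
  obtain ⟨r, hr, hr1, c, hc, C, hC, hB⟩ := hu.exists_centered_normalization hn
  obtain ⟨θ, hθ, heng⟩ := hu.exists_engulfing hn
  obtain ⟨κ, hκ, hκ1, hdil⟩ := hu.exists_dilation hn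
  have hR : 1 ≤ √n := by rw [Real.one_le_sqrt]; exact_mod_cast hn
  obtain ⟨k, hk⟩ := pow_unbounded_of_one_lt (√n / (r / 4)) (by linarith : 1 < 1 + κ)
  have hit : ∀ (x z : Eu n) (h : ℝ), 0 < h → z ∈ sec u x h → ∀ k : ℕ,
      x + (1 + κ) ^ k • (z - x) ∈ sec u x (2 ^ k * h) := by
    intro x z h hh hz k
    induction k with
    | zero => simpa using hz
    | succ k ih =>
      have := hdil x _ x _ (by positivity) ih (self_mem_sec u x (by positivity))
      rw [← mul_assoc, ← pow_succ'] at this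
      convert this using 1
      rw [pow_succ, add_sub_cancel_left]
      module
  choose! B h1 h2 h3 h4 using hB
  refine ⟨⟨θ * θ, by nlinarith, ?_, ?_, r, √n, hr, hr1, hR, B,
    fun hh hz => h1 _ _ hh _ hz, fun hh hz => h2 _ _ hh _ hz, c, C, hc, hC, fun x _ hh => h3 x _ hh,
    fun x _ hh => h4 x _ hh, 2 ^ k, one_le_pow₀ (by norm_num), ?_⟩⟩
  · intro x y h hh hy
    exact (heng hh hy).trans (sec_mono u y (mul_le_mul_of_nonneg_right (by nlinarith) hh.le))
  · intro x y h hh hy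
    have hx : x ∈ sec u y (θ * h) := heng hh hy (self_mem_sec u x hh.le)
    have := heng (by positivity) hx
    rw [← mul_assoc] at this
    exact (sec_mono u y (by nlinarith : h ≤ θ * h)).trans this
  · intro x z h hh hz
    have := h2 x (2 ^ k * h) (by positivity) _ (hit x z h hh hz k)
    rw [add_sub_cancel_left, map_smul, norm_smul, norm_of_nonneg (by positivity)] at this
    rw [div_lt_iff₀ (by positivity)] at hk
    have hp : 0 < (1 + κ) ^ k := by positivity
    refine le_of_mul_le_mul_left ?_ hp
    linarith

end Pinched

/-- The linearized Monge-Ampère operator of `u`, normalized as `tr ((D²u)⁻¹ D²v)`. -/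
noncomputable def lin (u v : Eu n → ℝ) (x : Eu n) : ℝ := ((hess u x)⁻¹ * hess v x).trace

theorem posSemidef_hess {φ : Eu n → ℝ} (hφ : ContDiff ℝ 2 φ) {x : Eu n}
    (h : ∀ a, 0 ≤ D2 φ x a a) : (hess φ x).PosSemidef := by
  refine PosSemidef.of_dotProduct_mulVec_nonneg ?_ fun a => ?_
  · rw [IsHermitian, conjTranspose_eq_transpose_of_trivial]; exact hess_isSymm hφ x
  · have := h (WithLp.toLp 2 a)
    rw [D2_eq_dotProduct] at this
    simpa using this

theorem isClosed_D2_nonneg {φ : Eu n → ℝ} (hφ : ContDiff ℝ 2 φ) :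
    IsClosed {x : Eu n | ∀ a, 0 ≤ D2 φ x a a} := by
  have : {x : Eu n | ∀ a, 0 ≤ D2 φ x a a} = ⋂ a, {x | 0 ≤ D2 φ x a a} := by ext; simp
  rw [this]
  exact isClosed_iInter fun a => isClosed_le continuous_const (continuous_D2 hφ a a)

theorem volume_le_of_contact {φ F : Eu n → ℝ} (hφ : ContDiff ℝ 2 φ) {S E P : Set (Eu n)}
    (hS : IsCompact S) (hE : MeasurableSet E) (hES : E ⊆ S) (q : Eu n) (hF : Continuous F)
    (hF0 : ∀ z, 0 ≤ F z) (hP : ∀ p ∈ P, ∃ z ∈ E, gradient φ z = q + p)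
    (hdet : ∀ z ∈ E, |(hess φ z).det| ≤ F z) :
    volume.real P ≤ ∫ z in S, F z := by
  have hsub : P ⊆ (fun w => -q + w) '' (gradient φ '' E) := by
    intro p hp
    obtain ⟨z, hz, h⟩ := hP p hp
    exact ⟨_, ⟨z, hz, rfl⟩, by simp [h]⟩
  have hInt : IntegrableOn F S := hF.integrableOn_compact hS
  have h1 : volume P ≤ ofReal (∫ z in S, F z) := by
    refine (measure_mono hsub).trans ?_
    rw [Set.image_add_left, measure_preimage_add]
    refine (addHaar_image_le_lintegral_abs_det_fderiv volume hE
      (fun x _ => (gradient_hasFDerivAt hφ x).hasFDerivWithinAt)).trans ?_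
    rw [ofReal_integral_eq_lintegral_ofReal hInt (.of_forall hF0)]
    simp_rw [det_toEuclideanCLM]
    refine le_trans ?_ (lintegral_mono_set hES)
    exact setLIntegral_mono' hE fun z hz => ofReal_le_ofReal (hdet z hz)
  exact ENNReal.toReal_le_of_le_ofReal (setIntegral_nonneg hS.measurableSet fun z _ => hF0 z) h1

theorem one_add_pow_le {t : ℝ} (ht : 0 ≤ t) (n : ℕ) : (1 + t) ^ n ≤ 2 ^ n * (1 + t ^ n) := by
  rcases le_total t 1 with h | h
  · calc (1 + t) ^ n ≤ 2 ^ n := by gcongr; linarith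
      _ ≤ 2 ^ n * (1 + t ^ n) := le_mul_of_one_le_right (by positivity) (by
        have : 0 ≤ t ^ n := by positivity
        linarith)
  · calc (1 + t) ^ n ≤ (2 * t) ^ n := by gcongr; linarith
      _ = 2 ^ n * t ^ n := mul_pow _ _ _
      _ ≤ 2 ^ n * (1 + t ^ n) := by gcongr; linarith

theorem Geom.le_volume_polar (G : Geom u) {τ : ℝ} (hτ : 0 < τ) :
    ∃ c > 0, ∀ (x : Eu n) (s : ℝ), 0 < s → ∃ P : Set (Eu n),
      (∀ p ∈ P, ∀ z ∈ sec u x s, inner ℝ p (z - x) ≤ τ * s) ∧ c * √s ^ n ≤ volume.real P := by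
  have hω := ballVol_pos n
  have hR : 0 < G.R := zero_lt_one.trans_le G.one_le_R
  have hCd := G.Cd_pos
  refine ⟨(τ / G.R) ^ n * ballVol n / G.Cd, by positivity, fun x s hs => ?_⟩
  set B : Eu n →L[ℝ] Eu n := (G.B x s : Eu n →L[ℝ] Eu n)
  have hss : 0 < √s := sqrt_pos.2 hs
  have hd := G.le_det x hs
  have hdp : 0 < |B.det| := lt_of_lt_of_le (by have := G.cd_pos; positivity) hd
  refine ⟨{p | ‖adjoint B p‖ ≤ τ * s / G.R}, fun p hp z hz => ?_, ?_⟩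
  · have h1 := G.outer_le hs hz
    have h2 : z - x = B ((G.B x s).symm (z - x)) := ((G.B x s).apply_symm_apply _).symm
    rw [h2, ← adjoint_inner_left]
    refine (real_inner_le_norm _ _).trans ?_
    calc _ ≤ τ * s / G.R * G.R := by gcongr; exact hp
      _ = τ * s := by field_simp
  · rw [volume_adjoint_preimage (abs_pos.1 hdp) (by positivity)]
    have h3 := G.det_le x hs
    have hsq : s ^ n = √s ^ n * √s ^ n := by rw [← mul_pow, mul_self_sqrt hs.le]
    rw [le_inv_mul_iff₀ hdp]
    calc |B.det| * ((τ / G.R) ^ n * ballVol n / G.Cd * √s ^ n)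
        ≤ (G.Cd * √s ^ n) * ((τ / G.R) ^ n * ballVol n / G.Cd * √s ^ n) := by gcongr
      _ = (τ * s / G.R) ^ n * ballVol n := by
          rw [show τ * s / G.R = τ / G.R * s by ring, mul_pow, hsq]; field_simp

namespace Pinched

/-- Growth lemma: if `v` stays below `q * N` on a section whose center has value at least `N`, then
the section carries a definite amount of mass of `v` or of the source. -/
theorem growth_step (hu : Pinched u lam Lam) (G : Geom u) (hn : 0 < n) {q : ℝ} (hq : 1 < q) :
    ∃ c > 0, ∀ (v g : Eu n → ℝ) (x : Eu n) (s N : ℝ), ContDiff ℝ 2 v → Continuous g →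
      (∀ z, 0 ≤ g z) → 0 < s → 0 < N → (∀ z ∈ sec u x s, 0 < v z → -g z ≤ lin u v z) →
      (∀ z ∈ sec u x s, v z ≤ q * N) → N ≤ v x →
      c * √s ^ n ≤ N⁻¹ * (∫ z in sec u x s, max (v z) 0)
        + (s / N) ^ n * ∫ z in sec u x s, g z ^ n := by
  have hn' : (1 : ℝ) ≤ n := by exact_mod_cast hn
  have hL := hu.Lam_pos
  obtain ⟨c, hc, hpol⟩ := G.le_volume_polar (τ := 1 / (2 * q - 1)) (by
    have : 0 < 2 * q - 1 := by linarith
    positivity)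
  set K : ℝ := Lam * 2 ^ n * (2 + 2 ^ n)
  have hK : 0 < K := by positivity
  refine ⟨c / K, by positivity, fun v g x s N hv hg hg0 hs hN hlin hvq hvx => ?_⟩
  obtain ⟨P, hP, hPv⟩ := hpol x s hs
  have hq1 : 0 < 2 * q - 1 := by linarith
  set a : ℝ := N * (2 * q - 1) / (2 * s) with ha
  have hap : 0 < a := by positivity
  set φ : Eu n → ℝ := fun y => u y + (-1 / a) * v y with hφd
  have hv' : ContDiff ℝ 2 fun y => (-1 / a) * v y := contDiff_const.mul hv
  have hφ : ContDiff ℝ 2 φ := hu.smooth.add hv'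
  set E : Set (Eu n) := sec u x s ∩ ({z | ∀ b, 0 ≤ D2 φ z b b} ∩ {z | N / 2 ≤ v z})
  have hE : MeasurableSet E := (hu.isClosed_sec x s).measurableSet.inter
    ((isClosed_D2_nonneg hφ).measurableSet.inter
      (isClosed_le continuous_const hv.continuous).measurableSet)
  set F : Eu n → ℝ := fun z => Lam * 2 ^ n * (2 / N * max (v z) 0 + (2 * s / N) ^ n * g z ^ n)
  have hFc : Continuous F := by have := hv.continuous; fun_prop
  have hF0 : ∀ z, 0 ≤ F z := fun z => by have := hg0 z; positivity
  have hcontact : ∀ p ∈ P, ∃ z ∈ E, gradient φ z = gradient u x + p := by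
    intro p hp
    set l : Eu n →L[ℝ] ℝ := -fderiv ℝ u x - innerSL ℝ p with hl
    set k : ℝ := -u x + fderiv ℝ u x x + inner ℝ p x + q * N / a
    set ψ : Eu n → ℝ := fun y => φ y + (l y + k)
    have hψ : ContDiff ℝ 2 ψ := hφ.add (l.contDiff.add contDiff_const)
    have hψe : ∀ y, ψ y = (q * N - v y) / a + breg u x y - inner ℝ p (y - x) := by
      intro y
      simp only [ψ, φ, l, k, breg, _root_.sub_apply, _root_.neg_apply, innerSL_apply_apply,
        map_sub, inner_sub_right]
      ring
    have hx0 : ψ x ≤ (q - 1) * N / a := by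
      rw [hψe]; simp only [breg_self, sub_self, inner_zero_right, add_zero, sub_zero]
      gcongr; linarith
    have hval : (q - 1) * N / a = s - 1 / (2 * q - 1) * s := by
      have hne := hq1.ne'
      rw [ha]
      generalize hd : 2 * q - 1 = d at hne
      rw [show q - 1 = (d - 1) / 2 by linarith]
      field_simp
    obtain ⟨z, hz, hmin, hzx⟩ := hu.exists_isLocalMin (x := x) (y := x) (h := s) hψ.continuous
      (by simpa using hs) (fun z hz => by
        refine hx0.trans ?_
        rw [hψe, hz, hval]
        have h1 := hP p hp z hz.le
        have h2 : 0 ≤ (q * N - v z) / a := div_nonneg (by linarith [hvq z hz.le]) hap.le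
        linarith)
    refine ⟨z, ⟨hz.le, fun b => ?_, ?_⟩, ?_⟩
    · have := D2_nonneg_of_isLocalMin hψ hmin b
      rw [D2_eq_dotProduct, hess_add hφ (l.contDiff.add contDiff_const), hess_affine, add_zero,
        ← D2_eq_dotProduct] at this
      exact this
    · have h1 := hzx.trans hx0
      rw [hψe, hval] at h1
      have h2 := hP p hp z hz.le
      have h3 := hu.breg_nonneg x z
      have h4 : (q * N - v z) / a ≤ s := by linarith
      rw [div_le_iff₀ hap, ha] at h4
      have h5 : s * (N * (2 * q - 1) / (2 * s)) = q * N - N / 2 := by field_simp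
      rw [h5] at h4
      exact (by linarith : N / 2 ≤ v z)
    · have h1 := hmin.fderiv_eq_zero
      have h2 : HasFDerivAt ψ (fderiv ℝ φ z + l) z :=
        ((hφ.differentiable (by norm_num)) z).hasFDerivAt.add (l.hasFDerivAt.add_const k)
      rw [h2.fderiv] at h1
      have h3 : fderiv ℝ φ z = fderiv ℝ u x + innerSL ℝ p := by
        rw [eq_neg_of_add_eq_zero_left h1, hl]; abel
      refine ext_inner_right ℝ fun w => ?_
      rw [inner_gradient_left, h3, inner_add_left, inner_gradient_left]
      simp
  have hdet : ∀ z ∈ E, |(hess φ z).det| ≤ F z := by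
    rintro z ⟨hzS, hzD, hzN⟩
    have hzN : N / 2 ≤ v z := hzN
    have hps := posSemidef_hess hφ hzD
    rw [abs_of_nonneg hps.det_nonneg]
    have hH := hu.pos z
    have h1 := det_le_det_mul_trace_pow hH hps
    have h0 := trace_inv_mul_nonneg hH hps
    have ht : ((hess u z)⁻¹ * hess φ z).trace = n + (-1 / a) * lin u v z := by
      rw [hφd, hess_add hu.smooth hv', hess_const_mul hv, Matrix.mul_add,
        nonsing_inv_mul _ hH.det_pos.ne'.isUnit, Matrix.mul_smul, trace_add, trace_smul, trace_one]
      simp [lin]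
    have hg1 := hlin z hzS (by linarith)
    have h2 : ((hess u z)⁻¹ * hess φ z).trace / n ≤ 1 + 2 * s / N * g z := by
      rw [div_le_iff₀ (by positivity), ht]
      have h3 : (-1 / a) * lin u v z ≤ 1 / a * g z := by
        have : 1 / a * (-lin u v z) ≤ 1 / a * g z := by gcongr; linarith
        calc _ = 1 / a * (-lin u v z) := by ring
          _ ≤ _ := this
      have h4 : 1 / a ≤ 2 * s / N := by
        rw [ha, one_div_div]
        gcongr
        nlinarith
      have h5 : 1 / a * g z ≤ 2 * s / N * g z * n := by
        calc 1 / a * g z ≤ 2 * s / N * g z := by gcongr; exact hg0 z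
          _ ≤ 2 * s / N * g z * n := le_mul_of_one_le_right (by have := hg0 z; positivity) hn'
      linarith
    calc (hess φ z).det ≤ (hess u z).det * (((hess u z)⁻¹ * hess φ z).trace / n) ^ n := h1
      _ ≤ Lam * (1 + 2 * s / N * g z) ^ n := by
          gcongr
          · exact hu.upper z
      _ ≤ Lam * (2 ^ n * (1 + (2 * s / N * g z) ^ n)) := by
          gcongr
          exact one_add_pow_le (by have := hg0 z; positivity) n
      _ ≤ F z := by
          simp only [F, mul_pow (2 * s / N) (g z)]
          rw [mul_assoc]
          gcongr
          rw [div_mul_eq_mul_div, le_div_iff₀ hN]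
          have := le_max_left (v z) 0
          linarith
  have hfin := volume_le_of_contact hφ (hu.isCompact_sec x s) hE Set.inter_subset_left
    (gradient u x) hFc hF0 hcontact hdet
  have hi1 : IntegrableOn (fun z => max (v z) 0) (sec u x s) :=
    (by have := hv.continuous; fun_prop : Continuous fun z => max (v z) 0).integrableOn_compact
      (hu.isCompact_sec x s)
  have hi2 : IntegrableOn (fun z => g z ^ n) (sec u x s) :=
    (by fun_prop : Continuous fun z => g z ^ n).integrableOn_compact (hu.isCompact_sec x s)
  have hF : ∫ z in sec u x s, F z = Lam * 2 ^ n * (2 / N * (∫ z in sec u x s, max (v z) 0)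
      + (2 * s / N) ^ n * ∫ z in sec u x s, g z ^ n) := by
    simp only [F]
    rw [integral_const_mul, integral_add (hi1.const_mul _) (hi2.const_mul _), integral_const_mul,
      integral_const_mul]
  have hI : 0 ≤ ∫ z in sec u x s, max (v z) 0 := integral_nonneg fun z => le_max_right _ _
  have hJ : 0 ≤ ∫ z in sec u x s, g z ^ n := integral_nonneg fun z => pow_nonneg (hg0 z) n
  rw [div_mul_eq_mul_div, div_le_iff₀ hK]
  refine (hPv.trans hfin).trans ?_
  rw [hF]
  set I := ∫ z in sec u x s, max (v z) 0
  set J := ∫ z in sec u x s, g z ^ n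
  have e1 : 2 / N * I ≤ (2 + 2 ^ n) * (N⁻¹ * I) := by
    rw [div_eq_mul_inv, mul_assoc]; gcongr; linarith [show (0:ℝ) < 2 ^ n by positivity]
  have e2 : (2 * s / N) ^ n * J ≤ (2 + 2 ^ n) * ((s / N) ^ n * J) := by
    rw [mul_div_assoc, mul_pow, mul_assoc]; gcongr; linarith
  calc Lam * 2 ^ n * (2 / N * I + (2 * s / N) ^ n * J)
      ≤ Lam * 2 ^ n * ((2 + 2 ^ n) * (N⁻¹ * I) + (2 + 2 ^ n) * ((s / N) ^ n * J)) := by gcongr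
    _ = (N⁻¹ * I + (s / N) ^ n * J) * K := by simp only [K]; ring

/-- Local maximum principle for subsolutions of the linearized Monge-Ampère equation. -/
theorem local_max (hu : Pinched u lam Lam) (G : Geom u) (hn : 0 < n) :
    ∃ C > 0, ∀ (v g : Eu n → ℝ) (x : Eu n) (h : ℝ), ContDiff ℝ 2 v → Continuous g →
      (∀ z, 0 ≤ g z) → 0 < h → (∀ z ∈ sec u x h, 0 < v z → -g z ≤ lin u v z) →
      v x ≤ C * ((√h ^ n)⁻¹ * (∫ z in sec u x h, max (v z) 0)
        + √h * (∫ z in sec u x h, g z ^ n) ^ ((1 : ℝ) / n)) := by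
  have hn' : (n : ℝ) ≠ 0 := by positivity
  have hΘ1 : 1 < G.Θ := lt_of_lt_of_le one_lt_two G.two_le
  have hΘ : 0 < G.Θ := one_pos.trans hΘ1
  have hsΘ : 1 < √G.Θ := by rw [Real.lt_sqrt zero_le_one]; simpa using hΘ1
  set q : ℝ := √G.Θ ^ n with hqd
  have hq1 : 1 < q := one_lt_pow₀ hsΘ hn.ne'
  have hq : 0 < q := one_pos.trans hq1
  obtain ⟨c, hc, hgrow⟩ := hu.growth_step G hn hq1
  obtain ⟨c', hc'p, hc'c⟩ : ∃ c' > 0, c' ^ n ≤ c / 4 / q := by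
    refine ⟨(c / 4 / q) ^ ((1 : ℝ) / n), by positivity, ?_⟩
    rw [← rpow_natCast, ← rpow_mul (by positivity), one_div_mul_cancel hn', rpow_one]
  refine ⟨4 * q / c + 1 / c', by positivity, fun v g x h hv hg hg0 hh hlin => ?_⟩
  set C := 4 * q / c + 1 / c'
  set S := sec u x h
  have hSc := hu.isCompact_sec x h
  have hmc : Continuous fun z => max (v z) 0 := by have := hv.continuous; fun_prop
  have hgc : Continuous fun z => g z ^ n := by fun_prop
  set I := ∫ z in S, max (v z) 0
  set M := (∫ z in S, g z ^ n) ^ ((1 : ℝ) / n)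
  have hI : 0 ≤ I := integral_nonneg fun z => le_max_right _ _
  have hJ : 0 ≤ ∫ z in S, g z ^ n := integral_nonneg fun z => pow_nonneg (hg0 z) n
  have hM : 0 ≤ M := Real.rpow_nonneg hJ _
  have hMn : M ^ n = ∫ z in S, g z ^ n := by
    rw [← rpow_natCast, ← rpow_mul hJ, one_div_mul_cancel hn', rpow_one]
  have hsh : 0 < √h := sqrt_pos.2 hh
  by_contra! hcon
  have hCp : 0 < C := by positivity
  set N := v x
  have hN : 0 < N := lt_of_le_of_lt (by positivity) hcon
  have hN1 : 4 * q / c * ((√h ^ n)⁻¹ * I) < N := by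
    refine lt_of_le_of_lt ?_ hcon
    have : 4 * q / c ≤ C := by simp only [C]; linarith [show 0 < 1 / c' by positivity]
    gcongr
    have : 0 ≤ √h * M := by positivity
    linarith
  have hN2 : 1 / c' * (√h * M) < N := by
    refine lt_of_le_of_lt ?_ hcon
    have : 1 / c' ≤ C := by simp only [C]; linarith [show 0 < 4 * q / c by positivity]
    gcongr
    have : 0 ≤ (√h ^ n)⁻¹ * I := by positivity
    linarith
  set s : ℕ → ℝ := fun k => h / G.Θ ^ (k + 1) with hs
  have hsp : ∀ k, 0 < s k := fun k => by simp only [hs]; positivity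
  have hss : ∀ k, √(s k) ^ n = √h ^ n / q ^ (k + 1) := by
    intro k
    have : √(s k) = √h / √G.Θ ^ (k + 1) := by
      simp only [hs]
      rw [Real.sqrt_div hh.le]
      congr 1
      rw [Real.sqrt_eq_iff_mul_self_eq (by positivity) (by positivity), ← mul_pow,
        mul_self_sqrt hΘ.le]
    rw [this, div_pow, hqd, ← pow_mul, ← pow_mul, mul_comm]
  have key : ∀ k : ℕ, ∃ y, sec u y (G.Θ * s k) ⊆ S ∧ q ^ k * N ≤ v y := by
    intro k
    induction k with
    | zero =>
      refine ⟨x, ?_, by simp [N]⟩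
      simp only [hs, zero_add, pow_one, mul_div_cancel₀ _ hΘ.ne']
      exact subset_rfl
    | succ k ih =>
      obtain ⟨y, hy, hyv⟩ := ih
      have hsub : sec u y (s k) ⊆ S := (sec_mono u y (by have := hsp k; nlinarith)).trans hy
      by_contra! hno
      have hle : ∀ z ∈ sec u y (s k), v z ≤ q * (q ^ k * N) := by
        intro z hz
        have e : G.Θ * s (k + 1) = s k := by simp only [hs, pow_succ]; field_simp
        have := hno z (by rw [e]; exact (G.engulf' (hsp k) hz).trans hy)
        rw [pow_succ'] at this
        linarith
      have h1 := hgrow v g y (s k) (q ^ k * N) hv hg hg0 (hsp k) (by positivity)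
        (fun z hz => hlin z (hsub hz)) hle hyv
      have hI1 : ∫ z in sec u y (s k), max (v z) 0 ≤ I :=
        setIntegral_mono_set (hmc.integrableOn_compact hSc)
          (.of_forall fun z => le_max_right _ _) hsub.eventuallyLE
      have hJ1 : ∫ z in sec u y (s k), g z ^ n ≤ M ^ n := by
        rw [hMn]
        exact setIntegral_mono_set (hgc.integrableOn_compact hSc)
          (.of_forall fun z => pow_nonneg (hg0 z) n) hsub.eventuallyLE
      have hA : (q ^ k * N)⁻¹ * (∫ z in sec u y (s k), max (v z) 0) ≤ c / 4 * √(s k) ^ n := by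
        rw [inv_mul_le_iff₀ (by positivity), hss]
        refine hI1.trans ?_
        have e : q ^ k * N * (c / 4 * (√h ^ n / q ^ (k + 1)))
            = c / (4 * q) * √h ^ n * N := by rw [pow_succ]; field_simp
        rw [e]
        have := mul_le_mul_of_nonneg_left hN1.le (show 0 ≤ c / (4 * q) * √h ^ n by positivity)
        calc I = c / (4 * q) * √h ^ n * (4 * q / c * ((√h ^ n)⁻¹ * I)) := by
              field_simp
          _ ≤ _ := this
      have hB : (s k / (q ^ k * N)) ^ n * (∫ z in sec u y (s k), g z ^ n) ≤ c / 4 * √(s k) ^ n := by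
        have hq1k : 1 ≤ q ^ k := one_le_pow₀ hq1.le
        have hsk : s k = √(s k) * √(s k) := (mul_self_sqrt (hsp k).le).symm
        have hskh : √(s k) ≤ √h := Real.sqrt_le_sqrt (by
          simp only [hs]; exact div_le_self hh.le (one_le_pow₀ hΘ1.le))
        have hb : s k / (q ^ k * N) * M ≤ c' * √(s k) := by
          rw [div_mul_eq_mul_div, div_le_iff₀ (by positivity)]
          rw [div_mul_eq_mul_div, one_mul, div_lt_iff₀ hc'p] at hN2
          calc s k * M = √(s k) * (√(s k) * M) := by
                rw [← mul_assoc, ← hsk]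
            _ ≤ √(s k) * (√h * M) := by gcongr
            _ ≤ √(s k) * (N * c') := by gcongr
            _ ≤ √(s k) * (q ^ k * N * c') := by gcongr; exact le_mul_of_one_le_left hN.le hq1k
            _ = _ := by ring
        calc _ ≤ (s k / (q ^ k * N)) ^ n * M ^ n := by
              have := hsp k
              gcongr
          _ = (s k / (q ^ k * N) * M) ^ n := (mul_pow _ _ _).symm
          _ ≤ (c' * √(s k)) ^ n := by
              have := hsp k
              gcongr
          _ = c' ^ n * √(s k) ^ n := mul_pow _ _ _
          _ ≤ c / 4 * √(s k) ^ n := by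
              gcongr
              exact hc'c.trans (div_le_self (by positivity) hq1.le)
      have hpos : 0 < √(s k) ^ n := pow_pos (sqrt_pos.2 (hsp k)) n
      nlinarith
  obtain ⟨b, hb⟩ := hSc.bddAbove_image hv.continuous.continuousOn
  obtain ⟨k, hk⟩ := pow_unbounded_of_one_lt (b / N) hq1
  obtain ⟨y, hy, hyv⟩ := key k
  have h1 : v y ≤ b := hb ⟨y, hy (self_mem_sec u y (by have := hsp k; positivity)), rfl⟩
  rw [div_lt_iff₀ hN] at hk
  linarith

end Pinched

/-- Jacobi's formula. -/
theorem hasDerivAt_det {M : ℝ → Mat n} {M' : Mat n} {t : ℝ}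
    (h : ∀ i j, HasDerivAt (fun s => M s i j) (M' i j) t) :
    HasDerivAt (fun s => (M s).det) ((adjugate (M t) * M').trace) t := by
  have h1 : HasDerivAt (fun s => ∑ σ : Equiv.Perm (Fin n),
      ((Equiv.Perm.sign σ : ℤ) : ℝ) * ∏ i, M s (σ i) i)
      (∑ σ : Equiv.Perm (Fin n), ((Equiv.Perm.sign σ : ℤ) : ℝ) *
        ∑ i, (∏ j ∈ univ.erase i, M t (σ j) j) • M' (σ i) i) t :=
    HasDerivAt.fun_sum fun σ _ => (HasDerivAt.fun_finsetProd fun i _ => h (σ i) i).const_mul _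
  have h2 : (adjugate (M t) * M').trace = ∑ σ : Equiv.Perm (Fin n), ((Equiv.Perm.sign σ : ℤ) : ℝ) *
        ∑ i, (∏ j ∈ univ.erase i, M t (σ j) j) • M' (σ i) i := by
    have h3 : ∀ i, (adjugate (M t) * M') i i = ((M t).updateCol i fun k => M' k i).det := by
      intro i
      rw [← cramer_apply, cramer_eq_adjugate_mulVec]
      rfl
    simp only [trace, diag_apply, h3, det_apply', mul_sum]
    rw [sum_comm]
    refine sum_congr rfl fun σ _ => sum_congr rfl fun i _ => ?_
    congr 1
    rw [← Finset.mul_prod_erase _ _ (mem_univ i), updateCol_self, smul_eq_mul, mul_comm]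
    congr 1
    refine Finset.prod_congr rfl fun j hj => ?_
    rw [updateCol_ne (Finset.ne_of_mem_erase hj)]
  rw [h2]
  simpa only [det_apply'] using h1

theorem contDiff_det {m : ℕ∞} {M : Eu n → Mat n}
    (h : ∀ i j, ContDiff ℝ m fun x => M x i j) : ContDiff ℝ m fun x => (M x).det := by
  simp only [det_apply']
  exact ContDiff.sum fun σ _ => contDiff_const.mul (contDiff_prod fun i _ => h (σ i) i)

theorem contDiff_adjugate {m : ℕ∞} {M : Eu n → Mat n}
    (h : ∀ i j, ContDiff ℝ m fun x => M x i j) (i j : Fin n) :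
    ContDiff ℝ m fun x => adjugate (M x) i j := by
  simp only [adjugate_apply]
  refine contDiff_det fun k l => ?_
  rcases eq_or_ne k j with rfl | hk
  · simp only [updateRow_self]; exact contDiff_const
  · simp only [updateRow_ne hk]; exact h k l

theorem hess_eq_fderiv (hu : ContDiff ℝ 2 u) (x : Eu n) (i j : Fin n) : hess u x i j
      = fderiv ℝ (fun y => fderiv ℝ u y (single i 1)) x (single j 1) := by
  rw [hess_apply, D2_comm hu]
  have h := ((differentiable_fderiv hu) x).hasFDerivAt.clm_apply
    (hasFDerivAt_const (single i (1 : ℝ)) x)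
  rw [h.fderiv]
  simp [D2]

theorem contDiff_fderiv_apply {m k : ℕ∞} (hu : ContDiff ℝ m u) (hk : k + 1 ≤ m)
    (a : Eu n) : ContDiff ℝ k fun y => fderiv ℝ u y a :=
  (hu.fderiv_right (by exact_mod_cast hk)).clm_apply contDiff_const

theorem contDiff_hess (hu : ContDiff ℝ 3 u) (i j : Fin n) : ContDiff ℝ 1 fun x => hess u x i j := by
  have h2 : ContDiff ℝ 2 u := hu.of_le (by norm_num)
  simp only [hess_eq_fderiv h2]
  exact contDiff_fderiv_apply (m := 2) (k := 1)
    (contDiff_fderiv_apply (m := 3) (k := 2) hu (by norm_num) _) (by norm_num) _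

theorem fderiv_hess_comm (hu : ContDiff ℝ 3 u) (x : Eu n) (i j k : Fin n) :
    fderiv ℝ (fun y => hess u y k j) x (single i 1)
      = fderiv ℝ (fun y => hess u y k i) x (single j 1) := by
  have h2 : ContDiff ℝ 2 u := hu.of_le (by norm_num)
  have hw : ContDiff ℝ 2 fun y => fderiv ℝ u y (single k 1) :=
    contDiff_fderiv_apply (m := 3) (k := 2) hu (by norm_num) _
  simp only [hess_eq_fderiv h2]
  rw [← hess_eq_fderiv hw, ← hess_eq_fderiv hw]
  exact (hess_isSymm hw x).apply i j

/-- The cofactor matrix of the Hessian. -/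
noncomputable def cof (u : Eu n → ℝ) (x : Eu n) : Mat n := adjugate (hess u x)

theorem contDiff_cof (hu : ContDiff ℝ 3 u) (i j : Fin n) :
    ContDiff ℝ 1 fun x => cof u x i j := contDiff_adjugate (m := 1) (contDiff_hess hu) i j

theorem fderiv_det_hess (hu : ContDiff ℝ 3 u) (x a : Eu n) : fderiv ℝ (fun y => (hess u y).det) x a
      = ∑ i, ∑ k, cof u x i k * fderiv ℝ (fun y => hess u y k i) x a := by
  have hline : ∀ w : Eu n → ℝ, ContDiff ℝ 1 w →
      HasDerivAt (fun s : ℝ => w (x + s • a)) (fderiv ℝ w x a) 0 := by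
    intro w hw
    simpa using hasDerivAt_line hw x a 0
  have h1 := hline _ (contDiff_det (m := 1) (contDiff_hess hu))
  have h2 := hasDerivAt_det (M := fun s : ℝ => hess u (x + s • a)) (t := 0)
    (M' := Matrix.of fun i j => fderiv ℝ (fun y => hess u y i j) x a)
    fun i j => hline _ (contDiff_hess hu i j)
  rw [h1.unique h2]
  simp [trace, mul_apply, cof]

/-- Piola identity: the rows of the cofactor matrix of a Hessian are divergence free. -/
theorem sum_fderiv_cof (hu : ContDiff ℝ 3 u) (x : Eu n) (hdet : (hess u x).det ≠ 0) (k : Fin n) :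
    ∑ i, fderiv ℝ (fun y => cof u y i k) x (single i 1) = 0 := by
  set w : Fin n → ℝ := fun k => ∑ i, fderiv ℝ (fun y => cof u y i k) x (single i 1)
  suffices h : w ᵥ* hess u x = 0 by
    have h2 : w = 0 := by
      have := congrArg (fun v => v ᵥ* (hess u x)⁻¹) h
      simpa [vecMul_vecMul, mul_nonsing_inv _ hdet.isUnit] using this
    exact congrFun h2 k
  funext j
  have hD : ∀ i l, DifferentiableAt ℝ (fun y => cof u y i l) x := fun i l =>
    (contDiff_cof hu i l).differentiable (by norm_num) x
  have hH : ∀ i l, DifferentiableAt ℝ (fun y => hess u y i l) x := fun i l =>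
    (contDiff_hess hu i l).differentiable (by norm_num) x
  have h1 : ∀ i a, ∑ l, (fderiv ℝ (fun y => cof u y i l) x a * hess u x l j
      + cof u x i l * fderiv ℝ (fun y => hess u y l j) x a)
      = if i = j then fderiv ℝ (fun y => (hess u y).det) x a else 0 := by
    intro i a
    have e : (fun y => ∑ l, cof u y i l * hess u y l j)
        = fun y => if i = j then (hess u y).det else 0 := by
      funext y
      have := congrFun (congrFun (adjugate_mul (hess u y)) i) j
      rw [mul_apply, Matrix.smul_apply, one_apply, smul_eq_mul, mul_ite, mul_one, mul_zero] at this
      exact this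
    have h2 : fderiv ℝ (fun y => ∑ l, cof u y i l * hess u y l j) x a
        = fderiv ℝ (fun y => if i = j then (hess u y).det else 0) x a := by rw [e]
    rw [fderiv_fun_sum fun l _ => (hD i l).fun_mul (hH l j)] at h2
    rw [_root_.sum_apply] at h2
    rw [show (if i = j then fderiv ℝ (fun y => (hess u y).det) x a else 0)
      = fderiv ℝ (fun y => if i = j then (hess u y).det else 0) x a by split_ifs <;> simp, ← h2]
    refine sum_congr rfl fun l _ => ?_
    rw [fderiv_fun_mul (hD i l) (hH l j)]
    simp only [_root_.add_apply, _root_.smul_apply, smul_eq_mul]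
    ring
  have h3 : ∑ i, ∑ l, (fderiv ℝ (fun y => cof u y i l) x (single i 1) * hess u x l j
      + cof u x i l * fderiv ℝ (fun y => hess u y l j) x (single i 1))
      = fderiv ℝ (fun y => (hess u y).det) x (single j 1) := by
    simp only [h1]
    simp
  rw [fderiv_det_hess hu] at h3
  simp only [sum_add_distrib] at h3
  have h4 : ∑ i, ∑ l, cof u x i l * fderiv ℝ (fun y => hess u y l j) x (single i 1)
      = ∑ i, ∑ l, cof u x i l * fderiv ℝ (fun y => hess u y l i) x (single j 1) :=
    sum_congr rfl fun i _ => sum_congr rfl fun l _ => by rw [fderiv_hess_comm hu]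
  rw [h4, add_eq_right] at h3
  simp only [vecMul, dotProduct, w, Pi.zero_apply, sum_mul]
  rw [sum_comm]
  exact h3

/-- The Dirichlet form density of the linearized operator in divergence form. -/
noncomputable def energy (u a b : Eu n → ℝ) (x : Eu n) : ℝ :=
  (gradient a x).ofLp ⬝ᵥ cof u x *ᵥ (gradient b x).ofLp

theorem gradient_apply (a : Eu n → ℝ) (x : Eu n) (i : Fin n) :
    gradient a x i = fderiv ℝ a x (single i 1) := by
  rw [← inner_gradient_left, EuclideanSpace.inner_single_right]
  simp

theorem energy_eq_sum (u a b : Eu n → ℝ) (x : Eu n) :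
    energy u a b x = ∑ i, fderiv ℝ a x (single i 1) *
      ∑ j, cof u x i j * fderiv ℝ b x (single j 1) := by
  simp only [energy, dotProduct, mulVec, gradient_apply]

theorem continuous_energy {u a b : Eu n → ℝ} (hu : ContDiff ℝ 3 u) (ha : ContDiff ℝ 1 a)
    (hb : ContDiff ℝ 1 b) : Continuous (energy u a b) := by
  have h1 : ∀ i, Continuous fun x => fderiv ℝ a x (single i 1) := fun i =>
    (contDiff_fderiv_apply (m := 1) (k := 0) ha (by norm_num) _).continuous
  have h2 : ∀ i, Continuous fun x => fderiv ℝ b x (single i 1) := fun i =>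
    (contDiff_fderiv_apply (m := 1) (k := 0) hb (by norm_num) _).continuous
  have h3 : ∀ i j, Continuous fun x => cof u x i j := fun i j => (contDiff_cof hu i j).continuous
  have : energy u a b = fun x => ∑ i, fderiv ℝ a x (single i 1) *
      ∑ j, cof u x i j * fderiv ℝ b x (single j 1) := funext (energy_eq_sum u a b)
  rw [this]
  fun_prop

/-- Integration by parts for the linearized Monge-Ampère operator. -/
theorem integral_mul_trace_cof {u a b : Eu n → ℝ} (hu : ContDiff ℝ 3 u)
    (hdet : ∀ x, (hess u x).det ≠ 0) (ha : ContDiff ℝ 1 a) (hac : HasCompactSupport a)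
    (hb : ContDiff ℝ 2 b) :
    ∫ x, a x * (cof u x * hess b x).trace = -∫ x, energy u a b x := by
  set E : Fin n → Eu n := fun i => single i 1
  set X : Fin n → Eu n → ℝ := fun i x => ∑ j, cof u x i j * fderiv ℝ b x (E j)
  have hbj : ∀ j, ContDiff ℝ 1 fun x => fderiv ℝ b x (E j) := fun j =>
    contDiff_fderiv_apply (m := 2) (k := 1) hb (by norm_num) _
  have hX : ∀ i, ContDiff ℝ 1 (X i) := fun i =>
    ContDiff.sum fun j _ => (contDiff_cof hu i j).mul (hbj j)
  have hdiv : ∀ x, ∑ i, fderiv ℝ (X i) x (E i) = (cof u x * hess b x).trace := by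
    intro x
    have h1 : ∀ i, fderiv ℝ (X i) x (E i) = ∑ j, (fderiv ℝ (fun y => cof u y i j) x (E i)
        * fderiv ℝ b x (E j) + cof u x i j * hess b x j i) := by
      intro i
      have hd1 : ∀ j, DifferentiableAt ℝ (fun y => cof u y i j) x := fun j =>
        (contDiff_cof hu i j).differentiable (by norm_num) x
      have hd2 : ∀ j, DifferentiableAt ℝ (fun y => fderiv ℝ b y (E j)) x := fun j =>
        (hbj j).differentiable (by norm_num) x
      simp only [X]
      rw [fderiv_fun_sum fun j _ => (hd1 j).fun_mul (hd2 j), _root_.sum_apply]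
      refine sum_congr rfl fun j _ => ?_
      rw [fderiv_fun_mul (hd1 j) (hd2 j), hess_eq_fderiv hb]
      simp only [_root_.add_apply, _root_.smul_apply, smul_eq_mul, E]
      ring
    simp only [h1, sum_add_distrib]
    have h2 : ∑ i, ∑ j, fderiv ℝ (fun y => cof u y i j) x (E i) * fderiv ℝ b x (E j) = 0 := by
      rw [sum_comm]
      simp only [← sum_mul]
      refine Finset.sum_eq_zero fun j _ => ?_
      rw [sum_fderiv_cof hu x (hdet x) j, zero_mul]
    rw [h2, zero_add]
    simp [trace, mul_apply]
  have hda : ∀ i, Continuous fun x => fderiv ℝ a x (E i) := fun i =>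
    (contDiff_fderiv_apply (m := 1) (k := 0) ha (by norm_num) _).continuous
  have hdX : ∀ i, Continuous fun x => fderiv ℝ (X i) x (E i) := fun i =>
    (contDiff_fderiv_apply (m := 1) (k := 0) (hX i) (by norm_num) _).continuous
  have hdac : ∀ i, HasCompactSupport fun x => fderiv ℝ a x (E i) := fun i =>
    hac.fderiv_apply ℝ (E i)
  have hi1 : ∀ i, Integrable fun x => a x * fderiv ℝ (X i) x (E i) := fun i =>
    (ha.continuous.mul (hdX i)).integrable_of_hasCompactSupport hac.mul_right
  have hi2 : ∀ i, Integrable fun x => fderiv ℝ a x (E i) * X i x := fun i =>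
    ((hda i).mul (hX i).continuous).integrable_of_hasCompactSupport (hdac i).mul_right
  have hi3 : ∀ i, Integrable fun x => a x * X i x := fun i =>
    (ha.continuous.mul (hX i).continuous).integrable_of_hasCompactSupport hac.mul_right
  calc ∫ x, a x * (cof u x * hess b x).trace
      = ∫ x, ∑ i, a x * fderiv ℝ (X i) x (E i) := by
        refine integral_congr_ae (.of_forall fun x => ?_)
        simp only [← hdiv, mul_sum]
    _ = ∑ i, ∫ x, a x * fderiv ℝ (X i) x (E i) := integral_finsetSum _ fun i _ => hi1 i
    _ = ∑ i, -∫ x, fderiv ℝ a x (E i) * X i x := sum_congr rfl fun i _ =>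
        integral_mul_fderiv_eq_neg_fderiv_mul_of_integrable (hi2 i) (hi1 i) (hi3 i)
          (fun x _ => ha.differentiable (by norm_num) x)
          (fun x _ => (hX i).differentiable (by norm_num) x)
    _ = -∫ x, energy u a b x := by
        rw [Finset.sum_neg_distrib, ← integral_finsetSum _ fun i _ => hi2 i]
        simp only [energy_eq_sum, X, E]

/-- Symmetric second difference. -/
def sd (u : Eu n → ℝ) (e x : Eu n) : ℝ := u (x + e) + u (x - e) - 2 * u x

/-- The decay profile of the perturbation. -/
noncomputable def gam (β : ℝ) (x : Eu n) : ℝ := (1 + ‖x‖) ^ (-β)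

/-- Source term produced by second differences. -/
noncomputable def src (β : ℝ) (e x : Eu n) : ℝ := gam β (x + e) + gam β (x - e) + 2 * gam β x

theorem gam_nonneg (β : ℝ) (x : Eu n) : 0 ≤ gam β x := by unfold gam; positivity

theorem continuous_gam (β : ℝ) : Continuous (gam β : Eu n → ℝ) := by
  unfold gam
  exact (by fun_prop : Continuous fun x : Eu n => 1 + ‖x‖).rpow_const fun x => Or.inl (by positivity)

theorem src_nonneg (β : ℝ) (e x : Eu n) : 0 ≤ src β e x := by
  have h1 := gam_nonneg β (x + e)
  have h2 := gam_nonneg β (x - e)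
  have h3 := gam_nonneg β x
  unfold src; linarith

theorem continuous_src (β : ℝ) (e : Eu n) : Continuous (src β e) := by
  unfold src
  have := continuous_gam (n := n) β
  fun_prop

theorem gam_le_rpow {β ρ : ℝ} (hβ : 0 ≤ β) (hρ : 0 < ρ) {x : Eu n} (hx : ρ ≤ ‖x‖) :
    gam β x ≤ ρ ^ (-β) :=
  rpow_le_rpow_of_nonpos hρ (by linarith) (by linarith)

theorem src_le_rpow {β ρ : ℝ} (hβ : 0 ≤ β) (hρ : 0 < ρ) {e x : Eu n} (hx : ρ ≤ ‖x‖)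
    (h1 : ρ ≤ ‖x + e‖) (h2 : ρ ≤ ‖x - e‖) : src β e x ≤ 4 * ρ ^ (-β) := by
  have := gam_le_rpow hβ hρ hx
  have := gam_le_rpow hβ hρ h1
  have := gam_le_rpow hβ hρ h2
  unfold src; linarith

theorem contDiff_sd {m : ℕ∞} (hu : ContDiff ℝ m u) (e : Eu n) : ContDiff ℝ m (sd u e) := by
  unfold sd
  exact ((hu.comp (contDiff_id.add contDiff_const)).add
    (hu.comp (contDiff_id.sub contDiff_const))).sub (contDiff_const.mul hu)

theorem hess_sd (hu : ContDiff ℝ 2 u) (e x : Eu n) :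
    hess (sd u e) x = hess u (x + e) + hess u (x - e) - (2 : ℝ) • hess u x := by
  have h1 : ContDiff ℝ 2 fun y => u (y + e) := hu.comp (contDiff_id.add contDiff_const)
  have h2 : ContDiff ℝ 2 fun y => u (y + -e) := hu.comp (contDiff_id.add contDiff_const)
  have h3 : sd u e = fun y => (u (y + e) + u (y + -e)) + (-2) * u y := by
    funext y; simp only [sd, sub_eq_add_neg]; ring
  rw [h3, hess_add (h1.add h2) (contDiff_const.mul hu), hess_add h1 h2, hess_comp_add,
    hess_comp_add, hess_const_mul hu, ← sub_eq_add_neg, neg_smul, ← sub_eq_add_neg]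

theorem lin_sd_ge (hu : ConvexC2 u) (hn : 0 < n) (e x : Eu n) :
    n * ((hess u (x + e)).det ^ ((1 : ℝ) / n) + (hess u (x - e)).det ^ ((1 : ℝ) / n)
      - 2 * (hess u x).det ^ ((1 : ℝ) / n)) ≤ (hess u x).det ^ ((1 : ℝ) / n) * lin u (sd u e) x := by
  have h1 := rpow_det_le_trace hn (hu.pos x) (hu.pos (x + e)).posSemidef
  have h2 := rpow_det_le_trace hn (hu.pos x) (hu.pos (x - e)).posSemidef
  have h3 : lin u (sd u e) x = ((hess u x)⁻¹ * hess u (x + e)).trace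
      + ((hess u x)⁻¹ * hess u (x - e)).trace - 2 * n := by
    rw [lin, hess_sd hu.smooth, Matrix.mul_sub, Matrix.mul_add, Matrix.mul_smul,
      nonsing_inv_mul _ (hu.pos x).det_pos.ne'.isUnit, trace_sub, trace_add, trace_smul, trace_one]
    simp
  rw [h3]
  linarith

theorem trace_cof_mul (hu : ConvexC2 u) (v : Eu n → ℝ) (x : Eu n) :
    (cof u x * hess v x).trace = (hess u x).det * lin u v x := by
  have hd := (hu.pos x).det_pos.ne'
  have : cof u x = (hess u x).det • (hess u x)⁻¹ := by
    rw [cof, inv_def, Ring.inverse_eq_inv, smul_smul, mul_inv_cancel₀ hd, one_smul]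
  rw [this, Matrix.smul_mul, trace_smul, lin, smul_eq_mul]

theorem ConvexC2.sd_nonneg (hu : ConvexC2 u) (e x : Eu n) : 0 ≤ sd u e x := by
  have h1 := hu.breg_nonneg x (x + e)
  have h2 := hu.breg_nonneg x (x - e)
  simp only [breg, add_sub_cancel_left, sub_sub_cancel_left, map_neg] at h1 h2
  unfold sd; linarith

/-- Fubini for the translates of a continuous function along a segment. -/
theorem integral_segment_swap {F : ℝ × Eu n → ℝ} (hF : Continuous F) {K : Set (Eu n)}
    (hK : IsCompact K) :
    ∫ s in (0 : ℝ)..1, ∫ x in K, F (s, x) = ∫ x in K, ∫ s in (0 : ℝ)..1, F (s, x) := by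
  simp only [intervalIntegral.integral_of_le zero_le_one]
  refine integral_integral_swap (f := fun s x => F (s, x)) ?_
  rw [Measure.prod_restrict]
  exact (hF.integrableOn_compact (isCompact_Icc.prod hK)).mono_set
    (Set.prod_mono Set.Ioc_subset_Icc_self subset_rfl)

theorem setIntegral_comp_add {F : Eu n → ℝ} (K : Set (Eu n)) (a : Eu n) :
    ∫ x in (fun x => x + a) ⁻¹' K, F (x + a) = ∫ x in K, F x :=
  (measurePreserving_add_right volume a).setIntegral_preimage_emb
    (measurableEmbedding_addRight a) F K

theorem integrable_gam_rpow {β p : ℝ} (hp : (n : ℝ) < β * p) :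
    Integrable fun x : Eu n => gam β x ^ p := by
  have h := integrable_one_add_norm (E := Eu n) (μ := volume) (r := β * p) (by simpa using hp)
  refine h.congr (.of_forall fun x => ?_)
  simp only [gam]
  rw [← rpow_mul (by positivity)]; ring_nf

theorem exists_integral_src_pow_le {β : ℝ} (hn : 0 < n) (hβ : 1 < β) :
    ∃ C > 0, ∀ (e : Eu n) (S : Set (Eu n)), MeasurableSet S → ∫ x in S, src β e x ^ n ≤ C := by
  have hg : Integrable fun x : Eu n => gam β x ^ n := by
    have := integrable_gam_rpow (n := n) (β := β) (p := n)
      (by have : (0 : ℝ) < n := by exact_mod_cast hn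
          nlinarith)
    simpa only [rpow_natCast] using this
  set I := ∫ x : Eu n, gam β x ^ n
  have hI : 0 ≤ I := integral_nonneg fun x => pow_nonneg (gam_nonneg β x) n
  refine ⟨4 ^ n * (3 * I) + 1, by positivity, fun e S hS => ?_⟩
  have hg1 : Integrable fun x : Eu n => gam β (x + e) ^ n := hg.comp_add_right e
  have hg2 : Integrable fun x : Eu n => gam β (x - e) ^ n := hg.comp_sub_right e
  have hF : Integrable fun x : Eu n => 4 ^ n * (gam β (x + e) ^ n + gam β (x - e) ^ n + gam β x ^ n) :=
    ((hg1.add hg2).add hg).const_mul _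
  have hle : ∀ x : Eu n, src β e x ^ n
      ≤ 4 ^ n * (gam β (x + e) ^ n + gam β (x - e) ^ n + gam β x ^ n) := by
    intro x
    have h1 := gam_nonneg β (x + e)
    have h2 := gam_nonneg β (x - e)
    have h3 := gam_nonneg β x
    have hp1 := pow_nonneg h1 n
    have hp2 := pow_nonneg h2 n
    have hp3 := pow_nonneg h3 n
    have key : ∀ t : ℝ, src β e x ≤ 4 * t →
        t ^ n ≤ gam β (x + e) ^ n + gam β (x - e) ^ n + gam β x ^ n →
        src β e x ^ n ≤ 4 ^ n * (gam β (x + e) ^ n + gam β (x - e) ^ n + gam β x ^ n) := by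
      intro t ht ht'
      calc src β e x ^ n ≤ (4 * t) ^ n := pow_le_pow_left₀ (src_nonneg β e x) ht n
        _ = 4 ^ n * t ^ n := mul_pow _ _ _
        _ ≤ _ := by gcongr
    unfold src at key ⊢
    rcases le_total (gam β (x + e)) (gam β (x - e)) with hA | hA <;>
      rcases le_total (gam β (x - e)) (gam β x) with hB | hB <;>
        rcases le_total (gam β (x + e)) (gam β x) with hC | hC
    all_goals first
      | exact key (gam β (x + e)) (by linarith) (by linarith)
      | exact key (gam β (x - e)) (by linarith) (by linarith)
      | exact key (gam β x) (by linarith) (by linarith)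
  have hs : Integrable fun x : Eu n => src β e x ^ n := by
    refine hF.mono' ((continuous_src β e).pow n).aestronglyMeasurable (.of_forall fun x => ?_)
    rw [norm_of_nonneg (pow_nonneg (src_nonneg β e x) n)]
    exact hle x
  have hi1 : ∫ x : Eu n, gam β (x + e) ^ n = I := integral_add_right_eq_self (fun x => gam β x ^ n) e
  have hi2 : ∫ x : Eu n, gam β (x - e) ^ n = I := integral_sub_right_eq_self (fun x => gam β x ^ n) e
  calc ∫ x in S, src β e x ^ n ≤ ∫ x, src β e x ^ n :=
        setIntegral_le_integral hs (.of_forall fun x => pow_nonneg (src_nonneg β e x) n)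
    _ ≤ ∫ x : Eu n, 4 ^ n * (gam β (x + e) ^ n + gam β (x - e) ^ n + gam β x ^ n) :=
        integral_mono hs hF hle
    _ = 4 ^ n * (3 * I) := by
        have h12 : Integrable fun x : Eu n => gam β (x + e) ^ n + gam β (x - e) ^ n := hg1.add hg2
        rw [integral_const_mul, integral_add h12 hg, integral_add hg1 hg2, hi1, hi2]
        simp only [I]; ring
    _ ≤ _ := by linarith

theorem Geom.volume_sec_le (G : Geom u) (x : Eu n) {h : ℝ} (hh : 0 < h) :
    volume.real (sec u x h) ≤ G.Cd * (G.R ^ n * ballVol n) * √h ^ n := by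
  have hR : 0 < G.R := zero_lt_one.trans_le G.one_le_R
  have hsub : sec u x h ⊆ ell x (G.B x h : Eu n →L[ℝ] Eu n) 0 G.R := by
    intro z hz
    refine ⟨(G.B x h).symm (z - x), by simpa using G.outer_le hh hz, ?_⟩
    simp
  have := measureReal_mono (μ := volume) hsub (isCompact_ell _ _ _ _).measure_lt_top.ne
  rw [volume_ell _ _ _ hR.le] at this
  have hω := ballVol_pos n
  calc _ ≤ _ := this
    _ ≤ G.Cd * √h ^ n * (G.R ^ n * ballVol n) := by gcongr; exact G.det_le x hh
    _ = _ := by ring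

theorem le_add_rpow_mul {g t p : ℝ} (hg : 0 ≤ g) (ht : 0 < t) (hp : 1 ≤ p) :
    g ≤ t + t ^ (1 - p) * g ^ p := by
  rcases le_total g t with h | h
  · have : 0 ≤ t ^ (1 - p) * g ^ p := by positivity
    linarith
  · have hg' : 0 < g := ht.trans_le h
    have h1 : g ^ (1 - p) ≤ t ^ (1 - p) := rpow_le_rpow_of_nonpos ht h (by linarith)
    calc g = g ^ (1 - p) * g ^ p := by rw [← rpow_add hg']; simp
      _ ≤ t ^ (1 - p) * g ^ p := by gcongr
      _ ≤ _ := by linarith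

theorem sqrt_pow_eq_rpow {h : ℝ} (hh : 0 ≤ h) (n : ℕ) : √h ^ n = h ^ ((n : ℝ) / 2) := by
  rw [sqrt_eq_rpow, ← rpow_natCast, ← rpow_mul hh]; ring_nf

theorem Geom.exists_integral_src_le (G : Geom u) (hu : ConvexC2 u) {β : ℝ}
    (hn : 3 ≤ n) (hβ : 2 < β) (hβ' : β ≤ 5 / 2) :
    ∃ σ : ℝ, 0 < σ ∧ ∃ C > 0, ∀ (e : Eu n) (h : ℝ), 0 < h →
      ∫ x in sec u 0 h, src β e x ≤ C * √h ^ n * h ^ (-1 - σ) := by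
  have hn3 : (3 : ℝ) ≤ n := by exact_mod_cast hn
  obtain ⟨p, hp1, hp2⟩ := exists_between (show (n : ℝ) / β < n / 2 by gcongr)
  rw [div_lt_iff₀ (by linarith)] at hp1
  rw [lt_div_iff₀ (by norm_num)] at hp2
  have hp : 1 < p := by
    by_contra! hle
    nlinarith
  have hg := integrable_gam_rpow (n := n) (β := β) (p := p) (by linarith)
  set I := ∫ x : Eu n, gam β x ^ p
  have hI : 0 ≤ I := integral_nonneg fun x => by have := gam_nonneg β x; positivity
  have hω := ballVol_pos n
  have hR : 0 < G.R := zero_lt_one.trans_le G.one_le_R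
  have hCd := G.Cd_pos
  set Cv := G.Cd * (G.R ^ n * ballVol n)
  have hCv : 0 < Cv := by positivity
  refine ⟨n / (2 * p) - 1, ?_, 4 * (Cv + I), by positivity, fun e h hh => ?_⟩
  · have : 1 < n / (2 * p) := by rw [lt_div_iff₀ (by linarith)]; linarith
    linarith
  set S := sec u 0 h
  have hSc : IsCompact S := hu.isCompact_sec 0 h
  set t : ℝ := h ^ (-(n / (2 * p)))
  have ht : 0 < t := by positivity
  have key : ∀ a : Eu n, ∫ x in S, gam β (x + a) ≤ (Cv + I) * (√h ^ n * t) := by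
    intro a
    have hga : Integrable fun x : Eu n => gam β (x + a) ^ p := hg.comp_add_right a
    have hct : IntegrableOn (fun _ : Eu n => t) S := integrableOn_const hSc.measure_lt_top.ne (by simp)
    have hia : ∫ x : Eu n, gam β (x + a) ^ p = I :=
      integral_add_right_eq_self (fun x => gam β x ^ p) a
    calc ∫ x in S, gam β (x + a) ≤ ∫ x in S, (t + t ^ (1 - p) * gam β (x + a) ^ p) := by
          refine setIntegral_mono ?_ ?_ fun x => le_add_rpow_mul (gam_nonneg β _) ht hp.le
          · have := continuous_gam (n := n) β
            exact (by fun_prop : Continuous fun x => gam β (x + a)).integrableOn_compact hSc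
          · exact hct.add (hga.const_mul _).integrableOn
      _ = t * volume.real S + t ^ (1 - p) * ∫ x in S, gam β (x + a) ^ p := by
          rw [integral_add hct (hga.const_mul _).integrableOn, integral_const_mul, setIntegral_const, smul_eq_mul,
            mul_comm]
      _ ≤ t * (Cv * √h ^ n) + t ^ (1 - p) * I := by
          gcongr
          · exact G.volume_sec_le 0 hh
          · rw [← hia]
            exact setIntegral_le_integral hga (.of_forall fun x => by
              have := gam_nonneg β (x + a)
              positivity)
      _ = (Cv + I) * (√h ^ n * t) := by
          have e1 : t ^ (1 - p) = √h ^ n * t := by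
            rw [sqrt_pow_eq_rpow hh.le]
            simp only [t]
            rw [← rpow_mul hh.le, ← rpow_add hh]
            congr 1
            field_simp
            ring
          rw [e1]; ring
  have hc : ∀ a : Eu n, IntegrableOn (fun x => gam β (x + a)) S := fun a => by
    have := continuous_gam (n := n) β
    exact (by fun_prop : Continuous fun x => gam β (x + a)).integrableOn_compact hSc
  have h1 := key e
  have h2 := key (-e)
  have h3 := key 0
  simp only [add_zero, ← sub_eq_add_neg] at h2 h3
  have hc2 := hc (-e)
  have hc3 := hc 0
  simp only [add_zero, ← sub_eq_add_neg] at hc2 hc3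
  have e2 : ∫ x in S, src β e x = (∫ x in S, gam β (x + e)) + (∫ x in S, gam β (x - e))
      + 2 * ∫ x in S, gam β x := by
    simp only [src]
    have h12 : IntegrableOn (fun x => gam β (x + e) + gam β (x - e)) S := (hc e).add hc2
    rw [integral_add h12 (hc3.const_mul 2), integral_add (hc e) hc2, integral_const_mul]
  have e3 : h ^ (-1 - ((n : ℝ) / (2 * p) - 1)) = t := by simp only [t]; congr 1; ring
  rw [e2, e3]
  linarith

/-- The standing assumptions: a normalized solution, a cocompact group `Γ` of translations, and the
resulting lower bound for the linearized operator on second differences along `Γ`. -/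
structure Setting (u : Eu n → ℝ) (lam Lam β : ℝ) (Γ : AddSubgroup (Eu n)) : Prop
    extends Pinched u lam Lam where
  dim : 3 ≤ n
  smooth3 : ContDiff ℝ 3 u
  zero : u 0 = 0
  grad_zero : fderiv ℝ u 0 = 0
  two_lt : 2 < β
  le_five_half : β ≤ 5 / 2
  cocompact : ∃ Ca > 0, ∀ z, ∃ e ∈ Γ, ‖z - e‖ ≤ Ca
  source : ∃ Cs > 0, ∀ e ∈ Γ, ∀ x, -(Cs * src β e x) ≤ lin u (sd u e) x

/-- Ellipsoids concentric with the sections centered at the origin. -/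
def Geom.W (G : Geom u) (h ρ : ℝ) : Set (Eu n) :=
  {z | ‖(G.B 0 (G.J * h)).symm z‖ ≤ ρ}

theorem Geom.W_eq_ell (G : Geom u) (h ρ : ℝ) :
    G.W h ρ = ell 0 (G.B 0 (G.J * h) : Eu n →L[ℝ] Eu n) 0 ρ := by
  ext z
  constructor
  · intro hz
    exact ⟨(G.B 0 (G.J * h)).symm z, mem_closedBall_zero_iff.2 hz, by simp⟩
  · rintro ⟨t, ht, rfl⟩
    simpa [Geom.W] using ht

theorem Geom.isCompact_W (G : Geom u) (h ρ : ℝ) : IsCompact (G.W h ρ) := by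
  rw [G.W_eq_ell]; exact isCompact_ell _ _ _ _

theorem Geom.J_pos (G : Geom u) : 0 < G.J := zero_lt_one.trans_le G.one_le_J

theorem Geom.R_pos (G : Geom u) : 0 < G.R := zero_lt_one.trans_le G.one_le_R

theorem Geom.Θ_pos (G : Geom u) : 0 < G.Θ := two_pos.trans_le G.two_le

theorem Geom.volume_W_le (G : Geom u) {h ρ : ℝ} (hh : 0 < h) (hρ : 0 ≤ ρ) :
    volume.real (G.W h ρ) ≤ G.Cd * √G.J ^ n * (ρ ^ n * ballVol n) * √h ^ n := by
  have hω := ballVol_pos n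
  have hJ := G.J_pos
  rw [G.W_eq_ell, volume_ell _ _ _ hρ]
  calc _ ≤ G.Cd * √(G.J * h) ^ n * (ρ ^ n * ballVol n) := by
        gcongr; exact G.det_le 0 (by positivity)
    _ = _ := by rw [Real.sqrt_mul hJ.le, mul_pow]; ring

theorem Geom.W_mono (G : Geom u) (h : ℝ) {ρ ρ' : ℝ} (hρ : ρ ≤ ρ') :
    G.W h ρ ⊆ G.W h ρ' := fun _ hz => le_trans hz hρ

theorem Geom.add_mem_W (G : Geom u) {h ρ ρ' : ℝ} {x y : Eu n} (hx : x ∈ G.W h ρ)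
    (hy : y ∈ G.W h ρ') : x + y ∈ G.W h (ρ + ρ') := by
  simp only [Geom.W, Set.mem_ofPred, map_add] at *
  exact (norm_add_le _ _).trans (add_le_add hx hy)

theorem Geom.smul_mem_W (G : Geom u) {h ρ t : ℝ} {x : Eu n} (hx : x ∈ G.W h ρ) :
    t • x ∈ G.W h (|t| * ρ) := by
  simp only [Geom.W, Set.mem_ofPred, map_smul, norm_smul, Real.norm_eq_abs] at *
  gcongr

theorem Geom.sec_subset_W (G : Geom u) {h : ℝ} (hh : 0 < h) :
    sec u 0 h ⊆ G.W h (G.r / 4) := fun z hz => by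
  have := G.swallow hh hz
  rwa [sub_zero] at this

theorem integral_D2_line (hu : ContDiff ℝ 2 u) (x a b : Eu n) :
    ∫ s in (0 : ℝ)..1, D2 u (x + s • a) a b = fderiv ℝ u (x + a) b - fderiv ℝ u x b := by
  have hc : Continuous fun s : ℝ => D2 u (x + s • a) a b :=
    (continuous_D2 hu a b).comp (by fun_prop)
  rw [integral_eq_sub_of_hasDerivAt
    (fun s _ => hasDerivAt_line_fderiv hu x a b s) (hc.intervalIntegrable _ _)]
  simp

namespace Setting

theorem dim_pos (hu : Setting u lam Lam β Γ) : 0 < n := by have := hu.dim; omega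

theorem breg_zero (hu : Setting u lam Lam β Γ) (z : Eu n) : breg u 0 z = u z := by
  simp [breg, hu.zero, hu.grad_zero]

theorem mem_sec_zero (hu : Setting u lam Lam β Γ) {z : Eu n} {h : ℝ} : z ∈ sec u 0 h ↔ u z ≤ h := by
  rw [mem_sec, hu.breg_zero]

theorem nonneg (hu : Setting u lam Lam β Γ) (z : Eu n) : 0 ≤ u z := by
  rw [← hu.breg_zero]; exact hu.breg_nonneg 0 z

theorem le_of_mem_W (hu : Setting u lam Lam β Γ) (G : Geom u) {h : ℝ} (hh : 0 < h) {z : Eu n}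
    (hz : z ∈ G.W h (4 * G.r)) : u z ≤ G.J * (G.J * h) := by
  have hJ := G.J_pos
  have h1 : (1 / 4 : ℝ) • z ∈ sec u 0 (G.J * h) := by
    refine G.inner_mem (by positivity) ?_
    have := G.smul_mem_W (t := 1 / 4) hz
    simp only [Geom.W, Set.mem_ofPred] at this
    rw [sub_zero]
    rw [abs_of_pos (by norm_num)] at this
    linarith
  have h2 := G.swallow (by positivity) h1
  rw [sub_zero, map_smul, norm_smul, norm_of_nonneg (by norm_num)] at h2
  rw [← hu.mem_sec_zero]
  refine G.inner_mem (by positivity) ?_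
  rw [sub_zero]; linarith

theorem integral_D2_le (hu : Setting u lam Lam β Γ) (G : Geom u) :
    ∃ C > 0, ∀ (h : ℝ) (ξ : Eu n), 0 < h → ∫ z in G.W h (G.r / 2), D2 u z ξ ξ
        ≤ C * √h ^ n * h * ‖(G.B 0 (G.J * h)).symm ξ‖ ^ 2 := by
  have hJ := G.J_pos
  have hr := G.r_pos
  have hω := ballVol_pos n
  have hCd := G.Cd_pos
  set Cv := G.Cd * √G.J ^ n * (G.r ^ n * ballVol n)
  have hCv : 0 < Cv := by have := sqrt_pos.2 hJ; positivity
  have key : ∀ (h : ℝ) (ξ : Eu n), 0 < h → ‖(G.B 0 (G.J * h)).symm ξ‖ = G.r / 2 →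
      ∫ z in G.W h (G.r / 2), D2 u z ξ ξ ≤ 2 * (G.J * (G.J * h)) * (Cv * √h ^ n) := by
    intro h ξ hh hξ
    have hξW : ξ ∈ G.W h (G.r / 2) := hξ.le
    set F : Eu n → ℝ := fun z => D2 u z ξ ξ
    have hF : Continuous F := continuous_D2 hu.smooth ξ ξ
    have hF0 : ∀ z, 0 ≤ F z := fun z => hu.D2_nonneg z ξ
    have h1 : ∀ s ∈ Set.Icc (0 : ℝ) 1, ∫ z in G.W h (G.r / 2), F z
        ≤ ∫ x in G.W h G.r, F (x + s • ξ) := by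
      intro s hs
      rw [← setIntegral_comp_add (G.W h (G.r / 2)) (s • ξ)]
      refine setIntegral_mono_set ((hF.comp (by fun_prop)).integrableOn_compact
        (G.isCompact_W h G.r)) (.of_forall fun x => hF0 _)
        (LE.le.eventuallyLE fun x hx => ?_)
      have h2 := G.smul_mem_W (t := -s) hξW
      have h3 := G.add_mem_W (show x + s • ξ ∈ G.W h (G.r / 2) from hx) h2
      rw [neg_smul, add_neg_cancel_right, abs_neg, abs_of_nonneg hs.1] at h3
      refine G.W_mono h ?_ h3
      nlinarith [hs.2]
    have hFs : Continuous fun p : ℝ × Eu n => F (p.2 + p.1 • ξ) := hF.comp (by fun_prop)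
    have h2 : ∫ z in G.W h (G.r / 2), F z ≤ ∫ s in (0 : ℝ)..1, ∫ x in G.W h G.r, F (x + s • ξ) := by
      have hc : Continuous fun s : ℝ => ∫ x in G.W h G.r, F (x + s • ξ) :=
        continuous_parametric_integral_of_continuous (by exact hFs) (G.isCompact_W h G.r)
      have := integral_mono_on (μ := volume) zero_le_one
        (intervalIntegrable_const (c := ∫ z in G.W h (G.r / 2), F z)) (hc.intervalIntegrable 0 1) h1
      simpa using this
    refine h2.trans ?_
    rw [integral_segment_swap hFs (G.isCompact_W h G.r)]
    have h3 : ∀ x ∈ G.W h G.r, ∫ s in (0 : ℝ)..1, F (x + s • ξ) ≤ 2 * (G.J * (G.J * h)) := by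
      intro x hx
      rw [integral_D2_line hu.smooth]
      have e1 := hu.breg_nonneg (x + ξ) (x + ξ + ξ)
      have e2 := hu.breg_nonneg x (x - ξ)
      simp only [breg, add_sub_cancel_left, sub_sub_cancel_left, map_neg] at e1 e2
      have e3 := hu.nonneg (x + ξ)
      have e4 := hu.nonneg x
      have e5 : u (x + ξ + ξ) ≤ G.J * (G.J * h) := by
        refine hu.le_of_mem_W G hh (G.W_mono h ?_ (G.add_mem_W (G.add_mem_W hx hξW) hξW))
        linarith
      have e6 : u (x - ξ) ≤ G.J * (G.J * h) := by
        have h7 := G.smul_mem_W (t := -1) hξW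
        rw [neg_one_smul] at h7
        refine hu.le_of_mem_W G hh (G.W_mono h ?_ (sub_eq_add_neg x ξ ▸ G.add_mem_W hx h7))
        rw [abs_neg, abs_one]; linarith
      linarith
    have hWm := (G.isCompact_W h G.r).measurableSet
    have hWf := (G.isCompact_W h G.r).measure_lt_top (μ := volume)
    calc ∫ x in G.W h G.r, ∫ s in (0 : ℝ)..1, F (x + s • ξ)
        ≤ ∫ _x in G.W h G.r, 2 * (G.J * (G.J * h)) := by
          refine setIntegral_mono_on ?_ (integrableOn_const hWf.ne enorm_ne_top) hWm h3
          refine ContinuousOn.integrableOn_compact (G.isCompact_W h G.r) (Continuous.continuousOn ?_)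
          exact continuous_parametric_intervalIntegral_of_continuous'
            (f := fun x s => F (x + s • ξ)) (hF.comp (by fun_prop)) 0 1
      _ = 2 * (G.J * (G.J * h)) * volume.real (G.W h G.r) := by
          rw [setIntegral_const, smul_eq_mul, mul_comm]
      _ ≤ _ := by
          gcongr
          exact G.volume_W_le hh hr.le
  refine ⟨8 * G.J * G.J * Cv / G.r ^ 2, by positivity, fun h ξ hh => ?_⟩
  rcases eq_or_ne ξ 0 with rfl | hξ
  · simp [D2]
  set B := G.B 0 (G.J * h)
  have hN : 0 < ‖B.symm ξ‖ := by rw [norm_pos_iff]; simpa using hξ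
  set c : ℝ := G.r / 2 / ‖B.symm ξ‖
  have hc : 0 < c := by positivity
  have h1 := key h (c • ξ) hh (by
    rw [map_smul, norm_smul, norm_of_nonneg hc.le, div_mul_cancel₀ _ hN.ne'])
  have h2 : ∀ z, D2 u z (c • ξ) (c • ξ) = c ^ 2 * D2 u z ξ ξ := by
    intro z; simp only [D2, map_smul, _root_.smul_apply, smul_eq_mul]; ring
  simp only [h2] at h1
  rw [integral_const_mul] at h1
  have hc2 : c ^ 2 = G.r ^ 2 / 4 / ‖B.symm ξ‖ ^ 2 := by simp only [c, div_pow]; norm_num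
  rw [hc2] at h1
  set I := ∫ z in G.W h (G.r / 2), D2 u z ξ ξ
  have h3 : I = (4 * ‖B.symm ξ‖ ^ 2 / G.r ^ 2) * (G.r ^ 2 / 4 / ‖B.symm ξ‖ ^ 2 * I) := by field_simp
  rw [h3]
  calc _ ≤ (4 * ‖B.symm ξ‖ ^ 2 / G.r ^ 2) * (2 * (G.J * (G.J * h)) * (Cv * √h ^ n)) := by
        gcongr
    _ = _ := by ring

theorem integral_sd_le (hu : Setting u lam Lam β Γ) (G : Geom u) :
    ∃ C > 0, ∀ (h : ℝ) (e : Eu n), 0 < h → ‖(G.B 0 (G.J * h)).symm e‖ ≤ G.r / 4 →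
      ∫ z in sec u 0 h, sd u e z ≤ C * √h ^ n * h * ‖(G.B 0 (G.J * h)).symm e‖ ^ 2 := by
  obtain ⟨C, hC, hD⟩ := hu.integral_D2_le G
  refine ⟨2 * C, by positivity, fun h e hh he => ?_⟩
  have heW : e ∈ G.W h (G.r / 4) := he
  have hr := G.r_pos
  set S := sec u 0 h
  have hSc : IsCompact S := hu.isCompact_sec 0 h
  set F : Eu n → ℝ := fun z => D2 u z e e
  have hF : Continuous F := continuous_D2 hu.smooth e e
  have hF0 : ∀ z, 0 ≤ F z := fun z => hu.D2_nonneg z e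
  have hFs : Continuous fun p : ℝ × Eu n => 2 * F (p.2 - e + p.1 • ((2 : ℝ) • e)) :=
    continuous_const.mul (hF.comp (by fun_prop))
  have h1 : ∀ x, sd u e x ≤ ∫ s in (0 : ℝ)..1, 2 * F (x - e + s • ((2 : ℝ) • e)) := by
    intro x
    have e0 : ∀ s : ℝ, 2 * F (x - e + s • ((2 : ℝ) • e))
        = D2 u (x - e + s • ((2 : ℝ) • e)) ((2 : ℝ) • e) e := by
      intro s; simp only [F, D2, map_smul, _root_.smul_apply, smul_eq_mul]
    simp only [e0]
    rw [integral_D2_line hu.smooth, show x - e + (2 : ℝ) • e = x + e by module]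
    have e1 := hu.breg_nonneg (x + e) x
    have e2 := hu.breg_nonneg (x - e) x
    simp only [breg, sub_add_cancel_left, sub_sub_cancel, map_neg] at e1 e2
    unfold sd
    linarith
  have hsd : Continuous (sd u e) := (contDiff_sd (m := 2) hu.smooth e).continuous
  calc ∫ z in S, sd u e z ≤ ∫ x in S, ∫ s in (0 : ℝ)..1, 2 * F (x - e + s • ((2 : ℝ) • e)) := by
        refine setIntegral_mono (hsd.integrableOn_compact hSc) ?_ h1
        refine ContinuousOn.integrableOn_compact hSc (Continuous.continuousOn ?_)
        exact continuous_parametric_intervalIntegral_of_continuous'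
          (f := fun x s => 2 * F (x - e + s • ((2 : ℝ) • e)))
          (continuous_const.mul (hF.comp (by fun_prop))) 0 1
    _ = ∫ s in (0 : ℝ)..1, ∫ x in S, 2 * F (x - e + s • ((2 : ℝ) • e)) :=
        (integral_segment_swap hFs hSc).symm
    _ ≤ ∫ _s in (0 : ℝ)..1, 2 * ∫ z in G.W h (G.r / 2), F z := by
        have hc : Continuous fun s : ℝ => ∫ x in S, 2 * F (x - e + s • ((2 : ℝ) • e)) :=
          continuous_parametric_integral_of_continuous (by exact hFs) hSc
        refine integral_mono_on zero_le_one (hc.intervalIntegrable 0 1)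
          intervalIntegrable_const fun s hs => ?_
        rw [integral_const_mul]
        gcongr
        rw [← setIntegral_comp_add (G.W h (G.r / 2)) ((2 * s - 1) • e)]
        have e1 : ∀ x : Eu n, x - e + s • ((2 : ℝ) • e) = x + (2 * s - 1) • e := fun x => by module
        simp only [e1]
        have hcl : IsClosed ((fun x : Eu n => x + (2 * s - 1) • e) ⁻¹' G.W h (G.r / 2)) :=
          (G.isCompact_W h _).isClosed.preimage (by fun_prop)
        have hcp : IsCompact ((fun x : Eu n => x + (2 * s - 1) • e) ⁻¹' G.W h (G.r / 2)) :=
          (Homeomorph.addRight ((2 * s - 1) • e)).isCompact_preimage.2 (G.isCompact_W h _)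
        refine setIntegral_mono_set ((hF.comp (by fun_prop)).integrableOn_compact hcp)
          (.of_forall fun x => hF0 _) (LE.le.eventuallyLE fun x hx => ?_)
        refine G.W_mono h ?_ (G.add_mem_W (G.sec_subset_W hh hx)
          (G.smul_mem_W (t := 2 * s - 1) heW))
        have : |2 * s - 1| ≤ 1 := abs_le.2 ⟨by linarith [hs.1], by linarith [hs.2]⟩
        nlinarith
    _ = 2 * ∫ z in G.W h (G.r / 2), F z := by simp
    _ ≤ 2 * (C * √h ^ n * h * ‖(G.B 0 (G.J * h)).symm e‖ ^ 2) := by gcongr; exact hD h e hh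
    _ = _ := by ring

end Setting

theorem energy_self_eq (hu : ConvexC2 u) (v : Eu n → ℝ) (x : Eu n) :
    energy u v v x = (hess u x).det *
      ((gradient v x).ofLp ⬝ᵥ (hess u x)⁻¹ *ᵥ (gradient v x).ofLp) := by
  have hd := (hu.pos x).det_pos.ne'
  have : cof u x = (hess u x).det • (hess u x)⁻¹ := by
    rw [cof, inv_def, Ring.inverse_eq_inv, smul_smul, mul_inv_cancel₀ hd, one_smul]
  rw [energy, this, smul_mulVec, dotProduct_smul, smul_eq_mul]

theorem energy_self_nonneg (hu : ConvexC2 u) (v : Eu n → ℝ) (x : Eu n) : 0 ≤ energy u v v x := by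
  rw [energy_self_eq hu]
  have h := (hu.pos x).inv.posSemidef.dotProduct_mulVec_nonneg (gradient v x).ofLp
  rw [star_trivial] at h
  exact mul_nonneg (hu.pos x).det_pos.le h

theorem det_mul_fderiv_sq_le (hu : ConvexC2 u) (v : Eu n → ℝ) (x ξ : Eu n) :
    (hess u x).det * fderiv ℝ v x ξ ^ 2 ≤ D2 u x ξ ξ * energy u v v x := by
  have h := dotProduct_sq_le (hu.pos x) ξ.ofLp (gradient v x).ofLp
  have e : ξ.ofLp ⬝ᵥ (gradient v x).ofLp = fderiv ℝ v x ξ := by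
    rw [← inner_gradient_left, EuclideanSpace.inner_eq_star_dotProduct, star_trivial]
  rw [e, ← D2_eq_dotProduct] at h
  rw [energy_self_eq hu]
  have hd := (hu.pos x).det_pos
  calc _ ≤ (hess u x).det * (D2 u x ξ ξ
        * ((gradient v x).ofLp ⬝ᵥ (hess u x)⁻¹ *ᵥ (gradient v x).ofLp)) := by gcongr
    _ = _ := by ring

theorem hasDerivAt_posPart_sq (t : ℝ) : HasDerivAt (fun t : ℝ => max t 0 ^ 2) (2 * max t 0) t := by
  rcases lt_trichotomy t 0 with h | rfl | h
  · rw [max_eq_right h.le, mul_zero]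
    refine (hasDerivAt_const t (0 : ℝ)).congr_of_eventuallyEq ?_
    filter_upwards [Iio_mem_nhds h] with s hs
    rw [max_eq_right (le_of_lt hs)]; simp
  · rw [hasDerivAt_iff_tendsto_slope_zero]
    have hc : Tendsto (fun t : ℝ => max t 0) (nhdsWithin 0 {0}ᶜ) (nhds (2 * max 0 0)) := by
      have : Continuous fun t : ℝ => max t 0 := by fun_prop
      simpa using (this.tendsto 0).mono_left nhdsWithin_le_nhds
    refine hc.congr' ?_
    filter_upwards [self_mem_nhdsWithin] with s hs
    have hs : s ≠ 0 := hs
    rcases le_total s 0 with h | h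
    · simp [max_eq_right h]
    · simp [max_eq_left h]; field_simp
  · rw [max_eq_left h.le]
    have := hasDerivAt_pow 2 t
    refine (this.congr_of_eventuallyEq ?_).congr_deriv (by simp)
    filter_upwards [Ioi_mem_nhds h] with s hs
    rw [max_eq_left (le_of_lt hs)]

theorem contDiff_posPart_sq : ContDiff ℝ 1 fun t : ℝ => max t 0 ^ 2 := by
  rw [contDiff_one_iff_deriv]
  refine ⟨fun t => (hasDerivAt_posPart_sq t).differentiableAt, ?_⟩
  rw [show deriv (fun t : ℝ => max t 0 ^ 2) = fun t => 2 * max t 0 from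
    funext fun t => (hasDerivAt_posPart_sq t).deriv]
  fun_prop

section Indicator

variable {w : Eu n → ℝ} {O K : Set (Eu n)}

theorem contDiff_indicator (hw : ContDiff ℝ 1 w) (hO : IsOpen O) (hK : IsClosed K) (hKO : K ⊆ O)
    (h0 : ∀ x ∈ O, x ∉ K → w x = 0) : ContDiff ℝ 1 (O.indicator w) := by
  rw [contDiff_iff_contDiffAt]
  intro x
  by_cases hx : x ∈ O
  · refine hw.contDiffAt.congr_of_eventuallyEq ?_
    filter_upwards [hO.mem_nhds hx] with y hy using indicator_of_mem hy w
  · refine (contDiffAt_const (c := (0 : ℝ))).congr_of_eventuallyEq ?_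
    filter_upwards [hK.isOpen_compl.mem_nhds fun h => hx (hKO h)] with y hy
    by_cases hyO : y ∈ O
    · rw [indicator_of_mem hyO]; exact h0 y hyO hy
    · exact indicator_of_notMem hyO w

theorem fderiv_indicator_of_mem (hO : IsOpen O) {x : Eu n} (hx : x ∈ O) :
    fderiv ℝ (O.indicator w) x = fderiv ℝ w x := by
  refine Filter.EventuallyEq.fderiv_eq ?_
  filter_upwards [hO.mem_nhds hx] with y hy using indicator_of_mem hy w

theorem fderiv_indicator_of_notMem (hK : IsClosed K) (hKO : K ⊆ O)
    (h0 : ∀ x ∈ O, x ∉ K → w x = 0) {x : Eu n} (hx : x ∉ O) :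
    fderiv ℝ (O.indicator w) x = 0 := by
  have : O.indicator w =ᶠ[nhds x] fun _ => 0 := by
    filter_upwards [hK.isOpen_compl.mem_nhds fun h => hx (hKO h)] with y hy
    by_cases hyO : y ∈ O
    · rw [indicator_of_mem hyO]; exact h0 y hyO hy
    · exact indicator_of_notMem hyO w
  rw [this.fderiv_eq]; simp

end Indicator

theorem energy_congr_fderiv {u a b a' : Eu n → ℝ} {x : Eu n} {c : ℝ}
    (h : fderiv ℝ a x = c • fderiv ℝ a' x) : energy u a b x = c * energy u a' b x := by
  simp only [energy_eq_sum, h, _root_.smul_apply, smul_eq_mul, mul_sum]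
  exact sum_congr rfl fun i _ => sum_congr rfl fun j _ => by ring

theorem energy_eq_zero {u a b : Eu n → ℝ} {x : Eu n} (h : fderiv ℝ a x = 0) :
    energy u a b x = 0 := by
  simp [energy_eq_sum, h]

/-- One-dimensional Poincaré inequality along a direction leaving the support. -/
theorem setIntegral_le_integral_abs_fderiv {a : Eu n → ℝ} (ha : ContDiff ℝ 1 a)
    (hac : HasCompactSupport a) {K : Set (Eu n)} (hK : IsCompact K) {ξ : Eu n}
    (hξ : ∀ x ∈ K, a (x + ξ) = 0) : ∫ x in K, a x ≤ ∫ x, |fderiv ℝ a x ξ| := by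
  set F : Eu n → ℝ := fun x => |fderiv ℝ a x ξ|
  have hd : Continuous fun x => fderiv ℝ a x ξ :=
    (contDiff_fderiv_apply (m := 1) (k := 0) ha (by norm_num) _).continuous
  have hF : Continuous F := hd.abs
  have hFi : Integrable F := hF.integrable_of_hasCompactSupport (by
    have : HasCompactSupport fun x => fderiv ℝ a x ξ := hac.fderiv_apply ℝ ξ
    exact this.comp_left (g := fun t : ℝ => |t|) (by simp))
  have hFs : Continuous fun p : ℝ × Eu n => F (p.2 + p.1 • ξ) := hF.comp (by fun_prop)
  have h1 : ∀ x ∈ K, a x ≤ ∫ s in (0 : ℝ)..1, F (x + s • ξ) := by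
    intro x hx
    have hc : Continuous fun s : ℝ => fderiv ℝ a (x + s • ξ) ξ := hd.comp (by fun_prop)
    have h2 : ∫ s in (0 : ℝ)..1, fderiv ℝ a (x + s • ξ) ξ = a (x + ξ) - a x := by
      rw [integral_eq_sub_of_hasDerivAt
        (fun s _ => hasDerivAt_line ha x ξ s) (hc.intervalIntegrable _ _)]
      simp
    rw [hξ x hx, zero_sub] at h2
    have h3 := intervalIntegral.abs_integral_le_integral_abs (μ := volume)
      (f := fun s : ℝ => fderiv ℝ a (x + s • ξ) ξ) (zero_le_one (α := ℝ))
    rw [h2, abs_neg] at h3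
    exact (le_abs_self _).trans h3
  calc ∫ x in K, a x ≤ ∫ x in K, ∫ s in (0 : ℝ)..1, F (x + s • ξ) := by
        refine setIntegral_mono_on (ha.continuous.integrableOn_compact hK) ?_ hK.measurableSet h1
        refine ContinuousOn.integrableOn_compact hK (Continuous.continuousOn ?_)
        exact continuous_parametric_intervalIntegral_of_continuous'
          (f := fun x s => F (x + s • ξ)) (hF.comp (by fun_prop)) 0 1
    _ = ∫ s in (0 : ℝ)..1, ∫ x in K, F (x + s • ξ) := (integral_segment_swap hFs hK).symm
    _ ≤ ∫ _s in (0 : ℝ)..1, ∫ x, F x := by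
        have hc : Continuous fun s : ℝ => ∫ x in K, F (x + s • ξ) :=
          continuous_parametric_integral_of_continuous (by exact hFs) hK
        refine integral_mono_on zero_le_one (hc.intervalIntegrable 0 1)
          intervalIntegrable_const fun s _ => ?_
        rw [← integral_add_right_eq_self F (s • ξ)]
        exact setIntegral_le_integral (hFi.comp_add_right _) (.of_forall fun x => abs_nonneg _)
    _ = ∫ x, F x := by simp

theorem two_mul_abs_le {t D E μ lam : ℝ} (hμ : 0 < μ) (hl : 0 < lam) (hD : 0 ≤ D) (hE : 0 ≤ E)
    (h : lam * t ^ 2 ≤ D * E) : 2 * |t| ≤ μ * D + E / (μ * lam) := by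
  refine le_of_sq_le_sq ?_ (by positivity)
  have e : (μ * D + E / (μ * lam)) ^ 2 = (μ * D - E / (μ * lam)) ^ 2 + 4 * (D * E) / lam := by
    field_simp; ring
  rw [e, mul_pow, sq_abs]
  have : 2 ^ 2 * t ^ 2 ≤ 4 * (D * E) / lam := by rw [le_div_iff₀ hl]; linarith
  linarith [sq_nonneg (μ * D - E / (μ * lam))]

namespace Setting

theorem trace_cof_sd_ge (hu : Setting u lam Lam β Γ) {Cs : ℝ} (hCs : 0 < Cs) {e : Eu n}
    (hs : ∀ x, -(Cs * src β e x) ≤ lin u (sd u e) x) (x : Eu n) :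
    -(Lam * Cs * src β e x) ≤ (cof u x * hess (sd u e) x).trace := by
  rw [trace_cof_mul hu.toConvexC2]
  have h1 := hs x
  have h2 := hu.upper x
  have h3 := (hu.pos x).det_pos
  have h4 := src_nonneg β e x
  have h5 : (hess u x).det * -(Cs * src β e x) ≤ (hess u x).det * lin u (sd u e) x :=
    mul_le_mul_of_nonneg_left h1 h3.le
  have h6 : (hess u x).det * (Cs * src β e x) ≤ Lam * (Cs * src β e x) :=
    mul_le_mul_of_nonneg_right h2 (by positivity)
  linarith

theorem continuous_trace_cof (hu : Setting u lam Lam β Γ) {v : Eu n → ℝ} (hv : ContDiff ℝ 2 v) :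
    Continuous fun x => (cof u x * hess v x).trace := by
  have h1 : ∀ i j, Continuous fun x => cof u x i j := fun i j =>
    (contDiff_cof hu.smooth3 i j).continuous
  have h2 : ∀ i j, Continuous fun x => hess v x i j := fun i j => by
    simp only [hess_apply]; exact continuous_D2 hv _ _
  simp only [trace, diag_apply, mul_apply]
  fun_prop

/-- Energy estimate for the excess of a second difference over its boundary values. -/
theorem integral_excess_le (hu : Setting u lam Lam β Γ) (G : Geom u) :
    ∃ σ : ℝ, 0 < σ ∧ ∃ C > 0, ∀ e ∈ Γ, ∀ h m V δ : ℝ, 0 < h → 0 ≤ m → 0 < V → 0 < δ →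
      (∀ x, u x = h → sd u e x < m) → (∀ x, u x ≤ h → sd u e x ≤ V) → V ^ 3 * h ^ (-σ) ≤ δ ^ 4 →
      ∫ x in sec u 0 h, max (sd u e x - m) 0 ≤ C * √h ^ n * δ := by
  obtain ⟨Cs, hCs, hsrc⟩ := hu.source
  obtain ⟨C₁, hC₁, hD2⟩ := hu.integral_D2_le G
  obtain ⟨σ, hσ, C₂, hC₂, hInt⟩ := G.exists_integral_src_le hu.toConvexC2 hu.dim hu.two_lt
    hu.le_five_half
  have hL := hu.Lam_pos
  have hl := hu.lam_pos
  have hω := ballVol_pos n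
  have hR := G.R_pos
  have hCd := G.Cd_pos
  have hr := G.r_pos
  set Cv := G.Cd * (G.R ^ n * ballVol n)
  have hCv : 0 < Cv := by positivity
  set K₂ := Lam * Cs * C₂ / (2 * lam)
  have hK₂ : 0 < K₂ := by positivity
  refine ⟨σ, hσ, Cv + (C₁ + K₂), by positivity, fun e he h m V δ hh hm hV hδ hbd hVb hδV => ?_⟩
  set v := sd u e
  have hv : ContDiff ℝ 2 v := contDiff_sd (m := 2) hu.smooth e
  have hv1 : ContDiff ℝ 1 v := hv.of_le (by norm_num)
  set S := sec u 0 h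
  have hSc : IsCompact S := hu.isCompact_sec 0 h
  have hSm := hSc.measurableSet
  set O : Set (Eu n) := {x | u x < h}
  have hO : IsOpen O := isOpen_lt hu.continuous continuous_const
  have hOS : ∀ x ∈ O, x ∈ S := fun x hx => hu.mem_sec_zero.2 (le_of_lt hx)
  set K : Set (Eu n) := S ∩ {x | m ≤ v x}
  have hKc : IsCompact K := hSc.inter_right (isClosed_le continuous_const hv.continuous)
  have hKO : K ⊆ O := by
    rintro x ⟨hxS, hxm⟩
    have hxS : u x ≤ h := hu.mem_sec_zero.1 hxS
    rcases hxS.lt_or_eq with h1 | h1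
    · exact h1
    · exact absurd hxm (not_le.2 (hbd x h1))
  set p : Eu n → ℝ := fun x => max (v x - m) 0
  have hpc : Continuous p := by have := hv.continuous; fun_prop
  have hp0 : ∀ x, 0 ≤ p x := fun x => le_max_right _ _
  have hpV : ∀ x ∈ S, p x ≤ V := fun x hx =>
    max_le (by have := hVb x (hu.mem_sec_zero.1 hx); linarith) hV.le
  set w : Eu n → ℝ := fun x => p x ^ 2
  have hw : ContDiff ℝ 1 w := contDiff_posPart_sq.comp (hv1.sub contDiff_const)
  have hwd : ∀ x, fderiv ℝ w x = (2 * p x) • fderiv ℝ v x := by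
    intro x
    have h1 : HasFDerivAt (fun y => v y - m) (fderiv ℝ v x) x :=
      (hv1.differentiable (by norm_num) x).hasFDerivAt.sub_const m
    exact ((hasDerivAt_posPart_sq (v x - m)).comp_hasFDerivAt x h1).fderiv
  have hw0 : ∀ x, x ∈ S → x ∉ K → w x = 0 := by
    intro x hx hxK
    have : v x < m := by
      by_contra! hcon
      exact hxK ⟨hx, hcon⟩
    simp [w, p, max_eq_right (by linarith : v x - m ≤ 0)]
  have hw0' : ∀ x ∈ O, x ∉ K → w x = 0 := fun x hx => hw0 x (hOS x hx)
  set a := O.indicator w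
  have ha : ContDiff ℝ 1 a := contDiff_indicator hw hO hKc.isClosed hKO hw0'
  have haK : ∀ x, x ∉ K → a x = 0 := fun x hx => by
    by_cases hxO : x ∈ O
    · exact (indicator_of_mem hxO w).trans (hw0' x hxO hx)
    · exact indicator_of_notMem hxO w
  have hac : HasCompactSupport a := HasCompactSupport.intro hKc haK
  have haS : ∀ x ∈ S, a x = w x := by
    intro x hx
    by_cases hxO : x ∈ O
    · exact indicator_of_mem hxO w
    · rw [hw0 x hx fun h => hxO (hKO h)]; exact indicator_of_notMem hxO w
  have hibp := integral_mul_trace_cof hu.smooth3 (fun x => (hu.pos x).det_pos.ne') ha hac hv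
  have hsc := continuous_src (n := n) β e
  have hsrcS : IntegrableOn (src β e) S := hsc.integrableOn_compact hSc
  have hen : ∫ x, energy u a v x ≤ Lam * Cs * V ^ 2 * (C₂ * √h ^ n * h ^ (-1 - σ)) := by
    rw [show ∫ x, energy u a v x = ∫ x, -(a x * (cof u x * hess v x).trace) by
      rw [integral_neg, hibp, neg_neg]]
    calc ∫ x, -(a x * (cof u x * hess v x).trace)
        ≤ ∫ x, S.indicator (fun x => Lam * Cs * V ^ 2 * src β e x) x := by
          refine integral_mono ?_ (IntegrableOn.integrable_indicator (hsrcS.const_mul _) hSm) fun x => ?_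
          · exact ((ha.continuous.mul (hu.continuous_trace_cof hv)).integrable_of_hasCompactSupport
              hac.mul_right).neg
          · by_cases hxO : x ∈ O
            · simp only [indicator_of_mem (hOS x hxO)]
              rw [haS x (hOS x hxO)]
              have h1 := hu.trace_cof_sd_ge hCs (hsrc e he) x
              have h2 : w x ≤ V ^ 2 := pow_le_pow_left₀ (hp0 x) (hpV x (hOS x hxO)) 2
              have h3 : 0 ≤ w x := sq_nonneg _
              have h4 := src_nonneg β e x
              calc -(w x * (cof u x * hess v x).trace) = w x * -(cof u x * hess v x).trace := by ring
                _ ≤ w x * (Lam * Cs * src β e x) := by gcongr; linarith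
                _ ≤ V ^ 2 * (Lam * Cs * src β e x) := by gcongr
                _ = _ := by ring
            · rw [show a x = 0 from indicator_of_notMem hxO w]
              simp only [zero_mul, neg_zero]
              refine indicator_nonneg (fun y _ => ?_) x
              have := src_nonneg β e y
              positivity
      _ = Lam * Cs * V ^ 2 * ∫ x in S, src β e x := by
          rw [integral_indicator hSm, integral_const_mul]
      _ ≤ _ := by gcongr; exact hInt e h hh
  obtain ⟨i₀⟩ : Nonempty (Fin n) := ⟨⟨0, hu.dim_pos⟩⟩
  set ξ : Eu n := G.B 0 (G.J * h) (G.r • single i₀ (1 : ℝ))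
  have hξn : ‖(G.B 0 (G.J * h)).symm ξ‖ = G.r := by
    simp only [ξ, ContinuousLinearEquiv.symm_apply_apply, norm_smul, norm_of_nonneg hr.le]
    simp
  have hξS : ∀ x ∈ S, a (x + ξ) = 0 := by
    intro x hx
    refine indicator_of_notMem (fun hxO => ?_) w
    have h1 := G.sec_subset_W hh hx
    have h2 := G.sec_subset_W hh (hOS _ hxO)
    simp only [Geom.W, Set.mem_ofPred, map_add] at h1 h2
    have h3 := norm_sub_le ((G.B 0 (G.J * h)).symm x + (G.B 0 (G.J * h)).symm ξ)
      ((G.B 0 (G.J * h)).symm x)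
    rw [add_sub_cancel_left, hξn] at h3
    linarith
  have hpoin := setIntegral_le_integral_abs_fderiv ha hac hSc hξS
  set μ : ℝ := δ ^ 2 / (V * h)
  have hμ : 0 < μ := by positivity
  have hD2c : Continuous fun x => D2 u x ξ ξ := continuous_D2 hu.smooth ξ ξ
  have hD2S : IntegrableOn (fun x => D2 u x ξ ξ) S := hD2c.integrableOn_compact hSc
  have heni : Integrable (energy u a v) :=
    (continuous_energy hu.smooth3 ha hv1).integrable_of_hasCompactSupport (by
      refine HasCompactSupport.intro hKc fun x hx => energy_eq_zero ?_
      have : x ∉ tsupport a := fun hxs => hx (closure_minimal (fun y hy => by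
        by_contra hyK
        exact hy (haK y hyK)) hKc.isClosed hxs)
      exact fderiv_of_notMem_tsupport ℝ this)
  have hgrad : ∫ x, |fderiv ℝ a x ξ| ≤ V * μ * (C₁ * √h ^ n * h)
      + (2 * (μ * lam))⁻¹ * (Lam * Cs * V ^ 2 * (C₂ * √h ^ n * h ^ (-1 - σ))) := by
    have hdi : Integrable fun x => |fderiv ℝ a x ξ| :=
      ((contDiff_fderiv_apply (m := 1) (k := 0) ha (by norm_num)
        ξ).continuous.integrable_of_hasCompactSupport (hac.fderiv_apply ℝ ξ)).abs
    have hI1 : Integrable fun x => S.indicator (fun x => V * μ * D2 u x ξ ξ) x :=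
      IntegrableOn.integrable_indicator (hD2S.const_mul _) hSm
    calc ∫ x, |fderiv ℝ a x ξ| ≤ ∫ x, (S.indicator (fun x => V * μ * D2 u x ξ ξ) x
          + (2 * (μ * lam))⁻¹ * energy u a v x) := by
          refine integral_mono hdi (hI1.add (heni.const_mul _)) fun x => ?_
          by_cases hxO : x ∈ O
          · have hd : fderiv ℝ a x = (2 * p x) • fderiv ℝ v x := by
              rw [fderiv_indicator_of_mem hO hxO, hwd]
            simp only [indicator_of_mem (hOS x hxO)]
            rw [energy_congr_fderiv hd, hd, _root_.smul_apply, smul_eq_mul, abs_mul,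
              abs_of_nonneg (by have := hp0 x; positivity)]
            have h1 := det_mul_fderiv_sq_le hu.toConvexC2 v x ξ
            have hE := energy_self_nonneg hu.toConvexC2 v x
            have hD := hu.D2_nonneg x ξ
            have h2 : lam * fderiv ℝ v x ξ ^ 2 ≤ D2 u x ξ ξ * energy u v v x :=
              (mul_le_mul_of_nonneg_right (hu.lower x) (sq_nonneg _)).trans h1
            have h3 := two_mul_abs_le hμ hl hD hE h2
            calc 2 * p x * |fderiv ℝ v x ξ| = p x * (2 * |fderiv ℝ v x ξ|) := by ring
              _ ≤ p x * (μ * D2 u x ξ ξ + energy u v v x / (μ * lam)) := by gcongr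
              _ = p x * (μ * D2 u x ξ ξ) + (2 * (μ * lam))⁻¹ * (2 * p x * energy u v v x) := by
                  field_simp
              _ ≤ V * (μ * D2 u x ξ ξ) + (2 * (μ * lam))⁻¹ * (2 * p x * energy u v v x) := by
                  gcongr; exact hpV x (hOS x hxO)
              _ = _ := by ring
          · have hd := fderiv_indicator_of_notMem hKc.isClosed hKO hw0' hxO
            simp only [a]
            rw [energy_eq_zero hd, hd]
            simp only [_root_.zero_apply, abs_zero, mul_zero, add_zero]
            refine indicator_nonneg (fun y _ => ?_) x
            have := hu.D2_nonneg y ξ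
            positivity
      _ = V * μ * (∫ x in S, D2 u x ξ ξ) + (2 * (μ * lam))⁻¹ * ∫ x, energy u a v x := by
          rw [integral_add hI1 (heni.const_mul _), integral_indicator hSm, integral_const_mul,
            integral_const_mul]
      _ ≤ _ := by
          gcongr
          calc ∫ x in S, D2 u x ξ ξ ≤ ∫ x in G.W h (G.r / 2), D2 u x ξ ξ :=
                setIntegral_mono_set (hD2c.integrableOn_compact (G.isCompact_W h _))
                  (.of_forall fun x => hu.D2_nonneg x ξ)
                  (LE.le.eventuallyLE fun x hx => G.W_mono h (by linarith) (G.sec_subset_W hh hx))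
            _ ≤ C₁ * √h ^ n * h * G.r ^ 2 := by
                have := hD2 h ξ hh
                rwa [hξn] at this
            _ ≤ C₁ * √h ^ n * h * 1 := by gcongr; exact pow_le_one₀ hr.le G.r_le
            _ = _ := mul_one _
  have hfin : ∫ x, |fderiv ℝ a x ξ| ≤ (C₁ + K₂) * √h ^ n * δ ^ 2 := by
    refine hgrad.trans ?_
    have e1 : V * μ * (C₁ * √h ^ n * h) = C₁ * √h ^ n * δ ^ 2 := by simp only [μ]; field_simp
    have e2 : h ^ (-1 - σ) = h⁻¹ * h ^ (-σ) := by
      rw [sub_eq_add_neg, rpow_add hh, Real.rpow_neg_one]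
    have e3 : (2 * (μ * lam))⁻¹ * (Lam * Cs * V ^ 2 * (C₂ * √h ^ n * h ^ (-1 - σ)))
        = K₂ * √h ^ n * ((V ^ 3 * h ^ (-σ)) / δ ^ 2) := by
      rw [e2]; simp only [μ, K₂]; field_simp
    rw [e1, e3]
    have e4 : V ^ 3 * h ^ (-σ) / δ ^ 2 ≤ δ ^ 2 := by
      rw [div_le_iff₀ (by positivity)]; linarith [hδV, show δ ^ 4 = δ ^ 2 * δ ^ 2 by ring]
    have : K₂ * √h ^ n * ((V ^ 3 * h ^ (-σ)) / δ ^ 2) ≤ K₂ * √h ^ n * δ ^ 2 := by gcongr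
    linarith
  have hSi : ∫ x in S, w x ≤ (C₁ + K₂) * √h ^ n * δ ^ 2 := by
    rw [← setIntegral_congr_fun hSm haS]
    exact hpoin.trans hfin
  have hct : IntegrableOn (fun _ : Eu n => δ) S :=
    integrableOn_const hSc.measure_lt_top.ne enorm_ne_top
  have hwi : IntegrableOn w S := hw.continuous.integrableOn_compact hSc
  calc ∫ x in S, p x ≤ ∫ x in S, (δ + δ⁻¹ * w x) := by
        refine setIntegral_mono (hpc.integrableOn_compact hSc)
          (hct.add (hwi.const_mul _)) fun x => ?_
        have h1 : 0 ≤ δ⁻¹ * (p x - δ) ^ 2 := by positivity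
        have h2 : δ⁻¹ * (p x - δ) ^ 2 = δ⁻¹ * w x - 2 * p x + δ := by
          simp only [w]; field_simp; ring
        have := hp0 x
        simp only
        linarith
    _ = δ * volume.real S + δ⁻¹ * ∫ x in S, w x := by
        rw [integral_add hct (hwi.const_mul _), integral_const_mul, setIntegral_const, smul_eq_mul,
          mul_comm]
    _ ≤ δ * (Cv * √h ^ n) + δ⁻¹ * ((C₁ + K₂) * √h ^ n * δ ^ 2) := by
        gcongr
        exact G.volume_sec_le 0 hh
    _ = (Cv + (C₁ + K₂)) * √h ^ n * δ := by field_simp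

theorem lin_sub_const {v : Eu n → ℝ} (hv : ContDiff ℝ 2 v) (m : ℝ) (x : Eu n) :
    lin u (fun y => v y - m) x = lin u v x := by
  have : (fun y => v y - m) = fun y => v y + ((0 : Eu n →L[ℝ] ℝ) y + -m) := by funext y; simp; ring
  rw [lin, this, hess_add hv (by fun_prop), hess_affine, add_zero, lin]

/-- A second difference is controlled in the interior of a section by its boundary values. -/
theorem interior_le_boundary (hu : Setting u lam Lam β Γ) (G : Geom u) :
    ∃ σ : ℝ, 0 < σ ∧ ∃ C > 0, ∀ e ∈ Γ, ∀ h m V δ : ℝ, 0 < h → 0 ≤ m → 0 < V → 0 < δ →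
      (∀ x, u x = h → sd u e x ≤ m) → (∀ x, u x ≤ h → sd u e x ≤ V) → V ^ 3 * h ^ (-σ) ≤ δ ^ 4 →
      ∀ x, u x ≤ h / G.Θ → sd u e x ≤ m + C * (δ + √h *
        (∫ z in sec u x (h / G.Θ ^ 5), src β e z ^ n) ^ ((1 : ℝ) / n)) := by
  obtain ⟨Cs, hCs, hsrc⟩ := hu.source
  obtain ⟨σ, hσ, C₁, hC₁, hexc⟩ := hu.integral_excess_le G
  obtain ⟨C₂, hC₂, hmax⟩ := hu.local_max G hu.dim_pos
  have hΘ := G.Θ_pos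
  have hΘ1 : 1 ≤ G.Θ := by linarith [G.two_le]
  have hsΘ : 0 < √(G.Θ ^ 5) := sqrt_pos.2 (by positivity)
  set C := C₂ * (√(G.Θ ^ 5) ^ n * C₁ + Cs)
  have hn' : (n : ℝ) ≠ 0 := by have := hu.dim_pos; positivity
  refine ⟨σ, hσ, C, by positivity, fun e he h m V δ hh hm hV hδ hbd hVb hδV x hx => ?_⟩
  set s := h / G.Θ ^ 5
  have hs : 0 < s := by positivity
  have hsub : sec u x s ⊆ sec u 0 h := by
    have h1 := G.engulf' (x := 0) (y := x) (h := h / G.Θ) (by positivity) (hu.mem_sec_zero.2 hx)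
    rw [mul_div_cancel₀ _ hΘ.ne'] at h1
    refine (sec_mono u x ?_).trans h1
    simp only [s]
    gcongr
    exact le_self_pow₀ hΘ1 (by norm_num)
  set v := sd u e
  have hv : ContDiff ℝ 2 v := contDiff_sd (m := 2) hu.smooth e
  set I := (∫ z in sec u x s, src β e z ^ n) ^ ((1 : ℝ) / n)
  have hI0 : 0 ≤ ∫ z in sec u x s, src β e z ^ n :=
    integral_nonneg fun z => pow_nonneg (src_nonneg β e z) n
  have hI : 0 ≤ I := Real.rpow_nonneg hI0 _
  have hsh : 0 < √h := sqrt_pos.2 hh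
  refine le_of_forall_pos_le_add fun ε hε => ?_
  have h1 := hexc e he h (m + ε) V δ hh (by linarith) hV hδ
    (fun x hx => by linarith [hbd x hx]) hVb hδV
  have h2 := hmax (fun y => v y - (m + ε)) (fun y => Cs * src β e y) x s (hv.sub contDiff_const)
    (continuous_const.mul (continuous_src β e))
    (fun z => mul_nonneg hCs.le (src_nonneg β e z)) hs
    (fun z _ _ => by rw [lin_sub_const hv]; exact hsrc e he z)
  have e1 : (∫ z in sec u x s, (Cs * src β e z) ^ n) ^ ((1 : ℝ) / n) = Cs * I := by
    simp only [mul_pow, integral_const_mul]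
    rw [mul_rpow (by positivity) hI0, ← rpow_natCast, ← rpow_mul hCs.le,
      mul_one_div_cancel hn', rpow_one]
  have hmc : Continuous fun z => max (v z - (m + ε)) 0 := by have := hv.continuous; fun_prop
  have e2 : ∫ z in sec u x s, max (v z - (m + ε)) 0 ≤ C₁ * √h ^ n * δ :=
    (setIntegral_mono_set (hmc.integrableOn_compact (hu.isCompact_sec 0 h))
      (.of_forall fun z => le_max_right _ _) (LE.le.eventuallyLE hsub)).trans h1
  have e3 : (√s ^ n)⁻¹ = √(G.Θ ^ 5) ^ n / √h ^ n := by
    simp only [s]; rw [Real.sqrt_div hh.le, div_pow, inv_div]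
  have e4 : √s ≤ √h := Real.sqrt_le_sqrt (div_le_self hh.le (one_le_pow₀ hΘ1))
  rw [e1, e3] at h2
  have h3 : C₂ * (√(G.Θ ^ 5) ^ n / √h ^ n
      * (∫ z in sec u x s, max (v z - (m + ε)) 0) + √s * (Cs * I))
      ≤ C₂ * (√(G.Θ ^ 5) ^ n / √h ^ n * (C₁ * √h ^ n * δ) + √h * (Cs * I)) := by gcongr
  have h4 : C₂ * (√(G.Θ ^ 5) ^ n / √h ^ n * (C₁ * √h ^ n * δ) + √h * (Cs * I))
      = C₂ * ((√(G.Θ ^ 5) ^ n * C₁) * δ + Cs * (√h * I)) := by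
    field_simp
  have h5 : C₂ * ((√(G.Θ ^ 5) ^ n * C₁) * δ + Cs * (√h * I)) ≤ C * (δ + √h * I) := by
    have h6 : 0 ≤ (√(G.Θ ^ 5) ^ n * C₁) * (√h * I) + Cs * δ := by positivity
    calc _ ≤ C₂ * ((√(G.Θ ^ 5) ^ n * C₁) * δ + Cs * (√h * I)
          + ((√(G.Θ ^ 5) ^ n * C₁) * (√h * I) + Cs * δ)) :=
          mul_le_mul_of_nonneg_left (by linarith) hC₂.le
      _ = _ := by simp only [C]; ring
  linarith

end Setting

/-- Bound for the inverse of a linear map in terms of its norm and determinant. -/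
theorem norm_le_of_norm_map_le {Y : Eu n →L[ℝ] Eu n} {M : ℝ} (hM : 0 < M) (hdet : Y.det ≠ 0)
    (hY : ∀ w, ‖Y w‖ ≤ M * ‖w‖) {a : Eu n} (ha : ‖Y a‖ ≤ 1) (hn : 0 < n) :
    ‖a‖ ≤ 4 * 2 ^ n * M ^ (n - 1) / |Y.det| := by
  have hω := ballVol_pos n
  set K : Set (Eu n) := Y ⁻¹' closedBall 0 1
  have hKc : Convex ℝ K := (convex_closedBall 0 1).linear_preimage (Y : Eu n →ₗ[ℝ] Eu n)
  have hball : closedBall 0 M⁻¹ ⊆ K := by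
    intro w hw
    rw [mem_closedBall_zero_iff] at hw
    rw [Set.mem_preimage, mem_closedBall_zero_iff]
    calc ‖Y w‖ ≤ M * ‖w‖ := hY w
      _ ≤ M * M⁻¹ := by gcongr
      _ = 1 := mul_inv_cancel₀ hM.ne'
  have hvol : volume K = ofReal |Y.det⁻¹| * volume (closedBall (0 : Eu n) 1) :=
    Measure.addHaar_preimage_continuousLinearMap _ hdet _
  have hfin : volume K ≠ ⊤ := by
    rw [hvol]; exact mul_ne_top ENNReal.ofReal_ne_top measure_closedBall_lt_top.ne
  have hreal : volume.real K = |Y.det|⁻¹ * ballVol n := by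
    rw [measureReal_def, hvol, toReal_mul, toReal_ofReal (abs_nonneg _), abs_inv,
      ← measureReal_def, volume_closedBall 0 zero_le_one, one_pow, one_mul]
  have h := volume_ge_of_ball_of_mem hKc (inv_pos.2 hM) hball (a := a) (by simpa [K] using ha) hfin
  rw [hreal] at h
  have hd : 0 < |Y.det| := abs_pos.2 hdet
  rw [le_div_iff₀ hd]
  have e : M ^ n = M * M ^ (n - 1) := by rw [← pow_succ', Nat.sub_add_cancel hn]
  have h2 := mul_le_mul_of_nonneg_left h (by positivity : 0 ≤ M ^ n * |Y.det| / ballVol n)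
  calc ‖a‖ * |Y.det| = M ^ n * |Y.det| / ballVol n * (‖a‖ * M⁻¹ ^ n * ballVol n) := by
        rw [inv_pow]; field_simp
    _ ≤ _ := h2
    _ = 4 * 2 ^ n * M ^ (n - 1) := by rw [e]; field_simp

namespace Geom


theorem symm_le_of_le (G : Geom u) {h H : ℝ} (hh : 0 < h) (hH : h ≤ H) (z : Eu n) :
    ‖(G.B 0 H).symm z‖ ≤ G.R / G.r * ‖(G.B 0 h).symm z‖ := by
  have hr := G.r_pos
  rcases eq_or_ne z 0 with rfl | hz
  · simp
  have hN : 0 < ‖(G.B 0 h).symm z‖ := by rw [norm_pos_iff]; simpa using hz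
  set c := G.r / ‖(G.B 0 h).symm z‖
  have hc : 0 < c := by positivity
  have h1 : c • z ∈ sec u 0 h := by
    refine G.inner_mem hh ?_
    rw [sub_zero, map_smul, norm_smul, norm_of_nonneg hc.le, div_mul_cancel₀ _ hN.ne']
  have h2 := G.outer_le (hh.trans_le hH) (sec_mono u 0 hH h1)
  rw [sub_zero, map_smul, norm_smul, norm_of_nonneg hc.le] at h2
  have h3 : ‖(G.B 0 H).symm z‖ ≤ G.R / c := by rw [le_div_iff₀ hc]; linarith
  refine h3.trans_eq ?_
  simp only [c]; field_simp

/-- Comparison of normalizations can be reversed, since both have comparable determinants. -/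
theorem symm_reverse (G : Geom u) (hn : 0 < n) {h H M : ℝ} (hh : 0 < h) (hH : 0 < H) (hM : 0 < M)
    (hle : ∀ z, √h * ‖(G.B 0 h).symm z‖ ≤ M * (√H * ‖(G.B 0 H).symm z‖))
    (z : Eu n) : √H * ‖(G.B 0 H).symm z‖
      ≤ 4 * 2 ^ n * M ^ (n - 1) * (G.Cd / G.cd) * (√h * ‖(G.B 0 h).symm z‖) := by
  have hsh := sqrt_pos.2 hh
  have hsH := sqrt_pos.2 hH
  have hcd := G.cd_pos
  have hCd := G.Cd_pos
  rcases eq_or_ne z 0 with rfl | hz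
  · simp
  set c : ℝ := √h / √H
  have hc : 0 < c := by positivity
  set Y : Eu n →L[ℝ] Eu n := c • ((G.B 0 h).symm : Eu n →L[ℝ] Eu n) ∘L (G.B 0 H : Eu n →L[ℝ] Eu n)
  have hYa : ∀ w, Y w = c • (G.B 0 h).symm (G.B 0 H w) := fun w => rfl
  have hYM : ∀ w, ‖Y w‖ ≤ M * ‖w‖ := by
    intro w
    have := hle (G.B 0 H w)
    rw [ContinuousLinearEquiv.symm_apply_apply] at this
    rw [hYa, norm_smul, norm_of_nonneg hc.le, div_mul_eq_mul_div, div_le_iff₀ hsH]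
    linarith
  have hdh := G.det_le 0 hh
  have hdH := G.le_det 0 hH
  set dh := (G.B 0 h : Eu n →L[ℝ] Eu n).det
  set dH := (G.B 0 H : Eu n →L[ℝ] Eu n).det
  have hdhp : 0 < |dh| := lt_of_lt_of_le (by positivity) (G.le_det 0 hh)
  have hinv : ((G.B 0 h).symm : Eu n →L[ℝ] Eu n).det * dh = 1 := by
    have h1 : ((G.B 0 h).symm : Eu n →L[ℝ] Eu n) ∘L (G.B 0 h : Eu n →L[ℝ] Eu n)
        = ContinuousLinearMap.id ℝ (Eu n) := by ext1 w; simp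
    have h2 := congrArg ContinuousLinearMap.det h1
    rw [ContinuousLinearMap.det, ContinuousLinearMap.toLinearMap_comp, LinearMap.det_comp] at h2
    rw [show (ContinuousLinearMap.id ℝ (Eu n)).det = 1 from LinearMap.det_id] at h2
    exact h2
  have hYd : Y.det = c ^ n * (((G.B 0 h).symm : Eu n →L[ℝ] Eu n).det * dH) := by
    simp only [Y]
    rw [ContinuousLinearMap.det, ContinuousLinearMap.toLinearMap_smul, LinearMap.det_smul,
      ContinuousLinearMap.toLinearMap_comp, LinearMap.det_comp, finrank_euclideanSpace_fin]
  have hYlow : G.cd / G.Cd ≤ |Y.det| := by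
    have hsi : ((G.B 0 h).symm : Eu n →L[ℝ] Eu n).det = dh⁻¹ := eq_inv_of_mul_eq_one_left hinv
    rw [hYd, hsi, abs_mul, abs_mul, abs_inv, abs_of_pos (by positivity)]
    simp only [c, div_pow]
    have e : √h ^ n / √H ^ n * (|dh|⁻¹ * |dH|) = (|dH| / √H ^ n) * (√h ^ n / |dh|) := by field_simp
    rw [e]
    have e1 : G.cd ≤ |dH| / √H ^ n := by rwa [le_div_iff₀ (by positivity)]
    have e2 : 1 / G.Cd ≤ √h ^ n / |dh| := by rw [div_le_div_iff₀ hCd hdhp]; linarith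
    calc G.cd / G.Cd = G.cd * (1 / G.Cd) := by ring
      _ ≤ _ := by gcongr
  have hYne : Y.det ≠ 0 := abs_pos.1 (lt_of_lt_of_le (by positivity) hYlow)
  have hN : 0 < ‖(G.B 0 h).symm z‖ := by rw [norm_pos_iff]; simpa using hz
  set t : ℝ := (c * ‖(G.B 0 h).symm z‖)⁻¹
  have ht : 0 < t := by positivity
  have h1 := norm_le_of_norm_map_le hM hYne hYM (a := t • (G.B 0 H).symm z) (by
    rw [map_smul, hYa, ContinuousLinearEquiv.apply_symm_apply, norm_smul, norm_smul,
      norm_of_nonneg ht.le, norm_of_nonneg hc.le, inv_mul_cancel₀ (by positivity)]) hn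
  rw [norm_smul, norm_of_nonneg ht.le] at h1
  have h2 : t * ‖(G.B 0 H).symm z‖ ≤ 4 * 2 ^ n * M ^ (n - 1) * (G.Cd / G.cd) := by
    refine h1.trans ?_
    rw [div_eq_mul_inv]
    gcongr
    calc |Y.det|⁻¹ ≤ (G.cd / G.Cd)⁻¹ := by gcongr
      _ = G.Cd / G.cd := inv_div _ _
  rw [inv_mul_le_iff₀ (by positivity)] at h2
  calc √H * ‖(G.B 0 H).symm z‖
      ≤ √H * (c * ‖(G.B 0 h).symm z‖ * (4 * 2 ^ n * M ^ (n - 1) * (G.Cd / G.cd))) := by gcongr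
    _ = _ := by simp only [c]; field_simp

theorem exists_symm_le_of_ratio (G : Geom u) (hn : 0 < n) {lm : ℝ} (hlm : 1 ≤ lm) :
    ∃ C > 0, ∀ h H : ℝ, 0 < h → h ≤ H → H ≤ lm * h → ∀ z,
      ‖(G.B 0 h).symm z‖ ≤ C * ‖(G.B 0 H).symm z‖ := by
  have hr := G.r_pos
  have hR := G.R_pos
  have hcd := G.cd_pos
  have hCd := G.Cd_pos
  have hsl : 0 < √lm := sqrt_pos.2 (by linarith)
  set M : ℝ := √lm * (G.R / G.r)
  have hM : 0 < M := by positivity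
  refine ⟨4 * 2 ^ n * M ^ (n - 1) * (G.Cd / G.cd) * √lm, by positivity, ?_⟩
  intro h H hh hhH hHl z
  have hH : 0 < H := hh.trans_le hhH
  have hsh := sqrt_pos.2 hh
  have hsHl : √H ≤ √lm * √h := by rw [← Real.sqrt_mul (by linarith)]; exact Real.sqrt_le_sqrt hHl
  have h1 := G.symm_reverse hn hH hh hM (fun z => by
    calc √H * ‖(G.B 0 H).symm z‖
        ≤ (√lm * √h) * (G.R / G.r * ‖(G.B 0 h).symm z‖) := by gcongr; exact G.symm_le_of_le hh hhH z
      _ = _ := by simp only [M]; ring) z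
  refine le_of_mul_le_mul_left ?_ hsh
  calc √h * ‖(G.B 0 h).symm z‖ ≤ _ := h1
    _ ≤ 4 * 2 ^ n * M ^ (n - 1) * (G.Cd / G.cd) * ((√lm * √h) * ‖(G.B 0 H).symm z‖) := by gcongr
    _ = _ := by ring

end Geom

/-- Downward propagation of bounds through a sequence of levels. -/
theorem le_add_sum_of_levels {α : Type*} {u v : α → ℝ} {H E : ℕ → ℝ} (hE : ∀ i, 0 ≤ E i)
    (hH : Monotone H) {T : ℝ} (hT : 0 ≤ T) {K : ℕ}
    (step : ∀ i ≤ K, ∀ m, 0 ≤ m → (∀ x, u x = H (i + 1) → v x ≤ m) →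
      ∀ x, u x ≤ H i → (i = 0 ∨ H (i - 1) ≤ u x) → v x ≤ m + E i)
    (top : ∀ x, H K ≤ u x → u x ≤ H (K + 1) → v x ≤ T) :
    ∀ x, u x ≤ H (K + 1) → v x ≤ T + ∑ i ∈ range (K + 1), E i := by
  have key : ∀ j k, k + j = K → ∀ x, H k ≤ u x → u x ≤ H (K + 1) →
      v x ≤ T + ∑ i ∈ Finset.Ico (k + 1) (K + 1), E i := by
    intro j
    induction j with
    | zero =>
      intro k hk x h1 h2
      obtain rfl : k = K := by omega
      simpa using top x h1 h2
    | succ j ih =>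
      intro k hk x h1 h2
      have hk' : k + 1 + j = K := by omega
      have e : ∑ i ∈ Finset.Ico (k + 1) (K + 1), E i
          = E (k + 1) + ∑ i ∈ Finset.Ico (k + 1 + 1) (K + 1), E i :=
        Finset.sum_eq_sum_Ico_succ_bot (by omega) E
      rcases le_total (H (k + 1)) (u x) with h3 | h3
      · have := ih (k + 1) hk' x h3 h2
        have := hE (k + 1)
        linarith
      · have hm : 0 ≤ T + ∑ i ∈ Finset.Ico (k + 1 + 1) (K + 1), E i :=
          add_nonneg hT (sum_nonneg fun i _ => hE i)
        have := step (k + 1) (by omega) _ hm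
          (fun y hy => ih (k + 1) hk' y (by rw [hy]; exact hH (by omega))
            (by rw [hy]; exact hH (by omega))) x h3 (Or.inr (by simpa using h1))
        linarith
  intro x hx
  have hm : 0 ≤ T + ∑ i ∈ Finset.Ico (0 + 1) (K + 1), E i :=
    add_nonneg hT (sum_nonneg fun i _ => hE i)
  have e : ∑ i ∈ range (K + 1), E i = E 0 + ∑ i ∈ Finset.Ico (0 + 1) (K + 1), E i := by
    rw [Finset.range_eq_Ico]; exact Finset.sum_eq_sum_Ico_succ_bot (by omega) E
  rcases le_total (H 0) (u x) with h0 | h0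
  · have := key K 0 (by omega) x h0 hx
    have := hE 0
    linarith
  · have := step 0 (by omega) _ hm (fun y hy => key K 0 (by omega) y
      (by rw [hy]; exact hH (by omega)) (by rw [hy]; exact hH (by omega))) x h0 (Or.inl rfl)
    linarith

namespace Setting

theorem exists_near_source (hu : Setting u lam Lam β Γ) : ∃ C > 0, ∀ (e x : Eu n) (s : ℝ),
      (∫ z in sec u x s, src β e z ^ n) ^ ((1 : ℝ) / n) ≤ C := by
  obtain ⟨C, hC, h⟩ := exists_integral_src_pow_le (n := n) (β := β) hu.dim_pos
    (by linarith [hu.two_lt])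
  refine ⟨C ^ ((1 : ℝ) / n), by positivity, fun e x s => ?_⟩
  exact Real.rpow_le_rpow (integral_nonneg fun z => pow_nonneg (src_nonneg β e z) n)
    (h e _ (hu.isClosed_sec x s).measurableSet) (by positivity)

theorem lt_of_mem_sec_far (hu : Setting u lam Lam β Γ) (G : Geom u) {h : ℝ} (hh : 0 < h) {x z : Eu n}
    (hx : h / G.Θ ^ 2 ≤ u x) (hz : z ∈ sec u x (h / G.Θ ^ 5)) : h / G.Θ ^ 5 < u z := by
  have hΘ := G.Θ_pos
  have hΘ2 := G.two_le
  by_contra! hle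
  set s := h / G.Θ ^ 5
  have hs : 0 < s := by positivity
  have h1 : x ∈ sec u z (G.Θ * s) := G.engulf hs hz (self_mem_sec u x hs.le)
  have h2 : z ∈ sec u 0 (G.Θ * s) := hu.mem_sec_zero.2 (by nlinarith)
  have h3 := hu.mem_sec_zero.1 (G.engulf' (by positivity) h2 h1)
  have h4 : G.Θ * (G.Θ * s) = h / G.Θ ^ 2 / G.Θ := by simp only [s]; field_simp
  rw [h4] at h3
  have h5 : h / G.Θ ^ 2 / G.Θ < h / G.Θ ^ 2 := div_lt_self (by positivity) (by linarith)
  linarith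

/-- Away from the origin the source is small. -/
theorem exists_far_source (hu : Setting u lam Lam β Γ) (G : Geom u) :
    ∃ C > 0, ∀ (e x : Eu n) (h b : ℝ), 0 < h → 0 < b → h / G.Θ ^ 2 ≤ u x →
      (∀ z, ‖(G.B 0 (h / G.Θ ^ 5)).symm z‖ ≤ b * ‖z‖) →
      ‖(G.B 0 (h / G.Θ ^ 5)).symm e‖ ≤ G.r / 2 →
      √h * (∫ z in sec u x (h / G.Θ ^ 5), src β e z ^ n) ^ ((1 : ℝ) / n) ≤ C * (h * b ^ β) := by
  have hn' : (n : ℝ) ≠ 0 := by have := hu.dim_pos; positivity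
  have hω := ballVol_pos n
  have hR := G.R_pos
  have hr := G.r_pos
  have hCd := G.Cd_pos
  have hΘ := G.Θ_pos
  have hΘ1 : 1 ≤ G.Θ := by linarith [G.two_le]
  have hβ : 0 ≤ β := by linarith [hu.two_lt]
  set Cv := G.Cd * (G.R ^ n * ballVol n)
  have hCv : 0 < Cv := by positivity
  refine ⟨4 * (2 / G.r) ^ β * Cv ^ ((1 : ℝ) / n), by positivity, ?_⟩
  intro e x h b hh hb hx hB he
  set s := h / G.Θ ^ 5
  have hs : 0 < s := by positivity
  set ρ := G.r / (2 * b)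
  have hρ : 0 < ρ := by positivity
  have hρle : ∀ y : Eu n, G.r / 2 ≤ ‖(G.B 0 s).symm y‖ → ρ ≤ ‖y‖ := by
    intro y hy
    simp only [ρ]
    rw [div_le_iff₀ (by positivity)]
    have := hB y
    linarith
  have hsrc : ∀ z ∈ sec u x s, src β e z ≤ 4 * ρ ^ (-β) := by
    intro z hz
    have h1 := hu.lt_of_mem_sec_far G hh hx hz
    have h2 : G.r < ‖(G.B 0 s).symm z‖ := by
      by_contra! hle
      have := hu.mem_sec_zero.1 (G.inner_mem (x := 0) (z := z) hs (by rwa [sub_zero]))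
      linarith
    refine src_le_rpow hβ hρ (hρle z (by linarith)) (hρle _ ?_) (hρle _ ?_)
    · rw [map_add]
      have := norm_sub_le ((G.B 0 s).symm z + (G.B 0 s).symm e) ((G.B 0 s).symm e)
      rw [add_sub_cancel_right] at this
      linarith
    · rw [map_sub]
      have := norm_add_le ((G.B 0 s).symm z - (G.B 0 s).symm e) ((G.B 0 s).symm e)
      rw [sub_add_cancel] at this
      linarith
  have hSc := hu.isCompact_sec x s
  have h1 : ∫ z in sec u x s, src β e z ^ n ≤ (4 * ρ ^ (-β)) ^ n * (Cv * √s ^ n) := by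
    calc ∫ z in sec u x s, src β e z ^ n ≤ ∫ _z in sec u x s, (4 * ρ ^ (-β)) ^ n := by
          refine setIntegral_mono_on (((continuous_src β e).pow n).integrableOn_compact hSc)
            (integrableOn_const hSc.measure_lt_top.ne enorm_ne_top) hSc.measurableSet fun z hz => ?_
          exact pow_le_pow_left₀ (src_nonneg β e z) (hsrc z hz) n
      _ = (4 * ρ ^ (-β)) ^ n * volume.real (sec u x s) := by
          rw [setIntegral_const, smul_eq_mul, mul_comm]
      _ ≤ _ := by gcongr; exact G.volume_sec_le x hs
  have hroot : ∀ t : ℝ, 0 ≤ t → (t ^ n) ^ ((1 : ℝ) / n) = t := fun t ht => by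
    rw [← rpow_natCast, ← rpow_mul ht, mul_one_div_cancel hn', rpow_one]
  have h2 : (∫ z in sec u x s, src β e z ^ n) ^ ((1 : ℝ) / n)
      ≤ 4 * ρ ^ (-β) * (Cv ^ ((1 : ℝ) / n) * √s) := by
    refine (Real.rpow_le_rpow (integral_nonneg fun z => pow_nonneg (src_nonneg β e z) n) h1
      (by positivity)).trans_eq ?_
    rw [mul_rpow (by positivity) (by positivity), hroot _ (by positivity),
      mul_rpow hCv.le (by positivity), hroot _ (Real.sqrt_nonneg s)]
  have h3 : ρ ^ (-β) = (2 / G.r) ^ β * b ^ β := by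
    rw [rpow_neg hρ.le, ← Real.inv_rpow hρ.le, ← mul_rpow (by positivity) hb.le]
    simp only [ρ, inv_div]; congr 1; ring
  have h4 : √s ≤ √h := Real.sqrt_le_sqrt (div_le_self hh.le (one_le_pow₀ hΘ1))
  calc _ ≤ √h * (4 * ρ ^ (-β) * (Cv ^ ((1 : ℝ) / n) * √h)) := by
        gcongr
        exact h2.trans (by gcongr)
    _ = 4 * ((2 / G.r) ^ β * b ^ β) * Cv ^ ((1 : ℝ) / n) * (√h * √h) := by rw [h3]; ring
    _ = _ := by rw [mul_self_sqrt hh.le]; ring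

/-- Upper bound for second differences through the normalization of a section. -/
theorem exists_sd_le (hu : Setting u lam Lam β Γ) (G : Geom u) :
    ∃ C > 0, ∀ e ∈ Γ, ∀ (h : ℝ) (x : Eu n), 0 < h → u x ≤ h / G.Θ →
      ‖(G.B 0 (G.J * h)).symm e‖ ≤ G.r / 4 →
      sd u e x ≤ C * (h * ‖(G.B 0 (G.J * h)).symm e‖ ^ 2 + √h *
        (∫ z in sec u x (h / G.Θ ^ 5), src β e z ^ n) ^ ((1 : ℝ) / n)) := by
  obtain ⟨Cs, hCs, hsrc⟩ := hu.source
  obtain ⟨C₁, hC₁, hInt⟩ := hu.integral_sd_le G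
  obtain ⟨C₂, hC₂, hmax⟩ := hu.local_max G hu.dim_pos
  have hΘ := G.Θ_pos
  have hΘ1 : 1 ≤ G.Θ := by linarith [G.two_le]
  have hsΘ : 0 < √(G.Θ ^ 5) := sqrt_pos.2 (by positivity)
  set C := C₂ * (√(G.Θ ^ 5) ^ n * C₁ + Cs)
  have hn' : (n : ℝ) ≠ 0 := by have := hu.dim_pos; positivity
  refine ⟨C, by positivity, fun e he h x hh hx heB => ?_⟩
  set s := h / G.Θ ^ 5
  have hs : 0 < s := by positivity
  have hsub : sec u x s ⊆ sec u 0 h := by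
    have h1 := G.engulf' (x := 0) (y := x) (h := h / G.Θ) (by positivity) (hu.mem_sec_zero.2 hx)
    rw [mul_div_cancel₀ _ hΘ.ne'] at h1
    refine (sec_mono u x ?_).trans h1
    simp only [s]
    gcongr
    exact le_self_pow₀ hΘ1 (by norm_num)
  set v := sd u e
  have hv : ContDiff ℝ 2 v := contDiff_sd (m := 2) hu.smooth e
  set I := (∫ z in sec u x s, src β e z ^ n) ^ ((1 : ℝ) / n)
  have hI0 : 0 ≤ ∫ z in sec u x s, src β e z ^ n :=
    integral_nonneg fun z => pow_nonneg (src_nonneg β e z) n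
  have hI : 0 ≤ I := Real.rpow_nonneg hI0 _
  have hsh : 0 < √h := sqrt_pos.2 hh
  have h2 := hmax v (fun y => Cs * src β e y) x s hv (continuous_const.mul (continuous_src β e))
    (fun z => mul_nonneg hCs.le (src_nonneg β e z)) hs
    (fun z _ _ => hsrc e he z)
  have e1 : (∫ z in sec u x s, (Cs * src β e z) ^ n) ^ ((1 : ℝ) / n) = Cs * I := by
    simp only [mul_pow, integral_const_mul]
    rw [mul_rpow (by positivity) hI0, ← rpow_natCast, ← rpow_mul hCs.le,
      mul_one_div_cancel hn', rpow_one]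
  have hvm : ∀ z, max (v z) 0 = v z := fun z => max_eq_left (hu.sd_nonneg e z)
  simp only [hvm] at h2
  set N := h * ‖(G.B 0 (G.J * h)).symm e‖ ^ 2
  have hN : 0 ≤ N := by positivity
  have e2 : ∫ z in sec u x s, v z ≤ C₁ * √h ^ n * N := by
    refine (setIntegral_mono_set (hv.continuous.integrableOn_compact
      (hu.isCompact_sec 0 h)) (.of_forall fun z => hu.sd_nonneg e z)
      (LE.le.eventuallyLE hsub)).trans ((hInt h e hh heB).trans_eq ?_)
    simp only [N]; ring
  have e3 : (√s ^ n)⁻¹ = √(G.Θ ^ 5) ^ n / √h ^ n := by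
    simp only [s]; rw [Real.sqrt_div hh.le, div_pow, inv_div]
  have e4 : √s ≤ √h := Real.sqrt_le_sqrt (div_le_self hh.le (one_le_pow₀ hΘ1))
  rw [e1, e3] at h2
  calc v x ≤ _ := h2
    _ ≤ C₂ * (√(G.Θ ^ 5) ^ n / √h ^ n * (C₁ * √h ^ n * N) + √h * (Cs * I)) := by gcongr
    _ = C₂ * ((√(G.Θ ^ 5) ^ n * C₁) * N + Cs * (√h * I)) := by field_simp
    _ ≤ C₂ * ((√(G.Θ ^ 5) ^ n * C₁) * N + Cs * (√h * I)
          + ((√(G.Θ ^ 5) ^ n * C₁) * (√h * I) + Cs * N)) := by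
        refine mul_le_mul_of_nonneg_left ?_ hC₂.le
        have : 0 ≤ (√(G.Θ ^ 5) ^ n * C₁) * (√h * I) + Cs * N := by positivity
        linarith
    _ = C * (N + √h * I) := by simp only [C]; ring

/-- The normalizations of large sections are large. -/
theorem exists_symm_small (hu : Setting u lam Lam β Γ) (G : Geom u) {ε : ℝ} (hε : 0 < ε) :
    ∃ h₀ > 0, ∀ h, h₀ ≤ h → ∀ z, ‖(G.B 0 h).symm z‖ ≤ ε * ‖z‖ := by
  have hR := G.R_pos
  set ρ := G.R / ε
  have hρ : 0 < ρ := by positivity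
  obtain ⟨b, hb⟩ := (isCompact_closedBall (0 : Eu n) ρ).bddAbove_image hu.continuous.continuousOn
  refine ⟨max b 1, by positivity, fun h hh z => ?_⟩
  have hh0 : 0 < h := one_pos.trans_le ((le_max_right _ _).trans hh)
  rcases eq_or_ne z 0 with rfl | hz
  · simp
  have hN : 0 < ‖z‖ := norm_pos_iff.2 hz
  set c := ρ / ‖z‖
  have hc : 0 < c := by positivity
  have h1 : u (c • z) ≤ b := hb ⟨c • z, by
    rw [mem_closedBall_zero_iff, norm_smul, norm_of_nonneg hc.le, div_mul_cancel₀ _ hN.ne'], rfl⟩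
  have h2 := G.outer_le hh0 (hu.mem_sec_zero.2 (h1.trans ((le_max_left _ _).trans hh)))
  rw [sub_zero, map_smul, norm_smul, norm_of_nonneg hc.le] at h2
  have h3 : ‖(G.B 0 h).symm z‖ ≤ G.R / c := by rw [le_div_iff₀ hc]; linarith
  refine h3.trans_eq ?_
  simp only [c, ρ]; field_simp

end Setting

theorem sqrt_mul_pow {h t : ℝ} (hh : 0 ≤ h) (ht : 0 ≤ t) (i : ℕ) : √(h * t ^ i) = √h * √t ^ i := by
  rw [Real.sqrt_mul hh]
  congr 1
  rw [Real.sqrt_eq_iff_mul_self_eq (by positivity) (by positivity), ← mul_pow, mul_self_sqrt ht]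

theorem geom_sum_le {q : ℝ} (h0 : 0 ≤ q) (h1 : q < 1) (K : ℕ) :
    ∑ i ∈ range K, q ^ i ≤ (1 - q)⁻¹ := by
  rw [← tsum_geometric_of_lt_one h0 h1]
  exact (summable_geometric_of_lt_one h0 h1).sum_le_tsum _ fun i _ => by positivity

namespace Setting

/-- Geometric decay of the source contributions along the dyadic levels, under an a priori
comparison of the normalizations. -/
theorem exists_source_level (hu : Setting u lam Lam β Γ) (G : Geom u) :
    ∃ q : ℝ, 0 < q ∧ q < 1 ∧ ∀ Λ : ℝ, 1 ≤ Λ → ∃ C > 0, ∀ (h₀ b₀ : ℝ) (K : ℕ) (e : Eu n), 0 < h₀ →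
      0 < b₀ →
      (∀ k ≤ K, ∀ z, √(h₀ * G.Θ ^ k) * ‖(G.B 0 (h₀ * G.Θ ^ k)).symm z‖
        ≤ Λ * (√h₀ * ‖(G.B 0 h₀).symm z‖)) →
      (∀ z, ‖(G.B 0 h₀).symm z‖ ≤ b₀ * ‖z‖) → ‖(G.B 0 h₀).symm e‖ ≤ 3 * G.R →
      ∀ i ≤ K + 1, ∀ x, (i = 0 ∨ h₀ * G.Θ ^ (i - 1) ≤ u x) → √(h₀ * G.Θ ^ (i + 1)) *
          (∫ z in sec u x (h₀ * G.Θ ^ (i + 1) / G.Θ ^ 5), src β e z ^ n) ^ ((1 : ℝ) / n)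
          ≤ C * (√h₀ + h₀ * b₀ ^ β) * q ^ i := by
  have hΘ := G.Θ_pos
  have hΘ2 := G.two_le
  have hΘ1 : 1 < G.Θ := by linarith
  have hR := G.R_pos
  have hr := G.r_pos
  obtain ⟨Cn, hCn, hnear⟩ := hu.exists_near_source
  obtain ⟨Cf, hCf, hfar⟩ := hu.exists_far_source G
  obtain ⟨Cr, hCr, hratio⟩ := G.exists_symm_le_of_ratio hu.dim_pos (one_le_pow₀ hΘ1.le : 1 ≤ G.Θ ^ 3)
  have hsΘ : 1 < √G.Θ := by rw [Real.lt_sqrt zero_le_one]; simpa using hΘ1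
  have hsΘ0 : 0 < √G.Θ := one_pos.trans hsΘ
  set p := (√G.Θ)⁻¹
  have hp0 : 0 < p := by positivity
  have hp1 : p < 1 := inv_lt_one_of_one_lt₀ hsΘ
  have hp2 : G.Θ * p ^ 2 = 1 := by
    simp only [p]; rw [inv_pow, sq_sqrt hΘ.le, mul_inv_cancel₀ hΘ.ne']
  set q := G.Θ * p ^ β
  have hq0 : 0 < q := by positivity
  have hq1 : q < 1 := by
    rw [← hp2]
    simp only [q]
    gcongr
    rw [← rpow_natCast]
    exact Real.rpow_lt_rpow_of_exponent_gt hp0 hp1 (by exact_mod_cast hu.two_lt)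
  refine ⟨q, hq0, hq1, fun Λ hΛ => ?_⟩
  have hΛ0 : 0 < Λ := one_pos.trans_le hΛ
  obtain ⟨j, hj⟩ := exists_pow_lt_of_lt_one (show 0 < G.r / 2 / (Cr * Λ * (3 * G.R)) by positivity) hp1
  rw [lt_div_iff₀ (by positivity)] at hj
  set C₁ := Cn * √G.Θ ^ (j + 1) / q ^ j
  set C₂ := Cf * G.Θ ^ 2 * (Cr * Λ) ^ β / q
  have hC₁ : 0 < C₁ := by positivity
  have hC₂ : 0 < C₂ := by positivity
  refine ⟨C₁ + C₂, by positivity, fun h₀ b₀ K e hh₀ hb₀ hyp hb he i hi x hx => ?_⟩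
  have hsh : 0 < √h₀ := sqrt_pos.2 hh₀
  rcases le_or_gt i j with hij | hij
  · have h1 := hnear e x (h₀ * G.Θ ^ (i + 1) / G.Θ ^ 5)
    calc _ ≤ √h₀ * √G.Θ ^ (i + 1) * Cn := by
          rw [sqrt_mul_pow hh₀.le hΘ.le]; gcongr
      _ ≤ √h₀ * √G.Θ ^ (j + 1) * Cn := by
          gcongr
          exact hsΘ.le
      _ ≤ √h₀ * √G.Θ ^ (j + 1) * Cn * (q ^ i / q ^ j) := by
          refine le_mul_of_one_le_right (by positivity) ?_
          rw [one_le_div (by positivity)]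
          exact pow_le_pow_of_le_one hq0.le hq1.le hij
      _ = C₁ * √h₀ * q ^ i := by simp only [C₁]; ring
      _ ≤ _ := by
          gcongr
          · linarith
          · have : 0 ≤ h₀ * b₀ ^ β := by positivity
            linarith
  · obtain ⟨k, rfl⟩ : ∃ k, i = k + 1 := ⟨i - 1, by omega⟩
    have hx' : h₀ * G.Θ ^ k ≤ u x := by
      rcases hx with h | h
      · omega
      · simpa using h
    set h := h₀ * G.Θ ^ (k + 1 + 1)
    have hh : 0 < h := by positivity
    have e1 : h / G.Θ ^ 2 = h₀ * G.Θ ^ k := by simp only [h, pow_succ]; field_simp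
    have e2 : h₀ * G.Θ ^ k = G.Θ ^ 3 * (h / G.Θ ^ 5) := by simp only [h, pow_succ]; field_simp
    have hcmp : ∀ z, ‖(G.B 0 (h / G.Θ ^ 5)).symm z‖ ≤ Cr * Λ * p ^ k * ‖(G.B 0 h₀).symm z‖ := by
      intro z
      have h1 := hratio (h / G.Θ ^ 5) (h₀ * G.Θ ^ k) (by positivity)
        (by rw [e2]; exact le_mul_of_one_le_left (by positivity) (one_le_pow₀ hΘ1.le)) e2.le z
      have h2 := hyp k (by omega) z
      rw [sqrt_mul_pow hh₀.le hΘ.le] at h2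
      have h3 : ‖(G.B 0 (h₀ * G.Θ ^ k)).symm z‖ ≤ Λ * p ^ k * ‖(G.B 0 h₀).symm z‖ := by
        have : 0 < √h₀ * √G.Θ ^ k := by positivity
        refine le_of_mul_le_mul_left (h2.trans_eq ?_) this
        simp only [p, inv_pow]; field_simp
      calc _ ≤ _ := h1
        _ ≤ Cr * (Λ * p ^ k * ‖(G.B 0 h₀).symm z‖) := by gcongr
        _ = _ := by ring
    have h1 := hfar e x h (Cr * Λ * p ^ k * b₀) hh (by positivity) (by rw [e1]; exact hx')
      (fun z => (hcmp z).trans (by rw [mul_assoc (Cr * Λ * p ^ k)]; gcongr; exact hb z))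
      ((hcmp e).trans (by
        have hpk : p ^ k ≤ p ^ j := pow_le_pow_of_le_one hp0.le hp1.le (by omega)
        calc Cr * Λ * p ^ k * ‖(G.B 0 h₀).symm e‖ ≤ Cr * Λ * p ^ j * (3 * G.R) := by gcongr
          _ = p ^ j * (Cr * Λ * (3 * G.R)) := by ring
          _ ≤ _ := hj.le))
    calc _ ≤ _ := h1
      _ = C₂ * (h₀ * b₀ ^ β) * q ^ (k + 1) := by
          rw [mul_rpow (by positivity) hb₀.le, mul_rpow (by positivity) (by positivity)]
          have e3 : (p ^ k) ^ β = (p ^ β) ^ k := by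
            rw [← rpow_natCast, ← rpow_natCast, ← rpow_mul hp0.le, ← rpow_mul hp0.le, mul_comm]
          rw [e3]
          have e4 : q ^ (k + 1) = q * (G.Θ ^ k * (p ^ β) ^ k) := by rw [pow_succ', ← mul_pow]
          rw [e4]
          simp only [C₂, h]
          field_simp
          ring
      _ ≤ _ := by
          gcongr
          · linarith
          · linarith

set_option maxHeartbeats 1000000 in
theorem exists_ellipticity_step (hu : Setting u lam Lam β Γ) (G : Geom u) :
    ∃ C > 0, ∀ Λ : ℝ, 1 ≤ Λ → ∃ hΛ > 0, ∀ h₀, hΛ ≤ h₀ → ∀ K : ℕ,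
      (∀ k ≤ K, ∀ z, √(h₀ * G.Θ ^ k) * ‖(G.B 0 (h₀ * G.Θ ^ k)).symm z‖
        ≤ Λ * (√h₀ * ‖(G.B 0 h₀).symm z‖)) →
      ∀ z, √h₀ * ‖(G.B 0 h₀).symm z‖ ≤ C * (√(h₀ * G.Θ ^ K) * ‖(G.B 0 (h₀ * G.Θ ^ K)).symm z‖) := by
  have hΘ := G.Θ_pos
  have hΘ2 := G.two_le
  have hΘ1 : 1 < G.Θ := by linarith
  have hR := G.R_pos
  have hr := G.r_pos
  have hJ := G.J_pos
  obtain ⟨Ca, hCa, hround⟩ := hu.cocompact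
  obtain ⟨q, hq0, hq1, hlevel⟩ := hu.exists_source_level G
  obtain ⟨σ, hσ, Ce, hCe, hes⟩ := hu.interior_le_boundary G
  obtain ⟨Cd, hCd, hsd⟩ := hu.exists_sd_le G
  set q₃ := G.Θ ^ (-(σ / 4))
  have hq₃0 : 0 < q₃ := by positivity
  have hq₃1 : q₃ < 1 := Real.rpow_lt_one_of_one_lt_of_neg hΘ1 (by linarith)
  set S₂ := (1 - q)⁻¹
  set S₃ := (1 - q₃)⁻¹
  have hS₂ : 0 < S₂ := inv_pos.2 (by linarith)
  have hS₃ : 0 < S₃ := inv_pos.2 (by linarith)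
  set c₁ := G.r ^ 2 / (4 * G.R)
  set c₂ := (√(2 * Cd) * (G.Θ * (G.R / G.r)))⁻¹
  have hc₁ : 0 < c₁ := by positivity
  have hc₂ : 0 < c₂ := by positivity
  set c := min c₁ c₂
  have hc : 0 < c := lt_min hc₁ hc₂
  refine ⟨4 * G.R / c, by positivity, fun Λ hΛ => ?_⟩
  have hΛ0 : 0 < Λ := one_pos.trans_le hΛ
  obtain ⟨CΛ, hCΛ, hlev⟩ := hlevel Λ hΛ
  set c' := (Ce * S₂ + Cd) * CΛ
  have hc' : 0 < c' := by positivity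
  set b₀ := min (min 1 (8 * c')⁻¹) (min (G.R / (2 * Ca)) (c / (2 * Λ * Ca)))
  have hb₀ : 0 < b₀ := by simp only [b₀]; positivity
  have hb1 : b₀ ≤ 1 := (min_le_left _ _).trans (min_le_left _ _)
  have hb2 : b₀ ≤ (8 * c')⁻¹ := (min_le_left _ _).trans (min_le_right _ _)
  have hb3 : b₀ ≤ G.R / (2 * Ca) := (min_le_right _ _).trans (min_le_left _ _)
  have hb4 : b₀ ≤ c / (2 * Λ * Ca) := (min_le_right _ _).trans (min_le_right _ _)
  obtain ⟨h₁, hh₁, hsmall⟩ := hu.exists_symm_small G hb₀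
  obtain ⟨h₂, hh₂⟩ : ∃ h₂ : ℝ, ∀ h, h₂ ≤ h → Ce * S₃ * h ^ (-(σ / 4)) ≤ 1 / 4 := by
    have ht : Tendsto (fun h : ℝ => Ce * S₃ * h ^ (-(σ / 4))) atTop (nhds (Ce * S₃ * 0)) :=
      (tendsto_rpow_neg_atTop (by linarith : 0 < σ / 4)).const_mul _
    rw [mul_zero] at ht
    exact eventually_atTop.1 (ht.eventually_le_const (by norm_num : (0 : ℝ) < 1 / 4))
  refine ⟨max (max h₁ h₂) (max 1 (64 * c' ^ 2)), by positivity, fun h₀ hh K hyp z => ?_⟩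
  have hh1 : h₁ ≤ h₀ := (le_max_left _ _).trans ((le_max_left _ _).trans hh)
  have hh2 : h₂ ≤ h₀ := (le_max_right _ _).trans ((le_max_left _ _).trans hh)
  have hh3 : 1 ≤ h₀ := (le_max_left _ _).trans ((le_max_right _ _).trans hh)
  have hh4 : 64 * c' ^ 2 ≤ h₀ := (le_max_right _ _).trans ((le_max_right _ _).trans hh)
  have hh0 : 0 < h₀ := by linarith
  have hsh : 0 < √h₀ := sqrt_pos.2 hh0
  have hbz := hsmall h₀ hh1
  have hes1 := hh₂ h₀ hh2
  set N₀ : Eu n → ℝ := fun z => √h₀ * ‖(G.B 0 h₀).symm z‖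
  set N : Eu n → ℝ := fun z => √(h₀ * G.Θ ^ K) * ‖(G.B 0 (h₀ * G.Θ ^ K)).symm z‖
  have hNK : 0 < h₀ * G.Θ ^ K := by positivity
  have hsrcsmall : c' * (√h₀ + h₀ * b₀ ^ β) ≤ h₀ / 4 := by
    have h1 : c' * √h₀ ≤ h₀ / 8 := by
      have : 8 * c' ≤ √h₀ := Real.le_sqrt_of_sq_le (by nlinarith)
      have h2 := mul_self_sqrt hh0.le
      nlinarith
    have h2 : b₀ ^ β ≤ (8 * c')⁻¹ := by
      refine le_trans ?_ hb2
      calc b₀ ^ β ≤ b₀ ^ (1 : ℝ) :=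
            Real.rpow_le_rpow_of_exponent_ge hb₀ hb1 (by linarith [hu.two_lt])
        _ = b₀ := rpow_one _
    have h3 : c' * (h₀ * b₀ ^ β) ≤ h₀ / 8 := by
      calc c' * (h₀ * b₀ ^ β) ≤ c' * (h₀ * (8 * c')⁻¹) := by gcongr
        _ = h₀ / 8 := by field_simp
    linarith
  -- the estimate for translations of definite normalized size
  have key : ∀ z, ‖(G.B 0 h₀).symm z‖ = 2 * G.R → c / 2 * √h₀ ≤ N z := by
    intro z hz
    obtain ⟨e, he, hze⟩ := hround z
    have hd : ‖(G.B 0 h₀).symm (z - e)‖ ≤ b₀ * Ca := (hbz _).trans (by gcongr)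
    have hdR : b₀ * Ca ≤ G.R / 2 := by rw [le_div_iff₀ (by positivity)] at hb3; linarith
    have hdc : Λ * (b₀ * Ca) ≤ c / 2 := by rw [le_div_iff₀ (by positivity)] at hb4; linarith
    rw [map_sub] at hd
    have he1 : G.R < ‖(G.B 0 h₀).symm e‖ := by
      have := norm_sub_norm_le ((G.B 0 h₀).symm z) ((G.B 0 h₀).symm e)
      rw [hz] at this; linarith
    have he2 : ‖(G.B 0 h₀).symm e‖ ≤ 3 * G.R := by
      have := norm_sub_norm_le ((G.B 0 h₀).symm e) ((G.B 0 h₀).symm z)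
      rw [norm_sub_rev] at this
      rw [hz] at this; linarith
    have hue : h₀ < u e := by
      by_contra! hle
      have := G.outer_le hh0 (hu.mem_sec_zero.2 hle)
      rw [sub_zero] at this; linarith
    set v := sd u e
    have hv : ContDiff ℝ 2 v := contDiff_sd (m := 2) hu.smooth e
    have hv0 : h₀ ≤ v 0 := by
      simp only [v, sd, zero_add, zero_sub, hu.zero]
      have := hu.nonneg (-e)
      linarith
    have hNe : c * √h₀ ≤ N e := by
      set H : ℕ → ℝ := fun i => h₀ * G.Θ ^ i
      have hHp : ∀ i, 0 < H i := fun i => by simp only [H]; positivity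
      have hHm : Monotone H := fun i j hij => by simp only [H]; gcongr; exact hΘ1.le
      have hHs : ∀ i, H (i + 1) / G.Θ = H i := fun i => by simp only [H, pow_succ]; field_simp
      have hB2 := G.symm_le_of_le (h := H K) (H := G.J * H (K + 2)) (hHp K)
        ((hHm (by omega : K ≤ K + 2)).trans (le_mul_of_one_le_left (hHp _).le G.one_le_J)) e
      rcases le_or_gt ‖(G.B 0 (G.J * H (K + 2))).symm e‖ (G.r / 4) with hsm | hbig
      · obtain ⟨x₀, hx₀, hmax⟩ := (hu.isCompact_sec 0 (H (K + 1))).exists_isMaxOn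
          ⟨0, self_mem_sec u 0 (hHp _).le⟩ hv.continuous.continuousOn
        set V := v x₀
        have hVh : h₀ ≤ V := hv0.trans (hmax (self_mem_sec u 0 (hHp _).le))
        have hV1 : 1 ≤ V := hh3.trans hVh
        have hV0 : 0 < V := by linarith
        have hVb : ∀ x, u x ≤ H (K + 1) → v x ≤ V := fun x hx => hmax (hu.mem_sec_zero.2 hx)
        set X := H (K + 2) * ‖(G.B 0 (G.J * H (K + 2))).symm e‖ ^ 2
        have hX : 0 ≤ X := by have := hHp (K + 2); positivity
        set Q := CΛ * (√h₀ + h₀ * b₀ ^ β)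
        have hQ : 0 ≤ Q := by positivity
        set E : ℕ → ℝ := fun i => Ce * (V * H (i + 1) ^ (-(σ / 4)) + Q * q ^ i)
        have hE : ∀ i, 0 ≤ E i := fun i => by have := hHp (i + 1); positivity
        have hsrc := hlev h₀ b₀ K e hh0 hb₀ hyp hbz he2
        have hchain := le_add_sum_of_levels (u := u) (v := v) (H := H) (E := E) hE hHm
          (T := Cd * (X + Q)) (by positivity) (K := K)
          (fun i hi m hm hbd x hx hxi => by
            have h1 := hes e he (H (i + 1)) m V (V * H (i + 1) ^ (-(σ / 4))) (hHp _) hm hV0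
              (by have := hHp (i + 1); positivity) hbd
              (fun y hy => hVb y (hy.trans (hHm (by omega)))) (by
                have e1 : (V * H (i + 1) ^ (-(σ / 4))) ^ 4 = V ^ 4 * H (i + 1) ^ (-σ) := by
                  rw [mul_pow]
                  congr 1
                  rw [← rpow_natCast, ← rpow_mul (hHp _).le]
                  congr 1; push_cast; ring
                rw [e1]
                have : 0 < H (i + 1) ^ (-σ) := Real.rpow_pos_of_pos (hHp _) _
                exact mul_le_mul_of_nonneg_right (pow_le_pow_right₀ hV1 (by norm_num)) this.le) x (by rw [hHs]; exact hx)
            refine h1.trans ?_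
            exact add_le_add le_rfl (mul_le_mul_of_nonneg_left
              (add_le_add le_rfl (hsrc i (by omega) x hxi)) hCe.le))
          (fun x hx1 hx2 => by
            have h1 := hsd e he (H (K + 2)) x (hHp _) (by rw [hHs]; exact hx2) hsm
            refine h1.trans (mul_le_mul_of_nonneg_left (add_le_add le_rfl ?_) hCd.le)
            have h2 := hsrc (K + 1) le_rfl x (Or.inr (by simpa using hx1))
            refine h2.trans (mul_le_of_le_one_right hQ (pow_le_one₀ hq0.le hq1.le)))
        have hVfin := hchain x₀ (hu.mem_sec_zero.1 hx₀)
        have hsum : ∑ i ∈ range (K + 1), E i ≤ V / 4 + Ce * S₂ * Q := by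
          have e1 : ∀ i, E i ≤ Ce * V * h₀ ^ (-(σ / 4)) * q₃ ^ i + Ce * Q * q ^ i := by
            intro i
            have e2 : H (i + 1) ^ (-(σ / 4)) ≤ h₀ ^ (-(σ / 4)) * q₃ ^ i := by
              simp only [H]
              rw [mul_rpow hh0.le (by positivity)]
              gcongr
              have e3 : (G.Θ ^ (i + 1)) ^ (-(σ / 4)) = q₃ ^ (i + 1) := by
                simp only [q₃]
                rw [← rpow_natCast, ← rpow_natCast, ← rpow_mul hΘ.le, ← rpow_mul hΘ.le, mul_comm]
              rw [e3]
              exact pow_le_pow_of_le_one hq₃0.le hq₃1.le (by omega)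
            calc E i ≤ Ce * (V * (h₀ ^ (-(σ / 4)) * q₃ ^ i) + Q * q ^ i) := by
                  simp only [E]; gcongr
              _ = _ := by ring
          calc ∑ i ∈ range (K + 1), E i
              ≤ ∑ i ∈ range (K + 1), (Ce * V * h₀ ^ (-(σ / 4)) * q₃ ^ i + Ce * Q * q ^ i) :=
                sum_le_sum fun i _ => e1 i
            _ = Ce * V * h₀ ^ (-(σ / 4)) * ∑ i ∈ range (K + 1), q₃ ^ i
                + Ce * Q * ∑ i ∈ range (K + 1), q ^ i := by
                rw [sum_add_distrib, mul_sum, mul_sum]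
            _ ≤ Ce * V * h₀ ^ (-(σ / 4)) * S₃ + Ce * Q * S₂ := by
                gcongr
                · exact geom_sum_le hq₃0.le hq₃1 _
                · exact geom_sum_le hq0.le hq1 _
            _ = V * (Ce * S₃ * h₀ ^ (-(σ / 4))) + Ce * S₂ * Q := by ring
            _ ≤ V * (1 / 4) + Ce * S₂ * Q := by gcongr
            _ = _ := by ring
        have hQs : Ce * S₂ * Q + Cd * Q ≤ h₀ / 4 := by
          refine le_trans (le_of_eq ?_) hsrcsmall
          simp only [Q, c']; ring
        have hXlow : h₀ ≤ 2 * Cd * X := by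
          have : Cd * (X + Q) = Cd * X + Cd * Q := by ring
          linarith
        have hXup : X ≤ (G.Θ * (G.R / G.r) * N e) ^ 2 := by
          have e1 : H (K + 2) = G.Θ ^ 2 * (h₀ * G.Θ ^ K) := by simp only [H, pow_succ]; ring
          have e2 : (G.Θ * (G.R / G.r) * N e) ^ 2
              = H (K + 2) * (G.R / G.r * ‖(G.B 0 (h₀ * G.Θ ^ K)).symm e‖) ^ 2 := by
            simp only [N, mul_pow, sq_sqrt hNK.le, e1]; ring
          rw [e2]
          have := hHp (K + 2)
          simp only [X]
          gcongr
        have hNe0 : 0 ≤ N e := by positivity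
        have h5 : √h₀ ≤ √(2 * Cd) * (G.Θ * (G.R / G.r)) * N e := by
          refine Real.sqrt_le_iff.2 ⟨by positivity, hXlow.trans ?_⟩
          calc 2 * Cd * X ≤ 2 * Cd * (G.Θ * (G.R / G.r) * N e) ^ 2 := by gcongr
            _ = _ := by
              rw [mul_assoc (√(2 * Cd)), mul_pow (√(2 * Cd)), sq_sqrt (by positivity)]
        calc c * √h₀ ≤ c₂ * √h₀ := by gcongr; exact min_le_right _ _
          _ ≤ c₂ * (√(2 * Cd) * (G.Θ * (G.R / G.r)) * N e) := by gcongr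
          _ = N e := by
            simp only [c₂]
            rw [← mul_assoc, inv_mul_cancel₀ (by positivity), one_mul]
      · have h1 : G.r / 4 ≤ G.R / G.r * ‖(G.B 0 (H K)).symm e‖ := hbig.le.trans hB2
        have h2 : c₁ ≤ ‖(G.B 0 (H K)).symm e‖ := by
          simp only [c₁]
          rw [div_le_iff₀ (by positivity)]
          rw [div_mul_eq_mul_div, le_div_iff₀ hr] at h1
          linarith
        calc c * √h₀ ≤ c₁ * √h₀ := by gcongr; exact min_le_left _ _
          _ ≤ ‖(G.B 0 (H K)).symm e‖ * √(h₀ * G.Θ ^ K) := by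
              gcongr
              exact le_mul_of_one_le_right hh0.le (one_le_pow₀ hΘ1.le)
          _ = N e := mul_comm _ _
    have hNd : N (z - e) ≤ c / 2 * √h₀ := by
      have h1 := hyp K le_rfl (z - e)
      calc N (z - e) ≤ Λ * (√h₀ * ‖(G.B 0 h₀).symm (z - e)‖) := h1
        _ ≤ Λ * (√h₀ * (b₀ * Ca)) := by rw [map_sub]; gcongr
        _ = Λ * (b₀ * Ca) * √h₀ := by ring
        _ ≤ _ := by gcongr
    have hNtri : N e ≤ N z + N (z - e) := by
      simp only [N]
      rw [← mul_add]
      gcongr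
      have := norm_sub_le ((G.B 0 (h₀ * G.Θ ^ K)).symm z) ((G.B 0 (h₀ * G.Θ ^ K)).symm (z - e))
      rwa [← map_sub, sub_sub_cancel] at this
    linarith
  rcases eq_or_ne z 0 with rfl | hz
  · simp
  have hN0 : 0 < ‖(G.B 0 h₀).symm z‖ := by rw [norm_pos_iff]; simpa using hz
  set t := 2 * G.R / ‖(G.B 0 h₀).symm z‖
  have ht : 0 < t := by positivity
  have h1 := key (t • z) (by
    rw [map_smul, norm_smul, norm_of_nonneg ht.le, div_mul_cancel₀ _ hN0.ne'])
  have h2 : N (t • z) = t * N z := by simp only [N, map_smul, norm_smul, norm_of_nonneg ht.le]; ring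
  rw [h2] at h1
  have h3 : c * √h₀ * ‖(G.B 0 h₀).symm z‖ ≤ 4 * G.R * N z := by
    have := mul_le_mul_of_nonneg_right h1 hN0.le
    have e1 : t * N z * ‖(G.B 0 h₀).symm z‖ = 2 * G.R * N z := by simp only [t]; field_simp
    rw [e1] at this
    linarith
  rw [div_mul_eq_mul_div, le_div_iff₀ hc]
  linarith

/-- Uniform ellipticity: large sections are comparable to balls. -/
theorem exists_uniform_ellipticity (hu : Setting u lam Lam β Γ) (G : Geom u) :
    ∃ h₀ > 0, ∃ c > 0, ∃ C > 0, ∀ h, h₀ ≤ h → ∀ z : Eu n,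
      c * ‖z‖ ≤ √h * ‖(G.B 0 h).symm z‖ ∧ √h * ‖(G.B 0 h).symm z‖ ≤ C * ‖z‖ := by
  have hΘ := G.Θ_pos
  have hΘ2 := G.two_le
  have hΘ1 : 1 < G.Θ := by linarith
  have hR := G.R_pos
  have hr := G.r_pos
  have hcd := G.cd_pos
  have hCd := G.Cd_pos
  obtain ⟨C₁, hC₁, hstep⟩ := hu.exists_ellipticity_step G
  set A := 4 * 2 ^ n * C₁ ^ (n - 1) * (G.Cd / G.cd)
  have hA : 0 < A := by positivity
  set Q := √G.Θ * (G.R / G.r)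
  have hQ : 0 < Q := by have := sqrt_pos.2 hΘ; positivity
  have hone : ∀ h H : ℝ, 0 < h → h ≤ H → H ≤ G.Θ * h → ∀ z,
      √H * ‖(G.B 0 H).symm z‖ ≤ Q * (√h * ‖(G.B 0 h).symm z‖) := by
    intro h H hh hhH hH z
    have h1 := G.symm_le_of_le hh hhH z
    have h2 : √H ≤ √G.Θ * √h := by rw [← Real.sqrt_mul hΘ.le]; exact Real.sqrt_le_sqrt hH
    calc _ ≤ (√G.Θ * √h) * (G.R / G.r * ‖(G.B 0 h).symm z‖) := by gcongr
      _ = _ := by simp only [Q]; ring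
  set Λ := max 1 (Q * A)
  obtain ⟨h₀, hh₀, hmain⟩ := hstep Λ (le_max_left _ _)
  have hh := hmain h₀ le_rfl
  have hyp : ∀ K : ℕ, ∀ k ≤ K, ∀ z, √(h₀ * G.Θ ^ k) * ‖(G.B 0 (h₀ * G.Θ ^ k)).symm z‖
      ≤ Λ * (√h₀ * ‖(G.B 0 h₀).symm z‖) := by
    intro K
    induction K with
    | zero =>
      intro k hk z
      obtain rfl : k = 0 := by omega
      simp only [pow_zero, mul_one]
      exact le_mul_of_one_le_left (by positivity) (le_max_left _ _)
    | succ K ih =>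
      intro k hk z
      rcases Nat.lt_or_ge k (K + 1) with hlt | hge
      · exact ih k (by omega) z
      obtain rfl : k = K + 1 := by omega
      have h1 := G.symm_reverse hu.dim_pos hh₀ (by positivity) hC₁ (hh K ih) z
      have h2 := hone (h₀ * G.Θ ^ K) (h₀ * G.Θ ^ (K + 1)) (by positivity)
        (by gcongr; exacts [hΘ1.le, by omega]) (by rw [pow_succ]; linarith) z
      calc _ ≤ _ := h2
        _ ≤ Q * (A * (√h₀ * ‖(G.B 0 h₀).symm z‖)) := by gcongr
        _ = Q * A * (√h₀ * ‖(G.B 0 h₀).symm z‖) := by ring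
        _ ≤ _ := by gcongr; exact le_max_right _ _
  have hΛ0 : 0 < Λ := one_pos.trans_le (le_max_left _ _)
  have hsh : 0 < √h₀ := sqrt_pos.2 hh₀
  set b := ‖((G.B 0 h₀).symm : Eu n →L[ℝ] Eu n)‖
  set d := ‖(G.B 0 h₀ : Eu n →L[ℝ] Eu n)‖
  have hb : ∀ z, ‖(G.B 0 h₀).symm z‖ ≤ b * ‖z‖ :=
    fun z => ((G.B 0 h₀).symm : Eu n →L[ℝ] Eu n).le_opNorm z
  have hd : ∀ z, ‖z‖ ≤ (d + 1) * ‖(G.B 0 h₀).symm z‖ := by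
    intro z
    have h1 := (G.B 0 h₀ : Eu n →L[ℝ] Eu n).le_opNorm ((G.B 0 h₀).symm z)
    simp only [ContinuousLinearEquiv.coe_coe, ContinuousLinearEquiv.apply_symm_apply] at h1
    nlinarith [norm_nonneg ((G.B 0 h₀).symm z)]
  have hb0 : 0 ≤ b := norm_nonneg _
  have hd0 : 0 ≤ d := norm_nonneg _
  refine ⟨h₀, hh₀, √h₀ / (Q * C₁ * (d + 1)), by positivity, Q * Λ * √h₀ * b + 1,
    by positivity, fun h hh0h z => ?_⟩
  obtain ⟨k, hk1, hk2⟩ : ∃ k : ℕ, h₀ * G.Θ ^ k ≤ h ∧ h < h₀ * G.Θ ^ (k + 1) := by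
    obtain ⟨k, hk1, hk2⟩ := exists_nat_pow_near (x := h / h₀) (y := G.Θ)
      (by rwa [one_le_div hh₀]) hΘ1
    rw [le_div_iff₀ hh₀] at hk1
    rw [div_lt_iff₀ hh₀] at hk2
    exact ⟨k, by linarith, by linarith⟩
  have hkp : 0 < h₀ * G.Θ ^ k := by positivity
  have hhp : 0 < h := hkp.trans_le hk1
  constructor
  · have h1 := hh (k + 1) (hyp (k + 1)) z
    have h2 := hone h (h₀ * G.Θ ^ (k + 1)) hhp hk2.le (by rw [pow_succ]; nlinarith) z
    rw [div_mul_eq_mul_div, div_le_iff₀ (by positivity)]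
    calc √h₀ * ‖z‖ ≤ √h₀ * ((d + 1) * ‖(G.B 0 h₀).symm z‖) := by
          gcongr; exact hd z
      _ = (d + 1) * (√h₀ * ‖(G.B 0 h₀).symm z‖) := by ring
      _ ≤ (d + 1) * (C₁ * (Q * (√h * ‖(G.B 0 h).symm z‖))) := by
          refine mul_le_mul_of_nonneg_left (h1.trans ?_) (by positivity)
          exact mul_le_mul_of_nonneg_left h2 hC₁.le
      _ = _ := by ring
  · have h1 := hyp k k le_rfl z
    have h2 := hone (h₀ * G.Θ ^ k) h hkp hk1 (by rw [pow_succ] at hk2; linarith) z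
    calc _ ≤ _ := h2
      _ ≤ Q * (Λ * (√h₀ * (b * ‖z‖))) := by
          refine mul_le_mul_of_nonneg_left (h1.trans ?_) hQ.le
          exact mul_le_mul_of_nonneg_left (mul_le_mul_of_nonneg_left (hb z) hsh.le) hΛ0.le
      _ = Q * Λ * √h₀ * b * ‖z‖ := by ring
      _ ≤ _ := by gcongr; linarith

theorem exists_quadratic_bounds (hu : Setting u lam Lam β Γ) (G : Geom u) :
    ∃ c > 0, ∃ C > 0, ∃ D > 0, ∀ z, c * ‖z‖ ^ 2 ≤ u z + D ∧ u z ≤ C * ‖z‖ ^ 2 + D := by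
  have hR := G.R_pos
  have hr := G.r_pos
  obtain ⟨h₀, hh₀, c, hc, C, hC, hell⟩ := hu.exists_uniform_ellipticity G
  refine ⟨(c / G.R) ^ 2, by positivity, (C / G.r) ^ 2, by positivity, h₀, hh₀, fun z => ⟨?_, ?_⟩⟩
  · set h := u z + h₀
    have hh : h₀ ≤ h := by have := hu.nonneg z; simp only [h]; linarith
    have hh0 : 0 < h := hh₀.trans_le hh
    have h1 := G.outer_le hh0 (hu.mem_sec_zero.2 (by simp only [h]; linarith : u z ≤ h))
    rw [sub_zero] at h1
    have h2 := (hell h hh z).1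
    have h3 : c / G.R * ‖z‖ ≤ √h := by
      rw [div_mul_eq_mul_div, div_le_iff₀ hR]
      exact h2.trans (by gcongr)
    calc (c / G.R) ^ 2 * ‖z‖ ^ 2 = (c / G.R * ‖z‖) ^ 2 := by ring
      _ ≤ √h ^ 2 := by gcongr
      _ = h := sq_sqrt hh0.le
  · set h := (C / G.r) ^ 2 * ‖z‖ ^ 2 + h₀
    have hh : h₀ ≤ h := by simp only [h]; linarith [show 0 ≤ (C / G.r) ^ 2 * ‖z‖ ^ 2 by positivity]
    have hh0 : 0 < h := hh₀.trans_le hh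
    have hs : 0 < √h := sqrt_pos.2 hh0
    have h2 := (hell h hh z).2
    have h3 : C / G.r * ‖z‖ ≤ √h := by
      refine Real.le_sqrt_of_sq_le ?_
      rw [mul_pow]; simp only [h]; linarith
    rw [div_mul_eq_mul_div, div_le_iff₀ hr] at h3
    refine hu.mem_sec_zero.1 (G.inner_mem hh0 ?_)
    rw [sub_zero]
    exact le_of_mul_le_mul_left (h2.trans h3) hs

theorem exists_eq (hu : Setting u lam Lam β Γ) (G : Geom u) {h : ℝ} (hh : 0 ≤ h) :
    ∃ x, u x = h := by
  obtain ⟨c, hc, C, hC, D, hD, hq⟩ := hu.exists_quadratic_bounds G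
  have hn := hu.dim_pos
  set z : Eu n := single ⟨0, hn⟩ (√((h + D) / c))
  have hz : ‖z‖ ^ 2 = (h + D) / c := by
    simp only [z, PiLp.norm_single, norm_of_nonneg (Real.sqrt_nonneg _)]
    exact sq_sqrt (by positivity)
  have h1 := (hq z).1
  rw [hz, mul_div_cancel₀ _ hc.ne'] at h1
  exact mem_range_of_exists_le_of_exists_ge hu.continuous ⟨0, by rw [hu.zero]; exact hh⟩
    ⟨z, by linarith⟩

theorem exists_far_source_decay (hu : Setting u lam Lam β Γ) (G : Geom u) (e : Eu n) :
    ∃ h₁ > 0, ∃ C > 0, ∀ h, h₁ ≤ h → ∀ x, h / G.Θ ^ 2 ≤ u x →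
      √h * (∫ z in sec u x (h / G.Θ ^ 5), src β e z ^ n) ^ ((1 : ℝ) / n) ≤ C * h ^ (1 - β / 2) := by
  have hr := G.r_pos
  have hΘ := G.Θ_pos
  obtain ⟨h₀, hh₀, c, hc, C, hC, hell⟩ := hu.exists_uniform_ellipticity G
  obtain ⟨Cf, hCf, hfar⟩ := hu.exists_far_source G
  obtain ⟨h₂, hh₂, hsm⟩ := hu.exists_symm_small G (show 0 < G.r / 2 / (‖e‖ + 1) by positivity)
  refine ⟨G.Θ ^ 5 * max h₀ h₂, by positivity, Cf * (C * √(G.Θ ^ 5)) ^ β, by positivity,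
    fun h hh x hx => ?_⟩
  have hp : 0 < h := lt_of_lt_of_le (by positivity) hh
  have hs : max h₀ h₂ ≤ h / G.Θ ^ 5 := by rw [le_div_iff₀ (by positivity)]; linarith
  have hs0 : 0 < h / G.Θ ^ 5 := by positivity
  have hsq : 0 < √(h / G.Θ ^ 5) := sqrt_pos.2 hs0
  have h1 := hfar e x h (C / √(h / G.Θ ^ 5)) hp (by positivity) hx (fun z => by
    have := (hell _ ((le_max_left _ _).trans hs) z).2
    rw [div_mul_eq_mul_div, le_div_iff₀ hsq]; linarith) (by
    refine (hsm _ ((le_max_right _ _).trans hs) e).trans ?_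
    rw [div_mul_eq_mul_div, div_le_iff₀ (by positivity)]
    nlinarith [norm_nonneg e])
  refine h1.trans_eq ?_
  have e1 : C / √(h / G.Θ ^ 5) = C * √(G.Θ ^ 5) * h ^ (-(1 / 2) : ℝ) := by
    rw [Real.sqrt_div hp.le, rpow_neg hp.le, ← sqrt_eq_rpow]
    have := sqrt_pos.2 hp
    field_simp
  rw [e1, mul_rpow (by positivity) (by positivity), ← rpow_mul hp.le, mul_assoc,
    mul_left_comm h, ← Real.rpow_one_add' hp.le (by linarith [hu.two_lt])]
  ring_nf

theorem exists_sd_bound (hu : Setting u lam Lam β Γ) (G : Geom u) {e : Eu n} (he : e ∈ Γ) :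
    ∃ V > 0, ∀ x, sd u e x ≤ V := by
  have hr := G.r_pos
  have hΘ := G.Θ_pos
  have hJ := G.J_pos
  obtain ⟨h₀, hh₀, c, hc, C, hC, hell⟩ := hu.exists_uniform_ellipticity G
  obtain ⟨h₁, hh₁, Cf, hCf, hfar⟩ := hu.exists_far_source_decay G e
  obtain ⟨h₂, hh₂, hsm⟩ := hu.exists_symm_small G (show 0 < G.r / 4 / (‖e‖ + 1) by positivity)
  obtain ⟨Cd, hCd, hsd⟩ := hu.exists_sd_le G
  set H := max (max h₀ h₁) (max h₂ 1)
  have hH : 0 < H := by positivity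
  obtain ⟨b, hb⟩ := (hu.isCompact_sec 0 H).bddAbove_image
    (contDiff_sd (m := 2) hu.smooth e).continuous.continuousOn
  refine ⟨max b 0 + Cd * ((C * ‖e‖) ^ 2 + Cf), by positivity, fun x => ?_⟩
  have hb0 := le_max_left b 0
  have hb1 := le_max_right b 0
  rcases le_or_gt (u x) H with hx | hx
  · have := hb ⟨x, hu.mem_sec_zero.2 hx, rfl⟩
    have h2 : 0 ≤ Cd * ((C * ‖e‖) ^ 2 + Cf) := by positivity
    linarith
  · set h := G.Θ * u x
    have hux : 0 < u x := hH.trans hx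
    have hhH : H ≤ h := by
      have := G.two_le
      simp only [h]; nlinarith
    have hh0 : h₀ ≤ h := (le_max_left _ _).trans ((le_max_left _ _).trans hhH)
    have hh1 : h₁ ≤ h := (le_max_right _ _).trans ((le_max_left _ _).trans hhH)
    have hh2 : h₂ ≤ h := (le_max_left _ _).trans ((le_max_right _ _).trans hhH)
    have hh3 : 1 ≤ h := (le_max_right _ _).trans ((le_max_right _ _).trans hhH)
    have hhp : 0 < h := by linarith
    have hJh : h ≤ G.J * h := le_mul_of_one_le_left hhp.le G.one_le_J
    have h1 := hsd e he h x hhp (by simp only [h]; rw [mul_div_cancel_left₀ _ hΘ.ne']) (by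
      refine (hsm _ (hh2.trans hJh) e).trans ?_
      rw [div_mul_eq_mul_div, div_le_iff₀ (by positivity)]
      nlinarith [norm_nonneg e])
    have h2 := hfar h hh1 x (by
      simp only [h]; rw [div_le_iff₀ (by positivity)]
      have := G.two_le
      nlinarith [mul_pos hΘ hux])
    have h3 : h ^ (1 - β / 2) ≤ 1 := Real.rpow_le_one_of_one_le_of_nonpos hh3 (by linarith [hu.two_lt])
    have h4 : h * ‖(G.B 0 (G.J * h)).symm e‖ ^ 2 ≤ (C * ‖e‖) ^ 2 := by
      calc h * ‖(G.B 0 (G.J * h)).symm e‖ ^ 2 ≤ (G.J * h) * ‖(G.B 0 (G.J * h)).symm e‖ ^ 2 := by gcongr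
        _ = (√(G.J * h) * ‖(G.B 0 (G.J * h)).symm e‖) ^ 2 := by
            rw [mul_pow, sq_sqrt (by positivity)]
        _ ≤ _ := by exact pow_le_pow_left₀ (by positivity) (hell _ (hh0.trans hJh) e).2 2
    have h5 : Cf * h ^ (1 - β / 2) ≤ Cf := mul_le_of_le_one_right hCf.le h3
    have h6 := mul_le_mul_of_nonneg_left (add_le_add h4 (h2.trans h5)) hCd.le
    linarith

/-- Almost monotonicity of the level maxima of second differences. -/
theorem exists_level_step (hu : Setting u lam Lam β Γ) (G : Geom u) :
    ∃ τ : ℝ, 0 < τ ∧ τ ≤ 1 / 4 ∧ ∀ e ∈ Γ, ∃ h₁ > 0, ∃ C > 0, ∀ h, h₁ ≤ h → ∀ m, 0 ≤ m →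
      (∀ x, u x = h → sd u e x ≤ m) →
      ∀ x, h / G.Θ ^ 2 ≤ u x → u x ≤ h / G.Θ → sd u e x ≤ m + C * h ^ (-τ) := by
  obtain ⟨σ, hσ, Ce, hCe, hes⟩ := hu.interior_le_boundary G
  have hβ := hu.two_lt
  have hβ' := hu.le_five_half
  refine ⟨min (σ / 4) (β / 2 - 1), lt_min (by linarith) (by linarith),
    (min_le_right _ _).trans (by linarith), fun e he => ?_⟩
  set τ := min (σ / 4) (β / 2 - 1)
  obtain ⟨h₁, hh₁, Cf, hCf, hfar⟩ := hu.exists_far_source_decay G e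
  obtain ⟨V, hV, hVb⟩ := hu.exists_sd_bound G he
  refine ⟨max h₁ 1, by positivity, Ce * (max V 1 + Cf), by positivity, fun h hh m hm hbd x hx1 hx2 => ?_⟩
  have hh1 : h₁ ≤ h := (le_max_left _ _).trans hh
  have hh2 : 1 ≤ h := (le_max_right _ _).trans hh
  have hp : 0 < h := by linarith
  set W := max V 1
  have hW1 : 1 ≤ W := le_max_right _ _
  have hW : 0 < W := by linarith
  have h1 := hes e he h m W (W * h ^ (-(σ / 4))) hp hm hW (by positivity) hbd
    (fun y _ => (hVb y).trans (le_max_left _ _)) (by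
      have e1 : (W * h ^ (-(σ / 4))) ^ 4 = W ^ 4 * h ^ (-σ) := by
        rw [mul_pow]
        congr 1
        rw [← rpow_natCast, ← rpow_mul hp.le]
        congr 1; push_cast; ring
      rw [e1]
      exact mul_le_mul_of_nonneg_right (pow_le_pow_right₀ hW1 (by norm_num)) (by positivity)) x hx2
  have h2 := hfar h hh1 x hx1
  have h3 : h ^ (-(σ / 4)) ≤ h ^ (-τ) :=
    rpow_le_rpow_of_exponent_le hh2 (neg_le_neg (min_le_left _ _))
  have h4 : h ^ (1 - β / 2) ≤ h ^ (-τ) :=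
    rpow_le_rpow_of_exponent_le hh2 (by have := min_le_right (σ / 4) (β / 2 - 1); linarith)
  have h5 : W * h ^ (-(σ / 4)) + Cf * h ^ (1 - β / 2) ≤ (W + Cf) * h ^ (-τ) := by
    rw [add_mul]; gcongr
  have h6 := mul_le_mul_of_nonneg_left ((add_le_add le_rfl h2).trans h5) hCe.le
  calc _ ≤ _ := h1
    _ ≤ _ := by rw [mul_assoc]; linarith

/-- Each second difference along the lattice has an upper limit at infinity, which bounds it up to
a power rate and is attained asymptotically on every large level. -/
theorem exists_limit (hu : Setting u lam Lam β Γ) (G : Geom u) :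
    ∃ τ : ℝ, 0 < τ ∧ τ ≤ 1 / 4 ∧ ∀ e ∈ Γ, ∃ K C : ℝ, 0 < C ∧
      (∀ x, sd u e x ≤ K + C * (1 + ‖x‖) ^ (-τ)) ∧
      ∀ ε > 0, ∃ k₀ : ℕ, ∀ k, k₀ ≤ k → ∃ x, u x = G.Θ ^ k ∧ K - ε ≤ sd u e x := by
  have hΘ := G.Θ_pos
  have hΘ2 := G.two_le
  have hΘ1 : 1 < G.Θ := by linarith
  obtain ⟨τ, hτ, hτ1, hstep⟩ := hu.exists_level_step G
  refine ⟨τ, hτ, hτ1, fun e he => ?_⟩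
  obtain ⟨h₁, hh₁, C, hC, hst⟩ := hstep e he
  obtain ⟨V, hV, hVb⟩ := hu.exists_sd_bound G he
  have hvc : Continuous (sd u e) := (contDiff_sd (m := 2) hu.smooth e).continuous
  have hmax : ∀ k : ℕ, ∃ x, u x = G.Θ ^ k ∧ ∀ y, u y = G.Θ ^ k → sd u e y ≤ sd u e x := by
    intro k
    obtain ⟨x, hx, hm⟩ := ((hu.isCompact_sec 0 (G.Θ ^ k)).inter_right
      (isClosed_eq hu.continuous continuous_const : IsClosed {y | u y = G.Θ ^ k})).exists_isMaxOn
      (by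
        obtain ⟨y, hy⟩ := hu.exists_eq G (show 0 ≤ G.Θ ^ k by positivity)
        exact ⟨y, hu.mem_sec_zero.2 hy.le, hy⟩) hvc.continuousOn
    exact ⟨x, hx.2, fun y hy => hm ⟨hu.mem_sec_zero.2 (le_of_eq hy), hy⟩⟩
  choose X hX hXm using hmax
  set m : ℕ → ℝ := fun k => sd u e (X k)
  have hm0 : ∀ k, 0 ≤ m k := fun k => hu.toConvexC2.sd_nonneg e (X k)
  set q := G.Θ ^ (-τ)
  have hq0 : 0 < q := by positivity
  have hq1 : q < 1 := Real.rpow_lt_one_of_one_lt_of_neg hΘ1 (by linarith)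
  have hqk : ∀ k : ℕ, (G.Θ ^ k) ^ (-τ) = q ^ k := fun k => by
    simp only [q]
    rw [← rpow_natCast, ← rpow_natCast, ← rpow_mul hΘ.le, ← rpow_mul hΘ.le, mul_comm]
  obtain ⟨k₁, hk₁⟩ := pow_unbounded_of_one_lt h₁ hΘ1
  have hbig : ∀ k, k₁ ≤ k → h₁ ≤ G.Θ ^ k := fun k hk => hk₁.le.trans (pow_le_pow_right₀ hΘ1.le hk)
  have hshell : ∀ k, k₁ ≤ k → ∀ x, G.Θ ^ k ≤ u x → u x ≤ G.Θ ^ (k + 1) →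
      sd u e x ≤ m (k + 2) + C * q ^ k := by
    intro k hk x hx1 hx2
    have := hst (G.Θ ^ (k + 2)) (hbig _ (by omega)) (m (k + 2)) (hm0 _) (hXm (k + 2)) x
      (by rw [pow_add, mul_div_cancel_right₀ _ (by positivity)]; exact hx1)
      (by rw [show k + 2 = k + 1 + 1 by rfl, pow_succ, mul_div_cancel_right₀ _ hΘ.ne']; exact hx2)
    rw [hqk] at this
    exact this.trans (add_le_add le_rfl (mul_le_mul_of_nonneg_left
      (pow_le_pow_of_le_one hq0.le hq1.le (by omega)) hC.le))
  have hmono : ∀ k, k₁ ≤ k → m k ≤ m (k + 1) + C * q ^ k := by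
    intro k hk
    have := hst (G.Θ ^ (k + 1)) (hbig _ (by omega)) (m (k + 1)) (hm0 _) (hXm (k + 1)) (X k) (by
        rw [hX, pow_succ, div_le_iff₀ (by positivity)]
        have : 0 < G.Θ ^ k := by positivity
        nlinarith [mul_pos this hΘ])
      (by rw [hX, pow_succ, mul_div_cancel_right₀ _ hΘ.ne'])
    rw [hqk] at this
    exact this.trans (add_le_add le_rfl (mul_le_mul_of_nonneg_left
      (pow_le_pow_of_le_one hq0.le hq1.le (by omega)) hC.le))
  set D := C / (1 - q)
  have h1q : 0 < 1 - q := by linarith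
  have hD : 0 < D := by positivity
  have hDq : D * (1 - q) = C := div_mul_cancel₀ _ h1q.ne'
  set a : ℕ → ℝ := fun k => m (k + k₁) - D * q ^ (k + k₁)
  have ham : Monotone a := monotone_nat_of_le_succ fun k => by
    have h1 := hmono (k + k₁) (by omega)
    simp only [a]
    rw [show k + 1 + k₁ = k + k₁ + 1 by omega, pow_succ]
    have : D * q ^ (k + k₁) - D * (q ^ (k + k₁) * q) = C * q ^ (k + k₁) := by rw [← hDq]; ring
    linarith
  have hab : BddAbove (Set.range a) := ⟨V, by
    rintro _ ⟨k, rfl⟩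
    have h1 : m (k + k₁) ≤ V := hVb _
    have h2 : 0 ≤ D * q ^ (k + k₁) := by positivity
    simp only [a]; linarith⟩
  set K := ⨆ k, a k
  have hlim := tendsto_atTop_ciSup ham hab
  have hmK : ∀ k, k₁ ≤ k → m k ≤ K + D * q ^ k := by
    intro k hk
    have := le_ciSup hab (k - k₁)
    simp only [a, Nat.sub_add_cancel hk] at this
    linarith
  have hfar : ∀ x, G.Θ ^ k₁ ≤ u x → sd u e x ≤ K + (D + C) / q * (u x) ^ (-τ) := by
    intro x hx
    obtain ⟨k, hk1, hk2⟩ := exists_nat_pow_near (x := u x) (y := G.Θ)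
      ((one_le_pow₀ hΘ1.le).trans hx) hΘ1
    have hk : k₁ ≤ k := by
      by_contra! hlt
      have : G.Θ ^ (k + 1) ≤ G.Θ ^ k₁ := pow_le_pow_right₀ hΘ1.le (by omega)
      linarith
    have h1 := hshell k hk x hk1 hk2.le
    have h2 := hmK (k + 2) (by omega)
    have hux : 0 < u x := lt_of_lt_of_le (by positivity) hx
    have h3 : q ^ (k + 1) ≤ (u x) ^ (-τ) := by
      rw [← hqk]
      exact rpow_le_rpow_of_nonpos hux hk2.le (by linarith)
    have h4 : q ^ (k + 2) ≤ q ^ k := pow_le_pow_of_le_one hq0.le hq1.le (by omega)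
    have h5 : (D + C) * q ^ k ≤ (D + C) / q * (u x) ^ (-τ) := by
      calc (D + C) * q ^ k = (D + C) / q * q ^ (k + 1) := by rw [pow_succ]; field_simp
        _ ≤ _ := by gcongr
    have h6 : D * q ^ (k + 2) ≤ D * q ^ k := by gcongr
    linarith
  obtain ⟨c, hc, C', hC', D', hD', hq⟩ := hu.exists_quadratic_bounds G
  -- conversion to the Euclidean norm
  set ρ := max 1 (√(2 * (D' + G.Θ ^ k₁) / c))
  have hρ : 0 < ρ := by positivity
  set E := (D + C) / q * (c / 8) ^ (-τ) + (V + |K|) * (1 + ρ)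
  have hE : 0 < E := by positivity
  refine ⟨K, E, hE, fun x => ?_, fun ε hε => ?_⟩
  · have hx1 : 1 ≤ 1 + ‖x‖ := by linarith [norm_nonneg x]
    rcases le_or_gt ‖x‖ ρ with hx | hx
    · have h1 : 1 ≤ (1 + ρ) * (1 + ‖x‖) ^ (-τ) := by
        have h2 : (1 + ρ) ^ (-1 : ℝ) ≤ (1 + ‖x‖) ^ (-τ) :=
          calc (1 + ρ) ^ (-1 : ℝ) ≤ (1 + ‖x‖) ^ (-1 : ℝ) :=
                rpow_le_rpow_of_nonpos (by positivity) (by linarith) (by norm_num)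
            _ ≤ _ := rpow_le_rpow_of_exponent_le hx1 (by linarith)
        rw [Real.rpow_neg_one] at h2
        calc (1 : ℝ) = (1 + ρ) * (1 + ρ)⁻¹ := by rw [mul_inv_cancel₀ (by positivity)]
          _ ≤ _ := by gcongr
      have h3 : V + |K| ≤ (V + |K|) * ((1 + ρ) * (1 + ‖x‖) ^ (-τ)) :=
        le_mul_of_one_le_right (by positivity) h1
      have h4 : 0 ≤ (D + C) / q * (c / 8) ^ (-τ) * (1 + ‖x‖) ^ (-τ) := by positivity
      have h5 : E * (1 + ‖x‖) ^ (-τ) = (D + C) / q * (c / 8) ^ (-τ) * (1 + ‖x‖) ^ (-τ)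
        + (V + |K|) * ((1 + ρ) * (1 + ‖x‖) ^ (-τ)) := by simp only [E]; ring
      have := hVb x
      have := neg_abs_le K
      linarith
    · have hx2 : 1 < ‖x‖ := (le_max_left _ _).trans_lt hx
      have hx3 : 2 * (D' + G.Θ ^ k₁) / c < ‖x‖ ^ 2 := by
        have h1 : √(2 * (D' + G.Θ ^ k₁) / c) < ‖x‖ := (le_max_right _ _).trans_lt hx
        exact (Real.sqrt_lt' (by linarith)).1 h1
      rw [div_lt_iff₀ hc] at hx3
      have hux := (hq x).1
      have hΘk : 0 < G.Θ ^ k₁ := by positivity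
      have h0 : c / 8 * (1 + ‖x‖) ≤ u x := by
        have : c * (1 + ‖x‖) ≤ c * (4 * ‖x‖ ^ 2) := by gcongr; nlinarith
        linarith
      have h1 := hfar x (by nlinarith)
      have h2 : u x ^ (-τ) ≤ (c / 8) ^ (-τ) * (1 + ‖x‖) ^ (-τ) := by
        rw [← mul_rpow (by positivity) (by positivity)]
        exact rpow_le_rpow_of_nonpos (by positivity) h0 (by linarith)
      have h3 : E * (1 + ‖x‖) ^ (-τ) = (D + C) / q * ((c / 8) ^ (-τ) * (1 + ‖x‖) ^ (-τ))
        + (V + |K|) * (1 + ρ) * (1 + ‖x‖) ^ (-τ) := by simp only [E]; ring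
      have h4 : 0 ≤ (V + |K|) * (1 + ρ) * (1 + ‖x‖) ^ (-τ) := by positivity
      have h5 : (D + C) / q * u x ^ (-τ) ≤ (D + C) / q * ((c / 8) ^ (-τ) * (1 + ‖x‖) ^ (-τ)) := by
        gcongr
      linarith
  · obtain ⟨j, hj⟩ := (hlim.eventually_const_lt (show K - ε < K by linarith)).exists
    refine ⟨j + k₁, fun k hk => ⟨X k, hX k, ?_⟩⟩
    have h1 : a j ≤ a (k - k₁) := ham (by omega)
    simp only [a, Nat.sub_add_cancel (show k₁ ≤ k by omega)] at h1
    have h2 : 0 ≤ D * q ^ k := by positivity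
    have h3 : K - ε < m (j + k₁) - D * q ^ (j + k₁) := hj
    change K - ε ≤ m k
    linarith

end Setting

theorem lintegral_contraction_le {g : Eu n → ENNReal} (hg : Measurable g) {B : Set (Eu n)}
    (hB : Convex ℝ B) (hBm : MeasurableSet B) {t : ℝ} (ht : 1 / 2 ≤ t) (ht1 : t ≤ 1) {x : Eu n}
    (hx : x ∈ B) : ∫⁻ y in B, g (x + t • (y - x)) ≤ 2 ^ n * ∫⁻ z in B, g z := by
  have ht0 : 0 < t := by linarith
  have hind : Measurable (B.indicator g) := hg.indicator hBm
  have e1 : ∀ y ∈ B, g (x + t • (y - x)) = B.indicator g ((x - t • x) + t • y) := by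
    intro y hy
    have e : x + t • (y - x) = (x - t • x) + t • y := by rw [smul_sub]; abel
    rw [← e, indicator_of_mem]
    exact hB.add_smul_sub_mem hx hy ⟨ht0.le, ht1⟩
  calc ∫⁻ y in B, g (x + t • (y - x)) = ∫⁻ y in B, B.indicator g ((x - t • x) + t • y) :=
        setLIntegral_congr_fun hBm e1
    _ ≤ ∫⁻ y, B.indicator g ((x - t • x) + t • y) := setLIntegral_le_lintegral _ _
    _ = ∫⁻ z, B.indicator g ((x - t • x) + z) ∂(Measure.map (fun y : Eu n => t • y) volume) := by
        rw [lintegral_map (by fun_prop) (by fun_prop)]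
    _ = ofReal |(t ^ n)⁻¹| * ∫⁻ z, B.indicator g ((x - t • x) + z) := by
        have := Measure.map_addHaar_smul (volume : Measure (Eu n)) ht0.ne'
        rw [show (fun y : Eu n => t • y) = (t • ·) from rfl, this, lintegral_smul_measure,
          finrank_euclideanSpace_fin, smul_eq_mul]
    _ = ofReal |(t ^ n)⁻¹| * ∫⁻ z in B, g z := by
        rw [lintegral_add_left_eq_self (fun z => B.indicator g z), lintegral_indicator hBm]
    _ ≤ 2 ^ n * ∫⁻ z in B, g z := by
        gcongr
        rw [abs_of_pos (by positivity), show (2 : ENNReal) ^ n = ofReal (2 ^ n) by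
          rw [ENNReal.ofReal_pow (by norm_num)]; norm_num]
        refine ofReal_le_ofReal ?_
        rw [← inv_pow]
        refine pow_le_pow_left₀ (by positivity) ?_ n
        rw [inv_le_comm₀ ht0 (by norm_num)]; linarith

theorem lintegral_segments_le {g : Eu n → ENNReal} (hg : Measurable g) {B : Set (Eu n)}
    (hB : Convex ℝ B) (hBm : MeasurableSet B) {t : ℝ} (ht0 : 0 ≤ t) (ht1 : t ≤ 1) :
    ∫⁻ x in B, ∫⁻ y in B, g (x + t • (y - x)) ≤ volume B * (2 ^ n * ∫⁻ z in B, g z) := by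
  have key : ∀ s : ℝ, 1 / 2 ≤ s → s ≤ 1 →
      ∫⁻ x in B, ∫⁻ y in B, g (x + s • (y - x)) ≤ volume B * (2 ^ n * ∫⁻ z in B, g z) := by
    intro s hs hs1
    calc _ ≤ ∫⁻ _ in B, (2 ^ n * ∫⁻ z in B, g z) :=
          setLIntegral_mono' hBm fun x hx => lintegral_contraction_le hg hB hBm hs hs1 hx
      _ = _ := by rw [setLIntegral_const, mul_comm]
  rcases le_total (1 / 2) t with h | h
  · exact key t h ht1
  · rw [lintegral_lintegral_swap (by fun_prop)]
    refine le_trans (le_of_eq ?_) (key (1 - t) (by linarith) (by linarith))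
    refine lintegral_congr fun y => lintegral_congr fun x => ?_
    congr 1
    rw [smul_sub, smul_sub, sub_smul, sub_smul, one_smul, one_smul]; abel

/-- A measure-theoretic Poincaré inequality: two sets on which a function takes separated values
cannot both be large if the gradient is controlled in the mean. -/
theorem volume_mul_volume_le_of_gap {F G : Eu n → ℝ} (hF : ContDiff ℝ 1 F) (hG : Continuous G)
    {R L : ℝ} (hL : 0 ≤ L)
    (hDF : ∀ p, ∀ ξ : Eu n, ‖ξ‖ ≤ 2 * R → |fderiv ℝ F p ξ| ≤ G p) {A₁ A₂ : Set (Eu n)}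
    (h₁ : A₁ ⊆ closedBall 0 R) (h₂ : A₂ ⊆ closedBall 0 R)
    (hm₁ : MeasurableSet A₁) (hm₂ : MeasurableSet A₂)
    (gap : ∀ x ∈ A₁, ∀ y ∈ A₂, L ≤ |F y - F x|) :
    L * volume.real A₁ * volume.real A₂
      ≤ volume.real (closedBall (0 : Eu n) R) * (2 ^ n * ∫ z in closedBall 0 R, G z) := by
  set B : Set (Eu n) := closedBall 0 R
  have hBm : MeasurableSet B := measurableSet_closedBall
  have hBc : Convex ℝ B := convex_closedBall _ _
  have hBf : volume B ≠ ⊤ := measure_closedBall_lt_top.ne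
  rcases lt_or_ge R 0 with hR | hR
  · have hB0 : B = ∅ := Metric.closedBall_eq_empty.2 hR
    have : A₁ = ∅ := Set.subset_empty_iff.1 (hB0 ▸ h₁)
    simp [this, hB0]
  have hG0 : ∀ p, 0 ≤ G p := fun p => by
    have := hDF p 0 (by simpa using hR)
    simpa using this
  set g : Eu n → ENNReal := fun z => ofReal (G z)
  have hg : Measurable g := hG.measurable.ennreal_ofReal
  have hline : ∀ x ∈ B, ∀ y ∈ B,
      ofReal |F y - F x| ≤ ∫⁻ t in Set.Ioc (0 : ℝ) 1, g (x + t • (y - x)) := by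
    intro x hx y hy
    have hc : Continuous fun t : ℝ => G (x + t • (y - x)) := by fun_prop
    have hc' : Continuous fun t : ℝ => fderiv ℝ F (x + t • (y - x)) (y - x) :=
      ((hF.continuous_fderiv (by norm_num)).comp (by fun_prop)).clm_apply continuous_const
    have h1 : F y - F x = ∫ t in (0 : ℝ)..1, fderiv ℝ F (x + t • (y - x)) (y - x) := by
      rw [integral_eq_sub_of_hasDerivAt
        (fun t _ => hasDerivAt_line hF x (y - x) t) (hc'.intervalIntegrable _ _)]
      simp
    have hxy : ‖y - x‖ ≤ 2 * R := by
      have := norm_sub_le y x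
      have h3 := mem_closedBall_zero_iff.1 hx
      have h4 := mem_closedBall_zero_iff.1 hy
      linarith
    have h2 : |F y - F x| ≤ ∫ t in (0 : ℝ)..1, G (x + t • (y - x)) := by
      rw [h1]
      exact intervalIntegral.norm_integral_le_of_norm_le
        (f := fun t => fderiv ℝ F (x + t • (y - x)) (y - x)) zero_le_one
        (.of_forall fun t _ => hDF (x + t • (y - x)) _ hxy) (hc.intervalIntegrable _ _)
    rw [intervalIntegral.integral_of_le zero_le_one] at h2
    refine (ofReal_le_ofReal h2).trans (le_of_eq ?_)
    rw [ofReal_integral_eq_lintegral_ofReal]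
    · exact (hc.intervalIntegrable 0 1).1
    · exact Eventually.of_forall fun t => hG0 _
  have hmain : ofReal L * volume A₁ * volume A₂ ≤ volume B * (2 ^ n * ∫⁻ z in B, g z) := by
    calc ofReal L * volume A₁ * volume A₂
        = ∫⁻ _ in A₁, ∫⁻ _ in A₂, ofReal L := by simp only [setLIntegral_const]; ring
      _ ≤ ∫⁻ x in A₁, ∫⁻ y in A₂, ∫⁻ t in Set.Ioc (0 : ℝ) 1, g (x + t • (y - x)) := by
          refine setLIntegral_mono' hm₁ fun x hx => setLIntegral_mono' hm₂ fun y hy => ?_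
          exact (ofReal_le_ofReal (gap x hx y hy)).trans (hline x (h₁ hx) y (h₂ hy))
      _ ≤ ∫⁻ x in B, ∫⁻ y in B, ∫⁻ t in Set.Ioc (0 : ℝ) 1, g (x + t • (y - x)) :=
          (lintegral_mono fun x => lintegral_mono_set h₂).trans (lintegral_mono_set h₁)
      _ = ∫⁻ x in B, ∫⁻ t in Set.Ioc (0 : ℝ) 1, ∫⁻ y in B, g (x + t • (y - x)) := by
          refine lintegral_congr fun x => ?_
          exact lintegral_lintegral_swap (by fun_prop)
      _ = ∫⁻ t in Set.Ioc (0 : ℝ) 1, ∫⁻ x in B, ∫⁻ y in B, g (x + t • (y - x)) := by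
          refine lintegral_lintegral_swap (Measurable.aemeasurable ?_)
          have : Measurable fun p : (Eu n × ℝ) × Eu n => g (p.1.1 + p.1.2 • (p.2 - p.1.1)) :=
            hg.comp (by fun_prop)
          exact this.lintegral_prod_right'
      _ ≤ ∫⁻ _ in Set.Ioc (0 : ℝ) 1, volume B * (2 ^ n * ∫⁻ z in B, g z) :=
          setLIntegral_mono' measurableSet_Ioc fun t ht =>
            lintegral_segments_le hg hBc hBm ht.1.le ht.2
      _ = _ := by simp
  have hGi : IntegrableOn G B := hG.integrableOn_compact (isCompact_closedBall 0 R)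
  have hgi : ∫⁻ z in B, g z = ofReal (∫ z in B, G z) :=
    (ofReal_integral_eq_lintegral_ofReal hGi (.of_forall fun z => hG0 z)).symm
  have hfin : volume B * (2 ^ n * ∫⁻ z in B, g z) ≠ ⊤ := by
    rw [hgi]
    exact mul_ne_top hBf (mul_ne_top (by simp) ENNReal.ofReal_ne_top)
  have := ENNReal.toReal_mono hfin hmain
  rw [hgi] at this
  simpa [toReal_mul, measureReal_def, toReal_ofReal hL,
    toReal_ofReal (setIntegral_nonneg hBm fun z _ => hG0 z)] using this

theorem posSemidef_cof (hu : ConvexC2 u) (x : Eu n) : (cof u x).PosSemidef := by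
  have hd := (hu.pos x).det_pos
  have : cof u x = (hess u x).det • (hess u x)⁻¹ := by
    rw [cof, inv_def, Ring.inverse_eq_inv, smul_smul, mul_inv_cancel₀ hd.ne', one_smul]
  rw [this]
  exact (hu.pos x).inv.posSemidef.smul hd.le

theorem energy_quadratic_nonneg (hu : ConvexC2 u) (a b : Eu n → ℝ) (x : Eu n) (s : ℝ) :
    0 ≤ energy u a a x + 2 * s * energy u a b x + s ^ 2 * energy u b b x := by
  have hM := posSemidef_cof hu x
  have h := hM.dotProduct_mulVec_nonneg ((gradient a x).ofLp + s • (gradient b x).ofLp)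
  have hsym : (gradient b x).ofLp ⬝ᵥ cof u x *ᵥ (gradient a x).ofLp
      = (gradient a x).ofLp ⬝ᵥ cof u x *ᵥ (gradient b x).ofLp := by
    have h1 : (cof u x)ᵀ = cof u x := by
      have := hM.1; rwa [IsHermitian, conjTranspose_eq_transpose_of_trivial] at this
    rw [dotProduct_mulVec, ← mulVec_transpose, h1, dotProduct_comm]
  rw [star_trivial, mulVec_add, mulVec_smul, add_dotProduct, dotProduct_add, dotProduct_add,
    smul_dotProduct, smul_dotProduct, dotProduct_smul, dotProduct_smul, hsym] at h
  simp only [smul_eq_mul] at h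
  simp only [energy]
  linarith

theorem two_mul_energy_le (hu : ConvexC2 u) (a b : Eu n → ℝ) (x : Eu n) (p q : ℝ) :
    -(2 * (p * q * energy u a b x)) ≤ 2 * p ^ 2 * energy u a a x + q ^ 2 / 2 * energy u b b x := by
  rcases eq_or_ne p 0 with rfl | hp
  · have := energy_self_nonneg hu b x
    simp; positivity
  have h := mul_nonneg (show 0 ≤ 2 * p ^ 2 by positivity)
    (energy_quadratic_nonneg hu a b x (q / (2 * p)))
  have e : 2 * p ^ 2 * (energy u a a x + 2 * (q / (2 * p)) * energy u a b x
      + (q / (2 * p)) ^ 2 * energy u b b x) = 2 * p ^ 2 * energy u a a x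
      + 2 * (p * q * energy u a b x) + q ^ 2 / 2 * energy u b b x := by
    field_simp
  linarith

/-- A smooth cutoff equal to one on `(-∞, 1]` and vanishing on `[2, ∞)`. -/
noncomputable def cutoff (t : ℝ) : ℝ := Real.smoothTransition (2 - t)

theorem contDiff_cutoff : ContDiff ℝ 1 cutoff :=
  Real.smoothTransition.contDiff.comp (contDiff_const.sub contDiff_id)

theorem cutoff_nonneg (t : ℝ) : 0 ≤ cutoff t := Real.smoothTransition.nonneg _

theorem cutoff_le_one (t : ℝ) : cutoff t ≤ 1 := Real.smoothTransition.le_one _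

theorem cutoff_eq_one {t : ℝ} (ht : t ≤ 1) : cutoff t = 1 :=
  Real.smoothTransition.one_of_one_le (by linarith)

theorem cutoff_eq_zero {t : ℝ} (ht : 2 ≤ t) : cutoff t = 0 :=
  Real.smoothTransition.zero_of_nonpos (by linarith)

theorem deriv_cutoff_eq_zero {t : ℝ} (ht : t < 1 ∨ 2 < t) : deriv cutoff t = 0 := by
  rcases ht with ht | ht
  · have : cutoff =ᶠ[nhds t] fun _ => 1 := by
      filter_upwards [Iio_mem_nhds ht] with s hs using cutoff_eq_one (le_of_lt hs)
    rw [this.deriv_eq, deriv_const]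
  · have : cutoff =ᶠ[nhds t] fun _ => 0 := by
      filter_upwards [Ioi_mem_nhds ht] with s hs using cutoff_eq_zero (le_of_lt hs)
    rw [this.deriv_eq, deriv_const]

theorem exists_deriv_cutoff_le : ∃ T > 0, ∀ t, |deriv cutoff t| ≤ T := by
  obtain ⟨T, hT⟩ := (isCompact_Icc (a := (1 : ℝ)) (b := 2)).exists_bound_of_continuousOn
    (contDiff_cutoff.continuous_deriv (by norm_num)).continuousOn
  refine ⟨max T 1, by positivity, fun t => ?_⟩
  by_cases ht : t ∈ Set.Icc (1 : ℝ) 2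
  · exact (hT t ht).trans (le_max_left _ _)
  · rw [deriv_cutoff_eq_zero, abs_zero]
    · positivity
    · rw [Set.mem_Icc, not_and_or, not_le, not_le] at ht; exact ht

namespace Setting

theorem exists_integral_energy_self_le (hu : Setting u lam Lam β Γ) (G : Geom u) :
    ∃ C > 0, ∀ h, 0 < h → ∫ x in sec u 0 (2 * h), energy u u u x ≤ C * √h ^ n * h := by
  have hL := hu.Lam_pos
  have hω := ballVol_pos n
  have hR := G.R_pos
  have hCd := G.Cd_pos
  have hn : (0 : ℝ) < n := by have := hu.dim_pos; positivity
  set Cv := G.Cd * (G.R ^ n * ballVol n)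
  refine ⟨4 * (n * Lam) * (Cv * 2 ^ n), by positivity, fun h hh => ?_⟩
  have hu1 : ContDiff ℝ 1 u := hu.smooth1
  set p : Eu n → ℝ := fun x => max (4 * h - u x) 0
  set a : Eu n → ℝ := fun x => p x ^ 2
  have ha : ContDiff ℝ 1 a := contDiff_posPart_sq.comp (contDiff_const.sub hu1)
  have hpc : Continuous p := by have := hu.continuous; fun_prop
  have hp0 : ∀ x, 0 ≤ p x := fun x => le_max_right _ _
  have had : ∀ x, fderiv ℝ a x = (-(2 * p x)) • fderiv ℝ u x := by
    intro x
    have h1 : HasFDerivAt (fun y => 4 * h - u y) (-fderiv ℝ u x) x :=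
      (hu.differentiable x).hasFDerivAt.const_sub _
    have h2 := ((hasDerivAt_posPart_sq (4 * h - u x)).comp_hasFDerivAt x h1).fderiv
    rw [show fderiv ℝ a x = _ from h2, smul_neg, neg_smul]
  set S := sec u 0 (4 * h)
  have hSc : IsCompact S := hu.isCompact_sec 0 _
  have hpS : ∀ x, x ∉ S → p x = 0 := fun x hx => by
    rw [hu.mem_sec_zero, not_le] at hx
    exact max_eq_right (by linarith)
  have hac : HasCompactSupport a := HasCompactSupport.intro hSc fun x hx => by
    simp only [a, hpS x hx]; norm_num
  have hibp := integral_mul_trace_cof hu.smooth3 (fun x => (hu.pos x).det_pos.ne') ha hac hu.smooth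
  have htr : ∀ x, (cof u x * hess u x).trace = (hess u x).det * n := by
    intro x
    rw [trace_cof_mul hu.toConvexC2, lin, nonsing_inv_mul _ (hu.pos x).det_pos.ne'.isUnit]
    simp
  have hEc : Continuous (energy u u u) := continuous_energy hu.smooth3 hu1 hu1
  have hE0 := energy_self_nonneg hu.toConvexC2 u
  have hpEs : HasCompactSupport fun x => 2 * p x * energy u u u x :=
    HasCompactSupport.intro hSc fun x hx => by simp [hpS x hx]
  have hpEi : Integrable fun x => 2 * p x * energy u u u x :=
    ((continuous_const.mul hpc).mul hEc).integrable_of_hasCompactSupport hpEs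
  have hIbp : ∫ x, 2 * p x * energy u u u x = ∫ x, a x * ((hess u x).det * n) := by
    have h1 : ∀ x, energy u a u x = -(2 * p x * energy u u u x) := fun x => by
      rw [energy_congr_fderiv (had x)]; ring
    simp only [htr, h1, integral_neg, neg_neg] at hibp
    exact hibp.symm
  have hlow : 4 * h * ∫ x in sec u 0 (2 * h), energy u u u x ≤ ∫ x, 2 * p x * energy u u u x := by
    rw [← integral_const_mul]
    refine le_trans (setIntegral_mono_on ((continuous_const.mul hEc).integrableOn_compact
      (hu.isCompact_sec 0 _)) hpEi.integrableOn (hu.isCompact_sec 0 _).measurableSet fun x hx => ?_)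
      (setIntegral_le_integral hpEi (.of_forall fun x =>
        mul_nonneg (mul_nonneg two_pos.le (hp0 x)) (hE0 x)))
    have h1 := hu.mem_sec_zero.1 hx
    have h2 : 2 * h ≤ p x := le_max_of_le_left (by linarith)
    exact mul_le_mul_of_nonneg_right (by linarith) (hE0 x)
  have hup : ∫ x, a x * ((hess u x).det * n) ≤ (4 * h) ^ 2 * (Lam * n) * volume.real S := by
    have hct : IntegrableOn (fun _ : Eu n => (4 * h) ^ 2 * (Lam * n)) S :=
      integrableOn_const hSc.measure_lt_top.ne enorm_ne_top
    have hdc : Continuous fun x => (hess u x).det := (continuous_hess hu.smooth).matrix_det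
    calc _ ≤ ∫ x, S.indicator (fun _ => (4 * h) ^ 2 * (Lam * n)) x := by
          refine integral_mono ((ha.continuous.mul (hdc.mul
            continuous_const)).integrable_of_hasCompactSupport hac.mul_right)
            (hct.integrable_indicator hSc.measurableSet) fun x => ?_
          by_cases hx : x ∈ S
          · simp only [indicator_of_mem hx]
            have h1 : p x ≤ 4 * h := max_le (by linarith [hu.nonneg x]) (by linarith)
            have h2 := hu.upper x
            have h3 := hp0 x
            have h4 := (hu.pos x).det_pos
            simp only [a]
            gcongr
          · simp [a, hpS x hx, indicator_of_notMem hx]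
      _ = _ := by
          rw [integral_indicator hSc.measurableSet, setIntegral_const, smul_eq_mul, mul_comm]
  have hvol := G.volume_sec_le 0 (show 0 < 4 * h by positivity)
  have hs4 : √(4 * h) = 2 * √h := by
    rw [Real.sqrt_mul (by norm_num), show (4 : ℝ) = 2 ^ 2 by norm_num, Real.sqrt_sq (by norm_num)]
  rw [hs4, mul_pow] at hvol
  have hfin : 4 * h * ∫ x in sec u 0 (2 * h), energy u u u x
      ≤ (4 * h) ^ 2 * (Lam * n) * (Cv * (2 ^ n * √h ^ n)) :=
    hlow.trans ((hIbp.trans_le hup).trans (by gcongr))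
  refine le_of_mul_le_mul_left (hfin.trans_eq ?_) (show 0 < 4 * h by positivity)
  ring

/-- Logarithmic energy estimate for second differences. -/
theorem exists_integral_energy_comp_le (hu : Setting u lam Lam β Γ) (G : Geom u) :
    ∃ σ : ℝ, 0 < σ ∧ ∃ C > 0, ∀ e ∈ Γ, ∀ (Z ζ g : ℝ → ℝ) (h Q : ℝ), 0 < h → Continuous g →
      (∀ t, HasDerivAt Z (g t) t) → (∀ t, HasDerivAt ζ (g t ^ 2) t) →
      (∀ x, 0 ≤ ζ (sd u e x)) → (∀ x, ζ (sd u e x) ≤ Q) →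
      (∀ x, h ≤ u x → ζ (sd u e x) ≤ g (sd u e x)) →
      ∫ x in sec u 0 h, energy u (Z ∘ sd u e) (Z ∘ sd u e) x
        ≤ C * (√h ^ n / h) * (1 + Q * h ^ (-σ)) := by
  obtain ⟨Cs, hCs, hsrc⟩ := hu.source
  obtain ⟨σ, hσ, C₂, hC₂, hInt⟩ := G.exists_integral_src_le hu.toConvexC2 hu.dim hu.two_lt
    hu.le_five_half
  obtain ⟨C₃, hC₃, huu⟩ := hu.exists_integral_energy_self_le G
  obtain ⟨T, hT, hTb⟩ := exists_deriv_cutoff_le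
  have hL := hu.Lam_pos
  set k₁ := 4 * T ^ 2 * C₃
  set k₂ := 2 * (Lam * Cs * (C₂ * 2 ^ n))
  refine ⟨σ, hσ, k₁ + k₂, by positivity, fun e he Z ζ g h Q hh hg hZ hζ hζ0 hζQ hζg => ?_⟩
  set v := sd u e
  have hv : ContDiff ℝ 2 v := contDiff_sd (m := 2) hu.smooth e
  have hv1 : ContDiff ℝ 1 v := hv.of_le (by norm_num)
  have hQ : 0 ≤ Q := (hζ0 0).trans (hζQ 0)
  set η : Eu n → ℝ := fun x => cutoff (u x / h)
  have hη : ContDiff ℝ 1 η := contDiff_cutoff.comp (hu.smooth1.div_const h)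
  have hηd : ∀ x, fderiv ℝ η x = (deriv cutoff (u x / h) / h) • fderiv ℝ u x := by
    intro x
    have h1 : HasFDerivAt (fun y => u y / h) (h⁻¹ • fderiv ℝ u x) x := by
      simpa only [div_eq_inv_mul] using (hu.differentiable x).hasFDerivAt.const_mul h⁻¹
    have h2 := ((contDiff_cutoff.differentiable (by norm_num) (u x / h)).hasDerivAt.comp_hasFDerivAt
      x h1).fderiv
    rw [show fderiv ℝ η x = _ from h2, smul_smul, ← div_eq_mul_inv]
  have hζ1 : ContDiff ℝ 1 ζ := contDiff_one_iff_deriv.2 ⟨fun t => (hζ t).differentiableAt, by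
    rw [show deriv ζ = fun t => g t ^ 2 from funext fun t => (hζ t).deriv]; fun_prop⟩
  have hZ1 : ContDiff ℝ 1 Z := contDiff_one_iff_deriv.2 ⟨fun t => (hZ t).differentiableAt, by
    rw [show deriv Z = g from funext fun t => (hZ t).deriv]; exact hg⟩
  have hgradζ : ∀ x, fderiv ℝ (fun y => ζ (v y)) x = (g (v x) ^ 2) • fderiv ℝ v x := fun x =>
    ((hζ (v x)).comp_hasFDerivAt x (hv1.differentiable (by norm_num) x).hasFDerivAt).fderiv
  have hgradZ : ∀ x, fderiv ℝ (Z ∘ v) x = g (v x) • fderiv ℝ v x := fun x =>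
    ((hZ (v x)).comp_hasFDerivAt x (hv1.differentiable (by norm_num) x).hasFDerivAt).fderiv
  set a : Eu n → ℝ := fun x => η x ^ 2 * ζ (v x)
  have ha : ContDiff ℝ 1 a := (hη.pow 2).mul (hζ1.comp hv1)
  set S := sec u 0 (2 * h)
  have hSc : IsCompact S := hu.isCompact_sec 0 _
  have hSm := hSc.measurableSet
  have hηS : ∀ x, x ∉ S → η x = 0 := fun x hx => by
    rw [hu.mem_sec_zero, not_le] at hx
    exact cutoff_eq_zero ((le_div_iff₀ hh).2 hx.le)
  have hac : HasCompactSupport a := HasCompactSupport.intro hSc fun x hx => by simp [a, hηS x hx]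
  have hibp := integral_mul_trace_cof hu.smooth3 (fun x => (hu.pos x).det_pos.ne') ha hac hv
  set Evv := energy u v v
  have hEv : Continuous Evv := continuous_energy hu.smooth3 hv1 hv1
  have hEu : Continuous (energy u u u) := continuous_energy hu.smooth3 hu.smooth1 hu.smooth1
  have hEvv0 : ∀ x, 0 ≤ Evv x := energy_self_nonneg hu.toConvexC2 v
  have hEuu0 : ∀ x, 0 ≤ energy u u u x := energy_self_nonneg hu.toConvexC2 u
  have hea : ∀ x, energy u a v x = η x ^ 2 * g (v x) ^ 2 * Evv x
      + 2 * (deriv cutoff (u x / h) / h * (η x * ζ (v x)) * energy u u v x) := by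
    intro x
    have hd : fderiv ℝ a x = (2 * η x * ζ (v x) * (deriv cutoff (u x / h) / h)) • fderiv ℝ u x
        + (η x ^ 2 * g (v x) ^ 2) • fderiv ℝ v x := by
      have d1 := (hη.differentiable (by norm_num) x).hasFDerivAt
      have d2 := ((hζ1.comp hv1).differentiable (by norm_num) x).hasFDerivAt
      have d3 := ((d1.pow 2).mul d2).fderiv
      rw [show fderiv ℝ a x = _ from d3, show fderiv ℝ (ζ ∘ v) x = _ from hgradζ x, hηd]
      ext i
      simp
      ring
    simp only [energy_eq_sum, hd, _root_.add_apply, _root_.smul_apply, smul_eq_mul, Evv, add_mul,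
      sum_add_distrib, mul_sum]
    rw [add_comm]
    congr 1
    · exact sum_congr rfl fun i _ => sum_congr rfl fun j _ => by ring
    · exact sum_congr rfl fun i _ => sum_congr rfl fun j _ => by ring
  have hpt : ∀ x, η x ^ 2 * g (v x) ^ 2 * Evv x
      ≤ 2 * energy u a v x + S.indicator (fun x => 4 * (T / h) ^ 2 * energy u u u x) x := by
    intro x
    rw [hea]
    have hη0 : 0 ≤ η x := cutoff_nonneg _
    by_cases hx : h ≤ u x ∧ u x ≤ 2 * h
    · rw [indicator_of_mem (show x ∈ S from hu.mem_sec_zero.2 hx.2)]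
      have h1 := two_mul_energy_le hu.toConvexC2 u v x (deriv cutoff (u x / h) / h) (η x * ζ (v x))
      have h2 : (deriv cutoff (u x / h) / h) ^ 2 ≤ (T / h) ^ 2 := by
        rw [← sq_abs, abs_div, abs_of_pos hh]
        gcongr
        exact hTb _
      have h3 : (η x * ζ (v x)) ^ 2 ≤ η x ^ 2 * g (v x) ^ 2 := by
        rw [mul_pow]
        have := hζ0 x
        gcongr
        exact hζg x hx.1
      have h4 := mul_le_mul_of_nonneg_right h2 (hEuu0 x)
      have h5 := mul_le_mul_of_nonneg_right h3 (hEvv0 x)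
      simp only [Evv] at h5 ⊢
      linarith
    · have h1 : deriv cutoff (u x / h) = 0 := deriv_cutoff_eq_zero (by
        rw [not_and_or, not_le, not_le] at hx
        rcases hx with hx | hx
        · left; rwa [div_lt_one hh]
        · right; rwa [lt_div_iff₀ hh])
      have h2 : 0 ≤ S.indicator (fun x => 4 * (T / h) ^ 2 * energy u u u x) x :=
        indicator_nonneg (fun y _ => by have := hEuu0 y; positivity) x
      have h3 : 0 ≤ η x ^ 2 * g (v x) ^ 2 * Evv x := by have := hEvv0 x; positivity
      simp only [h1, zero_div, zero_mul, mul_zero, add_zero]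
      linarith
  have hgc : Continuous fun x => g (v x) := hg.comp hv.continuous
  have hI1 : Integrable fun x => η x ^ 2 * g (v x) ^ 2 * Evv x :=
    (((hη.continuous.pow 2).mul (hgc.pow 2)).mul hEv).integrable_of_hasCompactSupport
      (HasCompactSupport.intro hSc fun x hx => by simp [hηS x hx])
  have hI2 : Integrable (energy u a v) :=
    (continuous_energy hu.smooth3 ha hv1).integrable_of_hasCompactSupport (by
      refine HasCompactSupport.intro hSc fun x hx => energy_eq_zero ?_
      have : x ∉ tsupport a := fun hxs => hx (closure_minimal (fun y hy => by
        by_contra hyS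
        exact hy (by simp [a, hηS y hyS])) hSc.isClosed hxs)
      exact fderiv_of_notMem_tsupport ℝ this)
  have hI3 : Integrable fun x => S.indicator (fun x => 4 * (T / h) ^ 2 * energy u u u x) x :=
    IntegrableOn.integrable_indicator ((hEu.integrableOn_compact hSc).const_mul _) hSm
  have hsrcS : IntegrableOn (src β e) S := (continuous_src β e).integrableOn_compact hSc
  have hen : ∫ x, energy u a v x ≤ Lam * Cs * Q * ∫ x in S, src β e x := by
    rw [show ∫ x, energy u a v x = ∫ x, -(a x * (cof u x * hess v x).trace) by
      rw [integral_neg, hibp, neg_neg], ← integral_const_mul, ← integral_indicator hSm]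
    refine integral_mono ((ha.continuous.mul (hu.continuous_trace_cof hv)).integrable_of_hasCompactSupport
      hac.mul_right).neg (IntegrableOn.integrable_indicator (hsrcS.const_mul _) hSm) fun x => ?_
    by_cases hx : x ∈ S
    · simp only [indicator_of_mem hx]
      have h1 := hu.trace_cof_sd_ge hCs (hsrc e he) x
      have h2 : η x ^ 2 ≤ 1 := pow_le_one₀ (cutoff_nonneg _) (cutoff_le_one _)
      have h3 := hζ0 x
      have h4 := src_nonneg β e x
      have h5 : a x ≤ Q := (mul_le_of_le_one_left h3 h2).trans (hζQ x)
      have h6 : 0 ≤ a x := mul_nonneg (sq_nonneg _) h3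
      calc -(a x * (cof u x * hess v x).trace) = a x * -(cof u x * hess v x).trace := by ring
        _ ≤ a x * (Lam * Cs * src β e x) := by gcongr; linarith
        _ ≤ Q * (Lam * Cs * src β e x) := by gcongr
        _ = _ := by ring
    · simp [indicator_of_notMem hx, a, hηS x hx]
  have hsum : ∫ x, η x ^ 2 * g (v x) ^ 2 * Evv x
      ≤ 2 * (Lam * Cs * Q * ∫ x in S, src β e x) + 4 * (T / h) ^ 2 * ∫ x in S, energy u u u x := by
    have h1 : Integrable fun x => 2 * energy u a v x := hI2.const_mul 2
    calc _ ≤ ∫ x, (2 * energy u a v x + S.indicator (fun x => 4 * (T / h) ^ 2 * energy u u u x) x) :=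
          integral_mono hI1 (h1.add hI3) hpt
      _ = 2 * (∫ x, energy u a v x) + 4 * (T / h) ^ 2 * ∫ x in S, energy u u u x := by
          rw [integral_add h1 hI3, integral_const_mul, integral_indicator hSm, integral_const_mul]
      _ ≤ _ := by gcongr
  have hlow : ∫ x in sec u 0 h, energy u (Z ∘ v) (Z ∘ v) x ≤ ∫ x, η x ^ 2 * g (v x) ^ 2 * Evv x := by
    have e1 : ∀ x ∈ sec u 0 h, energy u (Z ∘ v) (Z ∘ v) x = η x ^ 2 * g (v x) ^ 2 * Evv x := by
      intro x hx
      have h1 : η x = 1 := cutoff_eq_one ((div_le_one hh).2 (hu.mem_sec_zero.1 hx))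
      rw [h1]
      simp only [Evv, energy_eq_sum, hgradZ, _root_.smul_apply, smul_eq_mul, mul_sum]
      exact sum_congr rfl fun i _ => sum_congr rfl fun j _ => by ring
    rw [setIntegral_congr_fun (hu.isCompact_sec 0 h).measurableSet e1]
    exact setIntegral_le_integral hI1 (.of_forall fun x => by have := hEvv0 x; positivity)
  have hs1 := hInt e (2 * h) (by positivity)
  have hs2 := huu h hh
  refine hlow.trans (hsum.trans ?_)
  have hsq : √(2 * h) ^ n ≤ 2 ^ n * √h ^ n := by
    rw [← mul_pow]
    refine pow_le_pow_left₀ (Real.sqrt_nonneg _) (Real.sqrt_le_iff.2 ⟨by positivity, ?_⟩) n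
    rw [mul_pow, sq_sqrt hh.le]; linarith
  have hpw : (2 * h) ^ (-1 - σ) ≤ h⁻¹ * h ^ (-σ) := by
    rw [← Real.rpow_neg_one h, ← rpow_add hh, ← sub_eq_add_neg]
    exact rpow_le_rpow_of_nonpos hh (by linarith) (by linarith)
  have h1 : ∫ x in S, src β e x ≤ C₂ * (2 ^ n * √h ^ n) * (h⁻¹ * h ^ (-σ)) := hs1.trans (by gcongr)
  calc _ ≤ 2 * (Lam * Cs * Q * (C₂ * (2 ^ n * √h ^ n) * (h⁻¹ * h ^ (-σ))))
        + 4 * (T / h) ^ 2 * (C₃ * √h ^ n * h) := by gcongr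
    _ = (√h ^ n / h) * (k₁ + k₂ * (Q * h ^ (-σ))) := by simp only [k₁, k₂]; field_simp; ring
    _ ≤ (√h ^ n / h) * ((k₁ + k₂) * (1 + Q * h ^ (-σ))) := by
        gcongr
        have h2 : 0 ≤ Q * h ^ (-σ) := by positivity
        have h3 : 0 < k₁ := by positivity
        have h4 : 0 < k₂ := by positivity
        nlinarith
    _ = _ := by ring

end Setting

theorem dotProduct_mulVec_le_trace {H : Mat n} (hH : H.PosSemidef) (a : Fin n → ℝ) :
    a ⬝ᵥ H *ᵥ a ≤ H.trace * (a ⬝ᵥ a) := by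
  obtain ⟨Q, rfl⟩ := exists_transpose_mul_self hH
  have e1 : a ⬝ᵥ (Qᵀ * Q) *ᵥ a = ∑ k, (∑ j, Q k j * a j) ^ 2 := by
    rw [← mulVec_mulVec, dotProduct_mulVec, vecMul_transpose]
    simp only [dotProduct, mulVec, sq]
  have e2 : (Qᵀ * Q).trace = ∑ k, ∑ j, Q k j ^ 2 := by
    rw [sum_comm]
    simp only [trace, diag_apply, mul_apply, transpose_apply, sq]
  have e3 : a ⬝ᵥ a = ∑ j, a j ^ 2 := by simp only [dotProduct, sq]
  rw [e1, e2, e3, sum_mul]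
  exact sum_le_sum fun k _ => Finset.sum_mul_sq_le_sq_mul_sq _ _ _

theorem ConvexC2.D2_le_trace (hu : ConvexC2 u) (x ξ : Eu n) :
    D2 u x ξ ξ ≤ (∑ i, D2 u x (single i 1) (single i 1)) * ‖ξ‖ ^ 2 := by
  have h := dotProduct_mulVec_le_trace (hu.pos x).posSemidef ξ.ofLp
  rw [← D2_eq_dotProduct] at h
  have e1 : (hess u x).trace = ∑ i, D2 u x (single i 1) (single i 1) := by
    simp only [trace, diag_apply, hess_apply]
  have e2 : ξ.ofLp ⬝ᵥ ξ.ofLp = ‖ξ‖ ^ 2 := by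
    rw [EuclideanSpace.norm_sq_eq]
    simp [dotProduct, sq]
  rwa [e1, e2] at h

section Truncation

variable {K s : ℝ}

/-- The truncated reciprocal of the distance to the level `K`. -/
noncomputable def recip (K s t : ℝ) : ℝ := (max (K - t) s)⁻¹

theorem continuous_recip (hs : 0 < s) : Continuous (recip K s) :=
  Continuous.inv₀ (by fun_prop) fun _ => (lt_max_of_lt_right hs).ne'

theorem recip_pos (hs : 0 < s) (t : ℝ) : 0 < recip K s t := inv_pos.2 (lt_max_of_lt_right hs)

theorem recip_le (hs : 0 < s) (t : ℝ) : recip K s t ≤ s⁻¹ := inv_anti₀ hs (le_max_right _ _)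

theorem recip_of_le {t : ℝ} (ht : t ≤ K - s) : recip K s t = (K - t)⁻¹ := by
  rw [recip, max_eq_left (by linarith)]

theorem integral_recip_sq_le (hs : 0 < s) {t : ℝ} (h0 : 0 ≤ t) (ht : t ≤ K - s) :
    ∫ r in (0 : ℝ)..t, recip K s r ^ 2 ≤ recip K s t := by
  have hc : Continuous fun r => recip K s r ^ 2 := (continuous_recip hs).pow 2
  have h1 : ∀ r ∈ Set.uIcc 0 t, HasDerivAt (fun r => (K - r)⁻¹) (recip K s r ^ 2) r := by
    intro r hr
    rw [Set.uIcc_of_le h0] at hr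
    have hr' : r ≤ K - s := hr.2.trans ht
    have h2 := ((hasDerivAt_id r).const_sub K).fun_inv (by simp only [id]; linarith : K - id r ≠ 0)
    rw [recip_of_le hr', inv_pow]
    simpa using h2
  rw [integral_eq_sub_of_hasDerivAt h1 (hc.intervalIntegrable _ _), recip_of_le ht]
  have : 0 ≤ (K - 0)⁻¹ := inv_nonneg.2 (by linarith)
  linarith

theorem le_integral_recip (hs : 0 < s) {a b a' b' : ℝ} (ha : a ≤ a') (hab : a' ≤ b') (hb : b' ≤ b)
    (hbs : b' ≤ K - s) :
    Real.log ((K - a') / (K - b')) ≤ ∫ r in a..b, recip K s r := by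
  have hc := continuous_recip (K := K) hs
  have h1 : ∀ r ∈ Set.uIcc a' b', HasDerivAt (fun r => -Real.log (K - r)) (recip K s r) r := by
    intro r hr
    rw [Set.uIcc_of_le hab] at hr
    have hr' : r ≤ K - s := hr.2.trans hbs
    have h2 := (((hasDerivAt_id r).const_sub K).log (by simp only [id]; linarith : K - id r ≠ 0)).fun_neg
    rw [recip_of_le hr']
    simpa [neg_div] using h2
  have h2 := integral_eq_sub_of_hasDerivAt h1 (hc.intervalIntegrable _ _)
  rw [Real.log_div (by linarith) (by linarith)]
  have h3 : ∫ r in a'..b', recip K s r ≤ ∫ r in a..b, recip K s r :=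
    intervalIntegral.integral_mono_interval ha hab hb
      (.of_forall fun r => (recip_pos hs r).le) (hc.intervalIntegrable _ _)
  linarith

end Truncation

namespace Setting

theorem exists_level_of_decay (hu : Setting u lam Lam β Γ) (G : Geom u) {e : Eu n} {K C τ : ℝ}
    (hτ : 0 < τ) (hK : ∀ x, sd u e x ≤ K + C * (1 + ‖x‖) ^ (-τ)) {s : ℝ} (hs : 0 < s) :
    ∃ h₀ > 0, ∀ x, h₀ ≤ u x → sd u e x ≤ K + s := by
  obtain ⟨c', hc', C', hC', D, hD, hq⟩ := hu.exists_quadratic_bounds G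
  have ht : Tendsto (fun r : ℝ => C * (1 + r) ^ (-τ)) atTop (nhds (C * 0)) :=
    ((tendsto_rpow_neg_atTop hτ).comp (tendsto_atTop_add_const_left _ 1 tendsto_id)).const_mul C
  rw [mul_zero] at ht
  obtain ⟨ρ, hρ⟩ := eventually_atTop.1 (ht.eventually_le_const hs)
  refine ⟨C' * max ρ 0 ^ 2 + D, by positivity, fun x hx => (hK x).trans ?_⟩
  have h1 := (hq x).2
  have h2 : max ρ 0 ≤ ‖x‖ := by
    refine le_of_sq_le_sq ?_ (norm_nonneg x)
    exact le_of_mul_le_mul_left (by linarith) hC'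
  have := hρ ‖x‖ ((le_max_left _ _).trans h2)
  linarith

/-- The near-maximal set of a second difference has positive density at every large scale. -/
theorem exists_density_superlevel (hu : Setting u lam Lam β Γ) (G : Geom u) {e : Eu n} (he : e ∈ Γ)
    {K C τ : ℝ} (hτ : 0 < τ) (hK : ∀ x, sd u e x ≤ K + C * (1 + ‖x‖) ^ (-τ))
    (happ : ∀ ε > 0, ∃ k₀ : ℕ, ∀ k, k₀ ≤ k → ∃ x, u x = G.Θ ^ k ∧ K - ε ≤ sd u e x) :
    ∃ c > 0, ∀ s > 0, ∃ R₀ : ℝ, ∀ R, R₀ ≤ R →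
      c * R ^ n ≤ volume.real ({x | K - 2 * s ≤ sd u e x} ∩ closedBall 0 R) := by
  have hΘ := G.Θ_pos
  have hΘ2 := G.two_le
  have hΘ1 : 1 < G.Θ := by linarith
  obtain ⟨Cs, hCs, hsrc⟩ := hu.source
  obtain ⟨C₂, hC₂, hmax⟩ := hu.local_max G hu.dim_pos
  obtain ⟨h₁, hh₁, Cf, hCf, hfar⟩ := hu.exists_far_source_decay G e
  obtain ⟨c', hc', C', hC', D, hD, hq⟩ := hu.exists_quadratic_bounds G
  set κ := √(c' / (2 * G.Θ) / G.Θ ^ 5)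
  have hκ : 0 < κ := sqrt_pos.2 (by positivity)
  have hn' : (n : ℝ) ≠ 0 := by have := hu.dim_pos; positivity
  refine ⟨κ ^ n / (6 * C₂), by positivity, fun s hs => ?_⟩
  obtain ⟨h₂, hh₂, hlev⟩ := hu.exists_level_of_decay G hτ hK hs
  obtain ⟨k₀, hk₀⟩ := happ s hs
  obtain ⟨h₃, hh₃⟩ : ∃ h₃ : ℝ, ∀ h, h₃ ≤ h → C₂ * Cs * Cf * h ^ (1 - β / 2) ≤ s / 2 := by
    have ht : Tendsto (fun h : ℝ => C₂ * Cs * Cf * h ^ (-(β / 2 - 1))) atTop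
        (nhds (C₂ * Cs * Cf * 0)) :=
      (tendsto_rpow_neg_atTop (by linarith [hu.two_lt])).const_mul _
    rw [mul_zero] at ht
    obtain ⟨h₃, hh₃⟩ := eventually_atTop.1 (ht.eventually_le_const (half_pos hs))
    exact ⟨h₃, fun h hh => by have := hh₃ h hh; rwa [neg_sub] at this⟩
  set M := max (max (G.Θ ^ (k₀ + 1)) (G.Θ ^ 5 * h₂)) (max h₁ (max h₃ (D / G.Θ)))
  have hM1 : 1 ≤ M := (one_le_pow₀ hΘ1.le).trans ((le_max_left _ _).trans (le_max_left _ _))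
  refine ⟨max 1 (M * (2 * G.Θ) / c'), fun R hR => ?_⟩
  have hR1 : 1 ≤ R := (le_max_left _ _).trans hR
  have hRM : M ≤ c' / (2 * G.Θ) * R ^ 2 := by
    have h1 : M * (2 * G.Θ) / c' ≤ R := (le_max_right _ _).trans hR
    have h2 : R ≤ R ^ 2 := le_self_pow₀ hR1 (by norm_num)
    rw [div_le_iff₀ hc'] at h1
    rw [div_mul_eq_mul_div, le_div_iff₀ (by positivity)]
    nlinarith
  obtain ⟨k, hk1, hk2⟩ := exists_nat_pow_near (hM1.trans hRM) hΘ1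
  set H := G.Θ ^ (k + 1)
  have hH : 0 < H := by positivity
  have hHM : M ≤ H := hRM.trans hk2.le
  have hkk : k₀ ≤ k := by
    by_contra! hlt
    have h1 : H < G.Θ ^ (k₀ + 1) := pow_lt_pow_right₀ hΘ1 (by omega)
    have h2 : G.Θ ^ (k₀ + 1) ≤ M := (le_max_left _ _).trans (le_max_left _ _)
    linarith
  obtain ⟨x, hux, hvx⟩ := hk₀ k hkk
  set t := H / G.Θ ^ 5
  have ht : 0 < t := by positivity
  have hth : h₂ ≤ t := by
    rw [le_div_iff₀ (by positivity), mul_comm]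
    exact ((le_max_right _ _).trans (le_max_left _ _)).trans hHM
  have hxH : H / G.Θ ^ 2 ≤ u x := by
    rw [hux, div_le_iff₀ (by positivity)]
    simp only [H, pow_succ]
    have : 0 < G.Θ ^ k := by positivity
    nlinarith [mul_pos this hΘ]
  have hxt : t ≤ G.Θ ^ k := by
    simp only [t, H]
    rw [div_le_iff₀ (by positivity), pow_succ]
    gcongr
    exact le_self_pow₀ hΘ1.le (by norm_num)
  have hsub : sec u x t ⊆ closedBall 0 R := by
    have h1 := G.engulf' (x := 0) (y := x) (h := G.Θ ^ k) (by positivity) (hu.mem_sec_zero.2 hux.le)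
    intro z hz
    have h2 := hu.mem_sec_zero.1 (h1 (sec_mono u x hxt hz))
    have h3 := (hq z).1
    rw [mem_closedBall_zero_iff]
    refine le_of_sq_le_sq (le_of_mul_le_mul_left ?_ hc') (by linarith)
    have h4 : D / G.Θ ≤ M := ((le_max_right _ _).trans (le_max_right _ _)).trans (le_max_right _ _)
    have h5 : G.Θ * (D / G.Θ) = D := mul_div_cancel₀ _ hΘ.ne'
    have h6 : G.Θ * (c' / (2 * G.Θ) * R ^ 2) = c' * R ^ 2 / 2 := by field_simp
    nlinarith
  set v := sd u e
  have hv : ContDiff ℝ 2 v := contDiff_sd (m := 2) hu.smooth e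
  set m := K - 2 * s
  set A : Set (Eu n) := {x | m ≤ v x} ∩ closedBall 0 R
  have hAc : IsCompact A := (isCompact_closedBall 0 R).inter_left
    (isClosed_le continuous_const hv.continuous)
  have h2 := hmax (fun y => v y - m) (fun y => Cs * src β e y) x t (hv.sub contDiff_const)
    (continuous_const.mul (continuous_src β e))
    (fun z => mul_nonneg hCs.le (src_nonneg β e z)) ht
    (fun z _ _ => by rw [lin_sub_const hv]; exact hsrc e he z)
  set I := (∫ z in sec u x t, src β e z ^ n) ^ ((1 : ℝ) / n)
  have hI0 : 0 ≤ ∫ z in sec u x t, src β e z ^ n :=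
    integral_nonneg fun z => pow_nonneg (src_nonneg β e z) n
  have hI : 0 ≤ I := Real.rpow_nonneg hI0 _
  have e1 : (∫ z in sec u x t, (Cs * src β e z) ^ n) ^ ((1 : ℝ) / n) = Cs * I := by
    simp only [mul_pow, integral_const_mul]
    rw [mul_rpow (by positivity) hI0, ← rpow_natCast, ← rpow_mul hCs.le,
      mul_one_div_cancel hn', rpow_one]
  have hSm := (hu.isCompact_sec x t).measurableSet
  have hmc : Continuous fun z => max (v z - m) 0 := by have := hv.continuous; fun_prop
  have hcA : IntegrableOn (fun _ : Eu n => 3 * s) A :=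
    integrableOn_const hAc.measure_lt_top.ne enorm_ne_top
  have hiA := hcA.integrable_indicator hAc.measurableSet
  have e2 : ∫ z in sec u x t, max (v z - m) 0 ≤ 3 * s * volume.real A := by
    calc _ ≤ ∫ z in sec u x t, A.indicator (fun _ => 3 * s) z := by
          refine setIntegral_mono_on (hmc.integrableOn_compact (hu.isCompact_sec x t))
            hiA.integrableOn hSm fun z hz => ?_
          have h3 := hlev z (hth.trans (hu.lt_of_mem_sec_far G hH hxH hz).le)
          by_cases hzm : m ≤ v z
          · rw [indicator_of_mem (show z ∈ A from ⟨hzm, hsub hz⟩)]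
            exact max_le (by simp only [m]; linarith) (by linarith)
          · rw [max_eq_right (by linarith)]
            exact indicator_nonneg (fun _ _ => by linarith) z
      _ ≤ ∫ z, A.indicator (fun _ => 3 * s) z := setIntegral_le_integral hiA (.of_forall fun z =>
            indicator_nonneg (fun _ _ => by linarith) z)
      _ = _ := by
          rw [integral_indicator hAc.measurableSet, setIntegral_const, smul_eq_mul, mul_comm]
  have e3 : √t * I ≤ Cf * H ^ (1 - β / 2) := by
    refine le_trans ?_ (hfar H (((le_max_left _ _).trans (le_max_right _ _)).trans hHM) x hxH)
    exact mul_le_mul_of_nonneg_right (Real.sqrt_le_sqrt (div_le_self hH.le (one_le_pow₀ hΘ1.le))) hI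
  have e4 := hh₃ H ((((le_max_left _ _).trans (le_max_right _ _)).trans (le_max_right _ _)).trans hHM)
  rw [e1] at h2
  have hst : 0 < √t := sqrt_pos.2 ht
  have h3 : s / 2 ≤ C₂ * ((√t ^ n)⁻¹ * (3 * s * volume.real A)) := by
    have h4 : C₂ * ((√t ^ n)⁻¹ * ∫ z in sec u x t, max (v z - m) 0)
        ≤ C₂ * ((√t ^ n)⁻¹ * (3 * s * volume.real A)) := by gcongr
    have h5 : C₂ * Cs * (√t * I) ≤ C₂ * Cs * (Cf * H ^ (1 - β / 2)) := by gcongr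
    have h6 : s ≤ v x - m := by simp only [m]; linarith
    linarith
  have h4 : √t ^ n ≤ 6 * C₂ * volume.real A := by
    have h5 : C₂ * ((√t ^ n)⁻¹ * (3 * s * volume.real A))
        = 3 * s * (C₂ * volume.real A) / √t ^ n := by field_simp
    rw [h5, le_div_iff₀ (by positivity)] at h3
    have h6 : s * √t ^ n ≤ s * (6 * C₂ * volume.real A) := by linarith
    exact le_of_mul_le_mul_left h6 hs
  have h5 : κ * R ≤ √t := by
    refine Real.le_sqrt_of_sq_le ?_
    rw [mul_pow, sq_sqrt (by positivity), div_mul_eq_mul_div]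
    simp only [t]
    gcongr
  rw [div_mul_eq_mul_div, div_le_iff₀ (by positivity), ← mul_pow]
  calc (κ * R) ^ n ≤ √t ^ n := by gcongr
    _ ≤ _ := h4.trans_eq (by ring)

/-- Superlevel and sublevel sets of a second difference near its upper limit cannot both be large. -/
theorem exists_log_estimate (hu : Setting u lam Lam β Γ) (G : Geom u) {e : Eu n} (he : e ∈ Γ)
    {K C τ : ℝ} (hτ : 0 < τ) (hK : ∀ x, sd u e x ≤ K + C * (1 + ‖x‖) ^ (-τ)) :
    ∃ C₁ > 0, ∀ s > 0, ∃ R₀ : ℝ, ∀ R, R₀ ≤ R → ∀ ε, 4 * s ≤ ε →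
      Real.log (ε / (4 * s)) * volume.real ({x | K - 2 * s ≤ sd u e x} ∩ closedBall 0 R)
        * volume.real ({x | sd u e x ≤ K - ε} ∩ closedBall 0 R) ≤ C₁ * (R ^ n * R ^ n) := by
  have hl := hu.lam_pos
  have hω := ballVol_pos n
  have hJ := G.J_pos
  have hr := G.r_pos
  obtain ⟨σ, hσ, Ce, hCe, hen⟩ := hu.exists_integral_energy_comp_le G
  obtain ⟨CD, hCD, hD2⟩ := hu.integral_D2_le G
  obtain ⟨h₀, hh₀, c₁, hc₁, C₁, hC₁, hell⟩ := hu.exists_uniform_ellipticity G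
  obtain ⟨c', hc', C', hC', D, hD, hq⟩ := hu.exists_quadratic_bounds G
  obtain ⟨V, hV, hVb⟩ := hu.exists_sd_bound G he
  set b := C' + D
  have hb : 0 < b := by positivity
  set k₁ := n * (CD * √b ^ n * C₁ ^ 2)
  set k₂ := Ce * (√b ^ n / b) * 2
  have hn : (0 : ℝ) < n := by have := hu.dim_pos; positivity
  refine ⟨ballVol n * (2 ^ n * (4 * k₁ + k₂ / lam)), by positivity, fun s hs => ?_⟩
  obtain ⟨h₂, hh₂, hlev⟩ := hu.exists_level_of_decay G hτ hK hs
  set K' := K + 2 * s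
  set g := recip K' s
  have hg : Continuous g := continuous_recip hs
  set Z : ℝ → ℝ := fun t => ∫ r in (0 : ℝ)..t, g r
  set ζ : ℝ → ℝ := fun t => ∫ r in (0 : ℝ)..t, g r ^ 2
  have hZ : ∀ t, HasDerivAt Z (g t) t := fun t => (hg.integral_hasStrictDerivAt 0 t).hasDerivAt
  have hζ : ∀ t, HasDerivAt ζ (g t ^ 2) t := fun t =>
    ((hg.pow 2).integral_hasStrictDerivAt 0 t).hasDerivAt
  set v := sd u e
  have hv : ContDiff ℝ 2 v := contDiff_sd (m := 2) hu.smooth e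
  have hv1 : ContDiff ℝ 1 v := hv.of_le (by norm_num)
  have hv0 : ∀ x, 0 ≤ v x := hu.toConvexC2.sd_nonneg e
  set Q := (s⁻¹) ^ 2 * V
  have hζ0 : ∀ x, 0 ≤ ζ (v x) := fun x =>
    intervalIntegral.integral_nonneg (hv0 x) fun r _ => sq_nonneg _
  have hζQ : ∀ x, ζ (v x) ≤ Q := fun x => by
    have h1 : ‖∫ r in (0 : ℝ)..v x, g r ^ 2‖ ≤ (s⁻¹) ^ 2 * |v x - 0| :=
      intervalIntegral.norm_integral_le_of_norm_le_const fun r _ => by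
        rw [norm_of_nonneg (sq_nonneg _)]
        exact pow_le_pow_left₀ (recip_pos hs r).le (recip_le hs r) 2
    rw [sub_zero, abs_of_nonneg (hv0 x)] at h1
    refine (le_abs_self _).trans (h1.trans ?_)
    simp only [Q]; gcongr; exact hVb x
  obtain ⟨h₃, hh₃⟩ : ∃ h₃ : ℝ, ∀ h, h₃ ≤ h → Q * h ^ (-σ) ≤ 1 := by
    have ht : Tendsto (fun h : ℝ => Q * h ^ (-σ)) atTop (nhds (Q * 0)) :=
      (tendsto_rpow_neg_atTop hσ).const_mul _
    rw [mul_zero] at ht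
    exact eventually_atTop.1 (ht.eventually_le_const one_pos)
  set M := max (max h₀ h₂) h₃
  refine ⟨max 1 (M / b), fun R hR ε hε => ?_⟩
  have hR1 : 1 ≤ R := (le_max_left _ _).trans hR
  have hR0 : 0 < R := by linarith
  set h := b * R ^ 2
  have hh : 0 < h := by positivity
  have hMh : M ≤ h := by
    have h1 : M / b ≤ R := (le_max_right _ _).trans hR
    have h2 : R ≤ R ^ 2 := le_self_pow₀ hR1 (by norm_num)
    rw [div_le_iff₀ hb] at h1
    simp only [h]; nlinarith
  have hsq : √h ^ n = √b ^ n * R ^ n := by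
    simp only [h]; rw [Real.sqrt_mul hb.le, Real.sqrt_sq hR0.le, mul_pow]
  set B : Set (Eu n) := closedBall 0 R
  have hBc : IsCompact B := isCompact_closedBall 0 R
  have hBS : B ⊆ sec u 0 h := by
    intro z hz
    rw [mem_closedBall_zero_iff] at hz
    refine hu.mem_sec_zero.2 ((hq z).2.trans ?_)
    have h1 : ‖z‖ ^ 2 ≤ R ^ 2 := pow_le_pow_left₀ (norm_nonneg z) hz 2
    have h2 : 1 ≤ R ^ 2 := one_le_pow₀ hR1
    simp only [h, b]; nlinarith
  have hE := hen e he Z ζ g h Q hh hg hZ hζ hζ0 hζQ (fun x hx => by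
    have h1 := hlev x (((le_max_right _ _).trans (le_max_left _ _)).trans (hMh.trans hx))
    exact integral_recip_sq_le hs (hv0 x) (by simp only [K']; linarith))
  have hZ1 : ContDiff ℝ 1 (Z ∘ v) := ContDiff.comp (contDiff_one_iff_deriv.2
    ⟨fun t => (hZ t).differentiableAt, by
      rw [show deriv Z = g from funext fun t => (hZ t).deriv]; exact hg⟩) hv1
  have hE2 : ∫ x in B, energy u (Z ∘ v) (Z ∘ v) x ≤ k₂ * (R ^ n / R ^ 2) := by
    calc _ ≤ ∫ x in sec u 0 h, energy u (Z ∘ v) (Z ∘ v) x :=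
          setIntegral_mono_set ((continuous_energy hu.smooth3 hZ1
            hZ1).integrableOn_compact (hu.isCompact_sec 0 h))
            (.of_forall fun x => energy_self_nonneg hu.toConvexC2 _ x)
            (LE.le.eventuallyLE hBS)
      _ ≤ Ce * (√h ^ n / h) * (1 + 1) := by
          refine hE.trans ?_
          gcongr
          exact hh₃ h ((le_max_right _ _).trans hMh)
      _ = _ := by rw [hsq]; simp only [k₂, h]; field_simp; ring
  set T : Eu n → ℝ := fun x => ∑ i, D2 u x (single i 1) (single i 1)
  have hTc : Continuous T := continuous_finsetSum _ fun i _ => continuous_D2 hu.smooth _ _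
  have hT0 : ∀ x, 0 ≤ T x := fun x => sum_nonneg fun i _ => hu.D2_nonneg x _
  have hTi : ∫ x in B, T x ≤ k₁ * R ^ n := by
    simp only [T]
    rw [integral_finsetSum _ fun i _ => (continuous_D2 hu.smooth _ _).integrableOn_compact hBc]
    calc _ ≤ ∑ _i : Fin n, CD * √h ^ n * C₁ ^ 2 := by
          refine sum_le_sum fun i _ => ?_
          set ξ : Eu n := single i 1
          have hξ : ‖ξ‖ = 1 := by simp [ξ]
          calc ∫ x in B, D2 u x ξ ξ ≤ ∫ x in G.W h (G.r / 2), D2 u x ξ ξ :=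
                setIntegral_mono_set ((continuous_D2 hu.smooth ξ ξ).integrableOn_compact
                  (G.isCompact_W h _)) (.of_forall fun x => hu.D2_nonneg x ξ)
                  (LE.le.eventuallyLE fun x hx =>
                    G.W_mono h (by linarith) (G.sec_subset_W hh (hBS hx)))
            _ ≤ CD * √h ^ n * (h * ‖(G.B 0 (G.J * h)).symm ξ‖ ^ 2) :=
                (hD2 h ξ hh).trans_eq (by ring)
            _ ≤ CD * √h ^ n * C₁ ^ 2 := by
                refine mul_le_mul_of_nonneg_left ?_ (by positivity)
                have hJh : h ≤ G.J * h := le_mul_of_one_le_left hh.le G.one_le_J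
                have h1 := (hell (G.J * h)
                  ((((le_max_left _ _).trans (le_max_left _ _)).trans hMh).trans hJh) ξ).2
                rw [hξ, mul_one] at h1
                calc h * ‖(G.B 0 (G.J * h)).symm ξ‖ ^ 2
                    ≤ (G.J * h) * ‖(G.B 0 (G.J * h)).symm ξ‖ ^ 2 := by gcongr
                  _ = (√(G.J * h) * ‖(G.B 0 (G.J * h)).symm ξ‖) ^ 2 := by
                      rw [mul_pow, sq_sqrt (by positivity)]
                  _ ≤ _ := pow_le_pow_left₀ (by positivity) h1 2
      _ = _ := by
          rw [Finset.sum_const, Finset.card_univ, Fintype.card_fin, nsmul_eq_mul, hsq]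
          simp only [k₁]; ring
  set P : Eu n → ℝ := fun x => 4 * T x + R ^ 2 / lam * energy u (Z ∘ v) (Z ∘ v) x
  have hEc := continuous_energy hu.smooth3 hZ1 hZ1
  have hPc : Continuous P := (hTc.const_mul 4).add (hEc.const_mul _)
  have hPi : ∫ x in B, P x ≤ (4 * k₁ + k₂ / lam) * R ^ n := by
    simp only [P]
    rw [integral_add ((hTc.const_mul 4).integrableOn_compact hBc)
      ((hEc.const_mul _).integrableOn_compact hBc), integral_const_mul, integral_const_mul]
    calc _ ≤ 4 * (k₁ * R ^ n) + R ^ 2 / lam * (k₂ * (R ^ n / R ^ 2)) := by gcongr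
      _ = _ := by field_simp
  have hgap := volume_mul_volume_le_of_gap hZ1 hPc (R := R) (L := Real.log (ε / (4 * s)))
    (Real.log_nonneg ((one_le_div (by positivity)).2 hε)) (fun p ξ hξ => by
      have h1 := det_mul_fderiv_sq_le hu.toConvexC2 (Z ∘ v) p ξ
      have h2 : lam * fderiv ℝ (Z ∘ v) p ξ ^ 2 ≤ D2 u p ξ ξ * energy u (Z ∘ v) (Z ∘ v) p :=
        (mul_le_mul_of_nonneg_right (hu.lower p) (sq_nonneg _)).trans h1
      have hE0 := energy_self_nonneg hu.toConvexC2 (Z ∘ v) p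
      have h3 := two_mul_abs_le (show 0 < (R ^ 2)⁻¹ by positivity) hl (hu.D2_nonneg p ξ) hE0 h2
      have h4 : D2 u p ξ ξ ≤ T p * (4 * R ^ 2) := by
        refine (hu.D2_le_trace p ξ).trans (mul_le_mul_of_nonneg_left ?_ (hT0 p))
        nlinarith [norm_nonneg ξ]
      have h5 : (R ^ 2)⁻¹ * D2 u p ξ ξ ≤ 4 * T p := by
        rw [inv_mul_le_iff₀ (by positivity)]; linarith
      have h6 : energy u (Z ∘ v) (Z ∘ v) p / ((R ^ 2)⁻¹ * lam)
          = R ^ 2 / lam * energy u (Z ∘ v) (Z ∘ v) p := by field_simp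
      have := abs_nonneg (fderiv ℝ (Z ∘ v) p ξ)
      simp only [P]
      linarith)
    (A₁ := {x | v x ≤ K - ε} ∩ B) (A₂ := {x | K - 2 * s ≤ v x} ∩ B) Set.inter_subset_right
    Set.inter_subset_right
    ((isClosed_le hv.continuous continuous_const).measurableSet.inter hBc.measurableSet)
    ((isClosed_le continuous_const hv.continuous).measurableSet.inter hBc.measurableSet)
    (fun x hx y hy => by
      have h1 := le_integral_recip (K := K') hs (show v x ≤ K - ε from hx.1)
        (by linarith : K - ε ≤ K - 2 * s) (show K - 2 * s ≤ v y from hy.1) (by simp only [K']; linarith)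
      have h2 : (Z ∘ v) y - (Z ∘ v) x = ∫ r in v x..v y, g r := by
        simp only [Z, Function.comp]
        exact intervalIntegral.integral_interval_sub_left (hg.intervalIntegrable _ _)
          (hg.intervalIntegrable _ _)
      rw [h2]
      refine le_trans ?_ (h1.trans (le_abs_self _))
      refine Real.log_le_log (by have : 0 < ε := by linarith
                                 positivity) ?_
      rw [show K' - (K - 2 * s) = 4 * s by simp only [K']; ring]
      gcongr
      simp only [K']; linarith)
  rw [volume_closedBall 0 hR0.le] at hgap
  calc _ = Real.log (ε / (4 * s)) * volume.real ({x | v x ≤ K - ε} ∩ B)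
        * volume.real ({x | K - 2 * s ≤ v x} ∩ B) := by ring
    _ ≤ _ := hgap
    _ ≤ R ^ n * ballVol n * (2 ^ n * ((4 * k₁ + k₂ / lam) * R ^ n)) := by gcongr
    _ = _ := by ring

/-- The averages of a second difference over large balls converge to its upper limit. -/
theorem exists_le_average (hu : Setting u lam Lam β Γ) (G : Geom u) {e : Eu n} (he : e ∈ Γ)
    {K C τ : ℝ} (hτ : 0 < τ) (hK : ∀ x, sd u e x ≤ K + C * (1 + ‖x‖) ^ (-τ))
    (happ : ∀ ε > 0, ∃ k₀ : ℕ, ∀ k, k₀ ≤ k → ∃ x, u x = G.Θ ^ k ∧ K - ε ≤ sd u e x)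
    {ε : ℝ} (hε : 0 < ε) :
    ∃ R₀ : ℝ, ∀ R, R₀ ≤ R → (K - ε) * (R ^ n * ballVol n) ≤ ∫ x in closedBall 0 R, sd u e x := by
  have hω := ballVol_pos n
  obtain ⟨c, hc, hdens⟩ := hu.exists_density_superlevel G he hτ hK happ
  obtain ⟨C₁, hC₁, hlog⟩ := hu.exists_log_estimate G he hτ hK
  set v := sd u e
  have hv : ContDiff ℝ 2 v := contDiff_sd (m := 2) hu.smooth e
  -- choose the truncation level so that the logarithm is large
  set N := C₁ * (|K| + 1) * 2 / (c * ε * ballVol n) + 1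
  have hN : 0 < N := by positivity
  set s := ε / 2 / (4 * Real.exp N)
  have hs : 0 < s := by positivity
  have hlogN : Real.log (ε / 2 / (4 * s)) = N := by
    have : ε / 2 / (4 * s) = Real.exp N := by simp only [s]; field_simp
    rw [this, Real.log_exp]
  obtain ⟨R₁, hR₁⟩ := hdens s hs
  obtain ⟨R₂, hR₂⟩ := hlog s hs
  refine ⟨max 1 (max R₁ R₂), fun R hR => ?_⟩
  have hR0 : 0 < R := one_pos.trans_le ((le_max_left _ _).trans hR)
  have h1 := hR₁ R (((le_max_left _ _).trans (le_max_right _ _)).trans hR)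
  have h2 := hR₂ R (((le_max_right _ _).trans (le_max_right _ _)).trans hR) (ε / 2) (by
    have h3 : 1 ≤ Real.exp N := Real.one_le_exp hN.le
    simp only [s]
    rw [mul_div_assoc', div_le_iff₀ (by positivity)]
    nlinarith)
  rw [hlogN] at h2
  set B : Set (Eu n) := closedBall 0 R
  have hBc : IsCompact B := isCompact_closedBall 0 R
  set A : Set (Eu n) := {x | v x ≤ K - ε / 2} ∩ B
  have hAc : IsCompact A := hBc.inter_left (isClosed_le hv.continuous continuous_const)
  have hRn : 0 < R ^ n := by positivity
  have hA : |K| * volume.real A ≤ ε / 2 * (R ^ n * ballVol n) := by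
    have h3 : N * (c * R ^ n) * volume.real A ≤ C₁ * (R ^ n * R ^ n) := le_trans (by gcongr) h2
    have h4 : R ^ n * (N * c * volume.real A) ≤ R ^ n * (C₁ * R ^ n) := by linarith
    have h5 := le_of_mul_le_mul_left h4 hRn
    have h6 : C₁ * (|K| + 1) * 2 / (c * ε * ballVol n) * c * volume.real A ≤ C₁ * R ^ n := by
      refine le_trans ?_ h5
      gcongr
      simp only [N]; linarith
    have h7 : C₁ * (|K| + 1) * 2 / (c * ε * ballVol n) * c * volume.real A
        = C₁ * ((|K| + 1) * volume.real A * 2 / (ε * ballVol n)) := by field_simp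
    rw [h7] at h6
    have h8 := le_of_mul_le_mul_left h6 hC₁
    rw [div_le_iff₀ (by positivity)] at h8
    have : 0 ≤ volume.real A := measureReal_nonneg
    linarith
  have hcB : IntegrableOn (fun _ : Eu n => K - ε / 2) B :=
    integrableOn_const hBc.measure_lt_top.ne enorm_ne_top
  have hcA : IntegrableOn (fun _ : Eu n => |K|) A :=
    integrableOn_const hAc.measure_lt_top.ne enorm_ne_top
  have hiA : IntegrableOn (A.indicator fun _ => |K|) B :=
    (hcA.integrable_indicator hAc.measurableSet).integrableOn
  calc (K - ε) * (R ^ n * ballVol n) ≤ (K - ε / 2) * (R ^ n * ballVol n) - |K| * volume.real A := by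
        linarith
    _ = ∫ x in B, ((K - ε / 2) - A.indicator (fun _ => |K|) x) := by
        rw [integral_sub hcB hiA, setIntegral_const, smul_eq_mul, volume_closedBall 0 hR0.le,
          setIntegral_indicator hAc.measurableSet, setIntegral_const, smul_eq_mul,
          Set.inter_eq_self_of_subset_right Set.inter_subset_right]
        ring
    _ ≤ ∫ x in B, v x := by
        refine setIntegral_mono_on (hcB.sub hiA) (hv.continuous.integrableOn_compact hBc)
          hBc.measurableSet fun x hx => ?_
        by_cases hxA : x ∈ A
        · rw [indicator_of_mem hxA]
          have := hu.toConvexC2.sd_nonneg e x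
          have := le_abs_self K
          simp only [v]; linarith
        · rw [indicator_of_notMem hxA, sub_zero]
          by_contra! hcon
          exact hxA ⟨hcon.le, hx⟩

end Setting

section BallMean

theorem hasFDerivAt_integral_translate {E : Type} [NormedAddCommGroup E] [NormedSpace ℝ E]
    [CompleteSpace E] {F : Eu n → E} (hF : ContDiff ℝ 1 F) {K : Set (Eu n)} (hK : IsCompact K)
    (x : Eu n) :
    HasFDerivAt (fun x => ∫ y in K, F (x + y)) (∫ y in K, fderiv ℝ F (x + y)) x := by
  have hF' : Continuous (fderiv ℝ F) := hF.continuous_fderiv (by norm_num)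
  obtain ⟨C, hC⟩ := ((isCompact_closedBall x 1).prod hK).exists_bound_of_continuousOn
    (f := fun p : Eu n × Eu n => fderiv ℝ F (p.1 + p.2)) (by fun_prop)
  have hc : ∀ z, Continuous fun y => F (z + y) := fun z => hF.continuous.comp (by fun_prop)
  have hc' : ∀ z, Continuous fun y => fderiv ℝ F (z + y) := fun z => hF'.comp (by fun_prop)
  refine hasFDerivAt_integral_of_dominated_of_fderiv_le (bound := fun _ => C)
    (F' := fun z y => fderiv ℝ F (z + y)) (Metric.closedBall_mem_nhds x one_pos)
    (.of_forall fun z => ((hc z).integrableOn_compact hK).1)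
    ((hc x).integrableOn_compact hK)
    ((hc' x).integrableOn_compact hK).1 ?_
    (integrableOn_const hK.measure_lt_top.ne enorm_ne_top) ?_
  · exact (ae_restrict_iff' hK.measurableSet).2 (.of_forall fun y hy z hz => hC (z, y) ⟨hz, hy⟩)
  · refine Eventually.of_forall fun y z _ => ?_
    have h1 := (hF.differentiable (by norm_num) (z + y)).hasFDerivAt.comp z
      ((hasFDerivAt_id z).add_const y)
    rwa [ContinuousLinearMap.comp_id] at h1

theorem contDiff_integral_translate (m : ℕ) {E : Type} [NormedAddCommGroup E] [NormedSpace ℝ E]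
    [CompleteSpace E] {F : Eu n → E} (hF : ContDiff ℝ m F) {K : Set (Eu n)} (hK : IsCompact K) :
    ContDiff ℝ m fun x => ∫ y in K, F (x + y) := by
  induction m generalizing E with
  | zero =>
    have hFc := hF.continuous
    exact contDiff_zero.2 (continuous_parametric_integral_of_continuous
      (f := fun x y => F (x + y)) (by fun_prop) hK)
  | succ m ih =>
    have h1 : ContDiff ℝ 1 F := hF.of_le (by norm_cast; omega)
    have hd := hasFDerivAt_integral_translate h1 hK
    have hF2 : ContDiff ℝ ((m : WithTop ℕ∞) + 1) F := by exact_mod_cast hF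
    suffices h : ContDiff ℝ ((m : WithTop ℕ∞) + 1) fun x => ∫ y in K, F (x + y) by exact_mod_cast h
    refine contDiff_succ_iff_fderiv.2 ⟨fun x => (hd x).differentiableAt, fun h => by simp at h, ?_⟩
    rw [show fderiv ℝ (fun x => ∫ y in K, F (x + y)) = fun x => ∫ y in K, fderiv ℝ F (x + y) from
      funext fun x => (hd x).fderiv]
    exact ih (contDiff_succ_iff_fderiv.1 hF2).2.2

/-- The mean of a function over the ball of radius `ρ` around a point. -/
noncomputable def bm (ρ : ℝ) (F : Eu n → ℝ) (x : Eu n) : ℝ :=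
  (ρ ^ n * ballVol n)⁻¹ * ∫ y in closedBall 0 ρ, F (x + y)

variable {ρ : ℝ} {F H : Eu n → ℝ}

theorem bm_eq (ρ : ℝ) (F : Eu n → ℝ) (x : Eu n) :
    bm ρ F x = (ρ ^ n * ballVol n)⁻¹ * ∫ y in closedBall x ρ, F y := by
  rw [bm, ← setIntegral_comp_add (closedBall x ρ) x]
  congr 2
  · ext y; simp
  · funext y; rw [add_comm]

theorem contDiff_bm (m : ℕ) (hF : ContDiff ℝ m F) : ContDiff ℝ m (bm ρ F) :=
  contDiff_const.mul (contDiff_integral_translate m hF (isCompact_closedBall 0 ρ))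

theorem continuous_bm (hF : Continuous F) : Continuous (bm ρ F) :=
  (contDiff_bm 0 (contDiff_zero.2 hF)).continuous

theorem integrableOn_comp_add (hF : Continuous F) (ρ : ℝ) (x : Eu n) :
    IntegrableOn (fun y => F (x + y)) (closedBall 0 ρ) :=
  (hF.comp (by fun_prop)).integrableOn_compact (isCompact_closedBall 0 ρ)

theorem fderiv_bm (hF : ContDiff ℝ 1 F) (x a : Eu n) :
    fderiv ℝ (bm ρ F) x a = bm ρ (fun z => fderiv ℝ F z a) x := by
  have h1 := (hasFDerivAt_integral_translate hF (isCompact_closedBall 0 ρ) x).const_mul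
    (ρ ^ n * ballVol n)⁻¹
  have hc : Continuous fun y => fderiv ℝ F (x + y) :=
    (hF.continuous_fderiv (by norm_num)).comp (by fun_prop)
  rw [show fderiv ℝ (bm ρ F) x = _ from h1.fderiv, _root_.smul_apply, smul_eq_mul,
    ContinuousLinearMap.integral_apply (hc.integrableOn_compact (isCompact_closedBall 0 ρ))]
  rfl

theorem D2_eq_fderiv_apply (hu : ContDiff ℝ 2 u) (x a b : Eu n) :
    D2 u x a b = fderiv ℝ (fun z => fderiv ℝ u z b) x a := by
  rw [D2]
  have h := (differentiable_fderiv hu x).hasFDerivAt.clm_apply (hasFDerivAt_const b x)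
  rw [h.fderiv]; simp

theorem D2_bm (hu : ContDiff ℝ 2 u) (x a b : Eu n) :
    D2 (bm ρ u) x a b = bm ρ (fun z => D2 u z a b) x := by
  have h1 : ContDiff ℝ 1 u := hu.of_le (by norm_num)
  rw [D2_eq_fderiv_apply (contDiff_bm 2 hu)]
  simp only [fderiv_bm h1, D2_eq_fderiv_apply hu]
  exact fderiv_bm (contDiff_fderiv_apply (m := 2) (k := 1) hu (by norm_num) b) x a

theorem bm_mono (hρ : 0 < ρ) (hF : Continuous F) (hH : Continuous H) {x : Eu n}
    (h : ∀ y, ‖y‖ ≤ ρ → F (x + y) ≤ H (x + y)) : bm ρ F x ≤ bm ρ H x := by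
  have := ballVol_pos n
  refine mul_le_mul_of_nonneg_left ?_ (by positivity)
  exact setIntegral_mono_on (integrableOn_comp_add hF ρ x) (integrableOn_comp_add hH ρ x)
    measurableSet_closedBall fun y hy => h y (mem_closedBall_zero_iff.1 hy)

theorem bm_const (hρ : 0 < ρ) (c : ℝ) (x : Eu n) : bm ρ (fun _ => c) x = c := by
  have := ballVol_pos n
  rw [bm, setIntegral_const, smul_eq_mul, volume_closedBall 0 hρ.le, ← mul_assoc,
    inv_mul_cancel₀ (by positivity), one_mul]

theorem bm_add (hF : Continuous F) (hH : Continuous H) (x : Eu n) :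
    bm ρ (fun z => F z + H z) x = bm ρ F x + bm ρ H x := by
  rw [bm, integral_add (integrableOn_comp_add hF ρ x) (integrableOn_comp_add hH ρ x), mul_add]; rfl

theorem bm_const_mul (c : ℝ) (F : Eu n → ℝ) (x : Eu n) :
    bm ρ (fun z => c * F z) x = c * bm ρ F x := by
  rw [bm, integral_const_mul]; simp only [bm]; ring

theorem bm_sum {ι : Type*} (s : Finset ι) {F : ι → Eu n → ℝ} (hF : ∀ i ∈ s, Continuous (F i))
    (x : Eu n) : bm ρ (fun z => ∑ i ∈ s, F i z) x = ∑ i ∈ s, bm ρ (F i) x := by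
  simp only [bm]
  rw [integral_finsetSum _ fun i hi => integrableOn_comp_add (hF i hi) ρ x, mul_sum]

end BallMean


theorem sd_eq_integral (hu : ContDiff ℝ 2 u) (e y : Eu n) :
    sd u e y = ∫ s in (0 : ℝ)..1, ∫ t in (0 : ℝ)..1, D2 u (y + (s + t - 1) • e) e e := by
  have h1 : ∀ s : ℝ, ∫ t in (0 : ℝ)..1, D2 u (y + (s + t - 1) • e) e e
      = fderiv ℝ u (y + s • e) e - fderiv ℝ u (y - e + s • e) e := by
    intro s
    have h2 := integral_D2_line hu (y - e + s • e) e e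
    rw [show y - e + s • e + e = y + s • e by abel] at h2
    rw [← h2]
    congr 1; funext t; congr 1; module
  have hu1 : ContDiff ℝ 1 u := hu.of_le (by norm_num)
  have hline : ∀ p : Eu n, ∫ s in (0 : ℝ)..1, fderiv ℝ u (p + s • e) e = u (p + e) - u p := by
    intro p
    have hc : Continuous fun s : ℝ => fderiv ℝ u (p + s • e) e :=
      ((hu1.continuous_fderiv (by norm_num)).comp (by fun_prop)).clm_apply continuous_const
    rw [integral_eq_sub_of_hasDerivAt (fun s _ => hasDerivAt_line hu1 p e s)
      (hc.intervalIntegrable _ _)]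
    simp
  have hi : ∀ p : Eu n, IntervalIntegrable (fun s : ℝ => fderiv ℝ u (p + s • e) e) volume 0 1 :=
    fun p => (((hu1.continuous_fderiv (by norm_num)).comp (by fun_prop)).clm_apply
      continuous_const).intervalIntegrable _ _
  simp only [h1]
  rw [intervalIntegral.integral_sub (hi y) (hi (y - e)), hline, hline, sub_add_cancel]
  unfold sd; ring

theorem integral_sd_eq (hu : ContDiff ℝ 2 u) (e : Eu n) {K : Set (Eu n)} (hK : IsCompact K) :
    ∫ y in K, sd u e y
      = ∫ s in (0 : ℝ)..1, ∫ t in (0 : ℝ)..1, ∫ y in K, D2 u (y + (s + t - 1) • e) e e := by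
  have hD := continuous_D2 hu e e
  have h1 : Continuous fun p : ℝ × Eu n => ∫ t in (0 : ℝ)..1, D2 u (p.2 + (p.1 + t - 1) • e) e e :=
    continuous_parametric_intervalIntegral_of_continuous'
      (f := fun (p : ℝ × Eu n) t => D2 u (p.2 + (p.1 + t - 1) • e) e e) (hD.comp (by fun_prop)) 0 1
  simp only [sd_eq_integral hu]
  rw [← integral_segment_swap h1 hK]
  congr 1; funext s
  exact (integral_segment_swap (F := fun p => D2 u (p.2 + (s + p.1 - 1) • e) e e)
    (hD.comp (by fun_prop)) hK).symm

theorem integral_sd_bounds (hu : ContDiff ℝ 2 u) (e : Eu n) {K : Set (Eu n)} (hK : IsCompact K)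
    {m M : ℝ} (h : ∀ θ : ℝ, |θ| ≤ 1 → m ≤ ∫ y in K, D2 u (y + θ • e) e e ∧
      ∫ y in K, D2 u (y + θ • e) e e ≤ M) :
    m ≤ ∫ y in K, sd u e y ∧ ∫ y in K, sd u e y ≤ M := by
  have hD := continuous_D2 hu e e
  set Φ : ℝ → ℝ := fun θ => ∫ y in K, D2 u (y + θ • e) e e
  have hΦ : Continuous Φ := continuous_parametric_integral_of_continuous
    (f := fun θ y => D2 u (y + θ • e) e e) (hD.comp (by fun_prop)) hK
  have hΦ2 : Continuous fun s : ℝ => ∫ t in (0 : ℝ)..1, Φ (s + t - 1) :=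
    continuous_parametric_intervalIntegral_of_continuous'
      (f := fun s t => Φ (s + t - 1)) (hΦ.comp (by fun_prop)) 0 1
  have hΦ1 : ∀ s : ℝ, IntervalIntegrable (fun t => Φ (s + t - 1)) volume 0 1 := fun s =>
    (hΦ.comp (by fun_prop)).intervalIntegrable _ _
  have hab : ∀ s ∈ Set.Icc (0 : ℝ) 1, ∀ t ∈ Set.Icc (0 : ℝ) 1, |s + t - 1| ≤ 1 :=
    fun s hs t ht => abs_le.2 ⟨by linarith [hs.1, ht.1], by linarith [hs.2, ht.2]⟩
  rw [integral_sd_eq hu e hK]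
  have hc : ∀ c : ℝ, ∫ _s in (0 : ℝ)..1, ∫ _t in (0 : ℝ)..1, c = c := fun c => by simp
  constructor
  · rw [← hc m]
    refine integral_mono_on zero_le_one (by simp) (hΦ2.intervalIntegrable _ _)
      fun s hs => integral_mono_on zero_le_one (by simp) (hΦ1 s) fun t ht => (h _ (hab s hs t ht)).1
  · rw [← hc M]
    refine integral_mono_on zero_le_one (hΦ2.intervalIntegrable _ _) (by simp)
      fun s hs => integral_mono_on zero_le_one (hΦ1 s) (by simp) fun t ht => (h _ (hab s hs t ht)).2

/-- Second differences and pure second derivatives have comparable integrals over balls. -/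
theorem ConvexC2.integral_sd_ball (hu : ConvexC2 u) (e x : Eu n) (ρ : ℝ) :
    ∫ y in closedBall x ρ, D2 u y e e ≤ ∫ y in closedBall x (ρ + ‖e‖), sd u e y ∧
    ∫ y in closedBall x ρ, sd u e y ≤ ∫ y in closedBall x (ρ + ‖e‖), D2 u y e e := by
  have hD := continuous_D2 hu.smooth e e
  have key : ∀ (θ r s : ℝ), |θ| ≤ 1 → r + ‖e‖ ≤ s →
      ∫ y in closedBall x r, D2 u (y + θ • e) e e ≤ ∫ y in closedBall x s, D2 u y e e ∧
      ∫ y in closedBall x r, D2 u y e e ≤ ∫ y in closedBall x s, D2 u (y + θ • e) e e := by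
    intro θ r s hθ hrs
    have hθe : ‖θ • e‖ ≤ ‖e‖ := by rw [norm_smul]; exact mul_le_of_le_one_left (norm_nonneg e) hθ
    have hpre : ∀ t : ℝ, (fun y => y + θ • e) ⁻¹' closedBall x t = closedBall (x - θ • e) t := by
      intro t; ext y
      simp only [Set.mem_preimage, mem_closedBall_iff_norm]
      rw [show y + θ • e - x = y - (x - θ • e) by abel]
    constructor
    · rw [← setIntegral_comp_add (closedBall x s) (θ • e), hpre]
      refine setIntegral_mono_set ((hD.comp (by fun_prop)).integrableOn_compact
        (isCompact_closedBall _ _)) (.of_forall fun y => hu.D2_nonneg _ e)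
        (LE.le.eventuallyLE (closedBall_subset_closedBall' ?_))
      rw [dist_eq_norm, sub_sub_cancel]; linarith
    · rw [← setIntegral_comp_add (closedBall x r) (θ • e), hpre]
      refine setIntegral_mono_set ((hD.comp (by fun_prop)).integrableOn_compact
        (isCompact_closedBall _ _)) (.of_forall fun y => hu.D2_nonneg _ e)
        (LE.le.eventuallyLE (closedBall_subset_closedBall' ?_))
      rw [dist_eq_norm, sub_sub_cancel_left, norm_neg]; linarith
  constructor
  · refine (integral_sd_bounds hu.smooth e (isCompact_closedBall x (ρ + ‖e‖))
      (M := ∫ y in closedBall x (ρ + ‖e‖ + ‖e‖), D2 u y e e) fun θ hθ => ⟨?_, ?_⟩).1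
    · exact (key θ ρ (ρ + ‖e‖) hθ le_rfl).2
    · exact (key θ (ρ + ‖e‖) _ hθ le_rfl).1
  · refine (integral_sd_bounds hu.smooth e (isCompact_closedBall x ρ) (m := 0)
      fun θ hθ => ⟨?_, ?_⟩).2
    · exact setIntegral_nonneg measurableSet_closedBall fun y _ => hu.D2_nonneg _ e
    · exact (key θ ρ (ρ + ‖e‖) hθ le_rfl).1

theorem integral_decay_le {τ : ℝ} (h0 : 0 < τ) (h1 : τ ≤ 1) (hn : 0 < n) {ρ : ℝ} (hρ : 1 ≤ ρ)
    (x : Eu n) : ∫ y in closedBall x ρ, (1 + ‖y‖) ^ (-τ)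
      ≤ 2 * (ρ ^ n * ballVol n) * ρ ^ (-(τ / 2)) := by
  have hω := ballVol_pos n
  have hρ0 : 0 < ρ := by linarith
  set s := √ρ
  have hs : 0 < s := sqrt_pos.2 hρ0
  set A : Set (Eu n) := closedBall 0 s
  have hAm : MeasurableSet A := measurableSet_closedBall
  have hc : Continuous fun y : Eu n => (1 + ‖y‖) ^ (-τ) :=
    (by fun_prop : Continuous fun y : Eu n => 1 + ‖y‖).rpow_const fun y => Or.inl (by positivity)
  have hcA : IntegrableOn (fun _ : Eu n => (1 : ℝ)) A :=
    integrableOn_const measure_closedBall_lt_top.ne enorm_ne_top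
  have hiA : Integrable (A.indicator fun _ : Eu n => (1 : ℝ)) := hcA.integrable_indicator hAm
  have hcB : IntegrableOn (fun _ : Eu n => ρ ^ (-(τ / 2))) (closedBall x ρ) :=
    integrableOn_const measure_closedBall_lt_top.ne enorm_ne_top
  have e1 : ρ ^ (-(τ / 2)) = s ^ (-τ) := by
    simp only [s]
    rw [sqrt_eq_rpow, ← rpow_mul hρ0.le]; congr 1; ring
  have e2 : s ^ n ≤ ρ ^ n * ρ ^ (-(τ / 2)) := by
    have h2 : ρ ^ n = s ^ n * s ^ n := by rw [← mul_pow]; simp only [s]; rw [mul_self_sqrt hρ0.le]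
    have hs1 : 1 ≤ s := by simp only [s]; rw [Real.one_le_sqrt]; exact hρ
    have h3 : 1 ≤ s ^ n * s ^ (-τ) := by
      rw [← rpow_natCast, ← rpow_add hs]
      refine Real.one_le_rpow hs1 ?_
      have : (1 : ℝ) ≤ n := by exact_mod_cast hn
      linarith
    rw [e1, h2, mul_assoc]
    exact le_mul_of_one_le_right (by positivity) h3
  calc ∫ y in closedBall x ρ, (1 + ‖y‖) ^ (-τ)
      ≤ ∫ y in closedBall x ρ, (A.indicator (fun _ => 1) y + ρ ^ (-(τ / 2))) := by
        refine setIntegral_mono (hc.integrableOn_compact (isCompact_closedBall x ρ))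
          (hiA.integrableOn.add hcB) fun y => ?_
        by_cases hy : y ∈ A
        · simp only [indicator_of_mem hy]
          have h2 : (1 + ‖y‖) ^ (-τ) ≤ 1 := Real.rpow_le_one_of_one_le_of_nonpos
            (by linarith [norm_nonneg y]) (by linarith)
          have : 0 ≤ ρ ^ (-(τ / 2)) := by positivity
          linarith
        · simp only [indicator_of_notMem hy, zero_add, e1]
          have h2 : s < ‖y‖ := by simpa [A] using hy
          exact rpow_le_rpow_of_nonpos hs (by linarith) (by linarith)
    _ ≤ s ^ n * ballVol n + ρ ^ n * ballVol n * ρ ^ (-(τ / 2)) := by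
        rw [integral_add hiA.integrableOn hcB, setIntegral_const, smul_eq_mul,
          volume_closedBall x hρ0.le]
        gcongr
        refine (setIntegral_le_integral hiA (.of_forall fun y =>
          indicator_nonneg (fun _ _ => zero_le_one) y)).trans_eq ?_
        rw [integral_indicator hAm, setIntegral_const, smul_eq_mul, mul_one,
          volume_closedBall 0 hs.le]
    _ ≤ ρ ^ n * ρ ^ (-(τ / 2)) * ballVol n + ρ ^ n * ballVol n * ρ ^ (-(τ / 2)) := by gcongr
    _ = _ := by ring

theorem one_add_div_pow_le {a ρ : ℝ} (ha : 0 ≤ a) (hρ : 1 ≤ ρ) (n : ℕ) :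
    (1 + a / ρ) ^ n ≤ 1 + (1 + a) ^ n * ρ⁻¹ := by
  have hρ0 : 0 < ρ := by linarith
  have hi : ρ⁻¹ ≤ 1 := inv_le_one_of_one_le₀ hρ
  have h := (convexOn_pow n).2 (show (1 : ℝ) ∈ Set.Ici 0 by simp) (show 1 + a ∈ Set.Ici 0 by
    simp; linarith) (show 0 ≤ 1 - ρ⁻¹ by linarith) (show 0 ≤ ρ⁻¹ by positivity) (by ring)
  simp only [smul_eq_mul, mul_one, one_pow] at h
  rw [show 1 - ρ⁻¹ + ρ⁻¹ * (1 + a) = 1 + a / ρ by ring] at h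
  have : 0 ≤ ρ⁻¹ := by positivity
  linarith

namespace Setting

theorem exists_bm_D2_le (hu : Setting u lam Lam β Γ) {e : Eu n} {K C τ : ℝ} (hτ : 0 < τ)
    (hτ1 : τ ≤ 1) (hC : 0 < C) (hK : ∀ x, sd u e x ≤ K + C * (1 + ‖x‖) ^ (-τ)) :
    ∃ C' > 0, ∀ ρ, 1 ≤ ρ → ∀ x, bm ρ (fun z => D2 u z e e) x ≤ K + C' * ρ ^ (-(τ / 2)) := by
  have hω := ballVol_pos n
  set M := (1 + ‖e‖) ^ n
  have hM : 0 < M := by positivity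
  refine ⟨|K| * M + 2 * C * (1 + M), by positivity, fun ρ hρ x => ?_⟩
  have hρ0 : 0 < ρ := by linarith
  set s := ρ + ‖e‖
  have hs : 1 ≤ s := by simp only [s]; linarith [norm_nonneg e]
  have hs0 : 0 < s := by linarith
  have hv : ContDiff ℝ 2 (sd u e) := contDiff_sd (m := 2) hu.smooth e
  have hc : Continuous fun y : Eu n => (1 + ‖y‖) ^ (-τ) :=
    (by fun_prop : Continuous fun y : Eu n => 1 + ‖y‖).rpow_const fun y => Or.inl (by positivity)
  have hcK : IntegrableOn (fun _ : Eu n => K) (closedBall x s) :=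
    integrableOn_const measure_closedBall_lt_top.ne enorm_ne_top
  have hcC : IntegrableOn (fun y : Eu n => C * (1 + ‖y‖) ^ (-τ)) (closedBall x s) :=
    (hc.const_mul C).integrableOn_compact (isCompact_closedBall x s)
  have h1 : ∫ y in closedBall x s, sd u e y
      ≤ K * (s ^ n * ballVol n) + C * (2 * (s ^ n * ballVol n) * s ^ (-(τ / 2))) := by
    calc _ ≤ ∫ y in closedBall x s, (K + C * (1 + ‖y‖) ^ (-τ)) :=
          setIntegral_mono (hv.continuous.integrableOn_compact (isCompact_closedBall x s))
            (hcK.add hcC) hK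
      _ = K * (s ^ n * ballVol n) + C * ∫ y in closedBall x s, (1 + ‖y‖) ^ (-τ) := by
          rw [integral_add hcK hcC, setIntegral_const, smul_eq_mul, volume_closedBall x hs0.le,
            integral_const_mul, mul_comm]
      _ ≤ _ := by gcongr; exact integral_decay_le hτ hτ1 hu.dim_pos hs x
  have h2 := (hu.toConvexC2.integral_sd_ball e x ρ).1.trans h1
  rw [bm_eq, inv_mul_le_iff₀ (by positivity)]
  refine h2.trans ?_
  set y := (1 + ‖e‖ / ρ) ^ n
  have hy1 : 1 ≤ y := one_le_pow₀ (by have : 0 ≤ ‖e‖ / ρ := by positivity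
                                      linarith)
  have hsy : s ^ n = ρ ^ n * y := by simp only [s, y]; rw [← mul_pow]; congr 1; field_simp
  have hy := one_add_div_pow_le (norm_nonneg e) hρ n
  have hρi : ρ⁻¹ ≤ ρ ^ (-(τ / 2)) := by
    rw [← Real.rpow_neg_one]
    exact rpow_le_rpow_of_exponent_le hρ (by linarith)
  have hsρ : s ^ (-(τ / 2)) ≤ ρ ^ (-(τ / 2)) :=
    rpow_le_rpow_of_nonpos hρ0 (by simp only [s]; linarith [norm_nonneg e]) (by linarith)
  set p := ρ ^ (-(τ / 2))
  have hp : 0 < p := by positivity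
  have hyp : y ≤ 1 + M * p := hy.trans (by gcongr)
  have hyM : y ≤ 1 + M := hy.trans (by
    have : ρ⁻¹ ≤ 1 := inv_le_one_of_one_le₀ hρ
    nlinarith)
  have h3 : K * y ≤ K + |K| * M * p := by
    have h4 : K * (y - 1) ≤ |K| * (M * p) :=
      mul_le_mul (le_abs_self K) (by linarith) (by linarith) (abs_nonneg K)
    linarith
  have h5 : C * (2 * y * s ^ (-(τ / 2))) ≤ 2 * C * (1 + M) * p := by
    calc C * (2 * y * s ^ (-(τ / 2))) ≤ C * (2 * (1 + M) * p) := by gcongr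
      _ = _ := by ring
  rw [hsy]
  calc _ = (ρ ^ n * ballVol n) * (K * y + C * (2 * y * s ^ (-(τ / 2)))) := by ring
    _ ≤ (ρ ^ n * ballVol n) * (K + (|K| * M + 2 * C * (1 + M)) * p) := by
        refine mul_le_mul_of_nonneg_left ?_ (by positivity)
        linarith

/-- Means of pure second derivatives along the lattice: a uniform upper bound with a rate, and
convergence of the means over balls centered at the origin. -/
theorem exists_bm_D2_limit (hu : Setting u lam Lam β Γ) (G : Geom u) :
    ∃ τ : ℝ, 0 < τ ∧ τ ≤ 1 ∧ ∀ e ∈ Γ, ∃ K C : ℝ, 0 < C ∧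
      (∀ ρ, 1 ≤ ρ → ∀ x, bm ρ (fun z => D2 u z e e) x ≤ K + C * ρ ^ (-τ)) ∧
      Tendsto (fun R => bm R (fun z => D2 u z e e) 0) atTop (nhds K) := by
  have hω := ballVol_pos n
  obtain ⟨τ, hτ, hτ1, hlim⟩ := hu.exists_limit G
  refine ⟨τ / 2, by positivity, by linarith, fun e he => ?_⟩
  obtain ⟨K, C, hC, hK, happ⟩ := hlim e he
  obtain ⟨C', hC', hup⟩ := hu.exists_bm_D2_le hτ (by linarith) hC hK
  refine ⟨K, C', hC', hup, ?_⟩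
  rw [tendsto_order]
  constructor
  · intro a ha
    set ε := (K - a) / 2
    have hε : 0 < ε := by simp only [ε]; linarith
    obtain ⟨R₀, hR₀⟩ := hu.exists_le_average G he hτ hK happ hε
    have hr : Tendsto (fun R : ℝ => (K - ε) * (1 - ‖e‖ * R⁻¹) ^ n) atTop
        (nhds ((K - ε) * (1 - ‖e‖ * 0) ^ n)) :=
      ((tendsto_const_nhds.sub (tendsto_inv_atTop_zero.const_mul ‖e‖)).pow n).const_mul _
    rw [mul_zero, sub_zero, one_pow, mul_one] at hr
    filter_upwards [hr.eventually_const_lt (show a < K - ε by simp only [ε]; linarith),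
      eventually_ge_atTop (max R₀ 1 + ‖e‖)] with R h1 h2
    have hR1 : 1 ≤ R := by linarith [le_max_right R₀ 1, norm_nonneg e]
    have hR0 : 0 < R := by linarith
    have h3 := hR₀ (R - ‖e‖) (by linarith [le_max_left R₀ 1])
    have h4 := (hu.toConvexC2.integral_sd_ball e 0 (R - ‖e‖)).2
    rw [sub_add_cancel] at h4
    rw [bm_eq]
    refine h1.trans_le ?_
    rw [le_inv_mul_iff₀ (by positivity)]
    refine le_trans (le_of_eq ?_) (h3.trans h4)
    have : (R - ‖e‖) ^ n = R ^ n * (1 - ‖e‖ * R⁻¹) ^ n := by rw [← mul_pow]; congr 1; field_simp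
    rw [this]; ring
  · intro a ha
    have hr : Tendsto (fun R : ℝ => K + C' * R ^ (-(τ / 2))) atTop (nhds (K + C' * 0)) :=
      ((tendsto_rpow_neg_atTop (by positivity)).const_mul C').const_add K
    rw [mul_zero, add_zero] at hr
    filter_upwards [hr.eventually_lt_const ha, eventually_ge_atTop 1] with R h1 h2
    exact (hup R h2 0).trans_lt h1

end Setting

section LimitMatrix

variable {ρ : ℝ}

theorem ConvexC2.bm (hu : ConvexC2 u) (hρ : 0 < ρ) : ConvexC2 (MongeAmpere.bm ρ u) := by
  have hs := contDiff_bm (ρ := ρ) 2 hu.smooth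
  refine ⟨hs, fun x => .of_dotProduct_mulVec_pos ?_ fun v hv => ?_⟩
  · rw [IsHermitian, conjTranspose_eq_transpose_of_trivial]; exact hess_isSymm hs x
  · set w : Eu n := WithLp.toLp 2 v with hw
    have hw0 : w ≠ 0 := by
      intro h
      exact hv (by simpa [hw] using congrArg WithLp.ofLp h)
    have hD := continuous_D2 hu.smooth w w
    obtain ⟨y₀, -, hy₀⟩ := (isCompact_closedBall (0 : Eu n) ρ).exists_isMinOn
      ⟨0, by simp [hρ.le]⟩ (f := fun y => D2 u (x + y) w w) (hD.comp (by fun_prop)).continuousOn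
    have h1 : D2 u (x + y₀) w w ≤ D2 (MongeAmpere.bm ρ u) x w w := by
      rw [D2_bm hu.smooth, ← bm_const hρ (D2 u (x + y₀) w w) x]
      exact bm_mono hρ continuous_const hD fun y hy => hy₀ (by simpa using hy)
    have h2 := (hu.D2_pos (x + y₀) hw0).trans_le h1
    rw [D2_eq_dotProduct] at h2
    simpa [hw] using h2

theorem hess_bm (hu : ContDiff ℝ 2 u) (x : Eu n) (i j : Fin n) :
    hess (bm ρ u) x i j = bm ρ (fun z => hess u z i j) x := by
  simp only [hess_apply, D2_bm hu]

theorem continuous_hess_apply (hu : ContDiff ℝ 2 u) (i j : Fin n) :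
    Continuous fun z => hess u z i j := (continuous_hess hu).matrix_elem i j

theorem continuous_trace_mul_hess (hu : ContDiff ℝ 2 u) (M : Mat n) :
    Continuous fun z => (M * hess u z).trace :=
  (continuous_const.matrix_mul (continuous_hess hu)).matrix_trace

theorem trace_mul_hess_bm (hu : ContDiff ℝ 2 u) (M : Mat n) (x : Eu n) :
    (M * hess (bm ρ u) x).trace = bm ρ (fun z => (M * hess u z).trace) x := by
  have hc := continuous_hess_apply hu
  simp only [Matrix.trace, Matrix.diag, Matrix.mul_apply, hess_bm hu]
  rw [bm_sum univ (F := fun i z => ∑ j, M i j * hess u z j i) fun i _ => by fun_prop]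
  refine sum_congr rfl fun i _ => ?_
  rw [bm_sum univ (F := fun j z => M i j * hess u z j i) fun j _ => by fun_prop]
  exact sum_congr rfl fun j _ => (bm_const_mul _ _ _).symm

theorem ConvexC2.le_det_hess_bm (hu : ConvexC2 u) (hn : 0 < n) (hρ : 0 < ρ) {lam : ℝ}
    (hlam : 0 < lam) (hl : ∀ z, lam ≤ (hess u z).det) (x : Eu n) :
    lam ≤ (hess (MongeAmpere.bm ρ u) x).det := by
  set H := hess (MongeAmpere.bm ρ u) x
  have hH : H.PosDef := (hu.bm hρ).pos x
  have hd := hH.det_pos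
  have hn' : (0 : ℝ) < n := by exact_mod_cast hn
  have hmean : n * lam ^ ((1 : ℝ) / n) ≤ H.det ^ ((1 : ℝ) / n) * (H⁻¹ * H).trace := by
    rw [trace_mul_hess_bm hu.smooth, ← bm_const_mul, ← bm_const hρ (n * lam ^ ((1 : ℝ) / n)) x]
    refine bm_mono hρ continuous_const
      (continuous_const.mul (continuous_trace_mul_hess hu.smooth _)) fun y _ => ?_
    refine le_trans ?_ (rpow_det_le_trace hn hH (hu.pos (x + y)).posSemidef)
    exact mul_le_mul_of_nonneg_left (Real.rpow_le_rpow hlam.le (hl _) (by positivity)) hn'.le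
  rw [nonsing_inv_mul _ hd.ne'.isUnit, trace_one, Fintype.card_fin, mul_comm] at hmean
  exact (Real.rpow_le_rpow_iff hlam.le hd.le (by positivity)).1 (le_of_mul_le_mul_right hmean hn')

theorem quadForm_eq_sum (A : Mat n) (e : Eu n) :
    e.ofLp ⬝ᵥ A *ᵥ e.ofLp = ∑ i, ∑ j, e i * e j * A i j := by
  simp only [dotProduct, mulVec, mul_sum]
  exact sum_congr rfl fun i _ => sum_congr rfl fun j _ => by ring

namespace Setting

/-- The means of the Hessian over large balls converge to a positive definite matrix, which bounds
the means over all balls from above in the directions of the period lattice. -/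
theorem exists_matrix (hu : Setting u lam Lam β Γ) (G : Geom u) {a : Fin n → ℝ}
    (ha0 : ∀ i, 0 < a i) (ha : ∀ i, single i (a i) ∈ Γ) :
    ∃ A : Mat n, A.PosDef ∧ (∀ i j, Tendsto (fun R => bm R (fun z => hess u z i j) 0) atTop
        (nhds (A i j))) ∧
      ∃ τ : ℝ, 0 < τ ∧ τ ≤ 1 ∧ ∀ e ∈ Γ, ∃ C > 0, ∀ ρ, 1 ≤ ρ → ∀ x,
        bm ρ (fun z => D2 u z e e) x ≤ e.ofLp ⬝ᵥ A *ᵥ e.ofLp + C * ρ ^ (-τ) := by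
  have hs := hu.smooth
  have hc := continuous_hess_apply hs
  obtain ⟨τ, hτ, hτ1, hK⟩ := hu.exists_bm_D2_limit G
  have hlim : ∀ i j, ∃ l, Tendsto (fun R => bm R (fun z => hess u z i j) 0) atTop (nhds l) := by
    intro i j
    obtain ⟨K₁, -, -, -, h₁⟩ := hK _ (ha i)
    obtain ⟨K₂, -, -, -, h₂⟩ := hK _ (ha j)
    obtain ⟨K₃, -, -, -, h₃⟩ := hK _ (Γ.add_mem (ha i) (ha j))
    refine ⟨(2 * (a i * a j))⁻¹ * (K₃ - K₁ - K₂),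
      (((h₃.sub h₁).sub h₂).const_mul (2 * (a i * a j))⁻¹).congr fun R => ?_⟩
    have hi := ha0 i
    have hj := ha0 j
    set ei : Eu n := single i (a i)
    set ej : Eu n := single j (a j)
    have hei : ei = a i • single i (1 : ℝ) := by ext k; simp [ei]
    have hej : ej = a j • single j (1 : ℝ) := by ext k; simp [ej]
    have hpol : ∀ z, D2 u z (ei + ej) (ei + ej)
        = (D2 u z ei ei + D2 u z ej ej) + 2 * (a i * a j) * hess u z i j := by
      intro z
      have h12 : D2 u z ej ei = D2 u z ei ej := D2_comm hs z _ _
      have h3 : D2 u z ei ej = a i * a j * hess u z i j := by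
        rw [hess_apply, hei, hej]; simp [D2]; ring
      have : D2 u z (ei + ej) (ei + ej) = D2 u z ei ei + D2 u z ei ej + (D2 u z ej ei + D2 u z ej ej) := by
        simp only [D2, map_add, _root_.add_apply]; ring
      rw [this, h12, h3]; ring
    have c1 := continuous_D2 hs ei ei
    have c2 := continuous_D2 hs ej ej
    simp only [hpol]
    rw [bm_add (F := fun z => D2 u z ei ei + D2 u z ej ej)
      (H := fun z => 2 * (a i * a j) * hess u z i j) (c1.add c2) (continuous_const.mul (hc i j)),
      bm_add c1 c2, bm_const_mul]
    field_simp; ring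
  choose A hA using hlim
  have hquad : ∀ e : Eu n, Tendsto (fun R => bm R (fun z => D2 u z e e) 0) atTop
      (nhds (e.ofLp ⬝ᵥ Matrix.of A *ᵥ e.ofLp)) := by
    intro e
    rw [quadForm_eq_sum]
    refine (tendsto_finsetSum _ fun i _ => tendsto_finsetSum _ fun j _ =>
      (hA i j).const_mul (e i * e j)).congr fun R => ?_
    simp only [D2_eq_sum u _ e e]
    rw [bm_sum univ (F := fun i z => ∑ j, e i * e j * hess u z i j) fun i _ => by fun_prop]
    refine sum_congr rfl fun i _ => ?_
    rw [bm_sum univ (F := fun j z => e i * e j * hess u z i j) fun j _ => by fun_prop]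
    exact sum_congr rfl fun j _ => (bm_const_mul _ _ _).symm
  have hpsd : (Matrix.of A).PosSemidef := by
    refine .of_dotProduct_mulVec_nonneg ?_ fun v => ?_
    · rw [IsHermitian, conjTranspose_eq_transpose_of_trivial]
      ext i j
      refine tendsto_nhds_unique (hA j i) ((hA i j).congr fun R => ?_)
      have : ∀ z, hess u z i j = hess u z j i := fun z => (hess_isSymm hs z).apply j i
      simp only [this]
    · have h := hquad (WithLp.toLp 2 v)
      refine ge_of_tendsto (by simpa using h) ?_
      filter_upwards [eventually_gt_atTop 0] with R hR
      rw [← bm_const hR 0 0]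
      exact bm_mono hR continuous_const (continuous_D2 hs _ _) fun y _ => hu.D2_nonneg _ _
  have hdet : lam ≤ (Matrix.of A).det := by
    have hcont : Continuous fun M : Mat n => M.det := Continuous.matrix_det continuous_id
    have ht : Tendsto (fun R => hess (bm R u) 0) atTop (nhds (Matrix.of A)) := by
      refine tendsto_pi_nhds.2 fun i => tendsto_pi_nhds.2 fun j => ?_
      exact (hA i j).congr fun R => (hess_bm hs 0 i j).symm
    refine ge_of_tendsto ((hcont.tendsto _).comp ht) ?_
    filter_upwards [eventually_gt_atTop 0] with R hR
    exact hu.toConvexC2.le_det_hess_bm hu.dim_pos hR hu.lam_pos hu.lower 0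
  refine ⟨Matrix.of A, hpsd.posDef_iff_det_ne_zero.2 (hu.lam_pos.trans_le hdet).ne', hA,
    τ, hτ, hτ1, fun e he => ?_⟩
  obtain ⟨K, C, hC, h1, h2⟩ := hK e he
  refine ⟨C, hC, ?_⟩
  rwa [tendsto_nhds_unique (hquad e) h2]

end Setting

end LimitMatrix

theorem tendsto_matrix_inv {α : Type*} {l : Filter α} {X : α → Mat n}
    {P : Mat n} (hX : Tendsto X l (nhds P)) (hP : P.det ≠ 0) :
    Tendsto (fun a => (X a)⁻¹) l (nhds P⁻¹) := by
  have hd : Tendsto (fun a => (X a).det) l (nhds P.det) :=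
    ((Continuous.matrix_det continuous_id).tendsto P).comp hX
  have had : Tendsto (fun a => (X a).adjugate) l (nhds P.adjugate) :=
    ((Continuous.matrix_adjugate continuous_id).tendsto P).comp hX
  simp only [Matrix.inv_def, Ring.inverse_eq_inv']
  exact (hd.inv₀ hP).smul had

/-- A positive definite matrix is congruent to a matrix close to the identity by a matrix whose
columns are proportional to vectors of a cocompact subgroup. -/
theorem exists_lattice_congruence {M : Mat n} (hM : M.PosDef)
    {Γ : AddSubgroup (Eu n)} (hΓ : ∃ Ca > 0, ∀ z : Eu n, ∃ e ∈ Γ, ‖z - e‖ ≤ Ca) {κ : ℝ}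
    (hκ : 0 < κ) :
    ∃ (N : ℝ) (x : Fin n → Eu n) (X Y : Mat n), 0 < N ∧ (∀ i, x i ∈ Γ) ∧
      X.det ≠ 0 ∧ (∀ i k, x i k = N * X k i) ∧ M = X * Y * Xᵀ ∧
      ∀ i j, |Y i j - (1 : Mat n) i j| < κ := by
  obtain ⟨Ca, hCa, hcov⟩ := hΓ
  obtain ⟨Q, hQ⟩ := exists_transpose_mul_self hM.posSemidef
  have hdet : Qᵀ.det ≠ 0 := by
    have h := hM.det_pos
    rw [hQ, det_mul, det_transpose] at h
    rw [det_transpose]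
    rintro h0
    simp [h0] at h
  choose g hgΓ hg using fun (N : ℕ) (i : Fin n) =>
    hcov (((N : ℝ) + 1) • (WithLp.toLp 2 (Q i) : Eu n))
  set X : ℕ → Mat n := fun N => Matrix.of fun k i => ((N : ℝ) + 1)⁻¹ * g N i k
  have hX : Tendsto X atTop (nhds Qᵀ) := by
    refine tendsto_pi_nhds.2 fun k => tendsto_pi_nhds.2 fun i => ?_
    have hz : Tendsto (fun N : ℕ => Ca * ((N : ℝ) + 1)⁻¹) atTop (nhds 0) := by
      have := (tendsto_one_div_add_atTop_nhds_zero_nat (𝕜 := ℝ)).const_mul Ca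
      simpa using this
    refine tendsto_iff_dist_tendsto_zero.2 (squeeze_zero (fun _ => dist_nonneg) (fun N => ?_) hz)
    have hN : (0 : ℝ) < (N : ℝ) + 1 := by positivity
    have h1 := (abs_apply_le_norm _ k).trans (hg N i)
    simp only [PiLp.sub_apply, PiLp.smul_apply, smul_eq_mul] at h1
    rw [Real.dist_eq, abs_sub_comm]
    have h2 : Qᵀ k i - X N k i = (((N : ℝ) + 1) * Q i k - g N i k) * ((N : ℝ) + 1)⁻¹ := by
      simp only [X, transpose_apply, of_apply]; field_simp
    rw [h2, abs_mul, abs_of_pos (inv_pos.2 hN)]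
    exact mul_le_mul_of_nonneg_right h1 (inv_pos.2 hN).le
  have hinv := tendsto_matrix_inv hX hdet
  have hY : Tendsto (fun N => (X N)⁻¹ * M * ((X N)⁻¹)ᵀ) atTop (nhds 1) := by
    have hT : Tendsto (fun N => ((X N)⁻¹)ᵀ) atTop (nhds ((Qᵀ)⁻¹)ᵀ) :=
      ((Continuous.matrix_transpose continuous_id).tendsto _).comp hinv
    have h := (hinv.mul (tendsto_const_nhds (x := M))).mul hT
    have h1 : (Qᵀ)⁻¹ * M * ((Qᵀ)⁻¹)ᵀ = 1 := by
      rw [hQ, ← Matrix.mul_assoc, nonsing_inv_mul _ hdet.isUnit, Matrix.one_mul, transpose_nonsing_inv,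
        transpose_transpose, mul_nonsing_inv _ (by rw [det_transpose] at hdet; exact hdet.isUnit)]
    rwa [h1] at h
  have hev1 : ∀ᶠ N in atTop, (X N).det ≠ 0 :=
    (((Continuous.matrix_det continuous_id).tendsto _).comp hX).eventually_ne hdet
  have hev2 : ∀ᶠ N in atTop, ∀ i j,
      |((X N)⁻¹ * M * ((X N)⁻¹)ᵀ) i j - (1 : Mat n) i j| < κ := by
    refine eventually_all.2 fun i => eventually_all.2 fun j => ?_
    have h := tendsto_pi_nhds.1 (tendsto_pi_nhds.1 hY i) j
    exact (Metric.tendsto_nhds.1 h κ hκ).mono fun N hN => by rwa [Real.dist_eq] at hN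
  obtain ⟨N, h1, h2⟩ := (hev1.and hev2).exists
  have hN : (0 : ℝ) < (N : ℝ) + 1 := by positivity
  refine ⟨(N : ℝ) + 1, g N, X N, _, hN, hgΓ N, h1, fun i k => ?_, ?_, h2⟩
  · simp only [X, of_apply]; field_simp
  · have h3 : ((X N)⁻¹)ᵀ * (X N)ᵀ = 1 := by
      rw [← transpose_mul, mul_nonsing_inv _ h1.isUnit, transpose_one]
    rw [Matrix.mul_assoc, Matrix.mul_assoc, h3, Matrix.mul_one, ← Matrix.mul_assoc,
      mul_nonsing_inv _ h1.isUnit, Matrix.one_mul]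

/-- A positive definite matrix is a positive combination of squares of vectors in a cocompact
subgroup, chosen so that they determine symmetric matrices. -/
theorem exists_lattice_decomposition (hn : 0 < n) {M : Mat n} (hM : M.PosDef)
    {Γ : AddSubgroup (Eu n)} (hΓ : ∃ Ca > 0, ∀ z : Eu n, ∃ e ∈ Γ, ‖z - e‖ ≤ Ca) :
    ∃ (e : Fin n × Fin n × Bool → Eu n) (c : Fin n × Fin n × Bool → ℝ) (L : ℝ),
      (∀ k, e k ∈ Γ) ∧ (∀ k, 0 < c k) ∧ 0 < L ∧ ∀ H : Mat n, H.IsSymm →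
        (M * H).trace = ∑ k, c k * ((e k).ofLp ⬝ᵥ H *ᵥ (e k).ofLp) ∧
        ∀ ξ : Eu n, |ξ.ofLp ⬝ᵥ H *ᵥ ξ.ofLp|
          ≤ L * ‖ξ‖ ^ 2 * ∑ k, c k * |(e k).ofLp ⬝ᵥ H *ᵥ (e k).ofLp| := by
  have hn' : (1 : ℝ) ≤ n := by exact_mod_cast hn
  set κ : ℝ := 1 / (8 * n) with hκd
  have hκ : 0 < κ := by positivity
  have hnκ : n * κ = 1 / 8 := by rw [hκd]; field_simp
  have hκ1 : κ ≤ 1 / 8 := by nlinarith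
  obtain ⟨N, x, X, Y, hN, hxΓ, hX, hxX, hMX, hY⟩ := exists_lattice_congruence hM hΓ hκ
  set e : Fin n × Fin n × Bool → Eu n := fun k => if k.2.2 then x k.1 + x k.2.1 else x k.1 - x k.2.1
  set c : Fin n × Fin n × Bool → ℝ := fun k => (N ^ 2)⁻¹ *
    if k.2.2 then κ + Y k.1 k.2.1 / 4 - (if k.1 = k.2.1 then 1 / 8 else 0)
    else if k.1 = k.2.1 then 1 else κ - Y k.1 k.2.1 / 4
  have hc : ∀ k, 0 < c k := by
    rintro ⟨i, j, b⟩
    have h := abs_lt.1 (hY i j)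
    refine mul_pos (by positivity) ?_
    by_cases hij : i = j
    · subst hij
      rw [one_apply_eq] at h
      cases b <;> simp; linarith
    · rw [one_apply_ne hij] at h
      cases b <;> simp [hij] <;> linarith
  set T := ‖(toEuclideanCLM (𝕜 := ℝ) X⁻¹ : Eu n →L[ℝ] Eu n)‖
  set Z := ∑ k, (c k)⁻¹
  have hZ : 0 ≤ Z := sum_nonneg fun k _ => (inv_pos.2 (hc k)).le
  refine ⟨e, c, (n * T) ^ 2 * ((2 * N ^ 2)⁻¹ * Z) + 1, ?_, hc, by positivity, fun H hH => ?_⟩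
  · rintro ⟨i, j, b⟩
    cases b
    · exact Γ.sub_mem (hxΓ i) (hxΓ j)
    · exact Γ.add_mem (hxΓ i) (hxΓ j)
  set B := Xᵀ * H * X
  have hBapp : ∀ v w : Fin n → ℝ, v ⬝ᵥ B *ᵥ w = (X *ᵥ v) ⬝ᵥ H *ᵥ (X *ᵥ w) := by
    intro v w
    simp only [B, Matrix.mul_assoc]
    rw [← mulVec_mulVec, ← mulVec_mulVec, dotProduct_mulVec, vecMul_transpose]
  have hBsymm : ∀ i j, B j i = B i j := fun i j => by
    have : B.IsSymm := by
      simp only [B, IsSymm, transpose_mul, transpose_transpose, hH.eq, Matrix.mul_assoc]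
    exact this.apply i j
  have hx : ∀ i, (x i).ofLp = X *ᵥ (N • Pi.single i 1) := by
    intro i; ext k
    rw [mulVec_smul, mulVec_single_one]
    simpa using hxX i k
  have hBs : ∀ i j, Pi.single i 1 ⬝ᵥ B *ᵥ Pi.single j 1 = B i j := fun i j => by simp
  have hadd : ∀ i j, (x i + x j).ofLp ⬝ᵥ H *ᵥ (x i + x j).ofLp
      = N ^ 2 * (B i i + 2 * B i j + B j j) := by
    intro i j
    rw [WithLp.ofLp_add, hx, hx, ← mulVec_add, ← hBapp, ← smul_add, mulVec_smul, smul_dotProduct,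
      dotProduct_smul, mulVec_add, add_dotProduct, dotProduct_add, dotProduct_add]
    simp only [hBs, hBsymm i j, smul_eq_mul]; ring
  have hsub : ∀ i j, (x i - x j).ofLp ⬝ᵥ H *ᵥ (x i - x j).ofLp
      = N ^ 2 * (B i i - 2 * B i j + B j j) := by
    intro i j
    rw [WithLp.ofLp_sub, hx, hx, ← mulVec_sub, ← hBapp, ← smul_sub, mulVec_smul, smul_dotProduct,
      dotProduct_smul, mulVec_sub, sub_dotProduct, dotProduct_sub, dotProduct_sub]
    simp only [hBs, hBsymm i j, smul_eq_mul]; ring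
  constructor
  · have htr : (M * H).trace = ∑ i, ∑ j, Y i j * B i j := by
      rw [hMX, Matrix.mul_assoc, Matrix.mul_assoc, Matrix.trace_mul_comm, Matrix.mul_assoc]
      simp only [trace, diag, Matrix.mul_apply (M := Y)]
      refine sum_congr rfl fun i _ => sum_congr rfl fun j _ => ?_
      rw [← hBsymm i j]
    have hterm : ∀ i j, ∑ b, c (i, j, b) * ((e (i, j, b)).ofLp ⬝ᵥ H *ᵥ (e (i, j, b)).ofLp)
        = 2 * κ * (B i i + B j j) + Y i j * B i j - if i = j then B i i / 2 else 0 := by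
      intro i j
      rw [Fintype.sum_bool]
      simp only [e, c, if_true, hadd, Bool.false_eq_true, if_false, hsub]
      by_cases hij : i = j
      · subst hij; simp; field_simp; ring
      · simp only [hij, if_false]; field_simp; ring
    simp only [Fintype.sum_prod_type]
    simp only [hterm, sum_sub_distrib, sum_add_distrib]
    rw [htr]
    simp only [Finset.sum_ite_eq, mem_univ, if_true, ← mul_sum, sum_add_distrib,
      Finset.sum_const, Finset.card_univ, Fintype.card_fin, nsmul_eq_mul, ← Finset.sum_div]
    linear_combination (-4 * ∑ i, B i i) * hnκ
  · intro ξ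
    set S := ∑ k, c k * |(e k).ofLp ⬝ᵥ H *ᵥ (e k).ofLp|
    have hS : 0 ≤ S := sum_nonneg fun k _ => mul_nonneg (hc k).le (abs_nonneg _)
    have hk : ∀ k, |(e k).ofLp ⬝ᵥ H *ᵥ (e k).ofLp| ≤ Z * S := by
      intro k
      have h1 : c k * |(e k).ofLp ⬝ᵥ H *ᵥ (e k).ofLp| ≤ S := single_le_sum
        (f := fun k => c k * |(e k).ofLp ⬝ᵥ H *ᵥ (e k).ofLp|)
        (fun k _ => mul_nonneg (hc k).le (abs_nonneg _)) (mem_univ k)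
      have h2 : (c k)⁻¹ ≤ Z := single_le_sum (f := fun k => (c k)⁻¹)
        (fun k _ => (inv_pos.2 (hc k)).le) (mem_univ k)
      calc |(e k).ofLp ⬝ᵥ H *ᵥ (e k).ofLp|
          = (c k)⁻¹ * (c k * |(e k).ofLp ⬝ᵥ H *ᵥ (e k).ofLp|) := by
            rw [← mul_assoc, inv_mul_cancel₀ (hc k).ne', one_mul]
        _ ≤ (c k)⁻¹ * S := mul_le_mul_of_nonneg_left h1 (inv_pos.2 (hc k)).le
        _ ≤ Z * S := mul_le_mul_of_nonneg_right h2 hS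
    have hB : ∀ i j, |B i j| ≤ (2 * N ^ 2)⁻¹ * Z * S := by
      intro i j
      have h1 := hk (i, j, true)
      have h2 := hk (i, j, false)
      simp only [e, if_true, hadd, Bool.false_eq_true, if_false, hsub] at h1 h2
      have h3 : B i j = (4 * N ^ 2)⁻¹ * (N ^ 2 * (B i i + 2 * B i j + B j j)
        - N ^ 2 * (B i i - 2 * B i j + B j j)) := by field_simp; ring
      rw [h3, abs_mul, abs_of_pos (by positivity)]
      calc _ ≤ (4 * N ^ 2)⁻¹ * (Z * S + Z * S) :=
            mul_le_mul_of_nonneg_left ((abs_sub _ _).trans (add_le_add h1 h2)) (by positivity)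
        _ = _ := by field_simp; ring
    set t : Eu n := toEuclideanCLM (𝕜 := ℝ) X⁻¹ ξ with ht
    have htn : ∀ i, |t i| ≤ T * ‖ξ‖ := fun i =>
      (abs_apply_le_norm t i).trans (ContinuousLinearMap.le_opNorm _ _)
    have hξ : ξ.ofLp = X *ᵥ t.ofLp := by
      rw [ht, ofLp_toEuclideanCLM, mulVec_mulVec, mul_nonsing_inv _ hX.isUnit, one_mulVec]
    rw [hξ, ← hBapp, quadForm_eq_sum]
    calc |∑ i, ∑ j, t i * t j * B i j|
        ≤ ∑ i : Fin n, ∑ j : Fin n, (T * ‖ξ‖) * (T * ‖ξ‖) * ((2 * N ^ 2)⁻¹ * Z * S) := by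
          refine (Finset.abs_sum_le_sum_abs _ _).trans (sum_le_sum fun i _ =>
            (Finset.abs_sum_le_sum_abs _ _).trans (sum_le_sum fun j _ => ?_))
          rw [abs_mul, abs_mul]
          exact mul_le_mul (mul_le_mul (htn i) (htn j) (abs_nonneg _) (by positivity)) (hB i j)
            (abs_nonneg _) (by positivity)
      _ = (n * T) ^ 2 * ((2 * N ^ 2)⁻¹ * Z) * ‖ξ‖ ^ 2 * S := by simp; ring
      _ ≤ _ := by
          refine mul_le_mul_of_nonneg_right (mul_le_mul_of_nonneg_right ?_ (by positivity)) hS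
          linarith


theorem sd_smul_two (u : Eu n → ℝ) (e x : Eu n) :
    sd u ((2 : ℝ) • e) x = sd u e (x + e) + sd u e (x - e) + 2 * sd u e x := by
  simp only [sd, two_smul]
  rw [show x + (e + e) = x + e + e by abel, show x - (e + e) = x - e - e by abel,
    show x + e - e = x by abel, show x - e + e = x by abel]
  ring

theorem sd_pow_smul_le {e : Eu n} {V : ℝ} (hV : ∀ x, sd u e x ≤ V) (k : ℕ) (x : Eu n) :
    sd u ((2 : ℝ) ^ k • e) x ≤ 4 ^ k * V := by
  induction k generalizing x with
  | zero => simpa using hV x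
  | succ k ih =>
    rw [pow_succ', mul_smul, sd_smul_two]
    have h1 := ih (x + (2 : ℝ) ^ k • e)
    have h2 := ih (x - (2 : ℝ) ^ k • e)
    have h3 := ih x
    rw [pow_succ]
    linarith

theorem ConvexC2.convexOn_sd (hu : ConvexC2 u) (x : Eu n) :
    ConvexOn ℝ Set.univ fun y => sd u y x := by
  refine ⟨convex_univ, fun y _ z _ a b ha hb hab => ?_⟩
  have h1 := hu.convexOn.2 (Set.mem_univ (x + y)) (Set.mem_univ (x + z)) ha hb hab
  have h2 := hu.convexOn.2 (Set.mem_univ (x - y)) (Set.mem_univ (x - z)) ha hb hab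
  have e1 : a • (x + y) + b • (x + z) = x + (a • y + b • z) := by
    rw [smul_add, smul_add, add_add_add_comm, ← add_smul, hab, one_smul]
  have e2 : a • (x - y) + b • (x - z) = x - (a • y + b • z) := by
    rw [smul_sub, smul_sub, sub_add_sub_comm, ← add_smul, hab, one_smul]
  rw [e1] at h1
  rw [e2] at h2
  simp only [sd, smul_eq_mul] at *
  have : u x = a * u x + b * u x := by rw [← add_mul, hab, one_mul]
  linarith

theorem sd_neg (u : Eu n → ℝ) (e x : Eu n) : sd u (-e) x = sd u e x := by
  simp only [sd, sub_neg_eq_add, ← sub_eq_add_neg]; ring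

theorem ConvexC2.sd_smul_le (hu : ConvexC2 u) (e x : Eu n) {s : ℝ} (hs : |s| ≤ 1) :
    sd u (s • e) x ≤ sd u e x := by
  have hs' := abs_le.1 hs
  have h := (hu.convexOn_sd x).2 (Set.mem_univ e) (Set.mem_univ (-e))
    (show 0 ≤ (1 + s) / 2 by linarith) (show 0 ≤ (1 - s) / 2 by linarith) (by ring)
  rw [smul_neg, ← sub_eq_add_neg, ← sub_smul, show (1 + s) / 2 - (1 - s) / 2 = s by ring] at h
  simp only [smul_eq_mul, sd_neg] at h
  linarith

theorem ConvexC2.breg_le_sd (hu : ConvexC2 u) (x y : Eu n) : breg u x (x + y) ≤ sd u y x := by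
  have h := hu.breg_nonneg x (x - y)
  simp only [breg, sd, add_sub_cancel_left, sub_sub_cancel_left, map_neg] at *
  linarith

namespace Setting

theorem exists_sd_quadratic_bound (hu : Setting u lam Lam β Γ) (G : Geom u) {a : Fin n → ℝ}
    (ha0 : ∀ i, 0 < a i) (ha : ∀ i, single i (a i) ∈ Γ) :
    ∃ C > 0, ∀ x y, sd u y x ≤ C * (1 + ‖y‖) ^ 2 := by
  have hn := hu.dim_pos
  have hn' : (0 : ℝ) < n := by exact_mod_cast hn
  choose V hV hVb using fun i => hu.exists_sd_bound G (ha i)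
  set W := ∑ i, V i
  have hW : 0 ≤ W := sum_nonneg fun i _ => (hV i).le
  set m : ℝ := 1 + ∑ i, n / a i
  have hm1 : 1 ≤ m := le_add_of_nonneg_right (sum_nonneg fun i _ => by have := ha0 i; positivity)
  have hmi : ∀ i, n / a i ≤ m := fun i => by
    have := single_le_sum (f := fun i => n / a i) (fun i _ => by
      have := ha0 i; positivity) (mem_univ i)
    simp only [m]; linarith
  refine ⟨4 * m ^ 2 * W + 1, by positivity, fun x y => ?_⟩
  have hy1 : 1 ≤ m * (1 + ‖y‖) := by nlinarith [norm_nonneg y]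
  obtain ⟨k, hk1, hk2⟩ := exists_nat_pow_near hy1 (one_lt_two (α := ℝ))
  have hyk : y = ∑ i : Fin n, (1 / n : ℝ) • (n * y i / (2 ^ (k + 1) * a i)) •
      ((2 : ℝ) ^ (k + 1) • (single i (a i) : Eu n)) := by
    conv_lhs => rw [sum_single y]
    refine sum_congr rfl fun i _ => ?_
    have := (ha0 i).ne'
    ext j
    simp only [PiLp.smul_apply, smul_eq_mul, PiLp.single_apply]
    split_ifs <;> field_simp <;> simp
  have hj : sd u y x ≤ ∑ i : Fin n, (1 / n : ℝ) * (4 ^ (k + 1) * V i) := by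
    conv_lhs => rw [hyk]
    refine ((hu.convexOn_sd x).map_sum_le (fun i _ => by positivity) (by simp; field_simp)
      (fun i _ => Set.mem_univ _)).trans (sum_le_sum fun i _ => ?_)
    rw [smul_eq_mul]
    refine mul_le_mul_of_nonneg_left ?_ (by positivity)
    refine (hu.sd_smul_le _ x ?_).trans (sd_pow_smul_le (hVb i) _ x)
    have hai := ha0 i
    rw [abs_div, abs_mul, abs_of_pos hn', abs_of_pos (show 0 < 2 ^ (k + 1) * a i by positivity),
      div_le_one (by positivity)]
    calc n * |y i| ≤ (n / a i) * (1 + ‖y‖) * a i := by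
          rw [mul_right_comm, div_mul_cancel₀ _ hai.ne']
          refine mul_le_mul_of_nonneg_left ?_ hn'.le
          linarith [abs_apply_le_norm y i]
      _ ≤ 2 ^ (k + 1) * a i := by
          refine mul_le_mul_of_nonneg_right (le_trans ?_ hk2.le) hai.le
          exact mul_le_mul_of_nonneg_right (hmi i) (by positivity)
  calc sd u y x ≤ ∑ i : Fin n, (1 / n : ℝ) * (4 ^ (k + 1) * V i) := hj
    _ = 1 / n * (4 ^ (k + 1) * W) := by rw [← mul_sum, ← mul_sum]
    _ ≤ 1 * (4 ^ (k + 1) * W) := by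
        refine mul_le_mul_of_nonneg_right ?_ (by positivity)
        rw [div_le_one hn']; exact_mod_cast hn
    _ = 4 * ((2 : ℝ) ^ k) ^ 2 * W := by
        rw [← pow_mul, mul_comm k 2, pow_mul, pow_succ, show (2 : ℝ) ^ 2 = 4 by norm_num]; ring
    _ ≤ 4 * (m * (1 + ‖y‖)) ^ 2 * W := by
        refine mul_le_mul_of_nonneg_right (mul_le_mul_of_nonneg_left ?_ (by norm_num)) hW
        exact pow_le_pow_left₀ (by positivity) hk1 2
    _ ≤ (4 * m ^ 2 * W + 1) * (1 + ‖y‖) ^ 2 := by nlinarith [sq_nonneg (1 + ‖y‖)]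

theorem exists_breg_quadratic_lower (hu : Setting u lam Lam β Γ) (G : Geom u) {C : ℝ} (hC : 0 < C)
    (hsd : ∀ x y, sd u y x ≤ C * (1 + ‖y‖) ^ 2) :
    ∃ c > 0, ∃ M₀ : ℝ, 1 ≤ M₀ ∧ ∀ x y, M₀ ≤ ‖y‖ → c * ‖y‖ ^ 2 ≤ breg u x (x + y) := by
  have hω := ballVol_pos n
  have hR := G.one_le_R
  have hCd := G.Cd_pos
  set Q : ℝ := 4 * 2 ^ n * (G.Cd * G.R ^ n * (√(4 * C)) ^ n) with hQ
  have hCs : 0 < √(4 * C) := sqrt_pos.2 (by positivity)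
  have hR0 : 0 < G.R := by linarith
  have hQ0 : 0 < Q := by positivity
  have key : ∀ (x y : Eu n) (r : ℝ), 1 ≤ r → breg u x (x + y) ≤ 4 * C * r ^ 2 → ‖y‖ ≤ Q * r := by
    intro x y r hr hy
    have hr0 : 0 < r := by linarith
    have hh : 0 < 4 * C * r ^ 2 := by positivity
    set K : Set (Eu n) := (fun z => x + z) ⁻¹' sec u x (4 * C * r ^ 2)
    have hKc : Convex ℝ K := (hu.convex_sec x _).translate_preimage_right x
    have hvol : volume K = volume (sec u x (4 * C * r ^ 2)) := measure_preimage_add _ _ _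
    have hfin : volume K ≠ ⊤ := by rw [hvol]; exact (hu.isCompact_sec x _).measure_lt_top.ne
    have hball : closedBall 0 r ⊆ K := by
      intro z hz
      rw [mem_closedBall_zero_iff] at hz
      refine mem_sec.2 ((hu.breg_le_sd x z).trans ((hsd x z).trans ?_))
      have : (1 + ‖z‖) ^ 2 ≤ (2 * r) ^ 2 := pow_le_pow_left₀ (by positivity) (by linarith) 2
      nlinarith
    have h := volume_ge_of_ball_of_mem hKc hr0 hball (a := y) (mem_sec.2 hy) hfin
    have hv : volume.real K ≤ G.Cd * (G.R ^ n * ballVol n) * √(4 * C * r ^ 2) ^ n := by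
      rw [measureReal_def, hvol]; exact G.volume_sec_le x hh
    rw [Real.sqrt_mul (by positivity), Real.sqrt_sq hr0.le, mul_pow] at hv
    have h2 : ‖y‖ * (r ^ n * ballVol n) ≤ (Q * r) * (r ^ n * ballVol n) := by
      calc ‖y‖ * (r ^ n * ballVol n) = ‖y‖ * r ^ n * ballVol n := by ring
        _ ≤ 4 * 2 ^ n * r * volume.real K := h
        _ ≤ 4 * 2 ^ n * r * _ := mul_le_mul_of_nonneg_left hv (by positivity)
        _ = _ := by rw [hQ]; ring
    exact le_of_mul_le_mul_right h2 (by positivity)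
  refine ⟨C / Q ^ 2, by positivity, 2 * Q + 1, by linarith, fun x y hy => ?_⟩
  by_contra! hlt
  set r := ‖y‖ / (2 * Q) with hr
  have hr1 : 1 ≤ r := by rw [hr, le_div_iff₀ (by positivity)]; linarith
  have hy0 : 0 < ‖y‖ := by linarith
  have h := key x y r hr1 (hlt.le.trans (le_of_eq (by rw [hr]; field_simp; ring)))
  have : Q * r = ‖y‖ / 2 := by rw [hr]; field_simp
  linarith

end Setting

/-- A ball mean differs from the value at the center by the mean of the Bregman divergence. -/
theorem bm_sub_eq (hu : ContDiff ℝ 1 u) {ρ : ℝ} (hρ : 0 < ρ) (x : Eu n) :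
    bm ρ u x - u x = bm ρ (breg u x) x := by
  have hc := hu.continuous
  have hodd : ∫ y in closedBall (0 : Eu n) ρ, fderiv ℝ u x y = 0 := by
    have h := integral_neg_eq_self
      (fun y => Set.indicator (closedBall (0 : Eu n) ρ) (fun y => fderiv ℝ u x y) y) volume
    rw [← integral_indicator measurableSet_closedBall]
    have h2 : (fun y => Set.indicator (closedBall (0 : Eu n) ρ) (fun y => fderiv ℝ u x y) (-y))
        = fun y => -Set.indicator (closedBall (0 : Eu n) ρ) (fun y => fderiv ℝ u x y) y := by
      funext y; by_cases hy : ‖y‖ ≤ ρ <;> simp [Set.indicator, hy]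
    simp only [h2] at h
    rw [integral_neg] at h
    linarith
  have hlin : bm ρ (fun z => fderiv ℝ u x (z - x)) x = 0 := by rw [bm]; simp [hodd]
  have hc1 : Continuous fun z => fderiv ℝ u x (z - x) := by fun_prop
  have hc2 : Continuous (breg u x) := by unfold breg; fun_prop
  have : u = fun z => breg u x z + (u x + fderiv ℝ u x (z - x)) := by funext z; simp [breg]
  conv_lhs => rw [this]
  rw [bm_add (H := fun z => u x + fderiv ℝ u x (z - x)) hc2 (continuous_const.add hc1),
    bm_add continuous_const hc1, hlin, bm_const hρ]
  simp [breg]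

theorem ConvexC2.le_bm (hu : ConvexC2 u) {ρ : ℝ} (hρ : 0 < ρ) (x : Eu n) :
    u x ≤ MongeAmpere.bm ρ u x := by
  have h : 0 ≤ MongeAmpere.bm ρ (breg u x) x := by
    rw [← bm_const hρ 0 x]
    exact bm_mono hρ continuous_const (hu.continuous_breg x) fun y _ => hu.breg_nonneg _ _
  rw [← bm_sub_eq hu.smooth1 hρ] at h
  linarith

theorem ConvexC2.bm_le (hu : ConvexC2 u) {C ρ : ℝ} (hC : 0 < C)
    (hsd : ∀ x y, sd u y x ≤ C * (1 + ‖y‖) ^ 2) (hρ : 1 ≤ ρ) (x : Eu n) :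
    MongeAmpere.bm ρ u x ≤ u x + 4 * C * ρ ^ 2 := by
  have hρ0 : 0 < ρ := by linarith
  have h : MongeAmpere.bm ρ (breg u x) x ≤ 4 * C * ρ ^ 2 := by
    rw [← bm_const hρ0 (4 * C * ρ ^ 2) x]
    refine bm_mono hρ0 (hu.continuous_breg x) continuous_const fun y hy => ?_
    refine (hu.breg_le_sd x y).trans ((hsd x y).trans ?_)
    have : (1 + ‖y‖) ^ 2 ≤ (2 * ρ) ^ 2 := pow_le_pow_left₀ (by positivity) (by linarith) 2
    nlinarith
  rw [← bm_sub_eq hu.smooth1 hρ0] at h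
  linarith

/-- A supporting plane that is strictly separated on a sphere touches the graph inside. -/
theorem exists_gradient_eq_of_sphere {v : Eu n → ℝ} (hv : Continuous v) {x₀ q p : Eu n} {r : ℝ}
    (hq : q ∈ closedBall x₀ r)
    (h : ∀ z, ‖z - x₀‖ = r → v q - inner ℝ p q < v z - inner ℝ p z) (hd : Differentiable ℝ v) :
    ∃ z ∈ closedBall x₀ r, gradient v z = p := by
  set ψ : Eu n → ℝ := fun z => v z - inner ℝ p z
  obtain ⟨z, hz, hmin⟩ := (isCompact_closedBall x₀ r).exists_isMinOn ⟨q, hq⟩ (f := ψ) (by fun_prop)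
  have hzr : ‖z - x₀‖ < r := by
    refine lt_of_le_of_ne (by simpa [dist_eq_norm] using hz) fun he => ?_
    exact absurd (hmin hq) (not_le.2 (h z he))
  have hloc : IsLocalMin ψ z := hmin.isLocalMin (mem_of_superset
    (Metric.isOpen_ball.mem_nhds (by simpa [dist_eq_norm] using hzr)) Metric.ball_subset_closedBall)
  refine ⟨z, hz, ?_⟩
  have h2 : HasFDerivAt (fun z : Eu n => inner ℝ p z) (innerSL ℝ p) z := (innerSL ℝ p).hasFDerivAt
  have h3 := sub_eq_zero.1 (hloc.hasFDerivAt_eq_zero ((hd z).hasFDerivAt.sub h2))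
  rw [gradient, h3]
  exact (InnerProductSpace.toDual ℝ (Eu n)).symm_apply_apply p

theorem ConvexC2.volume_real_gradient_image (hu : ConvexC2 u) {K : Set (Eu n)}
    (hK : IsCompact K) : volume (gradient u '' K) ≠ ⊤ ∧
      volume.real (gradient u '' K) = ∫ x in K, (hess u x).det := by
  have hc : Continuous fun x => (hess u x).det := (continuous_hess hu.smooth).matrix_det
  refine ⟨(hK.image (continuous_gradient hu.smooth)).measure_lt_top.ne, ?_⟩
  rw [measureReal_def, hu.volume_gradient_image hK.measurableSet,
    integral_eq_lintegral_of_nonneg_ae (.of_forall fun x => (hu.pos x).det_pos.le)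
      hc.aestronglyMeasurable]

/-- A convex function with quadratic growth whose Hessian is dominated on average by the matrix
`A` in the directions of a cocompact subgroup. -/
structure MeanDominated (u : Eu n → ℝ) (A : Mat n) (τ : ℝ)
    (Γ : AddSubgroup (Eu n)) : Prop extends ConvexC2 u where
  dim_pos : 0 < n
  posDef : A.PosDef
  zero : u 0 = 0
  grad_zero : fderiv ℝ u 0 = 0
  sd_le : ∃ C > 0, ∀ x y, sd u y x ≤ C * (1 + ‖y‖) ^ 2
  le_breg : ∃ c > 0, ∃ M₀ : ℝ, 1 ≤ M₀ ∧ ∀ x y, M₀ ≤ ‖y‖ → c * ‖y‖ ^ 2 ≤ breg u x (x + y)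
  tau_pos : 0 < τ
  tau_le : τ ≤ 1
  cocompact : ∃ Ca > 0, ∀ z : Eu n, ∃ e ∈ Γ, ‖z - e‖ ≤ Ca
  mean_le : ∀ e ∈ Γ, ∃ C > 0, ∀ ρ, 1 ≤ ρ → ∀ x,
    bm ρ (fun z => D2 u z e e) x ≤ e.ofLp ⬝ᵥ A *ᵥ e.ofLp + C * ρ ^ (-τ)

/-- Second-order Taylor estimate along a ray from the origin. -/
theorem abs_taylor_sub_le {w : Eu n → ℝ} (hw : ContDiff ℝ 2 w) (x : Eu n) {q B : ℝ}
    (h : ∀ t : ℝ, 0 ≤ t → t ≤ 1 → |D2 w (t • x) x x - q| ≤ B) :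
    |w x - w 0 - fderiv ℝ w 0 x - 1 / 2 * q| ≤ B := by
  have hw1 : ContDiff ℝ 1 w := hw.of_le (by norm_num)
  have hB : 0 ≤ B := (abs_nonneg _).trans (h 0 le_rfl zero_le_one)
  set ψ : ℝ → ℝ := fun t => fderiv ℝ w (t • x) x - q * t
  have hψ : ∀ t, HasDerivAt ψ (D2 w (t • x) x x - q) t := by
    intro t
    have h1 := hasDerivAt_line_fderiv hw 0 x x t
    simp only [zero_add] at h1
    exact (h1.fun_sub ((hasDerivAt_id t).const_mul q)).congr_deriv (by rw [mul_one])
  set φ : ℝ → ℝ := fun t => w (t • x) - q * t ^ 2 / 2 - ψ 0 * t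
  have hφ : ∀ t, HasDerivAt φ (ψ t - ψ 0) t := by
    intro t
    have h1 := hasDerivAt_line hw1 0 x t
    simp only [zero_add] at h1
    have h2 := ((hasDerivAt_pow 2 t).const_mul q).div_const 2
    refine ((h1.fun_sub h2).fun_sub ((hasDerivAt_id t).const_mul (ψ 0))).congr_deriv ?_
    simp only [ψ]; ring
  have hψb : ∀ t ∈ Set.Icc (0 : ℝ) 1, ‖ψ t - ψ 0‖ ≤ B := by
    intro t ht
    refine (norm_image_sub_le_of_norm_deriv_le_segment' (f := ψ) (a := 0) (b := 1) (C := B)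
      (fun t _ => (hψ t).hasDerivWithinAt) (fun s hs => h s hs.1 hs.2.le) t ht).trans ?_
    nlinarith [ht.1, ht.2]
  have := norm_image_sub_le_of_norm_deriv_le_segment_01' (f := φ) (C := B)
    (fun t _ => (hφ t).hasDerivWithinAt) fun t ht => hψb t ⟨ht.1, ht.2.le⟩
  rw [Real.norm_eq_abs] at this
  convert this using 2
  simp [φ, ψ]; ring

namespace MeanDominated

variable {A : Mat n} {τ : ℝ}

/-- The Monge-Ampère mass is not lost under averaging. -/
theorem exists_mass_le (hu : MeanDominated u A τ Γ) :
    ∃ M : ℝ, 1 ≤ M ∧ ∀ ρ, 1 ≤ ρ → ∀ R : ℝ, ∫ x in closedBall 0 R, (hess u x).det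
      ≤ ∫ x in closedBall 0 (R + M * ρ), (hess (bm ρ u) x).det := by
  obtain ⟨C, hC, hsd⟩ := hu.sd_le
  obtain ⟨c, hc, M₀, hM₀, hlow⟩ := hu.le_breg
  have hdiv : 0 < 4 * C / c := by positivity
  set M := M₀ + 4 * C / c + 1 with hM
  have hM1 : 1 ≤ M := by linarith
  have hMc : 4 * C < c * M ^ 2 := by
    have h1 : 4 * C < c * M := by
      have : c * (4 * C / c) = 4 * C := by field_simp
      rw [hM]; nlinarith
    nlinarith [mul_pos hc (by linarith : 0 < M)]
  refine ⟨M, hM1, fun ρ hρ R => ?_⟩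
  have hρ0 : 0 < ρ := by linarith
  have hv := hu.toConvexC2.bm hρ0
  have hsub : gradient u '' closedBall 0 R ⊆ gradient (bm ρ u) '' closedBall 0 (R + M * ρ) := by
    rintro _ ⟨x, hx, rfl⟩
    rw [mem_closedBall_zero_iff] at hx
    obtain ⟨z, hz, hzp⟩ := exists_gradient_eq_of_sphere hv.continuous (x₀ := x) (q := x)
      (p := gradient u x) (r := M * ρ) (by simp; positivity) (fun z hz => by
        have hM0 : M₀ ≤ M * ρ := by nlinarith
        have h1 := hlow x (z - x) (by rw [hz]; exact hM0)
        rw [add_sub_cancel, hz, breg] at h1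
        have h2 := hu.toConvexC2.le_bm hρ0 z
        have h3 := hu.toConvexC2.bm_le hC hsd hρ x
        have h4 : ∀ w, inner ℝ (gradient u x) w = fderiv ℝ u x w := fun w => by rw [gradient]; simp
        rw [h4, h4]
        rw [map_sub] at h1
        have h5 : 4 * C * ρ ^ 2 < c * M ^ 2 * ρ ^ 2 := by
          exact mul_lt_mul_of_pos_right hMc (by positivity)
        nlinarith) hv.differentiable
    refine ⟨z, ?_, hzp⟩
    rw [mem_closedBall_iff_norm] at hz
    rw [mem_closedBall_zero_iff]
    calc ‖z‖ = ‖x + (z - x)‖ := by rw [add_sub_cancel]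
      _ ≤ R + M * ρ := (norm_add_le _ _).trans (add_le_add hx hz)
  rw [← (hu.volume_real_gradient_image (isCompact_closedBall 0 R)).2,
    ← (hv.volume_real_gradient_image (isCompact_closedBall 0 (R + M * ρ))).2]
  exact measureReal_mono hsub (hv.volume_real_gradient_image (isCompact_closedBall 0 _)).1

theorem trace_inv_mul_self (hu : MeanDominated u A τ Γ) : (A⁻¹ * A).trace = n := by
  rw [nonsing_inv_mul _ hu.posDef.det_pos.ne'.isUnit, trace_one, Fintype.card_fin]

/-- Where the trace of the averaged Hessian is nearly maximal, the averaged Hessian is close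
to `A`. -/
theorem exists_pinching (hu : MeanDominated u A τ Γ) : ∃ L > 0, ∃ D > 0, ∀ ρ₁, 1 ≤ ρ₁ →
      (∀ x, (A⁻¹ * hess (bm ρ₁ u) x).trace ≤ n + D * ρ₁ ^ (-τ)) ∧
      ∀ ρ₂, 0 < ρ₂ → ∀ x ξ : Eu n, |D2 (bm ρ₂ (bm ρ₁ u)) x ξ ξ - ξ.ofLp ⬝ᵥ A *ᵥ ξ.ofLp|
        ≤ L * ‖ξ‖ ^ 2 * (D * ρ₁ ^ (-τ) + (n - (A⁻¹ * hess (bm ρ₂ (bm ρ₁ u)) x).trace)) := by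
  have hs := hu.smooth
  obtain ⟨e, c, L, heΓ, hc, hL, hdec⟩ :=
    exists_lattice_decomposition hu.dim_pos hu.posDef.inv hu.cocompact
  choose C hC hmean using fun k => hu.mean_le (e k) (heΓ k)
  have hAs : A.IsSymm := by
    have := hu.posDef.isHermitian
    rwa [IsHermitian, conjTranspose_eq_transpose_of_trivial] at this
  set D₀ := ∑ k, c k * C k with hD₀
  have hD₀0 : 0 ≤ D₀ := sum_nonneg fun k _ => (mul_pos (hc k) (hC k)).le
  have hnA := hu.trace_inv_mul_self
  refine ⟨L, hL, 2 * D₀ + 1, by positivity, fun ρ₁ hρ₁ => ⟨fun x => ?_, fun ρ₂ hρ₂ x ξ => ?_⟩⟩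
  · have hρ0 : 0 < ρ₁ := by linarith
    have hs₁ := contDiff_bm (ρ := ρ₁) 2 hs
    have hp : 0 ≤ ρ₁ ^ (-τ) := by positivity
    rw [(hdec _ (hess_isSymm hs₁ x)).1, ← hnA, (hdec A hAs).1]
    calc ∑ k, c k * ((e k).ofLp ⬝ᵥ hess (bm ρ₁ u) x *ᵥ (e k).ofLp)
        ≤ ∑ k, (c k * ((e k).ofLp ⬝ᵥ A *ᵥ (e k).ofLp) + c k * C k * ρ₁ ^ (-τ)) := by
          refine sum_le_sum fun k _ => ?_
          rw [mul_assoc, ← mul_add, ← D2_eq_dotProduct, D2_bm hs]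
          exact mul_le_mul_of_nonneg_left (hmean k ρ₁ hρ₁ x) (hc k).le
      _ ≤ _ := by
          rw [sum_add_distrib, ← sum_mul]
          have := mul_le_mul_of_nonneg_right (show D₀ ≤ 2 * D₀ + 1 by linarith) hp
          linarith
  · have hρ0 : 0 < ρ₁ := by linarith
    have hs₁ := contDiff_bm (ρ := ρ₁) 2 hs
    have hs₂ := contDiff_bm (ρ := ρ₂) 2 hs₁
    set p := ρ₁ ^ (-τ)
    have hp : 0 ≤ p := by positivity
    set H := hess (bm ρ₂ (bm ρ₁ u)) x with hH
    have hHs : H.IsSymm := hess_isSymm hs₂ x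
    have hdiff := hdec (H - A) (by rw [IsSymm, transpose_sub, hHs.eq, hAs.eq])
    have hq : ∀ v : Fin n → ℝ, v ⬝ᵥ (H - A) *ᵥ v = v ⬝ᵥ H *ᵥ v - v ⬝ᵥ A *ᵥ v := fun v => by
      rw [sub_mulVec, dotProduct_sub]
    have hk : ∀ k, (e k).ofLp ⬝ᵥ (H - A) *ᵥ (e k).ofLp ≤ C k * p := by
      intro k
      rw [hq, sub_le_iff_le_add, hH, ← D2_eq_dotProduct, D2_bm hs₁, add_comm]
      rw [← bm_const hρ₂ ((e k).ofLp ⬝ᵥ A *ᵥ (e k).ofLp + C k * p) x]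
      refine bm_mono hρ₂ (continuous_D2 hs₁ _ _) continuous_const fun y _ => ?_
      rw [D2_bm hs]; exact hmean k ρ₁ hρ₁ _
    have hsum : ∑ k, c k * |(e k).ofLp ⬝ᵥ (H - A) *ᵥ (e k).ofLp|
        ≤ (2 * D₀ + 1) * p + (n - (A⁻¹ * H).trace) := by
      calc _ ≤ ∑ k, (2 * (c k * C k * p) - c k * ((e k).ofLp ⬝ᵥ (H - A) *ᵥ (e k).ofLp)) := by
            refine sum_le_sum fun k _ => ?_
            have hCp : 0 ≤ C k * p := mul_nonneg (hC k).le hp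
            have : |(e k).ofLp ⬝ᵥ (H - A) *ᵥ (e k).ofLp|
                ≤ 2 * (C k * p) - (e k).ofLp ⬝ᵥ (H - A) *ᵥ (e k).ofLp :=
              abs_le.2 ⟨by linarith [hk k], by linarith [hk k]⟩
            nlinarith [mul_le_mul_of_nonneg_left this (hc k).le]
        _ = 2 * (D₀ * p) - (A⁻¹ * (H - A)).trace := by
            rw [sum_sub_distrib, ← mul_sum, ← sum_mul, hdiff.1]
        _ ≤ _ := by rw [Matrix.mul_sub, trace_sub, hnA]; linarith
    rw [D2_eq_dotProduct, ← hH, ← hq]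
    exact (hdiff.2 ξ).trans (mul_le_mul_of_nonneg_left hsum (by positivity))

/-- If the averaged Hessian has nearly maximal trace in mean over a ball, then the function is
close to the quadratic form of `A`. -/
theorem exists_quadratic_approximation (hu : MeanDominated u A τ Γ) :
    ∃ C > 0, ∀ R, 1 ≤ R → ∀ δ : ℝ, 0 < δ → δ ≤ 1 / 4 → R ^ (-(τ / 2)) ≤ δ ^ (n + 1) →
      ∫ x in closedBall 0 R, (n - (A⁻¹ * hess (bm (√R) u) x).trace)
        ≤ δ ^ (n + 1) * (R ^ n * ballVol n) →
      ∀ x, ‖x‖ ≤ R / 2 → |u x - 1 / 2 * (x.ofLp ⬝ᵥ A *ᵥ x.ofLp)| ≤ C * (δ * R ^ 2) := by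
  have hω := ballVol_pos n
  obtain ⟨C, hC, hsd⟩ := hu.sd_le
  obtain ⟨L, hL, D, hD, hpin⟩ := hu.exists_pinching
  refine ⟨28 * C + L * (D + 1), by positivity, fun R hR δ hδ hδ4 hRδ hInt x hx => ?_⟩
  have hR0 : 0 < R := by linarith
  set ρ₁ := √R with hρ₁d
  have hρ₁ : 1 ≤ ρ₁ := Real.one_le_sqrt.2 hR
  have hρ₁0 : 0 < ρ₁ := by linarith
  have hρτ : ρ₁ ^ (-τ) = R ^ (-(τ / 2)) := by rw [hρ₁d, sqrt_eq_rpow, ← rpow_mul hR0.le]; ring_nf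
  set ρ₂ := δ * R with hρ₂d
  have hρ₂0 : 0 < ρ₂ := by positivity
  have hρ₁₂ : ρ₁ ≤ ρ₂ := by
    have h1 : R ^ (-(1 / 2) : ℝ) ≤ δ := calc
      R ^ (-(1 / 2) : ℝ) ≤ R ^ (-(τ / 2)) :=
        rpow_le_rpow_of_exponent_le hR (by linarith [hu.tau_le])
      _ ≤ δ ^ (n + 1) := hRδ
      _ ≤ δ ^ 1 := pow_le_pow_of_le_one hδ.le (by linarith) (by omega)
      _ = δ := pow_one _
    calc ρ₁ = R ^ (-(1 / 2) : ℝ) * R := by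
          rw [hρ₁d, sqrt_eq_rpow]
          nth_rewrite 3 [← rpow_one R]
          rw [← rpow_add hR0]; norm_num
      _ ≤ δ * R := mul_le_mul_of_nonneg_right h1 hR0.le
  have hρ₂ : 1 ≤ ρ₂ := hρ₁.trans hρ₁₂
  have hs := hu.smooth
  have hv := hu.toConvexC2.bm hρ₁0
  have hw := hv.bm hρ₂0
  set v := bm ρ₁ u
  set w := bm ρ₂ v
  obtain ⟨htr, hpin⟩ := hpin ρ₁ hρ₁
  have hclose : ∀ z ξ : Eu n, ‖z‖ ≤ R / 2 →
      |D2 w z ξ ξ - ξ.ofLp ⬝ᵥ A *ᵥ ξ.ofLp| ≤ L * ‖ξ‖ ^ 2 * ((D + 1) * δ) := by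
    intro z ξ hz
    refine (hpin ρ₂ hρ₂0 z ξ).trans (mul_le_mul_of_nonneg_left ?_ (by positivity))
    set F : Eu n → ℝ := fun y => D * ρ₁ ^ (-τ) + (n - (A⁻¹ * hess v y).trace) with hF
    have hFc : Continuous F :=
      continuous_const.add (continuous_const.sub (continuous_trace_mul_hess hv.smooth _))
    have hF0 : ∀ y, 0 ≤ F y := fun y => by simp only [hF]; linarith [htr y]
    have heq : D * ρ₁ ^ (-τ) + (n - (A⁻¹ * hess w z).trace) = bm ρ₂ F z := by
      rw [trace_mul_hess_bm hv.smooth]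
      have h1 : F = fun y => (D * ρ₁ ^ (-τ) + n) + (-1) * (A⁻¹ * hess v y).trace := by
        funext y; simp only [hF]; ring
      rw [h1, bm_add (H := fun y => (-1) * (A⁻¹ * hess v y).trace) continuous_const
        (continuous_const.mul (continuous_trace_mul_hess hv.smooth _)), bm_const hρ₂0, bm_const_mul]
      ring
    rw [heq, bm_eq]
    have hIF : IntegrableOn F (closedBall 0 R) :=
      hFc.integrableOn_compact (isCompact_closedBall 0 R)
    have hsubset : closedBall z ρ₂ ⊆ closedBall 0 R := by
      refine closedBall_subset_closedBall' ?_
      rw [dist_zero_right]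
      have : ρ₂ ≤ 1 / 4 * R := mul_le_mul_of_nonneg_right hδ4 hR0.le
      linarith
    have hle : ∫ y in closedBall z ρ₂, F y ≤ (D + 1) * δ ^ (n + 1) * (R ^ n * ballVol n) := by
      calc ∫ y in closedBall z ρ₂, F y ≤ ∫ y in closedBall 0 R, F y :=
            setIntegral_mono_set hIF (.of_forall hF0) (LE.le.eventuallyLE hsubset)
        _ = D * ρ₁ ^ (-τ) * (R ^ n * ballVol n)
            + ∫ y in closedBall 0 R, (n - (A⁻¹ * hess v y).trace) := by
            have h1 : IntegrableOn (fun _ : Eu n => D * ρ₁ ^ (-τ)) (closedBall 0 R) :=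
              integrableOn_const (isCompact_closedBall 0 R).measure_lt_top.ne enorm_ne_top
            have h2 : IntegrableOn (fun y => n - (A⁻¹ * hess v y).trace) (closedBall 0 R) :=
              (continuous_const.sub (continuous_trace_mul_hess hv.smooth
                _)).integrableOn_compact (isCompact_closedBall 0 R)
            rw [hF, integral_add h1 h2, setIntegral_const, volume_closedBall 0 hR0.le, smul_eq_mul,
              mul_comm (R ^ n * ballVol n)]
        _ ≤ D * δ ^ (n + 1) * (R ^ n * ballVol n) + δ ^ (n + 1) * (R ^ n * ballVol n) := by
            refine add_le_add (mul_le_mul_of_nonneg_right ?_ (by positivity)) hInt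
            exact mul_le_mul_of_nonneg_left (hρτ.trans_le hRδ) hD.le
        _ = _ := by ring
    calc (ρ₂ ^ n * ballVol n)⁻¹ * ∫ y in closedBall z ρ₂, F y
        ≤ (ρ₂ ^ n * ballVol n)⁻¹ * ((D + 1) * δ ^ (n + 1) * (R ^ n * ballVol n)) :=
          mul_le_mul_of_nonneg_left hle (by positivity)
      _ = (D + 1) * δ := by rw [hρ₂d, mul_pow, pow_succ]; field_simp
  have hwlow : ∀ z, u z ≤ w z := fun z => (hu.toConvexC2.le_bm hρ₁0 z).trans (hv.le_bm hρ₂0 z)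
  have hwup : ∀ z, w z ≤ u z + 8 * C * ρ₂ ^ 2 := by
    intro z
    have h1 : w z ≤ bm ρ₂ (fun y => u y + 4 * C * ρ₁ ^ 2) z :=
      bm_mono hρ₂0 hv.continuous (hu.continuous.add continuous_const) fun y _ =>
        hu.toConvexC2.bm_le hC hsd hρ₁ _
    rw [bm_add hu.continuous continuous_const, bm_const hρ₂0] at h1
    have h2 := hu.toConvexC2.bm_le hC hsd hρ₂ z
    have h3 : ρ₁ ^ 2 ≤ ρ₂ ^ 2 := pow_le_pow_left₀ hρ₁0.le hρ₁₂ 2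
    nlinarith
  have hunn : ∀ z, 0 ≤ u z := fun z => by
    have := hu.breg_nonneg 0 z
    simpa [breg, hu.zero, hu.grad_zero] using this
  have huup : ∀ z, ‖z‖ ≤ ρ₂ → u z ≤ 4 * C * ρ₂ ^ 2 := by
    intro z hz
    have h1 := (hu.toConvexC2.breg_le_sd 0 z).trans (hsd 0 z)
    simp only [breg, zero_add, hu.zero, hu.grad_zero, sub_zero, _root_.zero_apply] at h1
    have : (1 + ‖z‖) ^ 2 ≤ (2 * ρ₂) ^ 2 := pow_le_pow_left₀ (by positivity) (by linarith) 2
    nlinarith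
  have hδR : ρ₂ ^ 2 ≤ δ * R ^ 2 := by
    rw [hρ₂d, mul_pow]
    exact mul_le_mul_of_nonneg_right (by nlinarith) (by positivity)
  have hgrad : ∀ z, ‖z‖ ≤ R → δ * fderiv ℝ w 0 z ≤ 12 * C * ρ₂ ^ 2 := by
    intro z hz
    have h1 := hw.breg_nonneg 0 (δ • z)
    rw [breg, sub_zero, map_smul, smul_eq_mul] at h1
    have h2 : ‖δ • z‖ ≤ ρ₂ := by
      rw [norm_smul, norm_of_nonneg hδ.le]; exact mul_le_mul_of_nonneg_left hz hδ.le
    linarith [hwup (δ • z), huup _ h2, hwlow 0, hunn 0]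
  have hgrad' : |fderiv ℝ w 0 x| ≤ 12 * C * (δ * R ^ 2) := by
    have h1 := hgrad x (by linarith)
    have h2 := hgrad (-x) (by rw [norm_neg]; linarith)
    rw [map_neg] at h2
    have h3 : 12 * C * ρ₂ ^ 2 = δ * (12 * C * (δ * R ^ 2)) := by rw [hρ₂d]; ring
    rw [h3] at h1 h2
    exact abs_le.2 ⟨by linarith [le_of_mul_le_mul_left h2 hδ], le_of_mul_le_mul_left h1 hδ⟩
  have htay := abs_taylor_sub_le hw.smooth x (q := x.ofLp ⬝ᵥ A *ᵥ x.ofLp) (fun t h0 h1 =>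
    hclose (t • x) x (by
      rw [norm_smul, norm_of_nonneg h0]
      exact (mul_le_of_le_one_left (norm_nonneg x) h1).trans hx))
  have htb : L * ‖x‖ ^ 2 * ((D + 1) * δ) ≤ L * (D + 1) * (δ * R ^ 2) := by
    have : ‖x‖ ^ 2 ≤ R ^ 2 := pow_le_pow_left₀ (norm_nonneg x) (by linarith) 2
    calc L * ‖x‖ ^ 2 * ((D + 1) * δ) = L * (D + 1) * δ * ‖x‖ ^ 2 := by ring
      _ ≤ L * (D + 1) * δ * R ^ 2 := mul_le_mul_of_nonneg_left this (by positivity)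
      _ = _ := by ring
  have h8 : 8 * C * ρ₂ ^ 2 ≤ 8 * C * (δ * R ^ 2) := mul_le_mul_of_nonneg_left hδR (by positivity)
  have hw0 := hwup 0
  rw [hu.zero] at hw0
  have ht := abs_le.1 (htay.trans htb)
  have hg := abs_le.1 hgrad'
  refine abs_le.2 ⟨?_, ?_⟩
  · linarith [hwup x, hwlow 0, hunn 0]
  · linarith [hwlow x]

end MeanDominated

theorem integral_le_integral_bm {F : Eu n → ℝ} (hF : Continuous F) (hF0 : ∀ z, 0 ≤ F z) {ρ : ℝ}
    (hρ : 0 < ρ) (R : ℝ) :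
    ∫ x in closedBall 0 (R - ρ), F x ≤ ∫ x in closedBall 0 R, bm ρ F x := by
  have hω := ballVol_pos n
  have hc : Continuous fun p : Eu n × Eu n => F (p.1 + p.2) := hF.comp (by fun_prop)
  have hswap : ∫ x in closedBall (0 : Eu n) R, ∫ y in closedBall (0 : Eu n) ρ, F (x + y)
      = ∫ y in closedBall (0 : Eu n) ρ, ∫ x in closedBall (0 : Eu n) R, F (x + y) := by
    refine integral_integral_swap (f := fun x y => F (x + y)) ?_
    rw [Measure.prod_restrict]
    exact hc.integrableOn_compact ((isCompact_closedBall 0 R).prod (isCompact_closedBall 0 ρ))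
  have hle : (ρ ^ n * ballVol n) * ∫ x in closedBall 0 (R - ρ), F x
      ≤ ∫ y in closedBall (0 : Eu n) ρ, ∫ x in closedBall (0 : Eu n) R, F (x + y) := by
    rw [← volume_closedBall (0 : Eu n) hρ.le, ← smul_eq_mul, ← setIntegral_const]
    refine setIntegral_mono_on (integrableOn_const (isCompact_closedBall 0 ρ).measure_lt_top.ne
      enorm_ne_top) ((continuous_parametric_integral_of_continuous
        (f := fun y x => F (x + y)) (hF.comp (by fun_prop))
        (isCompact_closedBall 0 R)).integrableOn_compact (isCompact_closedBall 0 ρ))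
      measurableSet_closedBall fun y hy => ?_
    rw [mem_closedBall_zero_iff] at hy
    rw [← setIntegral_comp_add (closedBall 0 (R - ρ)) y]
    refine setIntegral_mono_set ((hF.comp (by fun_prop : Continuous fun x => x + y)).continuousOn
      |>.integrableOn_compact (isCompact_closedBall 0 R))
      (.of_forall fun x => hF0 _) (LE.le.eventuallyLE fun x hx => ?_)
    simp only [Set.mem_preimage, mem_closedBall_zero_iff] at hx ⊢
    calc ‖x‖ = ‖x + y - y‖ := by rw [add_sub_cancel_right]
      _ ≤ ‖x + y‖ + ‖y‖ := norm_sub_le _ _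
      _ ≤ R := by linarith
  simp only [bm]
  rw [integral_const_mul, hswap, ← div_eq_inv_mul, le_div_iff₀ (by positivity), mul_comm]
  exact hle

theorem exists_le_quadForm {A : Mat n} (hA : A.PosDef) :
    ∃ a > 0, ∀ ξ : Eu n, a * ‖ξ‖ ^ 2 ≤ ξ.ofLp ⬝ᵥ A *ᵥ ξ.ofLp := by
  have ht : 0 ≤ A⁻¹.trace := hA.inv.posSemidef.trace_nonneg
  refine ⟨(A⁻¹.trace + 1)⁻¹, by positivity, fun ξ => ?_⟩
  have hself : ξ.ofLp ⬝ᵥ ξ.ofLp = ‖ξ‖ ^ 2 := by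
    rw [EuclideanSpace.real_norm_sq_eq]
    exact sum_congr rfl fun i _ => (sq (ξ i)).symm
  have hnn : 0 ≤ ξ.ofLp ⬝ᵥ A *ᵥ ξ.ofLp := by
    simpa using hA.posSemidef.dotProduct_mulVec_nonneg ξ.ofLp
  have h1 := dotProduct_sq_le hA ξ.ofLp ξ.ofLp
  have h2 := dotProduct_mulVec_le_trace hA.inv.posSemidef ξ.ofLp
  rw [hself] at h1 h2
  rw [inv_mul_le_iff₀ (by positivity)]
  rcases (norm_nonneg ξ).eq_or_lt with h0 | h0
  · rw [← h0]; simp only [ne_eq, OfNat.ofNat_ne_zero, not_false_eq_true, zero_pow]; positivity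
  have h3 : ‖ξ‖ ^ 2 * ‖ξ‖ ^ 2 ≤ ((A⁻¹.trace + 1) * (ξ.ofLp ⬝ᵥ A *ᵥ ξ.ofLp)) * ‖ξ‖ ^ 2 := by
    nlinarith [mul_le_mul_of_nonneg_left h2 hnn, mul_nonneg hnn (sq_nonneg ‖ξ‖)]
  exact le_of_mul_le_mul_right h3 (by positivity)

namespace MeanDominated

variable {A : Mat n} {τ : ℝ}

theorem eventually_trace_deficit_le (hu : MeanDominated u A τ Γ)
    (hlim : ∀ i j, Tendsto (fun R => bm R (fun z => hess u z i j) 0) atTop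
      (nhds (A i j))) {ε : ℝ} (hε : 0 < ε) :
    ∀ᶠ R in atTop, ∫ x in closedBall 0 R, (n - (A⁻¹ * hess (bm (√R) u) x).trace)
        ≤ ε * (R ^ n * ballVol n) := by
  have hω := ballVol_pos n
  set F : Eu n → ℝ := fun z => (A⁻¹ * hess u z).trace
  have hF : Continuous F := continuous_trace_mul_hess hu.smooth _
  have hF0 : ∀ z, 0 ≤ F z := fun z => trace_inv_mul_nonneg hu.posDef (hu.pos z).posSemidef
  have hb : Tendsto (fun R => bm R F 0) atTop (nhds n) := by
    have hH : Tendsto (fun R => hess (bm R u) 0) atTop (nhds A) :=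
      tendsto_pi_nhds.2 fun i => tendsto_pi_nhds.2 fun j =>
        (hlim i j).congr fun R => (hess_bm hu.smooth 0 i j).symm
    have hc : Continuous fun H : Mat n => (A⁻¹ * H).trace :=
      (continuous_const.matrix_mul continuous_id).matrix_trace
    have := (hc.tendsto A).comp hH
    rw [hu.trace_inv_mul_self] at this
    exact this.congr fun R => trace_mul_hess_bm hu.smooth _ _
  have hsq : Tendsto (fun R : ℝ => 1 - (√R)⁻¹) atTop (nhds 1) := by
    simpa using (tendsto_inv_atTop_zero.comp Real.tendsto_sqrt_atTop).const_sub 1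
  have hinf : Tendsto (fun R : ℝ => R - √R) atTop atTop := by
    refine tendsto_atTop_mono' _ ?_ Real.tendsto_sqrt_atTop
    filter_upwards [eventually_ge_atTop 4] with R hR
    have h1 : 2 ≤ √R := Real.le_sqrt_of_sq_le (by linarith)
    nlinarith [mul_self_sqrt (show 0 ≤ R by linarith)]
  have hprod := (hsq.pow n).mul (hb.comp hinf)
  rw [one_pow, one_mul] at hprod
  filter_upwards [hprod.eventually (lt_mem_nhds (show (n : ℝ) - ε < n by linarith)),
    eventually_gt_atTop 1] with R hR hR1
  have hR0 : 0 < R := by linarith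
  set s := √R
  have hs : 1 < s := Real.lt_sqrt_of_sq_lt (by linarith)
  have hss : s * s = R := mul_self_sqrt hR0.le
  have hRs : 0 < R - s := by nlinarith
  have h1 := integral_le_integral_bm hF hF0 (show 0 < s by linarith) R
  have h2 : ∫ x in closedBall 0 (R - s), F x = (R - s) ^ n * ballVol n * bm (R - s) F 0 := by
    rw [bm_eq, ← mul_assoc, mul_inv_cancel₀ (by positivity), one_mul]
  have h3 : (R - s) ^ n = R ^ n * (1 - s⁻¹) ^ n := by
    rw [← mul_pow]; congr 1
    have : R * s⁻¹ = s := by rw [← hss]; field_simp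
    linear_combination this
  have h4 : ∫ x in closedBall 0 R, (n - (A⁻¹ * hess (bm s u) x).trace)
      = n * (R ^ n * ballVol n) - ∫ x in closedBall 0 R, bm s F x := by
    have hc : IntegrableOn (fun _ : Eu n => (n : ℝ)) (closedBall 0 R) :=
      integrableOn_const (isCompact_closedBall 0 R).measure_lt_top.ne enorm_ne_top
    have hi : IntegrableOn (bm s F) (closedBall 0 R) :=
      (continuous_bm hF).integrableOn_compact (isCompact_closedBall 0 R)
    simp only [trace_mul_hess_bm hu.smooth]
    rw [integral_sub hc hi, setIntegral_const, volume_closedBall 0 hR0.le, smul_eq_mul, mul_comm]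
  rw [h4]
  rw [h2, h3] at h1
  have h5 : (n - ε) * (R ^ n * ballVol n) ≤ ((1 - s⁻¹) ^ n * bm (R - s) F 0) * (R ^ n * ballVol n) :=
    mul_le_mul_of_nonneg_right hR.le (by positivity)
  nlinarith

/-- A function asymptotic to a quadratic form carries at least its Monge-Ampère mass. -/
theorem eventually_det_mul_le (hu : MeanDominated u A τ Γ)
    (happ : ∀ ε > 0, ∀ᶠ r in atTop, ∀ x : Eu n, ‖x‖ ≤ r →
      |u x - 1 / 2 * (x.ofLp ⬝ᵥ A *ᵥ x.ofLp)| ≤ ε * r ^ 2) {θ : ℝ} (hθ : 0 < θ) (hθ1 : θ < 1) :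
    ∀ᶠ r in atTop, A.det * ((1 - θ) ^ n * (r ^ n * ballVol n))
      ≤ ∫ x in closedBall 0 r, (hess u x).det := by
  obtain ⟨a, ha, hquad⟩ := exists_le_quadForm hu.posDef
  have hAs : A.IsSymm := by
    have := hu.posDef.isHermitian
    rwa [IsHermitian, conjTranspose_eq_transpose_of_trivial] at this
  filter_upwards [happ (a * θ ^ 2 / 8) (by positivity), eventually_gt_atTop 0] with r hr hr0
  set T : Eu n →L[ℝ] Eu n := toEuclideanCLM (𝕜 := ℝ) A
  have hin : ∀ x y : Eu n, inner ℝ (T x) y = y.ofLp ⬝ᵥ A *ᵥ x.ofLp := fun x y => by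
    rw [EuclideanSpace.inner_eq_star_dotProduct]; simp [T, ofLp_toEuclideanCLM]
  have hsym : ∀ x y : Eu n, y.ofLp ⬝ᵥ A *ᵥ x.ofLp = x.ofLp ⬝ᵥ A *ᵥ y.ofLp := fun x y => by
    rw [dotProduct_mulVec, ← mulVec_transpose, hAs.eq, dotProduct_comm]
  have hsub : ell 0 T 0 ((1 - θ) * r) ⊆ gradient u '' closedBall 0 r := by
    rintro _ ⟨q, hq, rfl⟩
    rw [mem_closedBall_zero_iff] at hq
    have hqr : ‖q‖ ≤ r := hq.trans (by nlinarith)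
    obtain ⟨z, hz, hzp⟩ := exists_gradient_eq_of_sphere hu.continuous (x₀ := 0) (q := q)
      (p := T q) (r := r) (by simpa using hqr) (fun z hz => by
        rw [sub_zero] at hz
        have h1 := abs_le.1 (hr z hz.le)
        have h2 := abs_le.1 (hr q hqr)
        have h3 := hquad (z - q)
        have h4 : θ * r ≤ ‖z - q‖ := by
          have := norm_sub_norm_le z q
          linarith
        have h5 : (θ * r) ^ 2 ≤ ‖z - q‖ ^ 2 := pow_le_pow_left₀ (by positivity) h4 2
        rw [hin, hin]
        rw [WithLp.ofLp_sub, mulVec_sub, dotProduct_sub, sub_dotProduct, sub_dotProduct,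
          hsym z q] at h3
        have h6 : 0 < a * θ ^ 2 * r ^ 2 := by positivity
        have h7 : a * (θ * r) ^ 2 ≤ a * ‖z - q‖ ^ 2 := mul_le_mul_of_nonneg_left h5 ha.le
        have h8 := hsym z q
        nlinarith) hu.differentiable
    exact ⟨z, hz, by simpa using hzp⟩
  have hvol := hu.volume_real_gradient_image (isCompact_closedBall 0 r)
  rw [← hvol.2]
  refine le_trans (le_of_eq ?_) (measureReal_mono hsub hvol.1)
  rw [volume_ell 0 T 0 (by nlinarith : 0 ≤ (1 - θ) * r), det_toEuclideanCLM,
    abs_of_pos hu.posDef.det_pos, mul_pow, mul_assoc]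

theorem det_le_of_mean (hu : MeanDominated u A τ Γ)
    (hlim : ∀ i j, Tendsto (fun R => bm R (fun z => hess u z i j) 0) atTop
      (nhds (A i j))) {c C₀ s : ℝ} (hs : 0 < s)
    (hmean : ∀ R, 1 ≤ R → ∫ x in closedBall 0 R, (hess u x).det
      ≤ (c + C₀ * R ^ (-s)) * (R ^ n * ballVol n)) : A.det ≤ c := by
  have hω := ballVol_pos n
  obtain ⟨C, hC, happ⟩ := hu.exists_quadratic_approximation
  have hquad : ∀ ε > 0, ∀ᶠ r in atTop, ∀ x : Eu n, ‖x‖ ≤ r →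
      |u x - 1 / 2 * (x.ofLp ⬝ᵥ A *ᵥ x.ofLp)| ≤ ε * r ^ 2 := by
    intro ε hε
    set δ := min (1 / 4) (ε / (4 * C))
    have hδ : 0 < δ := lt_min (by norm_num) (by positivity)
    have h1 := hu.eventually_trace_deficit_le hlim (pow_pos hδ (n + 1))
    have h2 := (tendsto_rpow_neg_atTop (half_pos hu.tau_pos)).eventually
      (ge_mem_nhds (pow_pos hδ (n + 1)))
    filter_upwards [(tendsto_id.const_mul_atTop (two_pos (α := ℝ))).eventually
      ((h1.and h2).and (eventually_ge_atTop 1))] with r ⟨⟨h1, h2⟩, h3⟩ x hx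
    refine (happ _ h3 δ hδ (min_le_left _ _) h2 h1 x (by simpa using hx)).trans ?_
    have h4 : δ * (4 * C) ≤ ε := (le_div_iff₀ (by positivity)).1 (min_le_right _ _)
    simp only [id]
    nlinarith [sq_nonneg r]
  have hθ : ∀ θ : ℝ, 0 < θ → θ < 1 → A.det * (1 - θ) ^ n ≤ c := by
    intro θ h0 h1
    have ht := ((tendsto_rpow_neg_atTop hs).const_mul C₀).const_add c
    rw [mul_zero, add_zero] at ht
    refine ge_of_tendsto ht ?_
    filter_upwards [hu.eventually_det_mul_le hquad h0 h1, eventually_ge_atTop 1] with r hr hr1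
    have hr0 : 0 < r := by linarith
    rw [← mul_assoc] at hr
    exact le_of_mul_le_mul_right (hr.trans (hmean r hr1)) (by positivity)
  have ht : Tendsto (fun θ : ℝ => A.det * (1 - θ) ^ n) (nhdsWithin 0 (Set.Ioi 0)) (nhds A.det) := by
    have : Continuous fun θ : ℝ => A.det * (1 - θ) ^ n := by fun_prop
    simpa using (this.tendsto 0).mono_left nhdsWithin_le_nhds
  refine le_of_tendsto ht ?_
  filter_upwards [Ioo_mem_nhdsGT (zero_lt_one (α := ℝ))] with θ h using hθ θ h.1 h.2

/-- A power rate for the mean of the Monge-Ampère density gives a power rate of convergence to a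
quadratic form. -/
theorem exists_power_rate (hu : MeanDominated u A τ Γ)
    (hlim : ∀ i j, Tendsto (fun R => bm R (fun z => hess u z i j) 0) atTop
      (nhds (A i j))) {c C₀ s : ℝ} (hs : 0 < s) (hs2 : s ≤ 1 / 2) (hC₀ : 0 < C₀)
    (hmean : ∀ R, 1 ≤ R → |(∫ x in closedBall 0 R, (hess u x).det) - c * (R ^ n * ballVol n)|
      ≤ C₀ * R ^ (-s) * (R ^ n * ballVol n)) :
    ∃ ε C : ℝ, 0 < ε ∧ ε ≤ 2 ∧ 0 < C ∧ ∀ x : Eu n, |u x - 1 / 2 * (x.ofLp ⬝ᵥ A *ᵥ x.ofLp)|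
      ≤ C * (1 + ‖x‖) ^ (2 - ε) := by
  have hω := ballVol_pos n
  have hn := hu.dim_pos
  have hn1 : (1 : ℝ) ≤ n := by exact_mod_cast hn
  have hd := hu.posDef.det_pos
  have hτ := hu.tau_pos
  have hdc : A.det ≤ c := hu.det_le_of_mean hlim (C₀ := C₀) hs fun R hR => by
    linarith [(abs_le.1 (hmean R hR)).2]
  set d := A.det
  obtain ⟨C, hC, happ⟩ := hu.exists_quadratic_approximation
  obtain ⟨L, hL, D, hD, hpin⟩ := hu.exists_pinching
  obtain ⟨M, hM, hmass⟩ := hu.exists_mass_le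
  set σ := min s (τ / 2)
  have hσ : 0 < σ := lt_min hs (by positivity)
  set κ := σ / (2 * (n + 1)) with hκd
  have hκ : 0 < κ := by positivity
  set K₁ := c * (n * M) + 2 * C₀
  have hK₁ : 0 < K₁ := by have : 0 < c := by linarith
                          positivity
  set K₂ := n / d * (d * (1 + D) ^ n + K₁) with hK₂
  have hdef : ∀ R : ℝ, 1 ≤ R → 2 * M ≤ √R →
      ∫ x in closedBall 0 R, (n - (A⁻¹ * hess (bm (√R) u) x).trace)
        ≤ K₂ * R ^ (-σ) * (R ^ n * ballVol n) := by
    intro R hR hRM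
    have hR0 : 0 < R := by linarith
    set ρ := √R with hρd
    have hρ : 1 ≤ ρ := Real.one_le_sqrt.2 hR
    have hρ0 : 0 < ρ := by linarith
    have hρρ : ρ * ρ = R := mul_self_sqrt hR0.le
    have hv := hu.toConvexC2.bm hρ0
    set X := R ^ n * ballVol n
    have hX : 0 < X := by positivity
    set E := (1 + D) ^ n * R ^ (-(τ / 2))
    set I := ∫ x in closedBall 0 R, (n - (A⁻¹ * hess (bm ρ u) x).trace)
    have hup : ∫ x in closedBall 0 R, (hess (bm ρ u) x).det ≤ d * (1 + E) * X - d / n * I := by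
      have hc1 : Continuous fun x => n - (A⁻¹ * hess (bm ρ u) x).trace :=
        continuous_const.sub (continuous_trace_mul_hess hv.smooth _)
      have hcpt := isCompact_closedBall (0 : Eu n) R
      have hconst : IntegrableOn (fun _ : Eu n => d * (1 + E)) (closedBall 0 R) :=
        integrableOn_const hcpt.measure_lt_top.ne enorm_ne_top
      have hi : IntegrableOn (fun x => d / n * (n - (A⁻¹ * hess (bm ρ u) x).trace))
          (closedBall 0 R) :=
        (continuous_const.mul hc1).integrableOn_compact hcpt
      have heq : d * (1 + E) * X - d / n * I = ∫ x in closedBall 0 R,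
          (d * (1 + E) - d / n * (n - (A⁻¹ * hess (bm ρ u) x).trace)) := by
        rw [integral_sub hconst hi, setIntegral_const, volume_closedBall 0 hR0.le, smul_eq_mul,
          integral_const_mul, mul_comm]
      rw [heq]
      refine setIntegral_mono_on ((continuous_hess hv.smooth).matrix_det.integrableOn_compact hcpt)
        (hconst.sub hi) measurableSet_closedBall fun x _ => ?_
      set y := (A⁻¹ * hess (bm ρ u) x).trace / n with hy
      have hy0 : 0 ≤ y := div_nonneg (trace_inv_mul_nonneg hu.posDef (hv.pos x).posSemidef)
        (by positivity)
      have hy1 : y ≤ 1 + D / R ^ (τ / 2) := by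
        have h1 := (hpin ρ hρ).1 x
        have h2 : ρ ^ (-τ) = (R ^ (τ / 2))⁻¹ := by
          rw [hρd, sqrt_eq_rpow, ← rpow_mul hR0.le, ← rpow_neg hR0.le]; ring_nf
        rw [h2, ← div_eq_mul_inv] at h1
        rw [hy, div_le_iff₀ (by positivity)]
        have : 0 ≤ D / R ^ (τ / 2) := by positivity
        nlinarith
      have hyn : y ^ n ≤ y + E := by
        have hE := one_add_div_pow_le hD.le (Real.one_le_rpow hR (half_pos hτ).le) n
        rw [← rpow_neg hR0.le] at hE
        rcases le_total y 1 with h | h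
        · have := pow_le_pow_of_le_one hy0 h (show 1 ≤ n from hn)
          rw [pow_one] at this
          have : 0 ≤ E := by positivity
          linarith
        · linarith [pow_le_pow_left₀ hy0 hy1 n]
      calc (hess (bm ρ u) x).det ≤ d * y ^ n := det_le_det_mul_trace_pow hu.posDef (hv.pos x).posSemidef
        _ ≤ d * (y + E) := mul_le_mul_of_nonneg_left hyn hd.le
        _ = d * (1 + E) - d / n * (n - (A⁻¹ * hess (bm ρ u) x).trace) := by
            rw [hy]; field_simp; ring
    have hlow : (c - K₁ * R ^ (-s)) * X ≤ ∫ x in closedBall 0 R, (hess (bm ρ u) x).det := by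
      have hR' : R / 2 ≤ R - M * ρ := by nlinarith
      have hR'1 : 1 ≤ R - M * ρ := by nlinarith
      have h1 := hmass ρ hρ (R - M * ρ)
      rw [sub_add_cancel] at h1
      refine le_trans ?_ h1
      have h2 := (abs_le.1 (hmean (R - M * ρ) hR'1)).1
      have hinv : ρ⁻¹ ≤ R ^ (-s) := by
        rw [hρd, sqrt_eq_rpow, ← rpow_neg hR0.le]
        exact rpow_le_rpow_of_exponent_le hR (by linarith)
      have h3 : (1 - n * M * R ^ (-s)) * R ^ n ≤ (R - M * ρ) ^ n := by
        have hMρ : M * ρ⁻¹ ≤ 1 := by rw [← div_eq_mul_inv, div_le_one hρ0]; linarith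
        have hb := one_add_mul_le_pow (show (-2 : ℝ) ≤ -(M * ρ⁻¹) by linarith) n
        have heq : R - M * ρ = (1 + -(M * ρ⁻¹)) * R := by rw [← hρρ]; field_simp; ring
        rw [heq, mul_pow]
        refine mul_le_mul_of_nonneg_right (le_trans ?_ hb) (by positivity)
        have : n * M * ρ⁻¹ ≤ n * M * R ^ (-s) := mul_le_mul_of_nonneg_left hinv (by positivity)
        linarith
      have h4 : (R - M * ρ) ^ (-s) ≤ 2 * R ^ (-s) := by
        calc (R - M * ρ) ^ (-s) ≤ (R / 2) ^ (-s) :=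
              rpow_le_rpow_of_nonpos (by positivity) hR' (by linarith)
          _ = 2 ^ s * R ^ (-s) := by
              rw [Real.div_rpow hR0.le two_pos.le, rpow_neg two_pos.le, div_inv_eq_mul, mul_comm]
          _ ≤ 2 * R ^ (-s) := by
              refine mul_le_mul_of_nonneg_right ?_ (by positivity)
              calc (2 : ℝ) ^ s ≤ 2 ^ (1 : ℝ) :=
                    rpow_le_rpow_of_exponent_le one_le_two (by linarith)
                _ = 2 := rpow_one 2
      have h5 : (R - M * ρ) ^ n ≤ R ^ n := pow_le_pow_left₀ (by linarith) (by nlinarith) n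
      have h6 : C₀ * (R - M * ρ) ^ (-s) * ((R - M * ρ) ^ n * ballVol n)
          ≤ C₀ * (2 * R ^ (-s)) * X := by
        refine mul_le_mul (mul_le_mul_of_nonneg_left h4 hC₀.le)
          (mul_le_mul_of_nonneg_right h5 hω.le) ?_ (by positivity)
        have : 0 < R - M * ρ := by linarith
        positivity
      have h7 : c * ((1 - n * M * R ^ (-s)) * R ^ n * ballVol n)
          ≤ c * ((R - M * ρ) ^ n * ballVol n) :=
        mul_le_mul_of_nonneg_left (mul_le_mul_of_nonneg_right h3 hω.le) (by linarith)
      have h8 : (c - K₁ * R ^ (-s)) * X = c * ((1 - n * M * R ^ (-s)) * R ^ n * ballVol n)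
          - C₀ * (2 * R ^ (-s)) * X := by ring
      linarith
    have he1 : R ^ (-s) ≤ R ^ (-σ) := rpow_le_rpow_of_exponent_le hR (neg_le_neg (min_le_left _ _))
    have he2 : R ^ (-(τ / 2)) ≤ R ^ (-σ) :=
      rpow_le_rpow_of_exponent_le hR (neg_le_neg (min_le_right _ _))
    have hI : d / n * I ≤ (d * (1 + D) ^ n + K₁) * R ^ (-σ) * X := by
      have h1 : d / n * I ≤ (d * E + K₁ * R ^ (-s) + (d - c)) * X := by linarith
      refine h1.trans (mul_le_mul_of_nonneg_right ?_ hX.le)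
      have h2 := mul_le_mul_of_nonneg_left he1 hK₁.le
      have h3 := mul_le_mul_of_nonneg_left he2 (show 0 ≤ d * (1 + D) ^ n by positivity)
      linarith
    calc I = n / d * (d / n * I) := by field_simp
      _ ≤ n / d * ((d * (1 + D) ^ n + K₁) * R ^ (-σ) * X) :=
          mul_le_mul_of_nonneg_left hI (by positivity)
      _ = K₂ * R ^ (-σ) * X := by rw [hK₂]; ring
  have hev : ∀ᶠ R : ℝ in atTop, ∀ x : Eu n, ‖x‖ ≤ R / 2 →
      |u x - 1 / 2 * (x.ofLp ⬝ᵥ A *ᵥ x.ofLp)| ≤ C * R ^ (2 - κ) := by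
    have t1 := ((tendsto_rpow_neg_atTop (half_pos hσ)).const_mul K₂).eventually
      (ge_mem_nhds (show K₂ * 0 < 1 by simp))
    have t2 := (tendsto_rpow_neg_atTop hκ).eventually (ge_mem_nhds (show (0 : ℝ) < 1 / 4 by norm_num))
    filter_upwards [t1, t2, Real.tendsto_sqrt_atTop.eventually (eventually_ge_atTop (2 * M)),
      eventually_ge_atTop 1] with R h1 h2 h3 h4 x hx
    have hR0 : 0 < R := by linarith
    have hδ : (R ^ (-κ)) ^ (n + 1) = R ^ (-(σ / 2)) := by
      rw [← rpow_natCast, ← rpow_mul hR0.le]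
      congr 1
      rw [hκd]; push_cast; field_simp
    have h5 := happ R h4 (R ^ (-κ)) (by positivity) h2
      (by rw [hδ]; exact rpow_le_rpow_of_exponent_le h4 (by linarith [min_le_right s (τ / 2)]))
      ((hdef R h4 h3).trans (mul_le_mul_of_nonneg_right (by
        rw [hδ, show -σ = -(σ / 2) + -(σ / 2) by ring, rpow_add hR0, ← mul_assoc]
        exact mul_le_of_le_one_left (by positivity) h1) (by positivity))) x hx
    rwa [show R ^ (-κ) * R ^ 2 = R ^ (2 - κ) by
      rw [← rpow_natCast R 2, ← rpow_add hR0]; congr 1; push_cast; ring] at h5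
  obtain ⟨R₀, hR₀⟩ := eventually_atTop.1 hev
  have hκ2 : κ ≤ 2 := by
    rw [hκd, div_le_iff₀ (by positivity)]
    nlinarith [min_le_left s (τ / 2)]
  refine ⟨κ, C * (|R₀| + 2) ^ (2 - κ), hκ, hκ2, by positivity, fun x => ?_⟩
  have hx := norm_nonneg x
  have hR := le_abs_self R₀
  refine (hR₀ (|R₀| + 2 * ‖x‖) (by linarith) x (by linarith [abs_nonneg R₀])).trans ?_
  rw [mul_assoc, ← mul_rpow (by positivity) (by positivity)]
  refine mul_le_mul_of_nonneg_left (Real.rpow_le_rpow (by positivity) ?_ (by linarith)) hC.le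
  nlinarith [mul_nonneg (abs_nonneg R₀) hx]

end MeanDominated

theorem integral_closedBall_le_add {p : Eu n → ℝ} (hp : Continuous p) {d : ℝ} (hp0 : ∀ x, 0 ≤ p x)
    (hpd : ∀ x, p x ≤ d) {D R : ℝ} (hD : 0 ≤ D) (hR : 1 ≤ R) {y z : Eu n} (hyz : ‖y - z‖ ≤ D) :
    ∫ x in closedBall y R, p x ≤ (∫ x in closedBall z R, p x)
      + d * (1 + D) ^ n * R⁻¹ * (R ^ n * ballVol n) := by
  have hω := ballVol_pos n
  have hR0 : 0 < R := by linarith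
  have hInt : ∀ (x : Eu n) r, IntegrableOn p (closedBall x r) := fun x r =>
    hp.integrableOn_compact (isCompact_closedBall x r)
  have hsub : closedBall z R ⊆ closedBall z (R + D) := closedBall_subset_closedBall (by linarith)
  have h1 : ∫ x in closedBall y R, p x ≤ ∫ x in closedBall z (R + D), p x :=
    setIntegral_mono_set (hInt _ _) (.of_forall hp0) (LE.le.eventuallyLE
      (closedBall_subset_closedBall' (by rw [dist_eq_norm]; linarith)))
  have h2 := setIntegral_sdiff₀ (f := p) measurableSet_closedBall.nullMeasurableSet (hInt z (R + D)) hsub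
  have hfin : volume (closedBall z (R + D)) ≠ ⊤ := (isCompact_closedBall _ _).measure_lt_top.ne
  have h3 : ∫ x in closedBall z (R + D) \ closedBall z R, p x
      ≤ d * ((R + D) ^ n * ballVol n - R ^ n * ballVol n) := by
    rw [← volume_closedBall z (by linarith : 0 ≤ R + D), ← volume_closedBall z hR0.le,
      ← measureReal_sdiff hsub measurableSet_closedBall hfin, mul_comm, ← smul_eq_mul,
      ← setIntegral_const]
    exact setIntegral_mono_on ((hInt _ _).mono_set Set.sdiff_subset)
      (integrableOn_const (measure_ne_top_of_subset Set.sdiff_subset hfin) enorm_ne_top)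
      (measurableSet_closedBall.diff measurableSet_closedBall) fun x _ => hpd x
  have h4 : (R + D) ^ n ≤ R ^ n * (1 + (1 + D) ^ n * R⁻¹) := by
    rw [show R + D = R * (1 + D / R) by field_simp, mul_pow]
    exact mul_le_mul_of_nonneg_left (one_add_div_pow_le hD hR n) (by positivity)
  have hd : 0 ≤ d := (hp0 0).trans (hpd 0)
  nlinarith [mul_le_mul_of_nonneg_left h4 (mul_nonneg hd hω.le)]

open scoped Pointwise in
/-- Means over large balls of a function with a full lattice of periods converge to its mean over
a fundamental domain. -/
theorem exists_periodic_mean (b : Module.Basis (Fin n) ℝ (Eu n)) {p : Eu n → ℝ} (hp : Continuous p)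
    {d : ℝ} (hp0 : ∀ x, 0 ≤ p x) (hpd : ∀ x, p x ≤ d)
    (hper : ∀ e ∈ Submodule.span ℤ (Set.range b), ∀ x, p (x + e) = p x) :
    ∃ c C : ℝ, 0 ≤ C ∧ ∀ R, 1 ≤ R → |(∫ x in closedBall 0 R, p x) - c * (R ^ n * ballVol n)|
      ≤ C * R⁻¹ * (R ^ n * ballVol n) := by
  have hω := ballVol_pos n
  set Q := ZSpan.fundamentalDomain b
  obtain ⟨D, hD0, hD⟩ := (ZSpan.fundamentalDomain_isBounded b).exists_pos_norm_le
  have hQD : Q ⊆ closedBall 0 D := fun y hy => mem_closedBall_zero_iff.2 (hD y hy)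
  have hQfin : volume Q ≠ ⊤ :=
    measure_ne_top_of_subset hQD (isCompact_closedBall _ _).measure_lt_top.ne
  have hQm : MeasurableSet Q := ZSpan.fundamentalDomain_measurableSet b
  have hV : 0 < volume.real Q := ENNReal.toReal_pos
    (ZSpan.measure_fundamentalDomain_ne_zero b) hQfin
  have hd : 0 ≤ d := (hp0 0).trans (hpd 0)
  have hfd : IsAddFundamentalDomain (Submodule.span ℤ (Set.range b)).toAddSubgroup Q
      (volume : Measure (Eu n)) := ZSpan.isAddFundamentalDomain' b _
  have : Countable (Submodule.span ℤ (Set.range b)).toAddSubgroup :=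
    inferInstanceAs (Countable (Submodule.span ℤ (Set.range b)))
  set I := ∫ y in Q, p y
  have hcell : ∀ x : Eu n, ∫ y in Q, p (x + y) = I := by
    intro x
    have h := (hfd.vadd_of_comm x).setIntegral_eq hfd (f := p) (fun g y => by
      have := hper g g.2 y
      rwa [add_comm] at this)
    rw [← setIntegral_comp_add (x +ᵥ Q) x] at h
    rw [show I = _ from h.symm]
    congr 1
    · congr 1
      ext y
      simp [Set.mem_vadd_set_iff_neg_vadd_mem, add_comm y x]
    · funext y; rw [add_comm]
  refine ⟨I / volume.real Q, d * (1 + D) ^ n, by positivity, fun R hR => ?_⟩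
  have hR0 : 0 < R := by linarith
  set X := R ^ n * ballVol n
  set J := ∫ x in closedBall 0 R, p x
  have hc : Continuous fun q : Eu n × Eu n => p (q.1 + q.2) := hp.comp (by fun_prop)
  have hpar : Continuous fun y => ∫ x in closedBall (0 : Eu n) R, p (x + y) :=
    continuous_parametric_integral_of_continuous (f := fun y x => p (x + y))
      (hp.comp (by fun_prop)) (isCompact_closedBall 0 R)
  have hswap : I * X = ∫ y in Q, ∫ x in closedBall (0 : Eu n) R, p (x + y) := by
    rw [← integral_integral_swap (f := fun x y => p (x + y))]
    · simp only [hcell]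
      rw [setIntegral_const, volume_closedBall 0 hR0.le, smul_eq_mul, mul_comm]
    · rw [Measure.prod_restrict]
      exact (hc.integrableOn_compact ((isCompact_closedBall 0 R).prod
        (isCompact_closedBall 0 D))).mono_set (Set.prod_mono subset_rfl hQD)
  have hdiff : |∫ y in Q, ((∫ x in closedBall (0 : Eu n) R, p (x + y)) - J)|
      ≤ d * (1 + D) ^ n * R⁻¹ * X * volume.real Q := by
    rw [← Real.norm_eq_abs]
    refine norm_setIntegral_le_of_norm_le_const hQfin.lt_top fun y hy => ?_
    have hball : ∫ x in closedBall (0 : Eu n) R, p (x + y) = ∫ x in closedBall y R, p x := by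
      rw [← setIntegral_comp_add (closedBall y R) y]
      congr 2
      ext x; simp
    rw [hball, Real.norm_eq_abs, abs_le]
    have h1 := integral_closedBall_le_add hp hp0 hpd hD0.le hR (y := y) (z := 0) (by simpa using hD y hy)
    have h2 := integral_closedBall_le_add hp hp0 hpd hD0.le hR (y := 0) (z := y) (by simpa using hD y hy)
    exact ⟨by linarith, by linarith⟩
  rw [integral_sub ((hpar.integrableOn_compact (isCompact_closedBall 0 D)).mono_set hQD)
    (integrableOn_const hQfin enorm_ne_top), ← hswap, setIntegral_const, smul_eq_mul] at hdiff
  have heq : J - I / volume.real Q * X = -(I * X - volume.real Q * J) / volume.real Q := by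
    field_simp; ring
  rw [heq, abs_div, abs_neg, abs_of_pos hV, div_le_iff₀ hV]
  exact hdiff

theorem convexC2_of_convexOn (hu : ContDiff ℝ 2 u) (hc : ConvexOn ℝ Set.univ u)
    (hd : ∀ x, 0 < (hess u x).det) : ConvexC2 u := by
  refine ⟨hu, fun x => (posSemidef_hess hu fun a => ?_).posDef_iff_det_ne_zero.2 (hd x).ne'⟩
  have hu1 : ContDiff ℝ 1 u := hu.of_le (by norm_num)
  set φ : ℝ → ℝ := fun t => u (x + t • a)
  have hφ : ∀ t, HasDerivAt φ (fderiv ℝ u (x + t • a) a) t := hasDerivAt_line hu1 x a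
  have hconv : ConvexOn ℝ Set.univ φ := by
    refine ⟨convex_univ, fun s _ t _ α β hα hβ hαβ => ?_⟩
    have := hc.2 (Set.mem_univ (x + s • a)) (Set.mem_univ (x + t • a)) hα hβ hαβ
    convert this using 2
    rw [smul_add, smul_add, add_add_add_comm, ← add_smul, hαβ, one_smul]
    simp [add_smul, mul_smul]
  have hmono := hconv.monotoneOn_deriv fun t _ => (hφ t).differentiableAt
  rw [monotoneOn_univ, show deriv φ = fun t => fderiv ℝ u (x + t • a) a from
    funext fun t => (hφ t).deriv] at hmono
  simpa using (hasDerivAt_line_fderiv hu x a a 0).nonneg_of_monotone hmono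

theorem Setting.meanDominated {lam Lam β : ℝ} {Γ : AddSubgroup (Eu n)}
    (hu : Setting u lam Lam β Γ) {a : Fin n → ℝ} (ha0 : ∀ i, 0 < a i)
    (ha : ∀ i, single i (a i) ∈ Γ) :
    ∃ (A : Mat n) (τ : ℝ), MeanDominated u A τ Γ ∧
      ∀ i j, Tendsto (fun R => bm R (fun z => hess u z i j) 0) atTop (nhds (A i j)) := by
  obtain ⟨G⟩ := hu.toPinched.nonempty_geom hu.dim_pos
  obtain ⟨A, hA, hlim, τ, hτ, hτ1, hmean⟩ := hu.exists_matrix G ha0 ha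
  obtain ⟨C, hC, hsd⟩ := hu.exists_sd_quadratic_bound G ha0 ha
  exact ⟨A, τ, ⟨hu.toConvexC2, hu.dim_pos, hA, hu.zero, hu.grad_zero, ⟨C, hC, hsd⟩,
    hu.exists_breg_quadratic_lower G hC hsd, hτ, hτ1, hu.cocompact, hmean⟩, hlim⟩

section AsymptoticallyPeriodic

variable {f fp u : Eu n → ℝ} {d₀ d₁ β : ℝ} {b : Module.Basis (Fin n) ℝ (Eu n)}

theorem periodic_of_basis (h : ∀ i x, fp (x + b i) = fp x) :
    ∀ e ∈ Submodule.span ℤ (Set.range b), ∀ x, fp (x + e) = fp x := by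
  intro e he
  have : Submodule.span ℤ (Set.range b) ≤ AddSubgroup.toIntSubmodule
      { carrier := {e | ∀ x, fp (x + e) = fp x}
        zero_mem' := fun x => by rw [add_zero]
        add_mem' := fun {e e'} he he' x => by rw [← add_assoc, he', he]
        neg_mem' := fun {e} he x => by rw [← he (x + -e), neg_add_cancel_right] } := by
    rw [Submodule.span_le]
    rintro _ ⟨i, rfl⟩
    exact h i
  exact this he

theorem exists_mean_of_decay (hf : Continuous f) (hfp : Continuous fp) (hfp0 : ∀ x, 0 ≤ fp x)
    (hfpd : ∀ x, fp x ≤ d₀) (hper : ∀ e ∈ Submodule.span ℤ (Set.range b), ∀ x, fp (x + e) = fp x)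
    (hn : 0 < n) {K : ℝ} (hK : 0 < K) (hdecay : ∀ x, |f x - fp x| ≤ K * (1 + ‖x‖) ^ (-1 : ℝ)) :
    ∃ c C : ℝ, 0 < C ∧ ∀ R, 1 ≤ R → |(∫ x in closedBall 0 R, f x) - c * (R ^ n * ballVol n)|
      ≤ C * R ^ (-(1 / 2) : ℝ) * (R ^ n * ballVol n) := by
  have hω := ballVol_pos n
  obtain ⟨c, C, hC, hmean⟩ := exists_periodic_mean b hfp hfp0 hfpd hper
  refine ⟨c, C + 2 * K, by positivity, fun R hR => ?_⟩
  have hR0 : 0 < R := by linarith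
  have hInt : ∀ {F : Eu n → ℝ}, Continuous F → IntegrableOn F (closedBall 0 R) := fun h =>
    h.integrableOn_compact (isCompact_closedBall 0 R)
  have hg : Continuous fun y : Eu n => (1 + ‖y‖) ^ (-1 : ℝ) :=
    (continuous_const.add continuous_norm).rpow_const fun y => .inl (show 1 + ‖y‖ ≠ 0 by positivity)
  have h1 : |(∫ x in closedBall 0 R, f x) - ∫ x in closedBall 0 R, fp x|
      ≤ K * (2 * (R ^ n * ballVol n) * R ^ (-(1 / 2) : ℝ)) := by
    rw [← integral_sub (hInt hf) (hInt hfp)]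
    refine abs_integral_le_integral_abs.trans ((setIntegral_mono_on (hInt (hf.sub hfp).abs)
      (g := fun x => K * (1 + ‖x‖) ^ (-1 : ℝ)) (hInt (continuous_const.mul hg)) measurableSet_closedBall fun x _ => hdecay x).trans ?_)
    rw [integral_const_mul]
    exact mul_le_mul_of_nonneg_left (integral_decay_le one_pos le_rfl hn hR 0) hK.le
  have h2 : C * R⁻¹ * (R ^ n * ballVol n) ≤ C * R ^ (-(1 / 2) : ℝ) * (R ^ n * ballVol n) := by
    refine mul_le_mul_of_nonneg_right (mul_le_mul_of_nonneg_left ?_ hC) (by positivity)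
    rw [← Real.rpow_neg_one]
    exact rpow_le_rpow_of_exponent_le hR (by norm_num)
  have h3 := (abs_sub_le _ _ _).trans (add_le_add h1 (hmean R hR))
  linarith

theorem abs_sub_le_of_root (hn : 0 < n) (hd₁ : 0 < d₁) (hβ : 1 ≤ β) (hf0 : ∀ x, 0 ≤ f x)
    (hf : ∀ x, f x ≤ d₁) (hfp0 : ∀ x, 0 ≤ fp x) (hfp : ∀ x, fp x ≤ d₀)
    (hg : ∀ x, |f x ^ ((1 : ℝ) / n) - fp x ^ ((1 : ℝ) / n)| ≤ d₁ * (1 + ‖x‖) ^ (-β)) :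
    ∃ K > 0, ∀ x, |f x - fp x| ≤ K * (1 + ‖x‖) ^ (-1 : ℝ) := by
  set m := max d₁ d₀ ^ ((1 : ℝ) / n)
  have hm : 0 < m := Real.rpow_pos_of_pos (lt_max_of_lt_left hd₁) _
  have hn' : (0 : ℝ) < n := by exact_mod_cast hn
  refine ⟨d₁ * n * m ^ (n - 1), by positivity, fun x => ?_⟩
  have hp : ∀ t : ℝ, 0 ≤ t → (t ^ ((1 : ℝ) / n)) ^ n = t := fun t ht => by
    rw [one_div, Real.rpow_inv_natCast_pow ht hn.ne']
  have hr : ∀ t : ℝ, 0 ≤ t → t ≤ max d₁ d₀ → |t ^ ((1 : ℝ) / n)| ≤ m := fun t h0 h1 => by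
    rw [abs_of_nonneg (by positivity)]
    exact Real.rpow_le_rpow h0 h1 (by positivity)
  have h := abs_pow_sub_pow_le (f x ^ ((1 : ℝ) / n)) (fp x ^ ((1 : ℝ) / n)) n
  rw [hp _ (hf0 x), hp _ (hfp0 x)] at h
  have h1 : (1 + ‖x‖) ^ (-β) ≤ (1 + ‖x‖) ^ (-1 : ℝ) :=
    rpow_le_rpow_of_exponent_le (by linarith [norm_nonneg x]) (by linarith)
  have h2 : |f x ^ ((1 : ℝ) / n) - fp x ^ ((1 : ℝ) / n)| ≤ d₁ * (1 + ‖x‖) ^ (-1 : ℝ) :=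
    (hg x).trans (mul_le_mul_of_nonneg_left h1 hd₁.le)
  refine h.trans ?_
  rw [show d₁ * n * m ^ (n - 1) * (1 + ‖x‖) ^ (-1 : ℝ)
    = d₁ * (1 + ‖x‖) ^ (-1 : ℝ) * n * m ^ (n - 1) by ring]
  exact mul_le_mul (mul_le_mul_of_nonneg_right h2 hn'.le) (pow_le_pow_left₀ (by positivity)
    (max_le (hr _ (hf0 x) ((hf x).trans (le_max_left _ _)))
      (hr _ (hfp0 x) ((hfp x).trans (le_max_right _ _)))) _) (by positivity) (by positivity)

theorem setting_of_asymptotically_periodic (hn : 3 ≤ n) (hd₁ : 0 < d₁) (hβ : 2 < β)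
    (hper : ∀ e ∈ Submodule.span ℤ (Set.range b), ∀ x, fp (x + e) = fp x)
    (hf_lower : ∀ x, d₁⁻¹ ≤ f x) (hf_upper : ∀ x, f x ≤ d₁)
    (hg : ∀ x, |f x ^ ((1 : ℝ) / n) - fp x ^ ((1 : ℝ) / n)| ≤ d₁ * (1 + ‖x‖) ^ (-β))
    (hu3 : ContDiff ℝ 3 u) (hu : ConvexC2 u) (hMA : ∀ x, (hess u x).det = f x) (h0 : u 0 = 0)
    (hg0 : fderiv ℝ u 0 = 0) :
    Setting u d₁⁻¹ d₁ (min β (5 / 2)) (Submodule.span ℤ (Set.range b)).toAddSubgroup := by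
  have hn0 : 0 < n := by omega
  have hn' : (0 : ℝ) < n := by exact_mod_cast hn0
  set γ := min β (5 / 2)
  refine { toConvexC2 := hu, lam_pos := inv_pos.2 hd₁, lower := fun x => by rw [hMA]; exact hf_lower x,
           upper := fun x => by rw [hMA]; exact hf_upper x, dim := hn, smooth3 := hu3, zero := h0,
           grad_zero := hg0, two_lt := lt_min hβ (by norm_num), le_five_half := min_le_right _ _,
           cocompact := ?_, source := ?_ }
  · refine ⟨1 + ∑ i, ‖b i‖, by positivity, fun z => ⟨ZSpan.floor b z, (ZSpan.floor b z).2, ?_⟩⟩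
    have := ZSpan.norm_fract_le (K := ℝ) b z
    rw [ZSpan.fract_apply] at this
    linarith
  · set m := d₁⁻¹ ^ ((1 : ℝ) / n)
    have hm : 0 < m := Real.rpow_pos_of_pos (inv_pos.2 hd₁) _
    refine ⟨n * d₁ / m, by positivity, fun e he x => ?_⟩
    have h := lin_sd_ge hu hn0 e x
    simp only [hMA] at h
    have hg' : ∀ y, |f y ^ ((1 : ℝ) / n) - fp y ^ ((1 : ℝ) / n)| ≤ d₁ * gam γ y := fun y =>
      (hg y).trans (mul_le_mul_of_nonneg_left (rpow_le_rpow_of_exponent_le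
        (by linarith [norm_nonneg y]) (neg_le_neg (min_le_left _ _))) hd₁.le)
    have e1 := abs_le.1 (hg' (x + e))
    have e2 := abs_le.1 (hg' (x - e))
    have e3 := abs_le.1 (hg' x)
    rw [hper e he x] at e1
    rw [sub_eq_add_neg x e, hper (-e) (neg_mem he) x, ← sub_eq_add_neg] at e2
    have hsrc : -(d₁ * src γ e x) ≤ f (x + e) ^ ((1 : ℝ) / n) + f (x - e) ^ ((1 : ℝ) / n)
        - 2 * f x ^ ((1 : ℝ) / n) := by rw [src]; linarith
    have hF : m ≤ f x ^ ((1 : ℝ) / n) :=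
      Real.rpow_le_rpow (inv_pos.2 hd₁).le (hf_lower x) (by positivity)
    have hS : 0 ≤ n * d₁ * src γ e x := mul_nonneg (by positivity) (src_nonneg γ e x)
    have h2 : -(n * d₁ * src γ e x) ≤ f x ^ ((1 : ℝ) / n) * lin u (sd u e) x := by
      nlinarith [mul_le_mul_of_nonneg_left hsrc hn'.le]
    rw [div_mul_eq_mul_div, ← neg_div, div_le_iff₀ hm, mul_comm (lin _ _ _)]
    rcases le_total 0 (lin u (sd u e) x) with h3 | h3
    · nlinarith [mul_nonneg hm.le h3]
    · exact h2.trans (mul_le_mul_of_nonpos_right hF h3)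

end AsymptoticallyPeriodic

end MongeAmpere

open MongeAmpere in
/-- Step one of the proof: an entire convex solution with asymptotically periodic
data is asymptotically a quadratic polynomial, with a power-rate error. -/
theorem monge_ampere_quadratic_growth
    (n : ℕ) (hn : 3 ≤ n)
    (d₀ d₁ α β : ℝ) (a : Fin n → ℝ)
    (hd₀ : 0 < d₀) (hd₁ : 0 < d₁) (hα : α ∈ Set.Ioo (0:ℝ) 1) (hβ : 2 < β)
    (ha : ∀ i, 0 < a i)
    (fp f u : EuclideanSpace ℝ (Fin n) → ℝ)
    -- periodic data fp
    (hfp_smooth : ContDiff ℝ 1 fp)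
    (hfp_lower : ∀ x, d₀⁻¹ ≤ fp x) (hfp_upper : ∀ x, fp x ≤ d₀)
    (hfp_grad : ∀ x, ‖fderiv ℝ fp x‖ ≤ d₀)
    (hfp_holder : ∀ x y, ‖fderiv ℝ fp x - fderiv ℝ fp y‖ ≤ d₀ * ‖x - y‖ ^ α)
    (hfp_per : ∀ x, ∀ i : Fin n, fp (x + a i • EuclideanSpace.single i 1) = fp x)
    -- asymptotically periodic forcing f
    (hf_smooth : ContDiff ℝ 1 f)
    (hf_lower : ∀ x, d₁⁻¹ ≤ f x) (hf_upper : ∀ x, f x ≤ d₁)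
    (hf_grad : ∀ x, ‖fderiv ℝ f x‖ ≤ d₁)
    (hf_holder : ∀ x y, ‖fderiv ℝ f x - fderiv ℝ f y‖ ≤ d₁ * ‖x - y‖ ^ α)
    (hg_smooth : ContDiff ℝ 3 (fun x => f x ^ ((1:ℝ)/n) - fp x ^ ((1:ℝ)/n)))
    (hg_decay : ∀ j : ℕ, j ≤ 3 → ∀ x,
      ‖iteratedFDeriv ℝ j (fun x => f x ^ ((1:ℝ)/n) - fp x ^ ((1:ℝ)/n)) x‖
        ≤ d₁ * (1 + ‖x‖) ^ (-β - (j:ℝ)))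
    -- the solution u
    (hu_smooth : ContDiff ℝ 3 u)
    (hu_convex : ConvexOn ℝ Set.univ u)
    (hMA : ∀ x, (hess u x).det = f x) :
    ∃ (A : Matrix (Fin n) (Fin n) ℝ) (b : EuclideanSpace ℝ (Fin n)) (ε C : ℝ),
      A.IsSymm ∧ A.PosDef ∧ 0 < ε ∧ 0 < C ∧
      ∀ x, |u x - (1/2 : ℝ) * (∑ i, ∑ j, A i j * x i * x j) - (∑ i, b i * x i)|
        ≤ C * (1 + ‖x‖) ^ ((2:ℝ) - ε) := by
  classical
  have hn0 : 0 < n := by omega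
  set b : Module.Basis (Fin n) ℝ (EuclideanSpace ℝ (Fin n)) :=
    (EuclideanSpace.basisFun (Fin n) ℝ).toBasis.isUnitSMul fun i => (ha i).ne'.isUnit
  have hb : ∀ i, b i = a i • EuclideanSpace.single i 1 := fun i => by
    simp [b, Module.Basis.isUnitSMul_apply]
  have hper := periodic_of_basis (b := b) (fp := fp) fun i x => by
    rw [hb]; exact hfp_per x i
  have hf0 : ∀ x, 0 < f x := fun x => (inv_pos.2 hd₁).trans_le (hf_lower x)
  have hfp0 : ∀ x, 0 ≤ fp x := fun x => (inv_pos.2 hd₀).le.trans (hfp_lower x)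
  have hg : ∀ x, |f x ^ ((1 : ℝ) / n) - fp x ^ ((1 : ℝ) / n)| ≤ d₁ * (1 + ‖x‖) ^ (-β) := fun x => by
    simpa using hg_decay 0 (by norm_num) x
  set v : EuclideanSpace ℝ (Fin n) → ℝ := fun x => u x + ((-fderiv ℝ u 0) x + -u 0)
  have hl : ContDiff ℝ 3 fun x => (-fderiv ℝ u 0) x + -u 0 := by fun_prop
  have hv3 : ContDiff ℝ 3 v := hu_smooth.add hl
  have hu2 : ContDiff ℝ 2 u := hu_smooth.of_le (by norm_num)
  have hhess : ∀ x, hess v x = hess u x := fun x => by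
    rw [hess_add hu2 (hl.of_le (by norm_num)), hess_affine, add_zero]
  have hMA' : ∀ x, (hess v x).det = f x := fun x => by rw [hhess, hMA]
  have hcu := convexC2_of_convexOn hu2 hu_convex fun x => by rw [hMA]; exact hf0 x
  have hcv : ConvexC2 v :=
    ⟨hv3.of_le (by norm_num), fun x => by rw [hhess]; exact hcu.pos x⟩
  have hv0 : v 0 = 0 := by simp [v]
  have hgv : fderiv ℝ v 0 = 0 := by
    have h := (hcu.differentiable 0).hasFDerivAt.add
      ((-fderiv ℝ u 0).hasFDerivAt.add_const (x := 0) (-u 0))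
    rw [add_neg_cancel] at h
    exact h.fderiv
  have hset := setting_of_asymptotically_periodic hn hd₁ hβ hper hf_lower hf_upper hg hv3
    hcv hMA' hv0 hgv
  obtain ⟨A, τ, hdom, hlim⟩ := hset.meanDominated ha fun i => by
    have : b i ∈ Submodule.span ℤ (Set.range b) := Submodule.subset_span ⟨i, rfl⟩
    rwa [hb, show a i • EuclideanSpace.single i (1 : ℝ) = EuclideanSpace.single i (a i) by
      ext k; simp] at this
  obtain ⟨K, hK, hdecay⟩ := abs_sub_le_of_root hn0 hd₁ (by linarith) (fun x => (hf0 x).le)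
    hf_upper hfp0 hfp_upper hg
  obtain ⟨c, C₀, hC₀, hmean⟩ := exists_mean_of_decay hf_smooth.continuous
    hfp_smooth.continuous hfp0 hfp_upper hper hn0 hK hdecay
  obtain ⟨ε, C, hε, hε2, hC, hrate⟩ := hdom.exists_power_rate hlim (by norm_num) le_rfl hC₀
    fun R hR => by simpa only [hMA'] using hmean R hR
  have hsymm := hdom.posDef.isHermitian
  rw [Matrix.IsHermitian, Matrix.conjTranspose_eq_transpose_of_trivial] at hsymm
  refine ⟨A, gradient u 0, ε, C + |u 0|, hsymm, hdom.posDef, hε, by positivity, fun x => ?_⟩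
  have hgrad : ∑ i, gradient u 0 i * x i = fderiv ℝ u 0 x := by
    have h : inner ℝ (gradient u 0) x = fderiv ℝ u 0 x := by rw [gradient]; simp
    rw [← h, PiLp.inner_apply]
    simp [mul_comm]
  have hquad : ∑ i, ∑ j, A i j * x i * x j = x.ofLp ⬝ᵥ A.mulVec x.ofLp := by
    rw [quadForm_eq_sum]
    exact Finset.sum_congr rfl fun i _ => Finset.sum_congr rfl fun j _ => by ring
  have hone : 1 ≤ (1 + ‖x‖) ^ (2 - ε) :=
    Real.one_le_rpow (by linarith [norm_nonneg x]) (by linarith)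
  have hsplit : u x - 1 / 2 * (∑ i, ∑ j, A i j * x i * x j) - ∑ i, gradient u 0 i * x i
      = (v x - 1 / 2 * (x.ofLp ⬝ᵥ A.mulVec x.ofLp)) + u 0 := by
    rw [hgrad, hquad]; simp [v]; ring
  rw [hsplit]
  calc _ ≤ C * (1 + ‖x‖) ^ (2 - ε) + |u 0| * 1 := by
        rw [mul_one]; exact (abs_add_le _ _).trans (add_le_add (hrate x) le_rfl)
    _ ≤ C * (1 + ‖x‖) ^ (2 - ε) + |u 0| * (1 + ‖x‖) ^ (2 - ε) := by gcongr
    _ = _ := by ring
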